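/- Let φ : ∂𝔻 → ℝ be bounded and lower semicontinuous and let ψ : 𝔻 → ℝ be smooth with a ≤ ψ(z) ≤ b for all z ∈ 𝔻, where 0 < a ≤ b < +∞. Then there exists a smooth convex function u : 𝔻 → ℝ such that det D²u(z) = (1/ψ(z))·(1−|z|²)⁻² for every z ∈ 𝔻, such that liminf_{w→z, w∈𝔻} u(w) = φ(z) for every z ∈ ∂𝔻, and such that co(φ)(z) − (1/√a)·√(1−|z|²) ≤ u(z) ≤ co(φ)(z) for every z ∈ 𝔻. -/

import Mathlib

open Metric Filter
open scoped RealInnerProductSpace Topology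

noncomputable section

/-- The plane `ℝ²`, as a Euclidean space. -/
abbrev E2 : Type := EuclideanSpace ℝ (Fin 2)

/-- The Hessian of `f : ℝ² → ℝ` at `p`, evaluated as a bilinear form on `(v, w)`. -/
def hess (f : E2 → ℝ) (p v w : E2) : ℝ := fderiv ℝ (fderiv ℝ f) p v w

/-- The determinant of the Hessian of `f : ℝ² → ℝ` at `p`. -/
def detHess (f : E2 → ℝ) (p : E2) : ℝ :=
  hess f p (EuclideanSpace.single 0 1) (EuclideanSpace.single 0 1) *
    hess f p (EuclideanSpace.single 1 1) (EuclideanSpace.single 1 1) -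
  hess f p (EuclideanSpace.single 0 1) (EuclideanSpace.single 1 1) *
    hess f p (EuclideanSpace.single 1 1) (EuclideanSpace.single 0 1)
/-- The convex envelope `co(φ)` of a boundary function `φ : ∂𝔻 → ℝ`:
`co(φ)(z) = sup{ℓ(z) : ℓ affine on ℝ², ℓ ≤ φ on ∂𝔻}`. -/
def convEnv (φ : E2 → ℝ) (z : E2) : ℝ :=
  sSup {y : ℝ | ∃ (a : E2) (b : ℝ),
    (∀ w ∈ sphere (0 : E2) 1, ⟪a, w⟫ + b ≤ φ w) ∧ y = ⟪a, z⟫ + b}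

section regF1
set_option linter.unusedSectionVars false
open MeasureTheory

/-- coordinate vectors -/
def ee (i : Fin 2) : E2 := EuclideanSpace.single i 1

lemma norm_ee (i : Fin 2) : ‖ee i‖ = 1 := by simp [ee]

variable {H : Type*} [NormedAddCommGroup H] [InnerProductSpace ℝ H]

/-- forward difference -/
def dif (h : E2) (F : E2 → H) : E2 → H := fun z => F (z + h) - F z

lemma dif_contDiff {n : WithTop ℕ∞} {F : E2 → H} (hF : ContDiff ℝ n F) (h : E2) :
    ContDiff ℝ n (dif h F) := by
  unfold dif
  exact (hF.comp (contDiff_id.add contDiff_const)).sub hF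

lemma dif_continuous {F : E2 → H} (hF : Continuous F) (h : E2) : Continuous (dif h F) := by
  unfold dif; fun_prop

lemma fderiv_dif {F : E2 → H} (hF : ContDiff ℝ 1 F) (h : E2) (v : E2) (z : E2) :
    fderiv ℝ (dif h F) z v = dif h (fun y => fderiv ℝ F y v) z := by
  have hd : Differentiable ℝ F := hF.differentiable (by norm_num)
  unfold dif
  have h1 : DifferentiableAt ℝ (fun y => F (y + h)) z :=
    (hd (z + h)).comp z (by fun_prop)
  have : fderiv ℝ (fun z => F (z + h) - F z) z = fderiv ℝ (fun y => F (y + h)) z - fderiv ℝ F z :=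
    fderiv_sub h1 (hd z)
  rw [this, fderiv_comp_add_right]
  simp

lemma integrableOn_ball_of_cont {G : Type*} [NormedAddCommGroup G] {g : E2 → G}
    (hg : Continuous g) (z0 : E2) (ρ : ℝ) :
    IntegrableOn g (ball z0 ρ) :=
  (hg.continuousOn.integrableOn_compact (isCompact_closedBall z0 ρ)).mono_set ball_subset_closedBall

lemma setInt_translate_le {g : E2 → ℝ} (hg : Continuous g) (h0 : ∀ z, 0 ≤ g z) (z0 : E2)
    {ρ ρ' : ℝ} {h : E2} (hh : ρ + ‖h‖ ≤ ρ') :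
    ∫ z in ball z0 ρ, g (z + h) ≤ ∫ z in ball z0 ρ', g z := by
  have h1 : ∫ z in ball z0 ρ, g (z + h) = ∫ z in (fun z => z + h) '' (ball z0 ρ), g z := by
    have := (measurePreserving_add_right (volume : Measure E2) h).setIntegral_image_emb
      (MeasurableEquiv.addRight h).measurableEmbedding g (ball z0 ρ)
    exact this.symm
  rw [h1]
  apply setIntegral_mono_set (integrableOn_ball_of_cont hg z0 ρ')
  · exact Eventually.of_forall h0
  · apply LE.le.eventuallyLE
    rintro _ ⟨z, hz, rfl⟩
    simp only [mem_ball] at *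
    calc dist (z + h) z0 ≤ dist (z + h) z + dist z z0 := dist_triangle _ _ _
      _ < ρ' := by simp; linarith

lemma setInt_mono_ball {g : E2 → ℝ} (hg : Continuous g) (h0 : ∀ z, 0 ≤ g z) (z0 : E2)
    {ρ ρ' : ℝ} (hh : ρ ≤ ρ') :
    ∫ z in ball z0 ρ, g z ≤ ∫ z in ball z0 ρ', g z :=
  setIntegral_mono_set (integrableOn_ball_of_cont hg z0 ρ') (Eventually.of_forall h0)
    (ball_subset_ball hh).eventuallyLE

lemma dif_sq_le [CompleteSpace H] {U : E2 → H} (hU : ContDiff ℝ 1 U) (v : E2) (z : E2) (s : ℝ) :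
    ‖dif (s • v) U z‖ ^ 2 ≤ s ^ 2 * ∫ t in (0:ℝ)..1, ‖fderiv ℝ U (z + (t * s) • v) v‖ ^ 2 := by
  have hd : Differentiable ℝ U := hU.differentiable (by norm_num)
  have hc : Continuous (fun y => fderiv ℝ U y v) := by
    have := hU.continuous_fderiv (by norm_num)
    fun_prop
  have hder : ∀ t : ℝ, HasDerivAt (fun t : ℝ => U (z + (t * s) • v))
      (s • fderiv ℝ U (z + (t * s) • v) v) t := by
    intro t
    have h1 : HasDerivAt (fun t : ℝ => z + (t * s) • v) (s • v) t := by
      have := ((hasDerivAt_id t).mul_const s).smul_const v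
      simpa using this.const_add z
    have := (hd (z + (t * s) • v)).hasFDerivAt.comp_hasDerivAt t h1
    rw [map_smul] at this
    exact this
  have hcc : Continuous (fun t : ℝ => fderiv ℝ U (z + (t * s) • v) v) := hc.comp (by fun_prop)
  have hFTC : dif (s • v) U z = ∫ t in (0:ℝ)..1, s • fderiv ℝ U (z + (t * s) • v) v := by
    rw [intervalIntegral.integral_eq_sub_of_hasDerivAt (fun t _ => hder t)
      ((hcc.const_smul s).intervalIntegrable _ _)]
    simp [dif]
  rw [hFTC, intervalIntegral.integral_smul, norm_smul, mul_pow, Real.norm_eq_abs, sq_abs]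
  gcongr
  set g : ℝ → H := fun t => fderiv ℝ U (z + (t * s) • v) v
  have hn : Continuous (fun t => ‖g t‖) := hcc.norm
  -- Cauchy-Schwarz via expanding a square
  set m := ∫ t in (0:ℝ)..1, ‖g t‖ with hm
  have h1 : ‖∫ t in (0:ℝ)..1, g t‖ ≤ m :=
    intervalIntegral.norm_integral_le_integral_norm zero_le_one
  have h2 : 0 ≤ ∫ t in (0:ℝ)..1, (‖g t‖ - m) ^ 2 :=
    intervalIntegral.integral_nonneg zero_le_one (fun t _ => sq_nonneg _)
  have h3 : ∫ t in (0:ℝ)..1, (‖g t‖ - m) ^ 2 = (∫ t in (0:ℝ)..1, ‖g t‖ ^ 2) - m ^ 2 := by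
    have : ∀ t, (‖g t‖ - m) ^ 2 = ‖g t‖ ^ 2 - (2 * m) * ‖g t‖ + m ^ 2 := fun t => by ring
    simp_rw [this]
    rw [intervalIntegral.integral_add, intervalIntegral.integral_sub,
      intervalIntegral.integral_const_mul, ← hm]
    · simp; ring
    all_goals apply Continuous.intervalIntegrable; fun_prop
  have h4 : 0 ≤ ‖∫ t in (0:ℝ)..1, g t‖ := norm_nonneg _
  nlinarith

lemma setInt_dif_sq_le [CompleteSpace H] {U : E2 → H} (hU : ContDiff ℝ 1 U) (i : Fin 2) (z0 : E2)
    {ρ ρ' s : ℝ} (hs : ρ + |s| ≤ ρ') :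
    ∫ z in ball z0 ρ, ‖dif (s • ee i) U z‖ ^ 2 ≤
      s ^ 2 * ∫ z in ball z0 ρ', ‖fderiv ℝ U z (ee i)‖ ^ 2 := by
  have hc : Continuous (fun y => fderiv ℝ U y (ee i)) := by
    have := hU.continuous_fderiv (by norm_num)
    fun_prop
  have hcU : Continuous (dif (s • ee i) U) := dif_continuous hU.continuous _
  have hjc : Continuous (fun q : E2 × ℝ => ‖fderiv ℝ U (q.1 + (q.2 * s) • ee i) (ee i)‖ ^ 2) :=
    ((hc.comp (by fun_prop : Continuous fun q : E2 × ℝ => q.1 + (q.2 * s) • ee i)).norm.pow 2)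
  have hI : Integrable (fun q : E2 × ℝ => ‖fderiv ℝ U (q.1 + (q.2 * s) • ee i) (ee i)‖ ^ 2)
      ((volume.restrict (ball z0 ρ)).prod (volume.restrict (Set.Ioc (0:ℝ) 1))) := by
    rw [Measure.prod_restrict]
    have : IntegrableOn (fun q : E2 × ℝ => ‖fderiv ℝ U (q.1 + (q.2 * s) • ee i) (ee i)‖ ^ 2)
      (closedBall z0 ρ ×ˢ Set.Icc (0:ℝ) 1) (volume.prod volume) :=
      hjc.continuousOn.integrableOn_compact ((isCompact_closedBall z0 ρ).prod isCompact_Icc)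
    exact this.mono_set (Set.prod_mono ball_subset_closedBall Set.Ioc_subset_Icc_self)
  calc ∫ z in ball z0 ρ, ‖dif (s • ee i) U z‖ ^ 2
      ≤ ∫ z in ball z0 ρ, s ^ 2 * ∫ t in Set.Ioc (0:ℝ) 1,
          ‖fderiv ℝ U (z + (t * s) • ee i) (ee i)‖ ^ 2 := by
        apply integral_mono_of_nonneg (Eventually.of_forall fun z => sq_nonneg _)
        · exact hI.integral_prod_left.const_mul _
        · refine Eventually.of_forall fun z => ?_
          have := dif_sq_le hU (ee i) z s
          rwa [intervalIntegral.integral_of_le zero_le_one] at this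
    _ = s ^ 2 * ∫ t in Set.Ioc (0:ℝ) 1, ∫ z in ball z0 ρ,
          ‖fderiv ℝ U (z + (t * s) • ee i) (ee i)‖ ^ 2 := by
        rw [integral_const_mul, integral_integral_swap hI]
    _ ≤ s ^ 2 * ∫ t in Set.Ioc (0:ℝ) 1, ∫ z in ball z0 ρ', ‖fderiv ℝ U z (ee i)‖ ^ 2 := by
        gcongr 1
        apply setIntegral_mono_on hI.integral_prod_right
        · simp
        · exact measurableSet_Ioc
        · intro t ht
          refine setInt_translate_le (g := fun z => ‖fderiv ℝ U z (ee i)‖ ^ 2) (h := (t * s) • ee i)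
            (by fun_prop) (fun z => sq_nonneg _) z0 ?_
          rw [norm_smul, norm_ee, mul_one, Real.norm_eq_abs, abs_mul, abs_of_pos ht.1]
          nlinarith [abs_nonneg s, ht.2]
    _ = _ := by simp

/-- weak equation -/
def WEq (U B : E2 → H) (z0 : E2) (r : ℝ) : Prop :=
  ∀ η : E2 → H, ContDiff ℝ 1 η → HasCompactSupport η → tsupport η ⊆ ball z0 r →
    ∫ z, (⟪fderiv ℝ U z (ee 0), fderiv ℝ η z (ee 0)⟫ + ⟪B z, fderiv ℝ η z (ee 1)⟫) = 0

lemma WEq.mono {U B : E2 → H} {z0 z1 : E2} {r r' : ℝ} (hw : WEq U B z0 r)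
    (h : ball z1 r' ⊆ ball z0 r) : WEq U B z1 r' :=
  fun η h1 h2 h3 => hw η h1 h2 (h3.trans h)

lemma cont_fderiv_apply {U : E2 → H} (hU : ContDiff ℝ 1 U) (v : E2) :
    Continuous (fun z => fderiv ℝ U z v) := by
  have := hU.continuous_fderiv (by norm_num)
  fun_prop

lemma weq_integrable {U B η : E2 → H} (hU : ContDiff ℝ 1 U) (hB : Continuous B)
    (h1 : ContDiff ℝ 1 η) (h2 : HasCompactSupport η) :
    Integrable (fun z => ⟪fderiv ℝ U z (ee 0), fderiv ℝ η z (ee 0)⟫ + ⟪B z, fderiv ℝ η z (ee 1)⟫) := by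
  have hc : ∀ v, HasCompactSupport (fun z => fderiv ℝ η z v) := fun v =>
    h2.fderiv_apply (𝕜 := ℝ) v
  apply Continuous.integrable_of_hasCompactSupport
  · have a1 := cont_fderiv_apply hU (ee 0)
    have a2 := cont_fderiv_apply h1 (ee 0)
    have a3 := cont_fderiv_apply h1 (ee 1)
    fun_prop
  · apply HasCompactSupport.add
    · exact (hc (ee 0)).mono (fun z hz => by
        simp only [Function.mem_support, ne_eq] at *; intro h; apply hz; rw [h, inner_zero_right])
    · exact (hc (ee 1)).mono (fun z hz => by
        simp only [Function.mem_support, ne_eq] at *; intro h; apply hz; rw [h, inner_zero_right])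

lemma WEq.dif {U B : E2 → H} {z0 : E2} {r r' : ℝ} (hU : ContDiff ℝ 1 U) (hB : Continuous B)
    (hw : WEq U B z0 r) {h : E2} (hh : r' + ‖h‖ ≤ r) : WEq (dif h U) (dif h B) z0 r' := by
  intro η h1 h2 h3
  have hr' : r' ≤ r := by linarith [norm_nonneg h]
  have e1 := hw η h1 h2 (h3.trans (ball_subset_ball hr'))
  set η' : E2 → H := fun z => η (z - h)
  have g1 : ContDiff ℝ 1 η' := h1.comp (contDiff_id.sub contDiff_const)
  have g2 : HasCompactSupport η' := h2.comp_homeomorph (Homeomorph.subRight h)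
  have g3 : tsupport η' ⊆ ball z0 r := by
    intro z hz
    have : z - h ∈ tsupport η := by
      have := tsupport_comp_subset_preimage η (continuous_id.sub (continuous_const (y := h)))
      exact this hz
    have := h3 this
    rw [mem_ball, dist_eq_norm] at *
    calc ‖z - z0‖ = ‖(z - h - z0) + h‖ := by congr 1; abel
      _ ≤ ‖z - h - z0‖ + ‖h‖ := norm_add_le _ _
      _ < r := by linarith
  have e2 := hw η' g1 g2 g3
  have e3 : ∀ z, fderiv ℝ η' z = fderiv ℝ η (z - h) := fun z => by
    
    have := fderiv_comp_add_right (𝕜 := ℝ) (f := η) (x := z) (-h)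
    simpa only [η', sub_eq_add_neg] using this
  rw [← integral_add_right_eq_self _ h] at e2
  simp only [e3, add_sub_cancel_right] at e2
  have key : ∀ z, (⟪fderiv ℝ (_root_.dif h U) z (ee 0), fderiv ℝ η z (ee 0)⟫ +
      ⟪_root_.dif h B z, fderiv ℝ η z (ee 1)⟫) =
      (⟪fderiv ℝ U (z + h) (ee 0), fderiv ℝ η z (ee 0)⟫ + ⟪B (z + h), fderiv ℝ η z (ee 1)⟫) -
      (⟪fderiv ℝ U z (ee 0), fderiv ℝ η z (ee 0)⟫ + ⟪B z, fderiv ℝ η z (ee 1)⟫) := by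
    intro z
    rw [fderiv_dif hU]
    simp only [_root_.dif, inner_sub_left]; ring
  simp_rw [key]
  rw [integral_sub, e1, e2, sub_zero]
  · have := weq_integrable (hU.comp (contDiff_id.add (contDiff_const (c := h))))
      (hB.comp (continuous_id.add (continuous_const (y := h)))) h1 h2
    have e4 : ∀ z, fderiv ℝ (U ∘ (id + fun _ => h)) z = fderiv ℝ U (z + h) := fun z => by
      have := fderiv_comp_add_right (𝕜 := ℝ) (f := U) (x := z) h
      exact this
    refine this.congr (Eventually.of_forall fun z => ?_)
    have := e4 z
    simp only [Function.comp_def, Pi.add_apply, id] at *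
    rw [this]
  · exact weq_integrable hU hB h1 h2
end regF1

section regF2
open MeasureTheory
set_option linter.unusedSectionVars false
variable {H : Type*} [NormedAddCommGroup H] [InnerProductSpace ℝ H]

/-- constant of the Caccioppoli inequality -/
def caccK (lam Lam : ℝ) : ℝ := (3 + 1 / lam + 4 * Lam ^ 2 / lam) / (min 1 lam / 2)

lemma caccK_pos {lam Lam : ℝ} (hl : 0 < lam) : 0 < caccK lam Lam := by
  unfold caccK
  have : 0 < min 1 lam := lt_min one_pos hl
  positivity

lemma cacc_pointwise {lam Lam L c cx cp g ux up un Bn Bu : ℝ} (hl : 0 < lam) (hLam : 0 ≤ Lam)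
    (hL : 0 ≤ L) (hc : 0 ≤ c) (hg : 0 ≤ g) (hux : 0 ≤ ux) (hup : 0 ≤ up) (hun : 0 ≤ un)
    (hBn : Bn ≤ Lam * up + g) (hBn0 : 0 ≤ Bn) (hBu : lam * up ^ 2 - g * up ≤ Bu)
    (hcx : cx ≤ L) (hcp : cp ≤ L) (hcx0 : 0 ≤ cx) (hcp0 : 0 ≤ cp) :
    (min 1 lam / 2) * (c ^ 2 * (ux ^ 2 + up ^ 2)) - (3 + 1 / lam + 4 * Lam ^ 2 / lam) *
      (c ^ 2 * g ^ 2 + L ^ 2 * un ^ 2) ≤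
    c ^ 2 * ux ^ 2 - 2 * c * cx * (ux * un) + (c ^ 2 * Bu - 2 * c * cp * (Bn * un)) := by
  have a1 : 2 * c * cx * (ux * un) ≤ c ^ 2 * ux ^ 2 / 2 + 2 * L ^ 2 * un ^ 2 := by
    have : 2 * c * cx * (ux * un) ≤ 2 * c * L * (ux * un) := by gcongr
    nlinarith [sq_nonneg (c * ux - 2 * L * un)]
  have a2 : 2 * c * cp * (Bn * un) ≤ 2 * c * L * ((Lam * up + g) * un) := by gcongr
  have a3 : 2 * c * L * (g * un) ≤ c ^ 2 * g ^ 2 + L ^ 2 * un ^ 2 := by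
    nlinarith [sq_nonneg (c * g - L * un)]
  have a4 : 2 * c * L * (Lam * up * un) ≤ lam / 4 * c ^ 2 * up ^ 2 + 4 * Lam ^ 2 / lam * (L ^ 2 * un ^ 2) := by
    have h1 : 0 ≤ (lam * c * up / 2 - 2 * Lam * L * un) ^ 2 / lam := by positivity
    have h2 : (lam * c * up / 2 - 2 * Lam * L * un) ^ 2 / lam =
      lam / 4 * c ^ 2 * up ^ 2 + 4 * Lam ^ 2 / lam * (L ^ 2 * un ^ 2) - 2 * c * L * (Lam * up * un) := by
      field_simp; ring
    linarith
  have a5 : c ^ 2 * (g * up) ≤ lam / 4 * c ^ 2 * up ^ 2 + 1 / lam * (c ^ 2 * g ^ 2) := by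
    have h1 : 0 ≤ c ^ 2 * (lam * up / 2 - g) ^ 2 / lam := by positivity
    have h2 : c ^ 2 * (lam * up / 2 - g) ^ 2 / lam =
      lam / 4 * c ^ 2 * up ^ 2 + 1 / lam * (c ^ 2 * g ^ 2) - c ^ 2 * (g * up) := by
      field_simp; ring
    linarith
  have a6 : c ^ 2 * (lam * up ^ 2 - g * up) ≤ c ^ 2 * Bu := by gcongr
  have m1 : min 1 lam / 2 * (c ^ 2 * ux ^ 2) ≤ 1 / 2 * (c ^ 2 * ux ^ 2) := by
    gcongr; exact min_le_left _ _
  have m2 : min 1 lam / 2 * (c ^ 2 * up ^ 2) ≤ lam / 2 * (c ^ 2 * up ^ 2) := by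
    gcongr; exact min_le_right _ _
  have p1 : 0 ≤ 1 / lam * (L ^ 2 * un ^ 2) := by positivity
  have p2 : 0 ≤ 4 * Lam ^ 2 / lam * (c ^ 2 * g ^ 2) := by positivity
  have p3 : 0 ≤ c ^ 2 * g ^ 2 := by positivity
  nlinarith

lemma cacc {lam Lam L r : ℝ} (hl : 0 < lam) (hLam : 0 ≤ Lam) (hL : 0 ≤ L)
    {U B : E2 → H} {g χ : E2 → ℝ} {z0 : E2} (hU : ContDiff ℝ 1 U) (hB : Continuous B)
    (hg : Continuous g) (hg0 : ∀ z, 0 ≤ g z) (hw : WEq U B z0 r)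
    (hχ : ContDiff ℝ 1 χ) (hχ0 : ∀ z, 0 ≤ χ z) (hχc : HasCompactSupport χ)
    (hχs : tsupport χ ⊆ ball z0 r)
    (hχL : ∀ i z, |fderiv ℝ χ z (ee i)| ≤ L)
    (h1 : ∀ z ∈ ball z0 r, lam * ‖fderiv ℝ U z (ee 1)‖ ^ 2 - g z * ‖fderiv ℝ U z (ee 1)‖ ≤
      ⟪B z, fderiv ℝ U z (ee 1)⟫)
    (h2 : ∀ z ∈ ball z0 r, ‖B z‖ ≤ Lam * ‖fderiv ℝ U z (ee 1)‖ + g z) :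
    ∫ z, χ z ^ 2 * (‖fderiv ℝ U z (ee 0)‖ ^ 2 + ‖fderiv ℝ U z (ee 1)‖ ^ 2) ≤
      caccK lam Lam * ((∫ z, χ z ^ 2 * g z ^ 2) + L ^ 2 * ∫ z in ball z0 r, ‖U z‖ ^ 2) := by
  set η : E2 → H := fun z => (χ z ^ 2) • U z with hη
  have hdχ : Differentiable ℝ χ := hχ.differentiable (by norm_num)
  have hdU : Differentiable ℝ U := hU.differentiable (by norm_num)
  have hη1 : ContDiff ℝ 1 η := (hχ.pow 2).smul hU
  have hsub : Function.support η ⊆ Function.support χ := by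
    intro z hz
    simp only [hη, Function.mem_support, ne_eq] at *
    intro h; apply hz; simp [h]
  have hηc : HasCompactSupport η := hχc.mono hsub
  have hηs : tsupport η ⊆ ball z0 r := (closure_mono hsub).trans hχs
  have hη' : ∀ z v, fderiv ℝ η z v = χ z ^ 2 • fderiv ℝ U z v + (2 * χ z * fderiv ℝ χ z v) • U z := by
    intro z v
    have : HasFDerivAt η _ z := ((hdχ z).hasFDerivAt.pow 2).smul (hdU z).hasFDerivAt
    rw [this.fderiv]
    simp
  have hE := hw η hη1 hηc hηs
  have cUx := cont_fderiv_apply hU (ee 0)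
  have cUp := cont_fderiv_apply hU (ee 1)
  have cU := hU.continuous
  have cχ := hχ.continuous
  have hcs : ∀ {k : E2 → ℝ}, Continuous k → Integrable (fun z => χ z ^ 2 * k z) := by
    intro k hk
    apply Continuous.integrable_of_hasCompactSupport (by fun_prop)
    apply hχc.mono
    intro z hz
    simp only [Function.mem_support, ne_eq] at *
    intro h; apply hz; simp [h]
  set k0 := min 1 lam / 2
  set K1 := 3 + 1 / lam + 4 * Lam ^ 2 / lam
  have hk0 : 0 < k0 := by
    have : 0 < min 1 lam := lt_min one_pos hl
    positivity
  have hK1 : 0 < K1 := by positivity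
  have i1 := hcs (k := fun z => ‖fderiv ℝ U z (ee 0)‖ ^ 2 + ‖fderiv ℝ U z (ee 1)‖ ^ 2) (by fun_prop)
  have i2 := hcs (k := fun z => g z ^ 2) (by fun_prop)
  have i3 : Integrable ((ball z0 r).indicator fun z => ‖U z‖ ^ 2) :=
    (integrable_indicator_iff measurableSet_ball).2 (integrableOn_ball_of_cont (by fun_prop) z0 r)
  have key : ∫ z, (k0 * (χ z ^ 2 * (‖fderiv ℝ U z (ee 0)‖ ^ 2 + ‖fderiv ℝ U z (ee 1)‖ ^ 2)) -
      K1 * (χ z ^ 2 * g z ^ 2 + L ^ 2 * (ball z0 r).indicator (fun z => ‖U z‖ ^ 2) z)) ≤ 0 := by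
    rw [← hE]
    apply integral_mono
    · exact (i1.const_mul _).sub ((i2.add (i3.const_mul _)).const_mul _)
    · exact weq_integrable hU hB hη1 hηc
    intro z
    by_cases hz : z ∈ ball z0 r
    · simp only [hη', Set.indicator_of_mem hz]
      have b1 : -(‖fderiv ℝ U z (ee 0)‖ * ‖U z‖) ≤ ⟪fderiv ℝ U z (ee 0), U z⟫ * SignType.sign (fderiv ℝ χ z (ee 0)) := by
        have := abs_real_inner_le_norm (fderiv ℝ U z (ee 0)) (U z)
        have hs : |(SignType.sign (fderiv ℝ χ z (ee 0)) : ℝ)| ≤ 1 := by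
          rcases SignType.sign (fderiv ℝ χ z (ee 0)) with _ | _ | _ <;> simp
        have := abs_le.1 ((abs_mul _ _).le.trans (mul_le_mul this hs (abs_nonneg _) (by positivity)))
        linarith [this.1]
      have b2 : -(‖B z‖ * ‖U z‖) ≤ ⟪B z, U z⟫ * SignType.sign (fderiv ℝ χ z (ee 1)) := by
        have := abs_real_inner_le_norm (B z) (U z)
        have hs : |(SignType.sign (fderiv ℝ χ z (ee 1)) : ℝ)| ≤ 1 := by
          rcases SignType.sign (fderiv ℝ χ z (ee 1)) with _ | _ | _ <;> simp
        have := abs_le.1 ((abs_mul _ _).le.trans (mul_le_mul this hs (abs_nonneg _) (by positivity)))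
        linarith [this.1]
      have s0 := abs_mul_sign (fderiv ℝ χ z (ee 0))
      have s1 := abs_mul_sign (fderiv ℝ χ z (ee 1))
      have := cacc_pointwise (c := χ z) (cx := |fderiv ℝ χ z (ee 0)|) (cp := |fderiv ℝ χ z (ee 1)|)
        (ux := ‖fderiv ℝ U z (ee 0)‖) (up := ‖fderiv ℝ U z (ee 1)‖) (un := ‖U z‖)
        hl hLam hL (hχ0 z) (hg0 z) (norm_nonneg _) (norm_nonneg _) (norm_nonneg _) (h2 z hz)
        (norm_nonneg _) (h1 z hz) (hχL 0 z) (hχL 1 z) (abs_nonneg _) (abs_nonneg _)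
      refine this.trans ?_
      simp only [inner_add_right, inner_smul_right, real_inner_self_eq_norm_sq]
      have c1 : 2 * χ z * |fderiv ℝ χ z (ee 0)| * -(‖fderiv ℝ U z (ee 0)‖ * ‖U z‖) ≤
        2 * χ z * fderiv ℝ χ z (ee 0) * ⟪fderiv ℝ U z (ee 0), U z⟫ := by
        calc _ ≤ 2 * χ z * |fderiv ℝ χ z (ee 0)| * (⟪fderiv ℝ U z (ee 0), U z⟫ * SignType.sign (fderiv ℝ χ z (ee 0))) :=
              mul_le_mul_of_nonneg_left b1 (by have := hχ0 z; positivity)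
          _ = _ := by linear_combination (2 * χ z * ⟪fderiv ℝ U z (ee 0), U z⟫) * s0
      have c2 : 2 * χ z * |fderiv ℝ χ z (ee 1)| * -(‖B z‖ * ‖U z‖) ≤
        2 * χ z * fderiv ℝ χ z (ee 1) * ⟪B z, U z⟫ := by
        calc _ ≤ 2 * χ z * |fderiv ℝ χ z (ee 1)| * (⟪B z, U z⟫ * SignType.sign (fderiv ℝ χ z (ee 1))) :=
              mul_le_mul_of_nonneg_left b2 (by have := hχ0 z; positivity)
          _ = _ := by linear_combination (2 * χ z * ⟪B z, U z⟫) * s1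
      linarith
    · have hχz : χ z = 0 := by
        by_contra hne
        exact hz (hχs (subset_tsupport χ hne))
      simp [hη', hχz, Set.indicator_of_notMem hz]
  rw [integral_sub, integral_const_mul, integral_const_mul, integral_add, integral_const_mul,
    integral_indicator measurableSet_ball] at key
  · unfold caccK
    change _ ≤ K1 / k0 * _
    rw [div_mul_eq_mul_div, le_div_iff₀ hk0]
    linarith
  · exact i2
  · exact i3.const_mul _
  · exact i1.const_mul _
  · exact (i2.add (i3.const_mul _)).const_mul _
end regF2

section regF3
open MeasureTheory
set_option maxSynthPendingDepth 4
variable {E F : Type*} [NormedAddCommGroup E] [NormedSpace ℝ E] [NormedAddCommGroup F]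
  [NormedSpace ℝ F]

lemma taylor1 {f : E → F} (hf : ContDiff ℝ 1 f) {K : Set E} (hK : Convex ℝ K) {C : ℝ}
    (hC : ∀ x ∈ K, ‖fderiv ℝ f x‖ ≤ C) {x y : E} (hx : x ∈ K) (hy : y ∈ K) :
    ‖f x - f y‖ ≤ C * ‖x - y‖ :=
  hK.norm_image_sub_le_of_norm_hasFDerivWithin_le
    (fun z _ => ((hf.differentiable (by norm_num)) z).hasFDerivAt.hasFDerivWithinAt) hC hy hx

lemma taylor2 {f : E → F} (hf : ContDiff ℝ 2 f) {K : Set E} (hK : Convex ℝ K) {C : ℝ} (hC0 : 0 ≤ C)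
    (hC : ∀ x ∈ K, ‖fderiv ℝ (fderiv ℝ f) x‖ ≤ C) {x y : E} (hx : x ∈ K) (hy : y ∈ K) :
    ‖f x - f y - fderiv ℝ f y (x - y)‖ ≤ C * ‖x - y‖ ^ 2 := by
  have hf1 : ContDiff ℝ 1 (fderiv ℝ f) := hf.fderiv_right (by norm_num)
  have hd := hf.differentiable (by norm_num)
  have hK' : Convex ℝ (K ∩ closedBall y ‖x - y‖) := hK.inter (convex_closedBall _ _)
  have := hK'.norm_image_sub_le_of_norm_hasFDerivWithin_le (f := fun w => f w - fderiv ℝ f y w)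
    (f' := fun w => fderiv ℝ f w - fderiv ℝ f y) (C := C * ‖x - y‖) (x := y) (y := x)
    (fun w _ => ((hd w).hasFDerivAt.sub (fderiv ℝ f y).hasFDerivAt).hasFDerivWithinAt)
    (fun w hw => by
      refine (taylor1 hf1 hK hC hw.1 hy).trans ?_
      gcongr
      have := hw.2
      rwa [mem_closedBall, dist_eq_norm] at this)
    ⟨hy, by simp⟩ ⟨hx, by simp [dist_eq_norm]⟩
  calc _ = ‖f x - fderiv ℝ f y x - (f y - fderiv ℝ f y y)‖ := by rw [map_sub]; congr 1; abel
    _ ≤ _ := this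
    _ = _ := by ring

lemma taylor3 {f : E → F} (hf : ContDiff ℝ 3 f) {K : Set E} (hK : Convex ℝ K) {C : ℝ} (hC0 : 0 ≤ C)
    (hC : ∀ x ∈ K, ‖fderiv ℝ (fderiv ℝ (fderiv ℝ f)) x‖ ≤ C) {x y : E} (hx : x ∈ K) (hy : y ∈ K) :
    ‖f x - f y - fderiv ℝ f y (x - y) - (1 / 2 : ℝ) • fderiv ℝ (fderiv ℝ f) y (x - y) (x - y)‖ ≤
      C * ‖x - y‖ ^ 3 := by
  have hf1 : ContDiff ℝ 2 (fderiv ℝ f) := hf.fderiv_right (by norm_num)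
  have hd := hf.differentiable (by norm_num)
  have hK' : Convex ℝ (K ∩ closedBall y ‖x - y‖) := hK.inter (convex_closedBall _ _)
  set B := fderiv ℝ (fderiv ℝ f) y with hB
  have hsymm : ∀ v w, B v w = B w v := by
    have : IsSymmSndFDerivAt ℝ f y :=
      (hf.contDiffAt (x := y)).isSymmSndFDerivAt (by simp; norm_num)
    exact fun v w => this v w
  have hder : ∀ w, HasFDerivAt (fun w => f w - fderiv ℝ f y w - (1 / 2 : ℝ) • B (w - y) (w - y))
      (fderiv ℝ f w - fderiv ℝ f y - B (w - y)) w := by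
    intro w
    have h1 : HasFDerivAt (fun w => w - y) (ContinuousLinearMap.id ℝ E) w :=
      (hasFDerivAt_id w).sub_const y
    have h2 : HasFDerivAt (fun w => B (w - y)) (B.comp (ContinuousLinearMap.id ℝ E)) w :=
      B.hasFDerivAt.comp w h1
    have h3 := (h2.clm_apply h1).const_smul (1 / 2 : ℝ)
    have h4 := ((hd w).hasFDerivAt.sub (fderiv ℝ f y).hasFDerivAt).sub h3
    refine h4.congr_fderiv ?_
    ext v
    simp only [_root_.sub_apply, _root_.smul_apply,
      _root_.add_apply, ContinuousLinearMap.comp_apply, ContinuousLinearMap.flip_apply,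
      ContinuousLinearMap.id_apply]
    rw [hsymm v (w - y), ← two_smul ℝ, smul_smul]
    norm_num
  have := hK'.norm_image_sub_le_of_norm_hasFDerivWithin_le
    (C := C * ‖x - y‖ ^ 2) (x := y) (y := x)
    (fun w _ => (hder w).hasFDerivWithinAt)
    (fun w hw => by
      refine (taylor2 hf1 hK hC0 hC hw.1 hy).trans ?_
      gcongr
      have := hw.2
      rwa [mem_closedBall, dist_eq_norm] at this)
    ⟨hy, by simp⟩ ⟨hx, by simp [dist_eq_norm]⟩
  calc _ = ‖f x - fderiv ℝ f y x - (1 / 2 : ℝ) • B (x - y) (x - y) - (f y - fderiv ℝ f y y - (1 / 2 : ℝ) • B (y - y) (y - y))‖ := by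
        rw [map_sub (fderiv ℝ f y)]; congr 1; rw [sub_self y]; simp only [map_zero, smul_zero]; abel
    _ ≤ _ := this
    _ = _ := by ring

lemma dif2_taylor {f : E → F} (hf : ContDiff ℝ 2 f) {K : Set E} (hK : Convex ℝ K) {C : ℝ}
    (hC0 : 0 ≤ C) (hC : ∀ x ∈ K, ‖fderiv ℝ (fderiv ℝ f) x‖ ≤ C) {x y z : E} (hx : x ∈ K)
    (hy : y ∈ K) (hz : z ∈ K) :
    ‖(f z - f y - (f y - f x)) - fderiv ℝ f y (z - y - (y - x))‖ ≤
      C * (‖z - y‖ ^ 2 + ‖y - x‖ ^ 2) := by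
  have h1 := taylor2 hf hK hC0 hC hz hy
  have h2 := taylor2 hf hK hC0 hC hx hy
  rw [norm_sub_rev x y] at h2
  calc _ = ‖(f z - f y - fderiv ℝ f y (z - y)) + (f x - f y - fderiv ℝ f y (x - y))‖ := by
        congr 1; simp only [map_sub]; abel
    _ ≤ _ := norm_add_le _ _
    _ ≤ _ := by linarith

lemma dif3_taylor {f : E → F} (hf : ContDiff ℝ 3 f) {K : Set E} (hK : Convex ℝ K) {C : ℝ}
    (hC0 : 0 ≤ C) (hC2 : ∀ x ∈ K, ‖fderiv ℝ (fderiv ℝ f) x‖ ≤ C)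
    (hC : ∀ x ∈ K, ‖fderiv ℝ (fderiv ℝ (fderiv ℝ f)) x‖ ≤ C) {x y z w : E} (hx : x ∈ K)
    (hy : y ∈ K) (hz : z ∈ K) (hw : w ∈ K) {m : ℝ} (hm : ‖y - x‖ + ‖z - y‖ + ‖w - z‖ ≤ m) :
    ‖((f w - f z - (f z - f y)) - (f z - f y - (f y - f x))) -
      fderiv ℝ f x ((w - z - (z - y)) - (z - y - (y - x)))‖ ≤
      C * (20 * m * (‖z - y - (y - x)‖ + ‖w - z - (z - y)‖) + 7 * m ^ 3) := by
  have t1 := taylor3 hf hK hC0 hC hy hx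
  have t2 := taylor3 hf hK hC0 hC hz hx
  have t3 := taylor3 hf hK hC0 hC hw hx
  set B := fderiv ℝ (fderiv ℝ f) x with hB
  have hBn : ∀ u v, ‖B u v‖ ≤ C * ‖u‖ * ‖v‖ := fun u v => by
    refine (B.le_opNorm₂ u v).trans ?_
    gcongr; exact hC2 x hx
  set a := y - x with ha
  set s := z - y - a with hs
  set s' := w - z - (z - y) with hs'
  have e2 : z - x = (2:ℝ) • a + s := by rw [hs, ha]; module
  have e3 : w - x = (3:ℝ) • a + (2:ℝ) • s + s' := by rw [hs', hs, ha]; module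
  have q : (1 / 2 : ℝ) • B (w - x) (w - x) - (3:ℝ) • (1 / 2 : ℝ) • B (z - x) (z - x) + (3:ℝ) • (1 / 2 : ℝ) • B a a
      = (1 / 2 : ℝ) • ((3:ℝ) • B a s' + (3:ℝ) • B s' a + B ((2:ℝ) • s + s') ((2:ℝ) • s + s') - (3:ℝ) • B s s) := by
    rw [e2, e3]
    simp only [map_add, map_smul, _root_.add_apply, _root_.smul_apply]
    module
  have hm0 : 0 ≤ m := le_trans (by positivity) hm
  have na : ‖a‖ ≤ m := by linarith [norm_nonneg (z - y), norm_nonneg (w - z)]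
  have nza : ‖z - x‖ ≤ m := by
    calc ‖z - x‖ = ‖(z - y) + a‖ := by rw [ha]; congr 1; abel
      _ ≤ ‖z - y‖ + ‖a‖ := norm_add_le _ _
      _ ≤ m := by linarith [norm_nonneg (w - z)]
  have nwa : ‖w - x‖ ≤ m := by
    calc ‖w - x‖ = ‖(w - z) + (z - y) + a‖ := by rw [ha]; congr 1; abel
      _ ≤ ‖w - z‖ + ‖z - y‖ + ‖a‖ := norm_add₃_le
      _ ≤ m := by linarith
  have ns : ‖s‖ ≤ m := by
    calc ‖s‖ ≤ ‖z - y‖ + ‖a‖ := norm_sub_le _ _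
      _ ≤ m := by linarith [norm_nonneg (w - z)]
  have ns' : ‖s'‖ ≤ m := by
    calc ‖s'‖ ≤ ‖w - z‖ + ‖z - y‖ := norm_sub_le _ _
      _ ≤ m := by linarith [norm_nonneg a]
  have hq : ‖(1 / 2 : ℝ) • ((3:ℝ) • B a s' + (3:ℝ) • B s' a + B ((2:ℝ) • s + s') ((2:ℝ) • s + s') - (3:ℝ) • B s s)‖
      ≤ C * (20 * m * (‖s‖ + ‖s'‖)) := by
    have n1 : ‖B a s'‖ ≤ C * m * ‖s'‖ := (hBn _ _).trans (by gcongr)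
    have n2 : ‖B s' a‖ ≤ C * ‖s'‖ * m := (hBn _ _).trans (by gcongr)
    have n5 : ‖(2:ℝ) • s + s'‖ ≤ 2 * ‖s‖ + ‖s'‖ := by
      refine (norm_add_le _ _).trans ?_
      rw [norm_smul]; simp
    have n3 : ‖B ((2:ℝ) • s + s') ((2:ℝ) • s + s')‖ ≤ C * (3 * m) * (2 * (‖s‖ + ‖s'‖)) := by
      refine (hBn _ _).trans ?_
      gcongr <;> linarith [norm_nonneg s, norm_nonneg s']
    have n4 : ‖B s s‖ ≤ C * m * ‖s‖ := (hBn _ _).trans (by gcongr)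
    have n6 := norm_sub_le ((3:ℝ) • B a s' + (3:ℝ) • B s' a + B ((2:ℝ) • s + s') ((2:ℝ) • s + s')) ((3:ℝ) • B s s)
    have n7 := norm_add₃_le (a := (3:ℝ) • B a s') (b := (3:ℝ) • B s' a) (c := B ((2:ℝ) • s + s') ((2:ℝ) • s + s'))
    rw [norm_smul] at n6
    rw [norm_smul, norm_smul] at n7
    simp only [Real.norm_ofNat] at n6 n7
    rw [norm_smul, Real.norm_of_nonneg (by norm_num)]
    have p1 : 0 ≤ C * m * ‖s‖ := by positivity
    have p2 : 0 ≤ C * m * ‖s'‖ := by positivity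
    nlinarith
  have cub : ∀ {t : ℝ}, 0 ≤ t → t ≤ m → C * t ^ 3 ≤ C * m ^ 3 := fun h1 h2 => by gcongr
  have c1 := t1.trans (cub (norm_nonneg _) na)
  have c2 := t2.trans (cub (norm_nonneg _) nza)
  have c3 := t3.trans (cub (norm_nonneg _) nwa)
  set T1 := f y - f x - fderiv ℝ f x a - (1 / 2 : ℝ) • B a a
  set T2 := f z - f x - fderiv ℝ f x (z - x) - (1 / 2 : ℝ) • B (z - x) (z - x)
  set T3 := f w - f x - fderiv ℝ f x (w - x) - (1 / 2 : ℝ) • B (w - x) (w - x)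
  have expr : ((f w - f z - (f z - f y)) - (f z - f y - (f y - f x))) - fderiv ℝ f x (s' - s) =
      (T3 - (3:ℝ) • T2 + (3:ℝ) • T1) + ((1 / 2 : ℝ) • B (w - x) (w - x) - (3:ℝ) • (1 / 2 : ℝ) • B (z - x) (z - x) + (3:ℝ) • (1 / 2 : ℝ) • B a a) := by
    have : fderiv ℝ f x (s' - s) = fderiv ℝ f x (w - x) - (3:ℝ) • fderiv ℝ f x (z - x) + (3:ℝ) • fderiv ℝ f x a := by
      rw [← map_smul, ← map_smul, ← map_sub, ← map_add]; congr 1; rw [hs', hs, ha]; module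
    rw [this]; simp only [T1, T2, T3]; module
  rw [expr, q]
  have m1 := norm_add_le (T3 - (3:ℝ) • T2 + (3:ℝ) • T1) ((1 / 2 : ℝ) • ((3:ℝ) • B a s' + (3:ℝ) • B s' a + B ((2:ℝ) • s + s') ((2:ℝ) • s + s') - (3:ℝ) • B s s))
  have m2 := norm_add_le (T3 - (3:ℝ) • T2) ((3:ℝ) • T1)
  have m3 := norm_sub_le T3 ((3:ℝ) • T2)
  rw [norm_smul, Real.norm_ofNat] at m2 m3
  nlinarith
end regF3

section regF4
open MeasureTheory FourierTransform

lemma plancherel_le {F : E2 → ℂ} (hF : Continuous F) (hFc : HasCompactSupport F) :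
    ∫⁻ ξ, ENNReal.ofReal (‖𝓕 F ξ‖ ^ 2) ≤ ENNReal.ofReal (∫ x, ‖F x‖ ^ 2) := by
  obtain ⟨R, hR⟩ : ∃ R, tsupport F ⊆ closedBall 0 R := hFc.isCompact.isBounded.subset_closedBall 0
  have huc : UniformContinuous F := hF.uniformContinuous_of_tendsto_cocompact
    (hFc.is_zero_at_infty)
  have happ : ∀ n : ℕ, ∃ g : E2 → ℂ, ContDiff ℝ (⊤ : ℕ∞) g ∧ (∀ a, ‖g a - F a‖ ≤ 1 / (n + 1)) ∧
      (∀ a, a ∉ closedBall 0 (R + 1) → g a = 0) := by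
    intro n
    obtain ⟨δ, hδ, hfδ⟩ := Metric.uniformContinuous_iff.mp huc (1 / (n + 1)) (by positivity)
    obtain ⟨g, hg, h⟩ := hF.exists_contDiff_dist_le_of_forall_mem_ball_dist_le (ε := min δ 1)
      (lt_min hδ one_pos)
    refine ⟨g, hg, fun a => ?_, fun a ha => ?_⟩
    · rw [← dist_eq_norm]
      exact h a _ fun x hx => (hfδ (hx.trans_le (min_le_left _ _))).le
    · have hz : ∀ x ∈ ball a 1, F x = 0 := by
        intro x hx
        apply image_eq_zero_of_notMem_tsupport
        intro hx'
        have h1 := hR hx'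
        apply ha
        rw [mem_closedBall, dist_zero_right] at *
        rw [mem_ball, dist_eq_norm] at hx
        calc ‖a‖ ≤ ‖x‖ + ‖x - a‖ := by
              have := norm_sub_norm_le a x
              rw [norm_sub_rev] at this; linarith
          _ ≤ R + 1 := by linarith
      have h0 : F a = 0 := hz a (mem_ball_self one_pos)
      have := h a 0 (fun x hx => by
        rw [hz x (ball_subset_ball (min_le_right _ _) hx), h0, dist_self])
      rw [h0] at this
      exact dist_le_zero.1 this
  choose g hg1 hg2 hg3 using happ
  have hgc : ∀ n, HasCompactSupport (g n) := fun n =>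
    HasCompactSupport.intro (isCompact_closedBall 0 (R + 1)) (fun x hx => hg3 n x hx)
  set S : ℕ → SchwartzMap E2 ℂ := fun n => (hgc n).toSchwartzMap (hg1 n)
  have hSg : ∀ n x, S n x = g n x := fun n x => rfl
  have hF0 : ∀ a, a ∉ closedBall (0 : E2) (R + 1) → F a = 0 := by
    intro a ha
    apply image_eq_zero_of_notMem_tsupport
    intro h; exact ha ((closedBall_subset_closedBall (by linarith)) (hR h))
  set V := (volume (closedBall (0 : E2) (R + 1))).toReal
  have hdiff : ∀ n, ∫ x, ‖g n x - F x‖ ≤ 1 / (n + 1) * V := by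
    intro n
    have hc : Continuous fun x => ‖g n x - F x‖ := ((hg1 n).continuous.sub hF).norm
    have : ∫ x, ‖g n x - F x‖ = ∫ x in closedBall (0 : E2) (R + 1), ‖g n x - F x‖ := by
      rw [setIntegral_eq_integral_of_forall_compl_eq_zero]
      intro x hx; rw [hg3 n x hx, hF0 x hx]; simp
    rw [this]
    calc _ ≤ ∫ x in closedBall (0 : E2) (R + 1), (1 / ((n : ℝ) + 1)) := by
          apply setIntegral_mono_on
          · exact hc.continuousOn.integrableOn_compact (isCompact_closedBall _ _)
          · exact (continuous_const).continuousOn.integrableOn_compact (isCompact_closedBall _ _)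
          · exact measurableSet_closedBall
          · intro x _; exact hg2 n x
      _ = _ := by simp [Measure.real, V]; ring
  have hlim0 : Tendsto (fun n : ℕ => 1 / ((n : ℝ) + 1)) atTop (𝓝 0) :=
    tendsto_one_div_add_atTop_nhds_zero_nat
  have hFi : Integrable F := hF.integrable_of_hasCompactSupport hFc
  have hgi : ∀ n, Integrable (g n) := fun n =>
    (hg1 n).continuous.integrable_of_hasCompactSupport (hgc n)
  have hpt : ∀ ξ, Tendsto (fun n => 𝓕 (g n) ξ) atTop (𝓝 (𝓕 F ξ)) := by
    intro ξ
    rw [tendsto_iff_norm_sub_tendsto_zero]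
    refine squeeze_zero (fun n => norm_nonneg _) (fun n => ?_) (g := fun n : ℕ => 1 / ((n : ℝ) + 1) * V)
      (by simpa only [zero_mul] using hlim0.mul_const V)
    refine le_trans ?_ (hdiff n)
    rw [Real.fourier_eq, Real.fourier_eq, ← integral_sub]
    · refine (norm_integral_le_integral_norm _).trans (le_of_eq ?_)
      congr 1; ext x
      rw [← smul_sub, Circle.norm_smul]
    · exact (Real.fourierIntegral_convergent_iff (μ := volume) ξ).2 (hgi n)
    · exact (Real.fourierIntegral_convergent_iff (μ := volume) ξ).2 hFi
  have hpt2 : ∀ x, Tendsto (fun n => g n x) atTop (𝓝 (F x)) := by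
    intro x
    rw [tendsto_iff_norm_sub_tendsto_zero]
    exact squeeze_zero (fun n => norm_nonneg _) (fun n => hg2 n x) hlim0
  obtain ⟨M, hM⟩ : ∃ M, ∀ x, ‖F x‖ ≤ M := hFc.exists_bound_of_continuous hF
  have hL2 : Tendsto (fun n => ∫ x, ‖g n x‖ ^ 2) atTop (𝓝 (∫ x, ‖F x‖ ^ 2)) := by
    apply tendsto_integral_of_dominated_convergence
      ((closedBall (0 : E2) (R + 1)).indicator fun _ => (M + 1) ^ 2)
    · intro n; exact ((hg1 n).continuous.norm.pow 2).aestronglyMeasurable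
    · exact (integrable_indicator_iff measurableSet_closedBall).2
        ((continuous_const).continuousOn.integrableOn_compact (isCompact_closedBall _ _))
    · intro n
      refine Eventually.of_forall fun x => ?_
      by_cases hx : x ∈ closedBall (0 : E2) (R + 1)
      · rw [Set.indicator_of_mem hx]
        rw [Real.norm_of_nonneg (by positivity)]
        gcongr
        have h1 := norm_sub_norm_le (g n x) (F x)
        have h2 := hg2 n x
        have h3 : 1 / ((n : ℝ) + 1) ≤ 1 := by
          rw [div_le_one (by positivity)]; linarith [(Nat.cast_nonneg n : (0:ℝ) ≤ n)]
        linarith [hM x]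
      · rw [Set.indicator_of_notMem hx, hg3 n x hx]; simp
    · exact Eventually.of_forall fun x => ((hpt2 x).norm.pow 2)
  have hPl : ∀ n, ∫⁻ ξ, ENNReal.ofReal (‖𝓕 (g n) ξ‖ ^ 2) = ENNReal.ofReal (∫ x, ‖g n x‖ ^ 2) := by
    intro n
    have h1 := SchwartzMap.integral_norm_sq_fourier (S n)
    have h2 : ∀ ξ, 𝓕 (g n) ξ = (𝓕 (S n)) ξ := fun ξ => by
      rw [SchwartzMap.fourier_coe]; rfl
    simp only [hSg] at h1
    rw [← h1]
    simp_rw [h2]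
    rw [ofReal_integral_eq_lintegral_ofReal]
    · exact ((𝓕 (S n)).memLp 2).integrable_norm_pow (by norm_num)
    · exact Eventually.of_forall fun ξ => sq_nonneg _
  calc ∫⁻ ξ, ENNReal.ofReal (‖𝓕 F ξ‖ ^ 2)
      = ∫⁻ ξ, liminf (fun n => ENNReal.ofReal (‖𝓕 (g n) ξ‖ ^ 2)) atTop := by
        congr 1; ext ξ
        exact ((ENNReal.continuous_ofReal.tendsto _).comp ((hpt ξ).norm.pow 2)).liminf_eq.symm
    _ ≤ liminf (fun n => ∫⁻ ξ, ENNReal.ofReal (‖𝓕 (g n) ξ‖ ^ 2)) atTop := by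
        apply lintegral_liminf_le
        intro n
        have : Continuous (𝓕 (g n)) := by
          have h2 : 𝓕 (g n) = (𝓕 (S n) : SchwartzMap E2 ℂ) := by
            rw [SchwartzMap.fourier_coe]; rfl
          rw [h2]; exact (𝓕 (S n)).continuous
        fun_prop
    _ = _ := by
        simp_rw [hPl]
        exact ((ENNReal.continuous_ofReal.tendsto _).comp hL2).liminf_eq

lemma fourier_dif {F : E2 → ℂ} (hF : Integrable F) (h ξ : E2) :
    𝓕 (dif h F) ξ = ((Real.fourierChar (⟪h, ξ⟫) : ℂ) - 1) * 𝓕 F ξ := by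
  have h1 : 𝓕 (fun v => F (v + h)) ξ = (Real.fourierChar (⟪h, ξ⟫)) • 𝓕 F ξ := by
    have := VectorFourier.fourierIntegral_comp_add_right Real.fourierChar (volume : Measure E2)
      (innerₗ E2) F h
    exact congrFun this ξ
  have h2 : 𝓕 (dif h F) ξ = 𝓕 (fun v => F (v + h)) ξ - 𝓕 F ξ := by
    unfold dif
    rw [Real.fourier_eq, Real.fourier_eq, Real.fourier_eq, ← integral_sub]
    · simp_rw [smul_sub]
    · exact (Real.fourierIntegral_convergent_iff (μ := volume) ξ).2 (hF.comp_add_right h)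
    · exact (Real.fourierIntegral_convergent_iff (μ := volume) ξ).2 hF
  rw [h2, h1, Circle.smul_def, smul_eq_mul]; ring

lemma fourierChar_sub_one {t : ℝ} (h1 : 1 / 4 ≤ |t|) (h2 : |t| ≤ 1 / 2) :
    1 ≤ ‖(Real.fourierChar t : ℂ) - 1‖ := by
  have hc : Real.cos (2 * Real.pi * t) ≤ 0 := by
    rw [← Real.cos_abs, abs_mul, abs_of_pos Real.two_pi_pos]
    apply Real.cos_nonpos_of_pi_div_two_le_of_le <;> nlinarith [Real.pi_pos]
  have hre : ((Real.fourierChar t : ℂ) - 1).re ≤ -1 := by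
    rw [Real.fourierChar_apply, Complex.sub_re, Complex.exp_ofReal_mul_I_re]
    simp; linarith
  have := Complex.abs_re_le_norm ((Real.fourierChar t : ℂ) - 1)
  rw [abs_of_nonpos (by linarith)] at this
  linarith

lemma difk_cs {F : E2 → ℂ} (hF : Continuous F) (hFc : HasCompactSupport F) (h : E2) (k : ℕ) :
    Continuous ((dif h)^[k] F) ∧ HasCompactSupport ((dif h)^[k] F) := by
  induction k with
  | zero => exact ⟨hF, hFc⟩
  | succ k ih =>
    rw [Function.iterate_succ_apply']
    refine ⟨dif_continuous ih.1 h, ?_⟩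
    unfold dif
    exact (ih.2.comp_homeomorph (Homeomorph.addRight h)).sub ih.2

lemma fourier_le_difk {F : E2 → ℂ} (hF : Continuous F) (hFc : HasCompactSupport F) (h ξ : E2)
    (h1 : 1 / 4 ≤ |⟪h, ξ⟫|) (h2 : |⟪h, ξ⟫| ≤ 1 / 2) (k : ℕ) :
    ‖𝓕 F ξ‖ ≤ ‖𝓕 ((dif h)^[k] F) ξ‖ := by
  induction k with
  | zero => simp
  | succ k ih =>
    rw [Function.iterate_succ_apply']
    have hc := difk_cs hF hFc h k
    rw [fourier_dif (hc.1.integrable_of_hasCompactSupport hc.2), norm_mul]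
    have := fourierChar_sub_one h1 h2
    nlinarith [norm_nonneg (𝓕 ((dif h)^[k] F) ξ)]
end regF4

section regF5
open MeasureTheory FourierTransform

lemma inner_ee (i : Fin 2) (ξ : E2) : ⟪ee i, ξ⟫ = ξ i := by
  simp [ee, EuclideanSpace.inner_single_left]

lemma norm_le_two_max (ξ : E2) : ‖ξ‖ ≤ 2 * max |ξ 0| |ξ 1| := by
  have h1 : ‖ξ‖ ^ 2 = ξ 0 ^ 2 + ξ 1 ^ 2 := by
    rw [EuclideanSpace.norm_sq_eq]; simp [Fin.sum_univ_two]
  have h2 := le_max_left |ξ 0| |ξ 1|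
  have h3 := le_max_right |ξ 0| |ξ 1|
  apply le_of_sq_le_sq _ (by positivity) |> fun h => h
  nlinarith [sq_abs (ξ 0), sq_abs (ξ 1), abs_nonneg (ξ 0), abs_nonneg (ξ 1)]

theorem fourier_int {F : E2 → ℂ} (hF : Continuous F) (hFc : HasCompactSupport F) {k : ℕ}
    {τ σ C s0 : ℝ} (hτ : 0 ≤ τ) (hσ : τ + 1 < σ) (hs0 : 0 < s0) (hC : 0 ≤ C)
    (hyp : ∀ i, ∀ s, 0 < s → s < s0 → ∫ x, ‖(dif (s • ee i))^[k] F x‖ ^ 2 ≤ C * s ^ (2 * σ)) :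
    Integrable (fun ξ => (1 + ‖ξ‖ ^ τ) * ‖𝓕 F ξ‖) := by
  have hFi : Integrable F := hF.integrable_of_hasCompactSupport hFc
  have hcF : Continuous (𝓕 F) := VectorFourier.fourierIntegral_continuous Real.continuous_fourierChar
    (L := innerₗ E2) (by simpa using! continuous_inner) hFi
  have hcont : Continuous (fun ξ : E2 => (1 + ‖ξ‖ ^ τ) * ‖𝓕 F ξ‖) := by
    have : Continuous fun ξ : E2 => ‖ξ‖ ^ τ := continuous_norm.rpow_const (fun _ => Or.inr hτ)
    fun_prop
  set N : E2 → ℝ := fun ξ => max |ξ 0| |ξ 1| with hN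
  have hNc : Continuous N := by
    simp only [hN]; fun_prop
  set A : ℕ → Set E2 := fun j => {ξ | (2:ℝ) ^ j ≤ N ξ ∧ N ξ < 2 ^ (j + 1)} with hA
  have hAm : ∀ j, MeasurableSet (A j) := fun j =>
    (measurableSet_le measurable_const hNc.measurable).inter
      (measurableSet_lt hNc.measurable measurable_const)
  obtain ⟨j0, hj0⟩ : ∃ j0 : ℕ, (1 / 2 : ℝ) ^ j0 < s0 := exists_pow_lt_of_lt_one hs0 (by norm_num)
  set ω : ENNReal := volume (ball (0 : E2) 1) with hω
  have hωf : ω ≠ ⊤ := measure_ball_lt_top.ne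
  -- L2 bound on the shells
  have hL2 : ∀ j ≥ j0, ∫⁻ ξ in A j, ENNReal.ofReal (‖𝓕 F ξ‖ ^ 2) ≤
      ENNReal.ofReal (2 * C * ((1 / 2 : ℝ) ^ j) ^ (2 * σ)) := by
    intro j hj
    set s : ℝ := (1 / 4) * (1 / 2) ^ j with hs
    have hsp : 0 < s := by positivity
    have hss : s < s0 := by
      have : (1 / 2 : ℝ) ^ j ≤ (1 / 2) ^ j0 := pow_le_pow_of_le_one (by norm_num) (by norm_num) hj
      have : 0 < (1 / 2 : ℝ) ^ j := by positivity
      linarith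
    have hs1 : s ^ (2 * σ) ≤ ((1 / 2 : ℝ) ^ j) ^ (2 * σ) := by
      apply Real.rpow_le_rpow hsp.le
      · have : 0 < (1 / 2 : ℝ) ^ j := by positivity
        linarith
      · linarith
    have hs2 : s * 2 ^ j = 1 / 4 := by
      rw [hs, mul_assoc, ← mul_pow]; norm_num
    have hb : ∀ i : Fin 2, ∫⁻ ξ, ENNReal.ofReal (‖𝓕 ((dif (s • ee i))^[k] F) ξ‖ ^ 2) ≤
        ENNReal.ofReal (C * ((1 / 2 : ℝ) ^ j) ^ (2 * σ)) := by
      intro i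
      have hc := difk_cs hF hFc (s • ee i) k
      refine (plancherel_le hc.1 hc.2).trans (ENNReal.ofReal_le_ofReal ?_)
      refine (hyp i s hsp hss).trans ?_
      gcongr
    have hpt : ∀ ξ ∈ A j, ENNReal.ofReal (‖𝓕 F ξ‖ ^ 2) ≤
        ENNReal.ofReal (‖𝓕 ((dif (s • ee 0))^[k] F) ξ‖ ^ 2) +
        ENNReal.ofReal (‖𝓕 ((dif (s • ee 1))^[k] F) ξ‖ ^ 2) := by
      intro ξ hξ
      have hi : ∀ i, (2:ℝ) ^ j ≤ |ξ i| → |ξ i| < 2 ^ (j + 1) → ENNReal.ofReal (‖𝓕 F ξ‖ ^ 2) ≤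
        ENNReal.ofReal (‖𝓕 ((dif (s • ee i))^[k] F) ξ‖ ^ 2) := by
        intro i h1 h2
        apply ENNReal.ofReal_le_ofReal
        have he : |⟪s • ee i, ξ⟫| = s * |ξ i| := by
          rw [real_inner_smul_left, inner_ee, abs_mul, abs_of_pos hsp]
        have := fourier_le_difk hF hFc (s • ee i) ξ (by rw [he]; nlinarith)
          (by rw [he]; rw [pow_succ] at h2; nlinarith) k
        gcongr
      obtain ⟨h1, h2⟩ := hξ
      rcases le_max_iff.1 h1 with h | h
      · exact (hi 0 h ((le_max_left _ _).trans_lt h2)).trans le_self_add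
      · exact (hi 1 h ((le_max_right _ _).trans_lt h2)).trans le_add_self
    have hmeas : ∀ i : Fin 2, Measurable fun ξ => ENNReal.ofReal (‖𝓕 ((dif (s • ee i))^[k] F) ξ‖ ^ 2) := by
      intro i
      have hc := difk_cs hF hFc (s • ee i) k
      have : Continuous (𝓕 ((dif (s • ee i))^[k] F)) :=
        VectorFourier.fourierIntegral_continuous Real.continuous_fourierChar
          (L := innerₗ E2) (by simpa using! continuous_inner)
          (hc.1.integrable_of_hasCompactSupport hc.2)
      fun_prop
    calc _ ≤ ∫⁻ ξ in A j, (ENNReal.ofReal (‖𝓕 ((dif (s • ee 0))^[k] F) ξ‖ ^ 2) +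
        ENNReal.ofReal (‖𝓕 ((dif (s • ee 1))^[k] F) ξ‖ ^ 2)) := setLIntegral_mono' (hAm j) hpt
      _ ≤ ∫⁻ ξ, (ENNReal.ofReal (‖𝓕 ((dif (s • ee 0))^[k] F) ξ‖ ^ 2) +
        ENNReal.ofReal (‖𝓕 ((dif (s • ee 1))^[k] F) ξ‖ ^ 2)) := setLIntegral_le_lintegral _ _
      _ ≤ ENNReal.ofReal (C * ((1 / 2 : ℝ) ^ j) ^ (2 * σ)) + ENNReal.ofReal (C * ((1 / 2 : ℝ) ^ j) ^ (2 * σ)) := by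
        rw [lintegral_add_left (hmeas 0)]
        exact add_le_add (hb 0) (hb 1)
      _ = _ := by
        rw [← ENNReal.ofReal_add (by positivity) (by positivity)]; congr 1; ring
  have hvol : ∀ j, volume (A j) ≤ ENNReal.ofReal ((4 * 2 ^ j) ^ 2) * ω := by
    intro j
    have : A j ⊆ closedBall 0 (4 * 2 ^ j) := by
      intro ξ hξ
      rw [mem_closedBall, dist_zero_right]
      have := norm_le_two_max ξ
      have h2 := hξ.2
      simp only [hN] at h2
      rw [pow_succ] at h2; linarith
    refine (measure_mono this).trans (le_of_eq ?_)
    rw [Measure.addHaar_closedBall _ _ (by positivity)]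
    simp [hω]
  set q : ℝ := (2:ℝ) ^ (τ + 1 - σ) with hq
  have hq0 : 0 < q := by positivity
  have hq1 : q < 1 := Real.rpow_lt_one_of_one_lt_of_neg (by norm_num) (by linarith)
  set K : ℝ := 2 * 4 ^ τ * (2 * C + 16 * ω.toReal) with hK
  have hK0 : 0 ≤ K := by positivity
  have hshell : ∀ j ≥ j0, ∫⁻ ξ in A j, ENNReal.ofReal ((1 + ‖ξ‖ ^ τ) * ‖𝓕 F ξ‖) ≤
      ENNReal.ofReal (K * q ^ j) := by
    intro j hj
    set B : ℝ := (2:ℝ) ^ j with hB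
    have hB1 : 1 ≤ B := one_le_pow₀ (by norm_num)
    have hB0 : 0 < B := by positivity
    set θ : ℝ := B ^ (1 + σ) with hθ
    have hθ0 : 0 < θ := by positivity
    have hw : ∀ ξ ∈ A j, ENNReal.ofReal ((1 + ‖ξ‖ ^ τ) * ‖𝓕 F ξ‖) ≤
        ENNReal.ofReal (2 * (4 * B) ^ τ) *
          (ENNReal.ofReal θ * ENNReal.ofReal (‖𝓕 F ξ‖ ^ 2) + ENNReal.ofReal θ⁻¹) := by
      intro ξ hξ
      rw [← ENNReal.ofReal_mul (by positivity), ← ENNReal.ofReal_add (by positivity) (by positivity),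
        ← ENNReal.ofReal_mul (by positivity)]
      apply ENNReal.ofReal_le_ofReal
      have h1 : ‖ξ‖ ≤ 4 * B := by
        have := norm_le_two_max ξ
        have h2 := hξ.2
        simp only [hN] at h2
        rw [pow_succ] at h2; linarith
      have h2 : ‖ξ‖ ^ τ ≤ (4 * B) ^ τ := Real.rpow_le_rpow (norm_nonneg _) h1 hτ
      have h3 : 1 ≤ (4 * B) ^ τ := Real.one_le_rpow (by linarith) hτ
      have h4 : ‖𝓕 F ξ‖ ≤ θ * ‖𝓕 F ξ‖ ^ 2 + θ⁻¹ := by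
        have : θ * ‖𝓕 F ξ‖ ^ 2 + θ⁻¹ - ‖𝓕 F ξ‖ = θ * (‖𝓕 F ξ‖ - 1 / (2 * θ)) ^ 2 + 3 / 4 * θ⁻¹ := by
          field_simp; ring
        have : 0 ≤ θ * (‖𝓕 F ξ‖ - 1 / (2 * θ)) ^ 2 + 3 / 4 * θ⁻¹ := by positivity
        linarith
      have h5 : 0 ≤ ‖𝓕 F ξ‖ := norm_nonneg _
      calc _ ≤ (2 * (4 * B) ^ τ) * ‖𝓕 F ξ‖ := by gcongr; linarith
        _ ≤ _ := by gcongr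
    have hmeas : Measurable fun ξ => ENNReal.ofReal θ * ENNReal.ofReal (‖𝓕 F ξ‖ ^ 2) := by
      fun_prop
    refine (setLIntegral_mono' (hAm j) hw).trans ?_
    rw [lintegral_const_mul _ (by fun_prop), lintegral_add_left hmeas, lintegral_const_mul _ (by fun_prop)]
    have e1 := hL2 j hj
    have e2 := hvol j
    rw [← ENNReal.ofReal_toReal hωf] at e2
    calc _ ≤ ENNReal.ofReal (2 * (4 * B) ^ τ) * (ENNReal.ofReal θ * ENNReal.ofReal (2 * C * ((1 / 2 : ℝ) ^ j) ^ (2 * σ))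
          + ENNReal.ofReal θ⁻¹ * (ENNReal.ofReal ((4 * 2 ^ j) ^ 2) * ENNReal.ofReal ω.toReal)) := by
          simp only [lintegral_const, Measure.restrict_apply MeasurableSet.univ, Set.univ_inter]
          gcongr
      _ = ENNReal.ofReal (2 * (4 * B) ^ τ * (θ * (2 * C * ((1 / 2 : ℝ) ^ j) ^ (2 * σ)) + θ⁻¹ * ((4 * 2 ^ j) ^ 2 * ω.toReal))) := by
          rw [← ENNReal.ofReal_mul (by positivity), ← ENNReal.ofReal_mul (by positivity),
            ← ENNReal.ofReal_mul (by positivity), ← ENNReal.ofReal_add (by positivity) (by positivity),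
            ← ENNReal.ofReal_mul (by positivity)]
      _ = _ := by
          congr 1
          have hh : ((1 / 2 : ℝ) ^ j) = B⁻¹ := by rw [hB, one_div, inv_pow]
          have hqj : q ^ j = B ^ τ * B ^ (1 - σ) := by
            rw [← Real.rpow_add hB0, hq, hB, ← Real.rpow_natCast, ← Real.rpow_natCast,
              ← Real.rpow_mul (by norm_num), ← Real.rpow_mul (by norm_num)]
            congr 1; ring
          have c1 : θ * (B⁻¹) ^ (2 * σ) = B ^ (1 - σ) := by
            rw [hθ, Real.inv_rpow hB0.le, ← Real.rpow_neg hB0.le, ← Real.rpow_add hB0]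
            congr 1; ring
          have c2 : θ⁻¹ * B ^ 2 = B ^ (1 - σ) := by
            rw [hθ, ← Real.rpow_neg hB0.le, ← Real.rpow_natCast B 2, ← Real.rpow_add hB0]
            congr 1; push_cast; ring
          rw [hh, hqj, Real.mul_rpow (by norm_num) hB0.le, hK, ← hB]
          linear_combination (2 * (4 ^ τ * B ^ τ)) * (2 * C) * c1 + (2 * (4 ^ τ * B ^ τ)) * 16 * ω.toReal * c2
  have hbig : ∫⁻ ξ in ⋃ j, A (j0 + j), ENNReal.ofReal ((1 + ‖ξ‖ ^ τ) * ‖𝓕 F ξ‖) < ⊤ := by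
    refine (lintegral_iUnion_le _ _).trans_lt ?_
    calc _ ≤ ∑' j, ENNReal.ofReal (K * q ^ (j0 + j)) := ENNReal.tsum_le_tsum fun j => hshell _ (by omega)
      _ < ⊤ := by
        have hsum : Summable fun j => K * q ^ (j0 + j) := by
          simp_rw [pow_add]
          exact ((summable_geometric_of_lt_one hq0.le hq1).mul_left _).mul_left _
        rw [← ENNReal.ofReal_tsum_of_nonneg (fun j => by positivity) hsum]
        exact ENNReal.ofReal_lt_top
  have hcover : (Set.univ : Set E2) ⊆ closedBall 0 (2 * 2 ^ j0) ∪ ⋃ j, A (j0 + j) := by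
    intro ξ _
    by_cases h : N ξ < 2 ^ j0
    · left
      rw [mem_closedBall, dist_zero_right]
      have := norm_le_two_max ξ
      simp only [hN] at h; linarith
    · right
      push Not at h
      have h1 : (1:ℝ) ≤ N ξ := le_trans (one_le_pow₀ (by norm_num)) h
      obtain ⟨n, hn1, hn2⟩ := exists_nat_pow_near h1 (by norm_num : (1:ℝ) < 2)
      have hnj : j0 ≤ n := by
        by_contra hlt
        push Not at hlt
        have : (2:ℝ) ^ (n + 1) ≤ 2 ^ j0 := pow_le_pow_right₀ (by norm_num) hlt
        linarith
      refine Set.mem_iUnion.2 ⟨n - j0, ?_⟩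
      rw [Nat.add_sub_cancel' hnj]
      exact ⟨hn1, hn2⟩
  rw [← integrableOn_univ]
  refine IntegrableOn.mono_set ?_ hcover
  apply IntegrableOn.union
  · exact hcont.continuousOn.integrableOn_compact (isCompact_closedBall _ _)
  · refine ⟨hcont.aestronglyMeasurable, ?_⟩
    rw [hasFiniteIntegral_iff_norm]
    convert hbig using 3 with ξ
    rw [Real.norm_of_nonneg]
    have : 0 ≤ ‖ξ‖ ^ τ := by positivity
    positivity

/-- Holder bound from Fourier side. -/
theorem fourier_holder {F : E2 → ℂ} (hF : Continuous F) (hFc : HasCompactSupport F) {k : ℕ}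
    {σ C s0 : ℝ} (hσ : 1 / 2 + 1 < σ) (hs0 : 0 < s0) (hC : 0 ≤ C)
    (hyp : ∀ i, ∀ s, 0 < s → s < s0 → ∫ x, ‖(dif (s • ee i))^[k] F x‖ ^ 2 ≤ C * s ^ (2 * σ)) :
    ∃ C', 0 ≤ C' ∧ ∀ h x, ‖F (x + h) - F x‖ ≤ C' * ‖h‖ ^ (1 / 2 : ℝ) := by
  have hI := fourier_int hF hFc (by norm_num) hσ hs0 hC hyp
  have hFi : Integrable F := hF.integrable_of_hasCompactSupport hFc
  have hcF : Continuous (𝓕 F) := VectorFourier.fourierIntegral_continuous Real.continuous_fourierChar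
    (L := innerₗ E2) (by simpa using! continuous_inner) hFi
  have hFFi : Integrable (𝓕 F) := by
    refine hI.mono' hcF.aestronglyMeasurable (Eventually.of_forall fun ξ => ?_)
    have : 0 ≤ ‖ξ‖ ^ (1 / 2 : ℝ) := by positivity
    nlinarith [norm_nonneg (𝓕 F ξ)]
  have hinv := hF.fourierInv_fourier_eq hFi hFFi
  refine ⟨4 * Real.pi * ∫ ξ, (1 + ‖ξ‖ ^ (1 / 2 : ℝ)) * ‖𝓕 F ξ‖, ?_, fun h x => ?_⟩
  · have : 0 ≤ ∫ ξ, (1 + ‖ξ‖ ^ (1 / 2 : ℝ)) * ‖𝓕 F ξ‖ := integral_nonneg fun ξ => by positivity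
    have := Real.pi_pos
    positivity
  have e : ∀ y, F y = ∫ ξ, Real.fourierChar (⟪ξ, y⟫) • 𝓕 F ξ := fun y => by
    rw [← Real.fourierInv_eq, hinv]
  have hconv : ∀ y, Integrable (fun ξ => Real.fourierChar (⟪ξ, y⟫) • 𝓕 F ξ) := fun y => by
    have := (Real.fourierIntegral_convergent_iff (μ := volume) (-y)).2 hFFi
    simpa using this
  rw [e (x + h), e x, ← integral_sub (hconv _) (hconv _)]
  refine (norm_integral_le_integral_norm _).trans ?_
  rw [mul_assoc, mul_comm _ (‖h‖ ^ (1 / 2 : ℝ)), ← mul_assoc, mul_comm (4 * Real.pi), mul_assoc,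
    ← integral_const_mul, ← integral_const_mul]
  apply integral_mono_of_nonneg (Eventually.of_forall fun ξ => norm_nonneg _)
  · exact (hI.const_mul _).const_mul _
  refine Eventually.of_forall fun ξ => ?_
  simp only [Circle.smul_def, ← sub_smul, norm_smul]
  have h1 : ‖(Real.fourierChar (⟪ξ, x + h⟫) : ℂ) - Real.fourierChar (⟪ξ, x⟫)‖ ≤
      4 * Real.pi * (‖h‖ ^ (1 / 2 : ℝ) * ‖ξ‖ ^ (1 / 2 : ℝ)) := by
    rw [inner_add_right, AddChar.map_add_eq_mul]
    have : ((Real.fourierChar (⟪ξ, x⟫) * Real.fourierChar (⟪ξ, h⟫) : Circle) : ℂ) - Real.fourierChar (⟪ξ, x⟫)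
      = (Real.fourierChar (⟪ξ, x⟫) : ℂ) * ((Real.fourierChar (⟪ξ, h⟫) : ℂ) - 1) := by push_cast; ring
    rw [this, norm_mul, Circle.norm_coe, one_mul]
    set t := ⟪ξ, h⟫
    have ht : |t| ≤ ‖h‖ * ‖ξ‖ := by rw [mul_comm]; exact abs_real_inner_le_norm _ _
    have n1 : ‖(Real.fourierChar t : ℂ) - 1‖ ≤ 2 := by
      refine (norm_sub_le _ _).trans ?_
      rw [Circle.norm_coe]; norm_num
    have n2 : ‖(Real.fourierChar t : ℂ) - 1‖ ≤ 2 * Real.pi * |t| := by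
      rw [Real.fourierChar_apply]
      have := Real.norm_exp_I_mul_ofReal_sub_one_le (x := 2 * Real.pi * t)
      rw [mul_comm] at this
      refine this.trans (le_of_eq ?_)
      rw [Real.norm_eq_abs, abs_mul, abs_of_pos Real.two_pi_pos]
    rw [← Real.mul_rpow (norm_nonneg _) (norm_nonneg _), ← Real.sqrt_eq_rpow]
    set m := ‖h‖ * ‖ξ‖
    have hm : 0 ≤ m := by positivity
    have hs := Real.sq_sqrt hm
    have hs0 := Real.sqrt_nonneg m
    have hpi := Real.pi_gt_three
    by_cases h1 : Real.sqrt m ≤ 1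
    · have : m ≤ Real.sqrt m := by nlinarith
      nlinarith
    · nlinarith
  have h2 : 0 ≤ ‖𝓕 F ξ‖ := norm_nonneg _
  calc _ ≤ 4 * Real.pi * (‖h‖ ^ (1 / 2 : ℝ) * ‖ξ‖ ^ (1 / 2 : ℝ)) * ‖𝓕 F ξ‖ := by gcongr
    _ = ‖h‖ ^ (1 / 2 : ℝ) * (4 * Real.pi * (‖ξ‖ ^ (1 / 2 : ℝ) * ‖𝓕 F ξ‖)) := by ring
    _ ≤ _ := by
      have := Real.pi_pos
      gcongr; linarith

theorem fourier_C1 {F : E2 → ℂ} (hF : Continuous F) (hFc : HasCompactSupport F) {k : ℕ}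
    {σ C s0 : ℝ} (hσ : 1 + 1 < σ) (hs0 : 0 < s0) (hC : 0 ≤ C)
    (hyp : ∀ i, ∀ s, 0 < s → s < s0 → ∫ x, ‖(dif (s • ee i))^[k] F x‖ ^ 2 ≤ C * s ^ (2 * σ)) :
    ContDiff ℝ 1 F := by
  have hI := fourier_int hF hFc (by norm_num) hσ hs0 hC hyp
  simp only [Real.rpow_one] at hI
  have hFi : Integrable F := hF.integrable_of_hasCompactSupport hFc
  have hcF : Continuous (𝓕 F) := VectorFourier.fourierIntegral_continuous Real.continuous_fourierChar
    (L := innerₗ E2) (by simpa using! continuous_inner) hFi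
  have hFFi : Integrable (𝓕 F) := by
    refine hI.mono' hcF.aestronglyMeasurable (Eventually.of_forall fun ξ => ?_)
    nlinarith [norm_nonneg (𝓕 F ξ), norm_nonneg ξ, mul_nonneg (norm_nonneg ξ) (norm_nonneg (𝓕 F ξ))]
  have hinv := hF.fourierInv_fourier_eq hFi hFFi
  have h2 : F = fun y => 𝓕 (𝓕 F) (-y) := by
    ext y
    rw [← Real.fourierInv_eq_fourier_neg, hinv]
  have h3 : ContDiff ℝ ((1 : ℕ∞) : WithTop ℕ∞) (𝓕 (𝓕 F)) := by
    apply Real.contDiff_fourier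
    intro n hn
    have hn' : n ≤ 1 := by exact_mod_cast hn
    refine hI.mono' (by fun_prop) (Eventually.of_forall fun ξ => ?_)
    rw [Real.norm_of_nonneg (by positivity)]
    have : ‖ξ‖ ^ n ≤ 1 + ‖ξ‖ := by
      interval_cases n <;> simp
    gcongr
  rw [h2]
  exact (h3.of_le (by norm_num)).comp contDiff_neg
end regF5

section regF6
open MeasureTheory
set_option linter.unusedSectionVars false

lemma exists_cutoff (z0 : E2) {ρ ρ' : ℝ} (h0 : 0 < ρ) (h : ρ < ρ') :
    ∃ χ : E2 → ℝ, ContDiff ℝ (⊤ : ℕ∞) χ ∧ (∀ z, 0 ≤ χ z) ∧ (∀ z, χ z ≤ 1) ∧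
      (∀ z ∈ ball z0 ρ, χ z = 1) ∧ HasCompactSupport χ ∧ tsupport χ ⊆ ball z0 ρ' ∧
      ∃ L, 0 ≤ L ∧ ∀ i z, |fderiv ℝ χ z (ee i)| ≤ L := by
  let f : ContDiffBump z0 := ⟨ρ, (ρ + ρ') / 2, h0, by linarith⟩
  have hs : ContDiff ℝ (⊤ : ℕ∞) f := f.contDiff
  have hcf : HasCompactSupport (fderiv ℝ f) := f.hasCompactSupport.fderiv (𝕜 := ℝ)
  have hc : Continuous (fderiv ℝ f) := hs.continuous_fderiv (by norm_num)
  obtain ⟨L, hL⟩ := hc.bounded_above_of_compact_support hcf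
  refine ⟨f, hs, fun z => f.nonneg, fun z => f.le_one, fun z hz =>
    f.one_of_mem_closedBall (ball_subset_closedBall hz), f.hasCompactSupport, ?_, L,
    (norm_nonneg _).trans (hL z0), fun i z => ?_⟩
  · rw [f.tsupport_eq]
    exact closedBall_subset_ball (by show (ρ + ρ') / 2 < ρ'; linarith)
  · calc |fderiv ℝ f z (ee i)| ≤ ‖fderiv ℝ f z‖ * ‖ee i‖ := (fderiv ℝ f z).le_opNorm _
      _ ≤ L := by rw [norm_ee, mul_one]; exact hL z

lemma difk_contDiff {n : WithTop ℕ∞} {f : E2 → ℝ} (hf : ContDiff ℝ n f) (h : E2) (k : ℕ) :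
    ContDiff ℝ n ((dif h)^[k] f) := by
  induction k with
  | zero => exact hf
  | succ k ih => rw [Function.iterate_succ_apply']; exact dif_contDiff ih h

lemma difk_smooth_le (k : ℕ) : ∀ {f : E2 → ℝ}, ContDiff ℝ (⊤ : ℕ∞) f → HasCompactSupport f →
    ∃ C, 0 ≤ C ∧ ∀ i s z, |(dif (s • ee i))^[k] f z| ≤ C * |s| ^ k := by
  induction k with
  | zero =>
    intro f hf hc
    obtain ⟨C, hC⟩ := hf.continuous.bounded_above_of_compact_support hc
    exact ⟨C, (norm_nonneg _).trans (hC 0), fun i s z => by simpa using hC z⟩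
  | succ k ih =>
    intro f hf hc
    have key : ∀ i, ∃ C, 0 ≤ C ∧ ∀ s z, |(dif (s • ee i))^[k+1] f z| ≤ C * |s| ^ (k+1) := by
      intro i
      obtain ⟨C, hC0, hC⟩ := ih (f := fun z => fderiv ℝ f z (ee i))
        ((hf.fderiv_right (m := (⊤ : ℕ∞)) (by norm_cast)).clm_apply contDiff_const)
        (hc.fderiv_apply (𝕜 := ℝ) (ee i))
      refine ⟨C, hC0, fun s z => ?_⟩
      have hg : ContDiff ℝ 1 ((dif (s • ee i))^[k] f) := difk_contDiff (hf.of_le (by norm_cast)) _ k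
      have hfd : ∀ (k : ℕ) (y : E2), fderiv ℝ ((dif (s • ee i))^[k] f) y (ee i) =
          (dif (s • ee i))^[k] (fun z => fderiv ℝ f z (ee i)) y := by
        intro k
        induction k with
        | zero => intro y; rfl
        | succ k ihk =>
          intro y
          rw [Function.iterate_succ_apply', Function.iterate_succ_apply',
            fderiv_dif (difk_contDiff (hf.of_le (by norm_cast)) _ k)]
          congr 1; funext y; exact ihk y
      rw [Function.iterate_succ_apply']
      have h1 := dif_sq_le hg (ee i) z s
      have h2 : ∫ t in (0:ℝ)..1, ‖fderiv ℝ ((dif (s • ee i))^[k] f) (z + (t * s) • ee i) (ee i)‖ ^ 2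
          ≤ ∫ t in (0:ℝ)..1, (C * |s| ^ k) ^ 2 := by
        have hcg := cont_fderiv_apply hg (ee i)
        apply intervalIntegral.integral_mono_on (by norm_num)
        · apply Continuous.intervalIntegrable
          fun_prop
        · simp
        · intro t _
          have := hC i s (z + (t * s) • ee i)
          rw [hfd]; rw [← Real.norm_eq_abs] at this
          gcongr
      simp only [intervalIntegral.integral_const, sub_zero, one_smul] at h2
      have h3 : ‖dif (s • ee i) ((dif (s • ee i))^[k] f) z‖ ^ 2 ≤ (C * |s| ^ (k+1)) ^ 2 := by
        calc _ ≤ s ^ 2 * (C * |s| ^ k) ^ 2 := h1.trans (by gcongr)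
          _ = _ := by rw [← sq_abs s]; ring
      exact le_of_sq_le_sq h3 (by positivity) |> fun h => h
    choose C hC0 hC using key
    refine ⟨C 0 + C 1, add_nonneg (hC0 0) (hC0 1), fun i s z => (hC i s z).trans ?_⟩
    have := hC0 0; have := hC0 1
    gcongr
    fin_cases i <;> simp <;> linarith

variable {H : Type*} [NormedAddCommGroup H] [InnerProductSpace ℝ H]

lemma dif_clm {G : Type*} [NormedAddCommGroup G] [InnerProductSpace ℝ G] (L : H →L[ℝ] G)
    (h : E2) (F : E2 → H) (k : ℕ) (z : E2) :
    (dif h)^[k] (fun y => L (F y)) z = L ((dif h)^[k] F z) := by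
  induction k generalizing F with
  | zero => rfl
  | succ k ih =>
    rw [Function.iterate_succ_apply, Function.iterate_succ_apply, ← ih]
    have : (dif h fun y => L (F y)) = fun y => L (dif h F y) := by funext y; simp [dif]
    rw [this]

lemma dif2_mul (χ : E2 → ℝ) (F : E2 → H) (h z : E2) :
    (dif h)^[2] (fun y => χ y • F y) z = χ (z+h+h) • (dif h)^[2] F z
      + (2 * dif h χ (z+h)) • dif h F z + (dif h)^[2] χ z • F z := by
  simp only [Function.iterate_succ_apply, Function.iterate_zero_apply, dif]
  module

lemma dif3_mul (χ : E2 → ℝ) (F : E2 → H) (h z : E2) :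
    (dif h)^[3] (fun y => χ y • F y) z = χ (z+h+h+h) • (dif h)^[3] F z
      + (3 * dif h χ (z+h+h)) • (dif h)^[2] F z + (3 * (dif h)^[2] χ (z+h)) • dif h F z +
       (dif h)^[3] χ z • F z := by
  simp only [Function.iterate_succ_apply, Function.iterate_zero_apply, dif]
  module

lemma difk_zero_of_far {χ : E2 → ℝ} {z0 : E2} {ρ ρ' : ℝ} (hs : tsupport χ ⊆ ball z0 ρ)
    (F : E2 → H) (h : E2) (k : ℕ) (z : E2) (hz : z ∉ ball z0 ρ') (hh : ρ + k * ‖h‖ ≤ ρ') :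
    (dif h)^[k] (fun y => χ y • F y) z = 0 := by
  have key : ∀ (k : ℕ) (G : E2 → H) (z : E2), (∀ j ≤ k, G (z + (j : ℝ) • h) = 0) →
      (dif h)^[k] G z = 0 := by
    intro k
    induction k with
    | zero => intro G z hG; simpa using hG 0 le_rfl
    | succ k ih =>
      intro G z hG
      rw [Function.iterate_succ_apply]
      apply ih
      intro j hj
      simp only [dif]
      have h1 := hG j (by omega)
      have h2 := hG (j+1) (by omega)
      rw [show z + (j:ℝ) • h + h = z + ((j+1 : ℕ) : ℝ) • h by push_cast; module, h1, h2, sub_zero]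
  apply key
  intro j hj
  have : z + (j:ℝ) • h ∉ tsupport χ := by
    intro hm
    have := hs hm
    rw [mem_ball, dist_eq_norm] at this
    apply hz
    rw [mem_ball, dist_eq_norm]
    have e : z - z0 = (z + (j:ℝ) • h - z0) - (j:ℝ) • h := by abel
    calc ‖z - z0‖ ≤ ‖z + (j:ℝ) • h - z0‖ + ‖(j:ℝ) • h‖ := by rw [e]; exact norm_sub_le _ _
      _ < ρ + j * ‖h‖ := by rw [norm_smul]; simp; linarith
      _ ≤ ρ + k * ‖h‖ := by gcongr
      _ ≤ ρ' := hh
  rw [image_eq_zero_of_notMem_tsupport this, zero_smul]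

lemma difk_continuous {F : E2 → H} (hF : Continuous F) (h : E2) (k : ℕ) :
    Continuous ((dif h)^[k] F) := by
  induction k with
  | zero => exact hF
  | succ k ih => rw [Function.iterate_succ_apply']; exact dif_continuous ih h

/-- integrated estimate -/
def IntE (F : E2 → H) (k : ℕ) (p : ℝ) (z0 : E2) (r : ℝ) : Prop :=
  ∀ ρ, 0 < ρ → ρ < r → ∃ C s0, 0 ≤ C ∧ 0 < s0 ∧ ∀ i s, 0 < s → s < s0 →
    ∫ z in ball z0 ρ, ‖(dif (s • ee i))^[k] F z‖ ^ 2 ≤ C * s ^ p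

lemma IntE.zero {F : E2 → H} (z0 : E2) (r : ℝ) : IntE F 0 0 z0 r := by
  intro ρ _ _
  refine ⟨∫ z in ball z0 ρ, ‖F z‖ ^ 2, 1, ?_, one_pos, fun i s _ _ => by simp⟩
  exact integral_nonneg fun z => by positivity

lemma IntE.weaken {F : E2 → H} {k : ℕ} {p q : ℝ} {z0 : E2} {r : ℝ} (h : IntE F k p z0 r)
    (hqp : q ≤ p) : IntE F k q z0 r := by
  intro ρ h0 h1
  obtain ⟨C, s0, hC, hs0, hh⟩ := h ρ h0 h1
  refine ⟨C, min s0 1, hC, by positivity, fun i s hs hs1 => (hh i s hs (hs1.trans_le (min_le_left _ _))).trans ?_⟩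
  have := Real.rpow_le_rpow_of_exponent_ge hs (hs1.le.trans (min_le_right _ _)) hqp
  gcongr

lemma sq_add_le (a b : H) (x y : ℝ) (ha : ‖a‖ ≤ x) (hb : ‖b‖ ≤ y) :
    ‖a + b‖ ^ 2 ≤ 2 * x ^ 2 + 2 * y ^ 2 := by
  have := norm_add_le a b
  have h0 := norm_nonneg (a + b)
  have h1 := norm_nonneg a
  have h2 := norm_nonneg b
  nlinarith [sq_nonneg (x - y)]

end regF6

section regF7
open MeasureTheory
set_option linter.unusedSectionVars false
variable {H : Type*} [NormedAddCommGroup H] [InnerProductSpace ℝ H]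

lemma setInt_smul_sq_le {c : E2 → ℝ} {G : E2 → H} (hc : Continuous c) (hG : Continuous G)
    (z0 : E2) (ρ : ℝ) {M : ℝ} (hM : ∀ z, |c z| ≤ M) :
    ∫ z in ball z0 ρ, ‖c z • G z‖ ^ 2 ≤ M ^ 2 * ∫ z in ball z0 ρ, ‖G z‖ ^ 2 := by
  rw [← integral_const_mul]
  apply setIntegral_mono_on
  · exact integrableOn_ball_of_cont (by fun_prop) z0 ρ
  · exact integrableOn_ball_of_cont (by fun_prop) z0 ρ
  · exact measurableSet_ball
  · intro z _
    rw [norm_smul, mul_pow]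
    have := hM z
    rw [← Real.norm_eq_abs] at this
    gcongr

lemma setInt_sum4_le {a b c d : E2 → H} (ha : Continuous a) (hb : Continuous b)
    (hc : Continuous c) (hd : Continuous d) (z0 : E2) (ρ : ℝ) :
    ∫ z in ball z0 ρ, ‖a z + b z + c z + d z‖ ^ 2 ≤ 4 * ((∫ z in ball z0 ρ, ‖a z‖ ^ 2) +
      (∫ z in ball z0 ρ, ‖b z‖ ^ 2) + (∫ z in ball z0 ρ, ‖c z‖ ^ 2) + ∫ z in ball z0 ρ, ‖d z‖ ^ 2) := by
  have I : ∀ {f : E2 → ℝ}, Continuous f → IntegrableOn f (ball z0 ρ) :=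
    fun hf => integrableOn_ball_of_cont hf z0 ρ
  rw [← integral_add (I (by fun_prop)) (I (by fun_prop)),
    ← integral_add (I (by fun_prop)) (I (by fun_prop)),
    ← integral_add (I (by fun_prop)) (I (by fun_prop)), ← integral_const_mul]
  apply setIntegral_mono_on (I (by fun_prop)) (I (by fun_prop)) measurableSet_ball
  intro z _
  have h1 : ‖a z + b z + c z + d z‖ ≤ ‖a z‖ + ‖b z‖ + ‖c z‖ + ‖d z‖ := by
    refine (norm_add_le _ _).trans ?_
    gcongr
    exact norm_add₃_le
  have h2 : ‖a z + b z + c z + d z‖ ^ 2 ≤ (‖a z‖ + ‖b z‖ + ‖c z‖ + ‖d z‖) ^ 2 := by gcongr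
  refine h2.trans ?_
  nlinarith [sq_nonneg (‖a z‖ - ‖b z‖), sq_nonneg (‖a z‖ - ‖c z‖), sq_nonneg (‖a z‖ - ‖d z‖),
    sq_nonneg (‖b z‖ - ‖c z‖), sq_nonneg (‖b z‖ - ‖d z‖), sq_nonneg (‖c z‖ - ‖d z‖)]

/-- one term of the Leibniz rule -/
lemma leib_term {F : E2 → H} (hF : Continuous F) {χ : E2 → ℝ} (hχ : ContDiff ℝ (⊤ : ℕ∞) χ)
    (hχc : HasCompactSupport χ) {z0 : E2} {ρ r : ℝ} (hρ0 : 0 < ρ) (hρ : ρ < r) (m j : ℕ) {q p : ℝ}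
    (hE : IntE F j q z0 r) (hp : p ≤ q + 2 * m) (κ : ℝ) (n : ℝ) :
    ∃ C s0, 0 ≤ C ∧ 0 < s0 ∧ ∀ i s, 0 < s → s < s0 →
      ∫ z in ball z0 ρ, ‖(κ * (dif (s • ee i))^[m] χ (z + (n * s) • ee i)) •
        (dif (s • ee i))^[j] F z‖ ^ 2 ≤ C * s ^ p := by
  obtain ⟨M, hM0, hM⟩ := difk_smooth_le m hχ hχc
  obtain ⟨C, s0, hC, hs0, hE⟩ := hE ρ hρ0 hρ
  refine ⟨(|κ| * M) ^ 2 * C, min s0 1, by positivity, by positivity, fun i s hs hs1 => ?_⟩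
  have h1 : s < s0 := hs1.trans_le (min_le_left _ _)
  have h2 : s < 1 := hs1.trans_le (min_le_right _ _)
  have hc1 : Continuous ((dif (s • ee i))^[m] χ) := difk_continuous hχ.continuous _ _
  refine (setInt_smul_sq_le (M := |κ| * (M * |s| ^ m)) (by fun_prop)
    (difk_continuous hF _ _) z0 ρ ?_).trans ?_
  · intro z
    rw [abs_mul]
    gcongr
    exact hM i s _
  · rw [abs_of_pos hs]
    calc (|κ| * (M * s ^ m)) ^ 2 * ∫ z in ball z0 ρ, ‖(dif (s • ee i))^[j] F z‖ ^ 2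
        ≤ (|κ| * (M * s ^ m)) ^ 2 * (C * s ^ q) := by gcongr; exact hE i s hs h1
      _ = (|κ| * M) ^ 2 * C * (s ^ q * s ^ (2 * m : ℝ)) := by
          have : s ^ (2 * m : ℝ) = (s ^ m) ^ 2 := by
            rw [mul_comm, Real.rpow_mul hs.le, Real.rpow_natCast]; norm_cast
          rw [this]; ring
      _ ≤ _ := by
          rw [← Real.rpow_add hs]
          have := Real.rpow_le_rpow_of_exponent_ge hs h2.le hp
          gcongr

lemma cut2 {F : E2 → H} (hF : Continuous F) {χ : E2 → ℝ} (hχ : ContDiff ℝ (⊤ : ℕ∞) χ)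
    (hχc : HasCompactSupport χ) {z0 : E2} {ρ r : ℝ} (hρ0 : 0 < ρ) (hρ : ρ < r)
    (hs : tsupport χ ⊆ ball z0 ρ)
    (h1 : IntE F 1 2 z0 r) (h2 : IntE F 2 4 z0 r) :
    ∃ C s0, 0 ≤ C ∧ 0 < s0 ∧ ∀ i s, 0 < s → s < s0 →
      ∫ z, ‖(dif (s • ee i))^[2] (fun y => χ y • F y) z‖ ^ 2 ≤ C * s ^ (4:ℝ) := by
  have hρ' : (ρ + r) / 2 < r := by linarith
  have hρ0' : 0 < (ρ + r) / 2 := by linarith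
  set R := (ρ + r) / 2 with hR
  obtain ⟨C0, t0, hC0, ht0, e0⟩ := leib_term hF hχ hχc hρ0' hρ' 2 0 (p := 4) (IntE.zero z0 r) (by norm_num) 1 0
  obtain ⟨C1, t1, hC1, ht1, e1⟩ := leib_term hF hχ hχc hρ0' hρ' 1 1 (p := 4) h1 (by norm_num) 2 1
  obtain ⟨C2, t2, hC2, ht2, e2⟩ := leib_term hF hχ hχc hρ0' hρ' 0 2 (p := 4) h2 (by norm_num) 1 2
  refine ⟨4 * (C0 + C1 + C2), min (min t0 t1) (min t2 ((r - ρ) / 4)), by positivity,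
    by have : 0 < (r - ρ) / 4 := by linarith
       positivity, fun i s hs0 hs1 => ?_⟩
  simp only [lt_min_iff] at hs1
  have hfar : ∀ z ∉ ball z0 R, ‖(dif (s • ee i))^[2] (fun y => χ y • F y) z‖ ^ 2 = 0 := by
    intro z hz
    rw [difk_zero_of_far hs F _ 2 z hz]
    · simp
    · rw [norm_smul, norm_ee, Real.norm_of_nonneg hs0.le]; push_cast; linarith
  rw [← setIntegral_eq_integral_of_forall_compl_eq_zero hfar]
  have f0 := e0 i s hs0 hs1.1.1
  have f1 := e1 i s hs0 hs1.1.2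
  have f2 := e2 i s hs0 hs1.2.1
  have c0 := hχ.continuous
  have cd := fun k => difk_continuous (H := ℝ) c0 (s • ee i) k
  have cF := fun k => difk_continuous hF (s • ee i) k
  have c1 := cd 0; have c2 := cd 1; have c3 := cd 2
  have d0 := cF 0; have d1 := cF 1; have d2 := cF 2
  have := setInt_sum4_le (a := fun z => (1 * (dif (s • ee i))^[0] χ (z + (2 * s) • ee i)) •
        (dif (s • ee i))^[2] F z) (b := fun z => (2 * (dif (s • ee i))^[1] χ (z + (1 * s) • ee i)) •
        (dif (s • ee i))^[1] F z) (c := fun z => (1 * (dif (s • ee i))^[2] χ (z + (0 * s) • ee i)) •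
        (dif (s • ee i))^[0] F z) (d := fun _ => 0) (by fun_prop) (by fun_prop) (by fun_prop)
        (by fun_prop) z0 R
  have e : ∀ z, (dif (s • ee i))^[2] (fun y => χ y • F y) z =
      (1 * (dif (s • ee i))^[0] χ (z + (2 * s) • ee i)) • (dif (s • ee i))^[2] F z +
      (2 * (dif (s • ee i))^[1] χ (z + (1 * s) • ee i)) • (dif (s • ee i))^[1] F z +
      (1 * (dif (s • ee i))^[2] χ (z + (0 * s) • ee i)) • (dif (s • ee i))^[0] F z + 0 := by
    intro z
    rw [dif2_mul, show z + s • ee i + s • ee i = z + (2 * s) • ee i by module,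
      show z + s • ee i = z + (1 * s) • ee i by module]
    simp
  simp only [e]
  refine this.trans ?_
  simp only [norm_zero, ne_eq, OfNat.ofNat_ne_zero, not_false_eq_true, zero_pow, integral_zero, add_zero]
  linarith

lemma cut3 {F : E2 → H} (hF : Continuous F) {χ : E2 → ℝ} (hχ : ContDiff ℝ (⊤ : ℕ∞) χ)
    (hχc : HasCompactSupport χ) {z0 : E2} {ρ r : ℝ} (hρ0 : 0 < ρ) (hρ : ρ < r)
    (hs : tsupport χ ⊆ ball z0 ρ)
    (h1 : IntE F 1 2 z0 r) (h2 : IntE F 2 4 z0 r) (h3 : IntE F 3 5 z0 r) :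
    ∃ C s0, 0 ≤ C ∧ 0 < s0 ∧ ∀ i s, 0 < s → s < s0 →
      ∫ z, ‖(dif (s • ee i))^[3] (fun y => χ y • F y) z‖ ^ 2 ≤ C * s ^ (5:ℝ) := by
  have hρ' : (ρ + r) / 2 < r := by linarith
  have hρ0' : 0 < (ρ + r) / 2 := by linarith
  set R := (ρ + r) / 2 with hR
  obtain ⟨C0, t0, hC0, ht0, e0⟩ := leib_term hF hχ hχc hρ0' hρ' 3 0 (p := 5) (IntE.zero z0 r) (by norm_num) 1 0
  obtain ⟨C1, t1, hC1, ht1, e1⟩ := leib_term hF hχ hχc hρ0' hρ' 2 1 (p := 5) h1 (by norm_num) 3 1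
  obtain ⟨C2, t2, hC2, ht2, e2⟩ := leib_term hF hχ hχc hρ0' hρ' 1 2 (p := 5) h2 (by norm_num) 3 2
  obtain ⟨C3, t3, hC3, ht3, e3⟩ := leib_term hF hχ hχc hρ0' hρ' 0 3 (p := 5) h3 (by norm_num) 1 3
  refine ⟨4 * (C0 + C1 + C2 + C3), min (min (min t0 t1) t3) (min t2 ((r - ρ) / 6)), by positivity,
    by have : 0 < (r - ρ) / 6 := by linarith
       positivity, fun i s hs0 hs1 => ?_⟩
  simp only [lt_min_iff] at hs1
  have hfar : ∀ z ∉ ball z0 R, ‖(dif (s • ee i))^[3] (fun y => χ y • F y) z‖ ^ 2 = 0 := by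
    intro z hz
    rw [difk_zero_of_far hs F _ 3 z hz]
    · simp
    · rw [norm_smul, norm_ee, Real.norm_of_nonneg hs0.le]; push_cast; linarith
  rw [← setIntegral_eq_integral_of_forall_compl_eq_zero hfar]
  have f0 := e0 i s hs0 hs1.1.1.1
  have f1 := e1 i s hs0 hs1.1.1.2
  have f2 := e2 i s hs0 hs1.2.1
  have f3 := e3 i s hs0 hs1.1.2
  have c0 := hχ.continuous
  have cd := fun k => difk_continuous (H := ℝ) c0 (s • ee i) k
  have cF := fun k => difk_continuous hF (s • ee i) k
  have c1 := cd 0; have c2 := cd 1; have c3 := cd 2; have c4 := cd 3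
  have d0 := cF 0; have d1 := cF 1; have d2 := cF 2; have d3 := cF 3
  have := setInt_sum4_le (a := fun z => (1 * (dif (s • ee i))^[0] χ (z + (3 * s) • ee i)) •
        (dif (s • ee i))^[3] F z) (b := fun z => (3 * (dif (s • ee i))^[1] χ (z + (2 * s) • ee i)) •
        (dif (s • ee i))^[2] F z) (c := fun z => (3 * (dif (s • ee i))^[2] χ (z + (1 * s) • ee i)) •
        (dif (s • ee i))^[1] F z) (d := fun z => (1 * (dif (s • ee i))^[3] χ (z + (0 * s) • ee i)) •
        (dif (s • ee i))^[0] F z) (by fun_prop) (by fun_prop) (by fun_prop)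
        (by fun_prop) z0 R
  have e : ∀ z, (dif (s • ee i))^[3] (fun y => χ y • F y) z =
      (1 * (dif (s • ee i))^[0] χ (z + (3 * s) • ee i)) • (dif (s • ee i))^[3] F z +
      (3 * (dif (s • ee i))^[1] χ (z + (2 * s) • ee i)) • (dif (s • ee i))^[2] F z +
      (3 * (dif (s • ee i))^[2] χ (z + (1 * s) • ee i)) • (dif (s • ee i))^[1] F z +
      (1 * (dif (s • ee i))^[3] χ (z + (0 * s) • ee i)) • (dif (s • ee i))^[0] F z := by
    intro z
    rw [dif3_mul, show z + s • ee i + s • ee i + s • ee i = z + (3 * s) • ee i by module,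
      show z + s • ee i + s • ee i = z + (2 * s) • ee i by module,
      show z + s • ee i = z + (1 * s) • ee i by module]
    simp
  simp only [e]
  refine this.trans ?_
  linarith

variable [FiniteDimensional ℝ H]

/-- the complexified `j`-th component -/
def compC (j : Fin (Module.finrank ℝ H)) : H →L[ℝ] ℂ :=
  Complex.ofRealCLM.comp (innerSL ℝ (stdOrthonormalBasis ℝ H j))

lemma norm_compC_le (j : Fin (Module.finrank ℝ H)) (w : H) : ‖compC j w‖ ≤ ‖w‖ := by
  simp only [compC, ContinuousLinearMap.comp_apply, Complex.ofRealCLM_apply, innerSL_apply_apply,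
    Complex.norm_real]
  refine (norm_inner_le_norm _ _).trans ?_
  simp

lemma compC_repr (w : H) : w = ∑ j, (compC j w).re • (stdOrthonormalBasis ℝ H j) := by
  conv_lhs => rw [← (stdOrthonormalBasis ℝ H).sum_repr w]
  refine Finset.sum_congr rfl fun j _ => ?_
  simp [compC, OrthonormalBasis.repr_apply_apply]

lemma comp_int_le {G : E2 → H} (hG : Continuous G) (hGc : HasCompactSupport G)
    (j : Fin (Module.finrank ℝ H)) (h : E2) (k : ℕ) :
    ∫ z, ‖(dif h)^[k] (fun y => compC j (G y)) z‖ ^ 2 ≤ ∫ z, ‖(dif h)^[k] G z‖ ^ 2 := by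
  have hcs : ∀ k, HasCompactSupport ((dif h)^[k] G) := by
    intro k
    induction k with
    | zero => exact hGc
    | succ k ih =>
      rw [Function.iterate_succ_apply']
      exact (ih.comp_homeomorph (Homeomorph.addRight h)).sub ih
  have hc := difk_continuous hG h k
  have hi : Integrable (fun z => ‖(dif h)^[k] G z‖ ^ 2) := by
    apply Continuous.integrable_of_hasCompactSupport (by fun_prop)
    apply (hcs k).mono
    intro z hz
    simp only [Function.mem_support] at hz ⊢
    contrapose! hz
    simp [hz]
  apply integral_mono_of_nonneg (Eventually.of_forall fun z => by positivity) hi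
  refine Eventually.of_forall fun z => ?_
  simp only [dif_clm]
  have := norm_compC_le j ((dif h)^[k] G z)
  gcongr

theorem loc_holder {F : E2 → H} (hF : Continuous F) {z0 : E2} {r : ℝ}
    (h1 : IntE F 1 2 z0 r) (h2 : IntE F 2 4 z0 r) {ρ : ℝ} (hρ0 : 0 < ρ) (hρ : ρ < r) :
    ∃ C, 0 ≤ C ∧ ∀ x ∈ ball z0 ρ, ∀ h, x + h ∈ ball z0 ρ → ‖F (x + h) - F x‖ ≤ C * ‖h‖ ^ (1/2 : ℝ) := by
  obtain ⟨χ, hχ, -, -, hχ1, hχc, hχs, -⟩ := exists_cutoff z0 hρ0 (show ρ < (ρ + r) / 2 by linarith)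
  obtain ⟨C, s0, hC, hs0, hcut⟩ := cut2 hF hχ hχc (by linarith) (by linarith) hχs h1 h2
  have hGc : Continuous (fun y => χ y • F y) := hχ.continuous.smul hF
  have hGs : HasCompactSupport (fun y => χ y • F y) := hχc.smul_right
  have key : ∀ j : Fin (Module.finrank ℝ H), ∃ C', 0 ≤ C' ∧ ∀ h x,
      ‖compC j (χ (x + h) • F (x + h)) - compC j (χ x • F x)‖ ≤ C' * ‖h‖ ^ (1 / 2 : ℝ) := by
    intro j
    apply fourier_holder (k := 2) (σ := 2) (C := C) (s0 := s0)
      (F := fun y => compC j (χ y • F y)) ((compC j).continuous.comp hGc)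
      (hGs.comp_left (map_zero _)) (by norm_num) hs0 hC
    intro i s hs hs1
    refine (comp_int_le hGc hGs j _ 2).trans ?_
    rw [show (2 * 2 : ℝ) = 4 by norm_num]
    exact hcut i s hs hs1
  choose C' hC'0 hC' using key
  refine ⟨∑ j, C' j, Finset.sum_nonneg fun j _ => hC'0 j, fun x hx h hxh => ?_⟩
  rw [compC_repr (F (x + h) - F x), Finset.sum_mul]
  refine (norm_sum_le _ _).trans (Finset.sum_le_sum fun j _ => ?_)
  rw [norm_smul, OrthonormalBasis.norm_eq_one, mul_one]
  have := hC' j h x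
  rw [hχ1 _ hx, hχ1 _ hxh, one_smul, one_smul, ← map_sub] at this
  exact (Complex.abs_re_le_norm _).trans this

theorem loc_C1 {F : E2 → H} (hF : Continuous F) {z0 : E2} {r : ℝ}
    (h1 : IntE F 1 2 z0 r) (h2 : IntE F 2 4 z0 r) (h3 : IntE F 3 5 z0 r) (hr : 0 < r) :
    ContDiffAt ℝ 1 F z0 := by
  obtain ⟨χ, hχ, -, -, hχ1, hχc, hχs, -⟩ := exists_cutoff z0 (show 0 < r / 4 by linarith)
    (show r / 4 < r / 2 by linarith)
  obtain ⟨C, s0, hC, hs0, hcut⟩ := cut3 hF hχ hχc (by linarith) (by linarith) hχs h1 h2 h3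
  have hGc : Continuous (fun y => χ y • F y) := hχ.continuous.smul hF
  have hGs : HasCompactSupport (fun y => χ y • F y) := hχc.smul_right
  have key : ∀ j : Fin (Module.finrank ℝ H), ContDiff ℝ 1 (fun y => compC j (χ y • F y)) := by
    intro j
    apply fourier_C1 (k := 3) (σ := 5/2) (C := C) (s0 := s0)
      (F := fun y => compC j (χ y • F y)) ((compC j).continuous.comp hGc)
      (hGs.comp_left (map_zero _)) (by norm_num) hs0 hC
    intro i s hs hs1
    refine (comp_int_le hGc hGs j _ 3).trans ?_
    rw [show (2 * (5 / 2) : ℝ) = 5 by norm_num]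
    exact hcut i s hs hs1
  have hG : ContDiff ℝ 1 (fun y => ∑ j, (compC j (χ y • F y)).re • (stdOrthonormalBasis ℝ H j)) := by
    apply ContDiff.sum
    intro j _
    exact (Complex.reCLM.contDiff.comp (key j)).smul contDiff_const
  refine hG.contDiffAt.congr_of_eventuallyEq ?_
  filter_upwards [ball_mem_nhds z0 (show 0 < r / 4 by linarith)] with y hy
  rw [← compC_repr, hχ1 y hy, one_smul]

end regF7

section regF8
open MeasureTheory
set_option linter.unusedSectionVars false
set_option maxSynthPendingDepth 4
variable {H : Type*} [NormedAddCommGroup H] [InnerProductSpace ℝ H]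

lemma B_est {B T W : H} {lam Lam g : ℝ} (hT : lam * ‖W‖ ^ 2 ≤ ⟪T, W⟫) (hT2 : ‖T‖ ≤ Lam * ‖W‖)
    (he : ‖B - T‖ ≤ g + lam / 2 * ‖W‖) (hl : 0 ≤ lam) :
    (lam / 2) * ‖W‖ ^ 2 - g * ‖W‖ ≤ ⟪B, W⟫ ∧ ‖B‖ ≤ (Lam + lam) * ‖W‖ + g := by
  constructor
  · have h1 : ⟪B, W⟫ = ⟪T, W⟫ + ⟪B - T, W⟫ := by rw [← inner_add_left]; simp
    have h2 : |⟪B - T, W⟫| ≤ ‖B - T‖ * ‖W‖ := abs_real_inner_le_norm _ _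
    have h3 : ‖B - T‖ * ‖W‖ ≤ (g + lam / 2 * ‖W‖) * ‖W‖ := by gcongr
    rw [h1]
    have := neg_abs_le ⟪B - T, W⟫
    nlinarith
  · have h1 : B = T + (B - T) := by abel
    have h2 := norm_add_le T (B - T)
    rw [← h1] at h2
    nlinarith [norm_nonneg W]

lemma cacc_ball {lam Lam : ℝ} (hl : 0 < lam) (hLam : 0 ≤ Lam) (z0 : E2) {ρ ρ' : ℝ} (h0 : 0 < ρ)
    (h : ρ < ρ') : ∃ K0, 0 ≤ K0 ∧ ∀ (U B : E2 → H) (g : E2 → ℝ), ContDiff ℝ 1 U → Continuous B →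
    Continuous g → (∀ z, 0 ≤ g z) → WEq U B z0 ρ' →
    (∀ z ∈ ball z0 ρ', lam * ‖fderiv ℝ U z (ee 1)‖ ^ 2 - g z * ‖fderiv ℝ U z (ee 1)‖ ≤
      ⟪B z, fderiv ℝ U z (ee 1)⟫ ∧ ‖B z‖ ≤ Lam * ‖fderiv ℝ U z (ee 1)‖ + g z) →
    ∀ j, ∫ z in ball z0 ρ, ‖fderiv ℝ U z (ee j)‖ ^ 2 ≤
      K0 * ((∫ z in ball z0 ρ', g z ^ 2) + ∫ z in ball z0 ρ', ‖U z‖ ^ 2) := by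
  obtain ⟨χ, hχ, hχ0, hχle, hχ1, hχc, hχs, L, hL0, hL⟩ := exists_cutoff z0 h0 h
  have hχ' : ContDiff ℝ 1 χ := hχ.of_le (by norm_cast)
  refine ⟨caccK lam Lam * (1 + L ^ 2), by have := (caccK_pos (Lam := Lam) hl).le; positivity, ?_⟩
  intro U B g hU hB hg hg0 hw hh j
  have hmain := cacc hl hLam hL0 hU hB hg hg0 hw hχ' hχ0 hχc hχs hL (fun z hz => (hh z hz).1)
    (fun z hz => (hh z hz).2)
  have hc0 := cont_fderiv_apply hU (ee 0)
  have hc1 := cont_fderiv_apply hU (ee 1)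
  have hcj := cont_fderiv_apply hU (ee j)
  have hχcont := hχ.continuous
  have e1 : ∫ z in ball z0 ρ, ‖fderiv ℝ U z (ee j)‖ ^ 2 ≤
      ∫ z, χ z ^ 2 * (‖fderiv ℝ U z (ee 0)‖ ^ 2 + ‖fderiv ℝ U z (ee 1)‖ ^ 2) := by
    calc _ ≤ ∫ z in ball z0 ρ, χ z ^ 2 * (‖fderiv ℝ U z (ee 0)‖ ^ 2 + ‖fderiv ℝ U z (ee 1)‖ ^ 2) := by
          apply setIntegral_mono_on (integrableOn_ball_of_cont (by fun_prop) _ _)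
            (integrableOn_ball_of_cont (by fun_prop) _ _) measurableSet_ball
          intro z hz
          rw [hχ1 z hz]
          fin_cases j <;> simp
      _ ≤ _ := by
          apply setIntegral_le_integral
          · apply Continuous.integrable_of_hasCompactSupport (by fun_prop)
            apply hχc.mono
            intro z hz
            simp only [Function.mem_support] at hz ⊢
            contrapose! hz
            simp [hz]
          · exact Eventually.of_forall fun z => by positivity
  have e2 : ∫ z, χ z ^ 2 * g z ^ 2 ≤ ∫ z in ball z0 ρ', g z ^ 2 := by
    have hfar : ∀ z ∉ ball z0 ρ', χ z ^ 2 * g z ^ 2 = 0 := by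
      intro z hz
      rw [image_eq_zero_of_notMem_tsupport (fun hm => hz (hχs hm))]; simp
    rw [← setIntegral_eq_integral_of_forall_compl_eq_zero hfar]
    apply setIntegral_mono_on (integrableOn_ball_of_cont (by fun_prop) _ _)
      (integrableOn_ball_of_cont (by fun_prop) _ _) measurableSet_ball
    intro z hz
    have : χ z ^ 2 ≤ 1 := pow_le_one₀ (hχ0 z) (hχle z)
    nlinarith [sq_nonneg (g z)]
  have n1 : 0 ≤ ∫ z in ball z0 ρ', g z ^ 2 := integral_nonneg fun z => by positivity
  have n2 : 0 ≤ ∫ z in ball z0 ρ', ‖U z‖ ^ 2 := integral_nonneg fun z => by positivity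
  have hK := (caccK_pos (Lam := Lam) hl).le
  refine e1.trans (hmain.trans ?_)
  rw [mul_assoc]
  gcongr
  nlinarith [mul_nonneg (sq_nonneg L) n1]

/-- hypotheses for the interior regularity argument -/
structure RegH (V : E2 → H) (A : E2 × H → H) (K : Set (E2 × H)) (z0 : E2) (r lam Lam ω : ℝ) :
    Prop where
  hV : ContDiff ℝ 1 V
  hA : ContDiff ℝ 3 A
  hK : Convex ℝ K
  hr : 0 < r
  hl : 0 < lam
  hLam : 0 ≤ Lam
  hω : 0 ≤ ω
  mem : ∀ z ∈ ball z0 r, (z, fderiv ℝ V z (ee 1)) ∈ K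
  ell : ∀ x ∈ K, ∀ W, lam * ‖W‖ ^ 2 ≤ ⟪fderiv ℝ A x (0, W), W⟫
  b1 : ∀ x ∈ K, ‖fderiv ℝ A x‖ ≤ Lam
  b2 : ∀ x ∈ K, ‖fderiv ℝ (fderiv ℝ A) x‖ ≤ Lam
  b3 : ∀ x ∈ K, ‖fderiv ℝ (fderiv ℝ (fderiv ℝ A)) x‖ ≤ Lam
  osc : ∀ z ∈ ball z0 r, ‖fderiv ℝ V z (ee 1) - fderiv ℝ V z0 (ee 1)‖ ≤ ω
  w : WEq V (fun z => A (z, fderiv ℝ V z (ee 1))) z0 r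
  sm1 : 16 * Lam * ω ≤ lam
  sm2 : caccK (lam / 2) (Lam + lam) * Lam ^ 2 * 3000 * ω ^ 2 ≤ 1

namespace RegH
variable {V : E2 → H} {A : E2 × H → H} {K : Set (E2 × H)} {z0 : E2} {r lam Lam ω : ℝ}

lemma contY (R : RegH V A K z0 r lam Lam ω) : Continuous (fun z => fderiv ℝ V z (ee 1)) :=
  cont_fderiv_apply R.hV _

lemma contB (R : RegH V A K z0 r lam Lam ω) :
    Continuous (fun z => A (z, fderiv ℝ V z (ee 1))) := by
  have := R.contY
  have h2 := R.hA.continuous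
  fun_prop

lemma add_mem (h : E2) {z : E2} {ρ : ℝ} (hz : z ∈ ball z0 ρ) (hh : ρ + ‖h‖ ≤ r) :
    z + h ∈ ball z0 r := by
  rw [mem_ball, dist_eq_norm] at *
  calc ‖z + h - z0‖ = ‖(z - z0) + h‖ := by congr 1; abel
    _ ≤ ‖z - z0‖ + ‖h‖ := norm_add_le _ _
    _ < r := by linarith

lemma difY_le (R : RegH V A K z0 r lam Lam ω) {x y : E2} (hx : x ∈ ball z0 r) (hy : y ∈ ball z0 r) :
    ‖fderiv ℝ V x (ee 1) - fderiv ℝ V y (ee 1)‖ ≤ 2 * ω := by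
  have h1 := R.osc x hx
  have h2 := R.osc y hy
  calc _ = ‖(fderiv ℝ V x (ee 1) - fderiv ℝ V z0 (ee 1)) - (fderiv ℝ V y (ee 1) - fderiv ℝ V z0 (ee 1))‖ := by
        congr 1; abel
    _ ≤ _ := (norm_sub_le _ _).trans (by linarith)

lemma T_est (R : RegH V A K z0 r lam Lam ω) {x : E2 × H} (hx : x ∈ K) (W : H) :
    ‖fderiv ℝ A x (0, W)‖ ≤ Lam * ‖W‖ := by
  refine ((fderiv ℝ A x).le_opNorm _).trans ?_
  have : ‖((0 : E2), W)‖ = ‖W‖ := by simp [Prod.norm_def]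
  rw [this]
  have := R.b1 x hx
  gcongr

lemma prod_norm_sq_le (h : E2) (W : H) : ‖(h, W)‖ ^ 2 ≤ ‖h‖ ^ 2 + ‖W‖ ^ 2 := by
  rw [Prod.norm_def]
  rcases max_choice ‖h‖ ‖W‖ with e | e <;> simp only [e] <;> nlinarith [sq_nonneg ‖h‖, sq_nonneg ‖W‖]

lemma norm_s (i : Fin 2) {s : ℝ} (hs : 0 < s) : ‖s • ee i‖ = s := by
  rw [norm_smul, norm_ee, mul_one, Real.norm_of_nonneg hs.le]

lemma k1_pt (R : RegH V A K z0 r lam Lam ω) {i : Fin 2} {s : ℝ} (hs : 0 < s) (hs1 : s ≤ 1)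
    {z : E2} (hz : z ∈ ball z0 r) (hz' : z + s • ee i ∈ ball z0 r) :
    (lam / 2) * ‖dif (s • ee i) (fun z => fderiv ℝ V z (ee 1)) z‖ ^ 2 -
      (2 * Lam * s) * ‖dif (s • ee i) (fun z => fderiv ℝ V z (ee 1)) z‖ ≤
      ⟪dif (s • ee i) (fun z => A (z, fderiv ℝ V z (ee 1))) z,
        dif (s • ee i) (fun z => fderiv ℝ V z (ee 1)) z⟫ ∧
    ‖dif (s • ee i) (fun z => A (z, fderiv ℝ V z (ee 1))) z‖ ≤
      (Lam + lam) * ‖dif (s • ee i) (fun z => fderiv ℝ V z (ee 1)) z‖ + 2 * Lam * s := by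
  have m1 := R.mem _ hz
  have m2 := R.mem _ hz'
  have t := taylor2 (R.hA.of_le (by norm_num)) R.hK R.hLam R.b2 m2 m1
  have d := R.difY_le hz' hz
  have hLam := R.hLam
  have e0 : (z + s • ee i, fderiv ℝ V (z + s • ee i) (ee 1)) - (z, fderiv ℝ V z (ee 1)) =
      (s • ee i, dif (s • ee i) (fun z => fderiv ℝ V z (ee 1)) z) := by
    ext1 <;> simp [dif]
  rw [e0] at t
  change ‖dif (s • ee i) (fun z => fderiv ℝ V z (ee 1)) z‖ ≤ _ at d
  set W := dif (s • ee i) (fun z => fderiv ℝ V z (ee 1)) z with hW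
  change ‖dif (s • ee i) (fun z => A (z, fderiv ℝ V z (ee 1))) z - _‖ ≤ _ at t
  set B := dif (s • ee i) (fun z => A (z, fderiv ℝ V z (ee 1))) z with hB
  refine B_est (R.ell _ m1 W) (R.T_est m1 W) ?_ R.hl.le
  have e1 : ((s • ee i, W) : E2 × H) = (s • ee i, 0) + (0, W) := by simp
  have e2 : ‖fderiv ℝ A (z, fderiv ℝ V z (ee 1)) (s • ee i, (0:H))‖ ≤ Lam * s := by
    refine ((fderiv ℝ A _).le_opNorm _).trans ?_
    have : ‖((s • ee i, 0) : E2 × H)‖ = s := by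
      rw [Prod.norm_def, norm_s i hs]; simp [hs.le]
    rw [this]
    have := R.b1 _ m1
    gcongr
  have p := prod_norm_sq_le (s • ee i) W
  rw [norm_s i hs] at p
  have e3 : fderiv ℝ A (z, fderiv ℝ V z (ee 1)) (s • ee i, W) =
    fderiv ℝ A (z, fderiv ℝ V z (ee 1)) (s • ee i, (0:H)) + fderiv ℝ A (z, fderiv ℝ V z (ee 1)) (0, W) := by
    rw [← map_add, ← e1]
  calc ‖B - fderiv ℝ A (z, fderiv ℝ V z (ee 1)) (0, W)‖
      = ‖(B - fderiv ℝ A (z, fderiv ℝ V z (ee 1)) (s • ee i, W)) +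
        fderiv ℝ A (z, fderiv ℝ V z (ee 1)) (s • ee i, (0:H))‖ := by rw [e3]; congr 1; abel
    _ ≤ Lam * ‖((s • ee i, W) : E2 × H)‖ ^ 2 + Lam * s := (norm_add_le _ _).trans (by linarith)
    _ ≤ Lam * (s ^ 2 + ‖W‖ ^ 2) + Lam * s := by gcongr
    _ ≤ 2 * Lam * s + lam / 2 * ‖W‖ := by
      have w0 := norm_nonneg W
      have a1 : Lam * s ^ 2 ≤ Lam * s := by gcongr; nlinarith
      have a2 : Lam * ‖W‖ ^ 2 ≤ Lam * (2 * ω) * ‖W‖ := by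
        rw [pow_two, mul_assoc]; gcongr
      have a3 : Lam * (2 * ω) * ‖W‖ ≤ lam / 2 * ‖W‖ := by
        gcongr; nlinarith [R.sm1, R.hω, mul_nonneg hLam R.hω]
      linarith

lemma k1 [CompleteSpace H] (R : RegH V A K z0 r lam Lam ω) (j : Fin 2) :
    IntE (fun z => fderiv ℝ V z (ee j)) 1 2 z0 r := by
  intro ρ hρ0 hρ
  have hl := R.hl
  have hLam := R.hLam
  obtain ⟨K0, hK0, hc⟩ := cacc_ball (H := H) (lam := lam / 2) (Lam := Lam + lam) (by positivity)
    (by positivity) z0 hρ0 (show ρ < (ρ + r) / 2 by linarith)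
  refine ⟨K0 * ((∫ z in ball z0 ((ρ + r) / 2), (2 * Lam) ^ 2) +
    ((∫ z in ball z0 r, ‖fderiv ℝ V z (ee 0)‖ ^ 2) + ∫ z in ball z0 r, ‖fderiv ℝ V z (ee 1)‖ ^ 2)),
    min 1 ((r - ρ) / 2), by positivity, by
      have : 0 < (r - ρ) / 2 := by linarith
      positivity, fun i s hs hs1 => ?_⟩
  simp only [lt_min_iff] at hs1
  have hns := norm_s i hs
  have hh : (ρ + r) / 2 + ‖s • ee i‖ ≤ r := by rw [hns]; linarith
  have hm := hc (dif (s • ee i) V) _ (fun _ => 2 * Lam * s) (dif_contDiff R.hV _)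
    (dif_continuous R.contB _) continuous_const (fun _ => by positivity) (R.w.dif R.hV R.contB hh)
    (fun z hz => by
      simp only [fderiv_dif R.hV]
      exact R.k1_pt hs hs1.1.le (ball_subset_ball (by linarith) hz) (add_mem _ hz hh)) j
  simp only [fderiv_dif R.hV] at hm
  refine hm.trans ?_
  rw [show s ^ (2:ℝ) = s ^ 2 by norm_cast, mul_assoc K0]
  refine mul_le_mul_of_nonneg_left ?_ hK0
  have e := setInt_dif_sq_le R.hV i z0 (ρ := (ρ + r) / 2) (ρ' := r) (s := s) (by rw [abs_of_pos hs]; linarith)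
  have e2 : ∫ z in ball z0 r, ‖fderiv ℝ V z (ee i)‖ ^ 2 ≤
    ((∫ z in ball z0 r, ‖fderiv ℝ V z (ee 0)‖ ^ 2) + ∫ z in ball z0 r, ‖fderiv ℝ V z (ee 1)‖ ^ 2) := by
    have n : ∀ i, 0 ≤ ∫ z in ball z0 r, ‖fderiv ℝ V z (ee i)‖ ^ 2 := fun i => by positivity
    have := n 0; have := n 1
    fin_cases i <;> simp <;> linarith
  have e3 : ∫ z in ball z0 ((ρ + r) / 2), (2 * Lam * s) ^ 2 =
      s ^ 2 * ∫ z in ball z0 ((ρ + r) / 2), (2 * Lam) ^ 2 := by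
    rw [← integral_const_mul]; congr 1; funext z; ring
  rw [e3]
  have e4 : s ^ 2 * ∫ z in ball z0 r, ‖fderiv ℝ V z (ee i)‖ ^ 2 ≤ s ^ 2 * _ :=
    mul_le_mul_of_nonneg_left e2 (sq_nonneg s)
  linarith

end RegH
end regF8

section regF9
open MeasureTheory
set_option linter.unusedSectionVars false
set_option maxSynthPendingDepth 4
variable {H : Type*} [NormedAddCommGroup H] [InnerProductSpace ℝ H]

lemma gn_real {c d ω α β γ : ℝ} (hc : 0 ≤ c) (α0 : 0 ≤ α) (β0 : 0 ≤ β) (γ0 : 0 ≤ γ) (hω : 0 ≤ ω)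
    (hd0 : 0 ≤ d) (ha : α ≤ 2 * ω) (hb : β ≤ 2 * ω) (tri1 : β ≤ α + γ) (tri2 : γ ≤ α + β) :
    (c ^ 2 * (γ * (α ^ 2 + (α + β) * β)) + d * (2 * c + d) * β ^ 3) * ω ≤
      c ^ 2 * (α ^ 4 / 2 + 41 * ω ^ 2 * γ ^ 2) + 40 * d ^ 2 * ω ^ 2 * β ^ 2 := by
  have β2 : β ^ 2 ≤ 2 * α ^ 2 + 2 * γ ^ 2 := by nlinarith [sq_nonneg (α - γ)]
  have p1 : γ * (α ^ 2 + (α + β) * β) * ω ≤ α ^ 4 / 4 + 37 * ω ^ 2 * γ ^ 2 := by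
    have q1 : α ^ 2 + (α + β) * β ≤ 5 * α ^ 2 + 3 * γ ^ 2 := by nlinarith [sq_nonneg (α - β)]
    have q2 : γ ^ 2 ≤ 4 * ω * γ := by nlinarith
    have q3 : γ * (α ^ 2 + (α + β) * β) * ω ≤ γ * (5 * α ^ 2 + 3 * (4 * ω * γ)) * ω := by
      have : α ^ 2 + (α + β) * β ≤ 5 * α ^ 2 + 3 * (4 * ω * γ) := by linarith
      gcongr
    have q4 := sq_nonneg (α ^ 2 / 2 - 5 * ω * γ)
    linarith
  have β4 : β ^ 4 ≤ 8 * α ^ 4 + 128 * ω ^ 2 * γ ^ 2 := by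
    have q2 : γ ^ 2 ≤ (4 * ω) ^ 2 := by gcongr; linarith
    have q3 : γ ^ 4 ≤ 16 * ω ^ 2 * γ ^ 2 := by
      calc γ ^ 4 = γ ^ 2 * γ ^ 2 := by ring
        _ ≤ (4 * ω) ^ 2 * γ ^ 2 := by gcongr
        _ = _ := by ring
    have q4 : β ^ 4 ≤ (2 * α ^ 2 + 2 * γ ^ 2) ^ 2 := by
      rw [show β ^ 4 = (β ^ 2) ^ 2 by ring]; gcongr
    have q5 := sq_nonneg (α ^ 2 - γ ^ 2)
    linarith
  have p2 : d * (2 * c) * β ^ 3 * ω ≤ c ^ 2 * β ^ 4 / 32 + 32 * d ^ 2 * ω ^ 2 * β ^ 2 := by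
    have q4 := sq_nonneg (c * β ^ 2 - 32 * d * ω * β)
    linarith
  have p3 : d * d * β ^ 3 * ω ≤ 2 * d ^ 2 * ω ^ 2 * β ^ 2 := by
    have : d * d * β ^ 2 * ω * β ≤ d * d * β ^ 2 * ω * (2 * ω) := by gcongr
    linarith
  have p4 : c ^ 2 * β ^ 4 ≤ c ^ 2 * (8 * α ^ 4 + 128 * ω ^ 2 * γ ^ 2) := by gcongr
  have p5 : c ^ 2 * (γ * (α ^ 2 + (α + β) * β) * ω) ≤ c ^ 2 * (α ^ 4 / 4 + 37 * ω ^ 2 * γ ^ 2) := by gcongr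
  have p6 : 0 ≤ d ^ 2 * ω ^ 2 * β ^ 2 := by positivity
  linarith

lemma gn_pt {a b y : H} {c c' d ω : ℝ} (hc : 0 ≤ c) (hc' : 0 ≤ c') (hd : |c - c'| ≤ d)
    (hy : ‖y‖ ≤ ω) (ha : ‖a‖ ≤ 2 * ω) (hb : ‖b‖ ≤ 2 * ω) :
    ⟪(c ^ 2 * ‖a‖ ^ 2) • a - (c' ^ 2 * ‖b‖ ^ 2) • b, y⟫ ≤
      c ^ 2 * (‖a‖ ^ 4 / 2 + 41 * ω ^ 2 * ‖b - a‖ ^ 2) + 40 * d ^ 2 * ω ^ 2 * ‖b‖ ^ 2 := by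
  have hω : 0 ≤ ω := (norm_nonneg y).trans hy
  have hd0 : 0 ≤ d := (abs_nonneg _).trans hd
  set α := ‖a‖ with hα
  set β := ‖b‖ with hβ
  set γ := ‖b - a‖ with hγ
  have α0 : 0 ≤ α := norm_nonneg _
  have β0 : 0 ≤ β := norm_nonneg _
  have γ0 : 0 ≤ γ := norm_nonneg _
  have tri1 : β ≤ α + γ := by
    have : b = a + (b - a) := by abel
    rw [hβ, this]; exact norm_add_le _ _
  have tri2 : γ ≤ α + β := by rw [hγ, add_comm]; exact norm_sub_le _ _
  have tri3 : |α ^ 2 - β ^ 2| ≤ γ * (α + β) := by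
    rw [show α ^ 2 - β ^ 2 = (α - β) * (α + β) by ring, abs_mul, abs_of_nonneg (add_nonneg α0 β0)]
    have : |α - β| ≤ γ := by
      rw [hγ, norm_sub_rev]; exact abs_norm_sub_norm_le a b
    gcongr
  have n1 : ‖(α ^ 2) • a - (β ^ 2) • b‖ ≤ γ * (α ^ 2 + (α + β) * β) := by
    have e : (α ^ 2) • a - (β ^ 2) • b = (α ^ 2) • (a - b) + (α ^ 2 - β ^ 2) • b := by module
    rw [e]
    refine (norm_add_le _ _).trans ?_
    rw [norm_smul, norm_smul, norm_sub_rev, Real.norm_eq_abs, Real.norm_eq_abs, abs_of_nonneg (sq_nonneg α)]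
    have : |α ^ 2 - β ^ 2| * ‖b‖ ≤ γ * (α + β) * β := by gcongr
    linarith
  have n2 : |c ^ 2 - c' ^ 2| ≤ d * (2 * c + d) := by
    rw [show c ^ 2 - c' ^ 2 = (c - c') * (c + c') by ring, abs_mul, abs_of_nonneg (add_nonneg hc hc')]
    have : c' ≤ c + d := by have := neg_abs_le (c - c'); linarith
    have h2 : c + c' ≤ 2 * c + d := by linarith
    gcongr
  have n3 : ‖(c ^ 2 * α ^ 2) • a - (c' ^ 2 * β ^ 2) • b‖ ≤
      c ^ 2 * (γ * (α ^ 2 + (α + β) * β)) + d * (2 * c + d) * β ^ 3 := by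
    have e : (c ^ 2 * α ^ 2) • a - (c' ^ 2 * β ^ 2) • b =
      c ^ 2 • ((α ^ 2) • a - (β ^ 2) • b) + ((c ^ 2 - c' ^ 2) * β ^ 2) • b := by module
    rw [e]
    refine (norm_add_le _ _).trans ?_
    rw [norm_smul, norm_smul, Real.norm_eq_abs, Real.norm_eq_abs, abs_of_nonneg (sq_nonneg c), abs_mul,
      abs_of_nonneg (sq_nonneg β)]
    have : |c ^ 2 - c' ^ 2| * β ^ 2 * ‖b‖ ≤ d * (2 * c + d) * β ^ 2 * β := by gcongr
    have : c ^ 2 * ‖(α ^ 2) • a - (β ^ 2) • b‖ ≤ c ^ 2 * (γ * (α ^ 2 + (α + β) * β)) := by gcongr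
    linarith
  have n4 : ⟪(c ^ 2 * α ^ 2) • a - (c' ^ 2 * β ^ 2) • b, y⟫ ≤
     (c ^ 2 * (γ * (α ^ 2 + (α + β) * β)) + d * (2 * c + d) * β ^ 3) * ω := by
    refine (real_inner_le_norm _ _).trans ?_
    gcongr
  refine n4.trans ?_
  exact gn_real hc α0 β0 γ0 hω hd0 ha hb tri1 tri2

lemma gn {Y : E2 → H} (hY : Continuous Y) {χ : E2 → ℝ} (hχ : Continuous χ) (hχ0 : ∀ z, 0 ≤ χ z)
    (hχc : HasCompactSupport χ) {z0 h : E2} {ρ r L ω : ℝ} (hs : tsupport χ ⊆ ball z0 ρ)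
    (hL : ∀ z, |χ z - χ (z + h)| ≤ L * ‖h‖) {Y0 : H} (hosc : ∀ z ∈ ball z0 r, ‖Y z - Y0‖ ≤ ω)
    (hr : ρ + 3 * ‖h‖ ≤ r) :
    ∫ z, χ z ^ 2 * ‖dif h Y z‖ ^ 4 ≤ 82 * ω ^ 2 * (∫ z, χ z ^ 2 * ‖(dif h)^[2] Y z‖ ^ 2) +
      80 * (L * ‖h‖) ^ 2 * ω ^ 2 * ∫ z in ball z0 (ρ + 2 * ‖h‖), ‖dif h Y z‖ ^ 2 := by
  have ca : Continuous (dif h Y) := dif_continuous hY h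
  have cc : Continuous ((dif h)^[2] Y) := difk_continuous hY h 2
  have h0 := norm_nonneg h
  set P : E2 → H := fun z => (χ z ^ 2 * ‖dif h Y z‖ ^ 2) • dif h Y z with hP
  have cP : Continuous P := by fun_prop
  have sP : HasCompactSupport P := by
    apply hχc.mono
    intro z hz
    simp only [Function.mem_support] at hz ⊢
    contrapose! hz
    simp [hP, hz]
  have isupp : ∀ {f : E2 → ℝ}, Continuous f → (∀ z, χ z = 0 → f z = 0) → Integrable f := by
    intro f hf hz
    apply hf.integrable_of_hasCompactSupport
    apply hχc.mono
    intro z h1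
    simp only [Function.mem_support] at h1 ⊢
    exact fun h2 => h1 (hz z h2)
  have i1 : Integrable (fun z => ⟪P z, Y z - Y0⟫) :=
    isupp (by fun_prop) (fun z hz => by simp [hP, hz])
  have i2 : Integrable (fun z => ⟪P z, Y (z + h) - Y0⟫) :=
    isupp (by fun_prop) (fun z hz => by simp [hP, hz])
  have i3 : Integrable (fun z => ⟪P (z + h), Y (z + h) - Y0⟫) :=
    i1.comp_add_right h
  have i4 : Integrable (fun z => χ z ^ 2 * ‖dif h Y z‖ ^ 4) :=
    isupp (by fun_prop) (fun z hz => by simp [hz])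
  have i5 : Integrable (fun z => χ z ^ 2 * ‖(dif h)^[2] Y z‖ ^ 2) :=
    isupp (by fun_prop) (fun z hz => by simp [hz])
  have e1 : ∫ z, χ z ^ 2 * ‖dif h Y z‖ ^ 4 = ∫ z, ⟪P z - P (z + h), Y (z + h) - Y0⟫ := by
    have : ∀ z, χ z ^ 2 * ‖dif h Y z‖ ^ 4 = ⟪P z, Y (z + h) - Y0⟫ - ⟪P z, Y z - Y0⟫ := by
      intro z
      rw [← inner_sub_right, show Y (z + h) - Y0 - (Y z - Y0) = dif h Y z by simp [dif], hP]
      simp only [inner_smul_left, real_inner_self_eq_norm_sq]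
      simp; ring
    simp only [this]
    rw [integral_sub i2 i1, ← integral_add_right_eq_self (fun z => ⟪P z, Y z - Y0⟫) h, ← integral_sub i2 i3]
    simp only [inner_sub_left]
  set S := ball z0 (ρ + ‖h‖) with hS
  have i6 : Integrable (S.indicator fun z => ‖dif h Y (z + h)‖ ^ 2) := by
    rw [integrable_indicator_iff measurableSet_ball]
    exact integrableOn_ball_of_cont (by fun_prop) _ _
  have e2 : ∫ z, ⟪P z - P (z + h), Y (z + h) - Y0⟫ ≤
     ∫ z, ((1/2) * (χ z ^ 2 * ‖dif h Y z‖ ^ 4) + 41 * ω ^ 2 * (χ z ^ 2 * ‖(dif h)^[2] Y z‖ ^ 2) +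
      40 * (L * ‖h‖) ^ 2 * ω ^ 2 * S.indicator (fun z => ‖dif h Y (z + h)‖ ^ 2) z) := by
    apply integral_mono
    · simp only [inner_sub_left]; exact i2.sub i3
    · exact ((i4.const_mul _).add (i5.const_mul _)).add (i6.const_mul _)
    · intro z
      by_cases hz : z ∈ S
      · simp only [Set.indicator_of_mem hz]
        have hz1 : z ∈ ball z0 r := ball_subset_ball (by linarith) hz
        have hz2 : z + h ∈ ball z0 r := RegH.add_mem h hz (by linarith)
        have hz3 : z + h + h ∈ ball z0 r := RegH.add_mem (ρ := ρ + 2 * ‖h‖) h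
          (RegH.add_mem (ρ := ρ + ‖h‖) h hz (by linarith)) (by linarith)
        have d2 : ∀ x ∈ ball z0 r, ∀ y ∈ ball z0 r, ‖Y x - Y y‖ ≤ 2 * ω := by
          intro x hx y hy
          have := hosc x hx; have := hosc y hy
          rw [show Y x - Y y = (Y x - Y0) - (Y y - Y0) by abel]
          exact (norm_sub_le _ _).trans (by linarith)
        have := gn_pt (a := dif h Y z) (b := dif h Y (z + h)) (hχ0 z) (hχ0 (z + h)) (hL z)
          (hosc _ hz2) (d2 _ hz2 _ hz1) (d2 _ hz3 _ hz2)
        have e3 : (dif h)^[2] Y z = dif h Y (z + h) - dif h Y z := rfl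
        rw [e3]
        simp only [hP]
        linarith
      · have c1 : χ z = 0 := image_eq_zero_of_notMem_tsupport fun hm =>
          hz (ball_subset_ball (by linarith) (hs hm))
        have c2 : χ (z + h) = 0 := image_eq_zero_of_notMem_tsupport fun hm => hz (by
          have := hs hm
          have := RegH.add_mem (r := ρ + ‖h‖) (-h) this (by rw [norm_neg])
          rwa [add_neg_cancel_right] at this)
        simp [hP, c1, c2, Set.indicator_of_notMem hz]
  rw [integral_add (by exact (i4.const_mul _).add (i5.const_mul _)) (i6.const_mul _),
    integral_add (i4.const_mul _) (i5.const_mul _), integral_const_mul, integral_const_mul,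
    integral_const_mul, integral_indicator measurableSet_ball] at e2
  have e4 : ∫ z in S, ‖dif h Y (z + h)‖ ^ 2 ≤ ∫ z in ball z0 (ρ + 2 * ‖h‖), ‖dif h Y z‖ ^ 2 :=
    setInt_translate_le (g := fun z => ‖dif h Y z‖ ^ 2) (by fun_prop) (fun z => by positivity) z0 (by linarith)
  have e5 : 40 * (L * ‖h‖) ^ 2 * ω ^ 2 * ∫ z in S, ‖dif h Y (z + h)‖ ^ 2 ≤
    40 * (L * ‖h‖) ^ 2 * ω ^ 2 * ∫ z in ball z0 (ρ + 2 * ‖h‖), ‖dif h Y z‖ ^ 2 := by gcongr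
  rw [← e1] at e2
  linarith

end regF9

section regF10
open MeasureTheory
set_option linter.unusedSectionVars false
set_option maxSynthPendingDepth 4
variable {H : Type*} [NormedAddCommGroup H] [InnerProductSpace ℝ H]

namespace RegH
variable {V : E2 → H} {A : E2 × H → H} {K : Set (E2 × H)} {z0 : E2} {r lam Lam ω : ℝ}

lemma k2_pt (R : RegH V A K z0 r lam Lam ω) {i : Fin 2} {s : ℝ} (hs : 0 < s)
    {z : E2} (hz : z ∈ ball z0 r) (hz' : z + s • ee i ∈ ball z0 r)
    (hz'' : z + s • ee i + s • ee i ∈ ball z0 r) :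
    (lam / 2) * ‖(dif (s • ee i))^[2] (fun z => fderiv ℝ V z (ee 1)) z‖ ^ 2 -
      (Lam * (2 * s ^ 2 + 3 * ‖dif (s • ee i) (fun z => fderiv ℝ V z (ee 1)) z‖ ^ 2)) *
        ‖(dif (s • ee i))^[2] (fun z => fderiv ℝ V z (ee 1)) z‖ ≤
      ⟪(dif (s • ee i))^[2] (fun z => A (z, fderiv ℝ V z (ee 1))) z,
        (dif (s • ee i))^[2] (fun z => fderiv ℝ V z (ee 1)) z⟫ ∧
    ‖(dif (s • ee i))^[2] (fun z => A (z, fderiv ℝ V z (ee 1))) z‖ ≤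
      (Lam + lam) * ‖(dif (s • ee i))^[2] (fun z => fderiv ℝ V z (ee 1)) z‖ +
      (Lam * (2 * s ^ 2 + 3 * ‖dif (s • ee i) (fun z => fderiv ℝ V z (ee 1)) z‖ ^ 2)) := by
  have m1 := R.mem _ hz
  have m2 := R.mem _ hz'
  have m3 := R.mem _ hz''
  have t := dif2_taylor (R.hA.of_le (by norm_num)) R.hK R.hLam R.b2 m1 m2 m3
  have d1 := R.difY_le hz' hz
  have d2 := R.difY_le hz'' hz'
  have hLam := R.hLam
  have e0 : (z + s • ee i, fderiv ℝ V (z + s • ee i) (ee 1)) - (z, fderiv ℝ V z (ee 1)) =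
      (s • ee i, dif (s • ee i) (fun z => fderiv ℝ V z (ee 1)) z) := by
    ext1 <;> simp [dif]
  have e0' : (z + s • ee i + s • ee i, fderiv ℝ V (z + s • ee i + s • ee i) (ee 1)) -
      (z + s • ee i, fderiv ℝ V (z + s • ee i) (ee 1)) =
      (s • ee i, dif (s • ee i) (fun z => fderiv ℝ V z (ee 1)) (z + s • ee i)) := by
    ext1 <;> simp [dif]
  rw [e0, e0'] at t
  change ‖dif (s • ee i) (fun z => fderiv ℝ V z (ee 1)) z‖ ≤ _ at d1
  change ‖dif (s • ee i) (fun z => fderiv ℝ V z (ee 1)) (z + s • ee i)‖ ≤ _ at d2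
  have eW : (dif (s • ee i))^[2] (fun z => fderiv ℝ V z (ee 1)) z =
    dif (s • ee i) (fun z => fderiv ℝ V z (ee 1)) (z + s • ee i) -
    dif (s • ee i) (fun z => fderiv ℝ V z (ee 1)) z := rfl
  set a := dif (s • ee i) (fun z => fderiv ℝ V z (ee 1)) z with ha
  set b := dif (s • ee i) (fun z => fderiv ℝ V z (ee 1)) (z + s • ee i) with hb
  change ‖(dif (s • ee i))^[2] (fun z => A (z, fderiv ℝ V z (ee 1))) z - _‖ ≤ _ at t
  set B := (dif (s • ee i))^[2] (fun z => A (z, fderiv ℝ V z (ee 1))) z with hB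
  rw [eW]
  have e2 : ((s • ee i, b) : E2 × H) - (s • ee i, a) = (0, b - a) := by simp
  rw [e2] at t
  refine B_est (R.ell _ m2 (b - a)) (R.T_est m2 (b - a)) (t.trans ?_) R.hl.le
  have p1 := prod_norm_sq_le (s • ee i) a
  have p2 := prod_norm_sq_le (s • ee i) b
  rw [norm_s i hs] at p1 p2
  have w0 := norm_nonneg (b - a)
  have q1 : ‖b‖ ≤ ‖a‖ + ‖b - a‖ := by
    have : b = a + (b - a) := by abel
    conv_lhs => rw [this]
    exact norm_add_le _ _
  have q2 : ‖b - a‖ ≤ 4 * ω := (norm_sub_le _ _).trans (by linarith)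
  have q3 : ‖b‖ ^ 2 ≤ 2 * ‖a‖ ^ 2 + 2 * ‖b - a‖ ^ 2 := by
    nlinarith [sq_nonneg (‖a‖ - ‖b - a‖), norm_nonneg b, norm_nonneg a]
  have q4 : ‖b - a‖ ^ 2 ≤ 4 * ω * ‖b - a‖ := by nlinarith
  calc Lam * (‖((s • ee i, b) : E2 × H)‖ ^ 2 + ‖((s • ee i, a) : E2 × H)‖ ^ 2)
      ≤ Lam * (2 * s ^ 2 + 3 * ‖a‖ ^ 2 + 8 * ω * ‖b - a‖) := by
        refine mul_le_mul_of_nonneg_left ?_ hLam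
        linarith
    _ ≤ _ := by nlinarith [R.sm1]

lemma fderiv_dif2 (hV : ContDiff ℝ 1 V) (h : E2) (v : E2) (k : ℕ) (z : E2) :
    fderiv ℝ ((dif h)^[k] V) z v = (dif h)^[k] (fun y => fderiv ℝ V y v) z ∧
     ContDiff ℝ 1 ((dif h)^[k] V) := by
  induction k generalizing z with
  | zero => exact ⟨rfl, hV⟩
  | succ k ih =>
    rw [Function.iterate_succ_apply', Function.iterate_succ_apply']
    refine ⟨?_, dif_contDiff (ih z).2 _⟩
    rw [fderiv_dif (ih z).2]
    simp only [dif, ih]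

lemma weqk (hV : ContDiff ℝ 1 V) {B : E2 → H} (hB : Continuous B) {r : ℝ} (hw : WEq V B z0 r)
    (h : E2) (k : ℕ) {r' : ℝ} (hr : r' + k * ‖h‖ ≤ r) : WEq ((dif h)^[k] V) ((dif h)^[k] B) z0 r' := by
  induction k generalizing r' with
  | zero => exact hw.mono (ball_subset_ball (by simpa using hr))
  | succ k ih =>
    rw [Function.iterate_succ_apply', Function.iterate_succ_apply']
    exact (ih (r' := r' + ‖h‖) (by push_cast at hr; linarith)).dif (fderiv_dif2 hV h (ee 0) k 0).2
      (difk_continuous hB h k) le_rfl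

/-- `L²` bound for the (k+1)-st differences of `V` by `k`-th differences of its gradient -/
lemma difV_le [CompleteSpace H] (hV : ContDiff ℝ 1 V) {k : ℕ} {p : ℝ}
    (hE : ∀ j, IntE (fun z => fderiv ℝ V z (ee j)) k p z0 r) {ρ : ℝ} (hρ0 : 0 < ρ) (hρ : ρ < r) :
    ∃ C s0, 0 ≤ C ∧ 0 < s0 ∧ ∀ i s, 0 < s → s < s0 →
      ∫ z in ball z0 ρ, ‖(dif (s • ee i))^[k+1] V z‖ ^ 2 ≤ C * (s ^ 2 * s ^ p) := by
  have h1 : 0 < (ρ + r) / 2 := by linarith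
  have h2 : (ρ + r) / 2 < r := by linarith
  obtain ⟨C0, s0, hC0, hs0, e0⟩ := hE 0 _ h1 h2
  obtain ⟨C1, s1, hC1, hs1, e1⟩ := hE 1 _ h1 h2
  refine ⟨C0 + C1, min (min s0 s1) ((r - ρ) / 2), by positivity,
    by have : 0 < (r - ρ) / 2 := by linarith
       positivity, fun i s hs hs' => ?_⟩
  simp only [lt_min_iff] at hs'
  have hd := fderiv_dif2 hV (s • ee i) (ee i) k
  rw [Function.iterate_succ_apply']
  refine (setInt_dif_sq_le (hd 0).2 i z0 (ρ' := (ρ + r) / 2) (by rw [abs_of_pos hs]; linarith)).trans ?_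
  simp only [fun z => (hd z).1]
  rw [← mul_assoc, mul_comm _ (s ^ 2), mul_assoc]
  refine mul_le_mul_of_nonneg_left ?_ (sq_nonneg s)
  have n0 : 0 ≤ C0 * s ^ p := by positivity
  have n1 : 0 ≤ C1 * s ^ p := by positivity
  rw [add_mul]
  fin_cases i
  · exact (e0 0 s hs hs'.1.1).trans (by linarith)
  · exact (e1 1 s hs hs'.1.2).trans (by linarith)

lemma k2 [CompleteSpace H] (R : RegH V A K z0 r lam Lam ω) {ρ : ℝ} (hρ0 : 0 < ρ) (hρ : ρ < r) :
    ∃ C s0, 0 ≤ C ∧ 0 < s0 ∧ ∀ i s, 0 < s → s < s0 →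
      (∀ j, ∫ z in ball z0 ρ, ‖(dif (s • ee i))^[2] (fun z => fderiv ℝ V z (ee j)) z‖ ^ 2 ≤ C * s ^ 4) ∧
      ∫ z in ball z0 ρ, ‖dif (s • ee i) (fun z => fderiv ℝ V z (ee 1)) z‖ ^ 4 ≤ C * s ^ 4 := by
  have hl := R.hl
  have hLam := R.hLam
  have hω := R.hω
  set δ := (r - ρ) / 4 with hδ
  have hδ0 : 0 < δ := by rw [hδ]; linarith
  obtain ⟨χ, hχ, hχ0, hχle, hχ1, hχc, hχs, L, hL0, hL⟩ := exists_cutoff z0 hρ0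
    (show ρ < ρ + δ by linarith)
  have hχ' : ContDiff ℝ 1 χ := hχ.of_le (by norm_cast)
  obtain ⟨M, hM0, hM⟩ := difk_smooth_le 1 hχ hχc
  obtain ⟨C1, s1, hC1, hs1, e1⟩ := R.k1 1 (ρ + 2 * δ) (by linarith) (by linarith)
  obtain ⟨C2, s2, hC2, hs2, e2⟩ := difV_le (k := 1) R.hV R.k1 (show 0 < ρ + δ by linarith) (by linarith)
  set vol := ∫ z in ball z0 (ρ + δ), (1:ℝ) with hvol
  have vol0 : 0 ≤ vol := by positivity
  set Kc := caccK (lam / 2) (Lam + lam) with hKc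
  have hKc0 : 0 < Kc := caccK_pos (by positivity)
  set E := 80 * M ^ 2 * ω ^ 2 * C1 with hE
  have hE0 : 0 ≤ E := by positivity
  set D := 2 * (Kc * (Lam ^ 2 * (8 * vol + 18 * E) + L ^ 2 * C2)) with hD
  have hD0 : 0 ≤ D := by positivity
  refine ⟨D + (82 * ω ^ 2 * D + E), min (min s1 s2) (δ / 2), by positivity, by positivity,
    fun i s hs hs' => ?_⟩
  simp only [lt_min_iff] at hs'
  have hns := norm_s i hs
  set h := s • ee i with hh
  set Y := fun z => fderiv ℝ V z (ee 1) with hY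
  have cY : Continuous Y := R.contY
  have cχ := hχ.continuous
  have cD : Continuous (dif h Y) := dif_continuous cY h
  have hdV := fun v => fderiv_dif2 R.hV h v 2
  have hU : ContDiff ℝ 1 ((dif h)^[2] V) := (hdV (ee 0) 0).2
  have f1 := e1 i s hs hs'.1.1
  have f2 := e2 i s hs hs'.1.2
  set g : E2 → ℝ := fun z => Lam * (2 * s ^ 2 + 3 * ‖dif h Y z‖ ^ 2) with hg
  have cg : Continuous g := by fun_prop
  have hmain := cacc (lam := lam / 2) (Lam := Lam + lam) (by positivity) (by positivity) hL0 hU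
    (difk_continuous R.contB h 2) cg (fun z => by positivity)
    (weqk R.hV R.contB R.w h 2 (r' := ρ + δ) (by rw [hns]; push_cast; linarith))
    hχ' hχ0 hχc hχs hL (fun z hz => by
      rw [(hdV (ee 1) z).1]
      exact (R.k2_pt hs (ball_subset_ball (by linarith) hz) (add_mem h hz (by linarith))
        (add_mem (ρ := ρ + δ + s) h (add_mem h hz (by linarith)) (by linarith))).1)
    (fun z hz => by
      rw [(hdV (ee 1) z).1]
      exact (R.k2_pt hs (ball_subset_ball (by linarith) hz) (add_mem h hz (by linarith))
        (add_mem (ρ := ρ + δ + s) h (add_mem h hz (by linarith)) (by linarith))).2)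
  have hgn := gn (L := M) (ω := ω) (r := r) (h := h) cY cχ hχ0 hχc hχs (fun z => by
    have := hM i s z
    rw [abs_sub_comm, hns]
    simpa [dif, abs_of_pos hs] using this) (Y0 := Y z0) R.osc (by linarith)
  rw [hns] at hgn
  simp only [(hdV _ _).1] at hmain
  have isupp : ∀ {f : E2 → ℝ}, Continuous f → (∀ z, χ z = 0 → f z = 0) → Integrable f := by
    intro f hf hz
    apply hf.integrable_of_hasCompactSupport
    apply hχc.mono
    intro z h1
    simp only [Function.mem_support] at h1 ⊢
    exact fun h2 => h1 (hz z h2)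
  have cdj : ∀ j, Continuous ((dif h)^[2] (fun z => fderiv ℝ V z (ee j))) := fun j =>
    difk_continuous (cont_fderiv_apply R.hV (ee j)) h 2
  have cd0 := cdj 0
  have cd1 := cdj 1
  have iZ : Integrable (fun z => χ z ^ 2 * (‖(dif h)^[2] (fun z => fderiv ℝ V z (ee 0)) z‖ ^ 2 +
    ‖(dif h)^[2] (fun z => fderiv ℝ V z (ee 1)) z‖ ^ 2)) :=
    isupp (by fun_prop) (fun z hz => by simp [hz])
  have iX : Integrable (fun z => χ z ^ 2 * ‖dif h Y z‖ ^ 4) :=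
    isupp (by fun_prop) (fun z hz => by simp [hz])
  set Z := ∫ z, χ z ^ 2 * (‖(dif h)^[2] (fun z => fderiv ℝ V z (ee 0)) z‖ ^ 2 +
    ‖(dif h)^[2] (fun z => fderiv ℝ V z (ee 1)) z‖ ^ 2) with hZ
  set X := ∫ z, χ z ^ 2 * ‖dif h Y z‖ ^ 4 with hX
  have Zge : ∫ z, χ z ^ 2 * ‖(dif h)^[2] Y z‖ ^ 2 ≤ Z := by
    apply integral_mono (isupp (by fun_prop) (fun z hz => by simp [hz])) iZ
    intro z
    have : 0 ≤ χ z ^ 2 * ‖(dif h)^[2] (fun z => fderiv ℝ V z (ee 0)) z‖ ^ 2 := by positivity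
    simp only [mul_add]; linarith
  have hg2 : ∫ z, χ z ^ 2 * g z ^ 2 ≤ Lam ^ 2 * (8 * vol * s ^ 4 + 18 * X) := by
    have j1 : ∫ z, χ z ^ 2 ≤ vol := by
      have hfar : ∀ z ∉ ball z0 (ρ + δ), χ z ^ 2 = 0 := by
        intro z hz
        rw [image_eq_zero_of_notMem_tsupport (fun hm => hz (hχs hm))]; simp
      rw [← setIntegral_eq_integral_of_forall_compl_eq_zero hfar]
      apply setIntegral_mono_on (integrableOn_ball_of_cont (by fun_prop) _ _)
        (integrableOn_ball_of_cont (by fun_prop) _ _) measurableSet_ball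
      intro z hz
      exact pow_le_one₀ (hχ0 z) (hχle z)
    have iχ : Integrable (fun z => χ z ^ 2) := isupp (by fun_prop) (fun z hz => by simp [hz])
    have j2 : ∫ z, χ z ^ 2 * g z ^ 2 ≤
        ∫ z, ((Lam ^ 2 * (8 * s ^ 4)) * χ z ^ 2 + Lam ^ 2 * 18 * (χ z ^ 2 * ‖dif h Y z‖ ^ 4)) := by
      apply integral_mono (isupp (by fun_prop) (fun z hz => by simp [hz]))
      · exact (iχ.const_mul _).add (iX.const_mul _)
      intro z
      simp only [hg]
      have t1 : (2 * s ^ 2 + 3 * ‖dif h Y z‖ ^ 2) ^ 2 ≤ 8 * s ^ 4 + 18 * ‖dif h Y z‖ ^ 4 := by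
        have := sq_nonneg (2 * s ^ 2 - 3 * ‖dif h Y z‖ ^ 2)
        linarith
      calc _ = (χ z ^ 2 * Lam ^ 2) * (2 * s ^ 2 + 3 * ‖dif h Y z‖ ^ 2) ^ 2 := by ring
        _ ≤ (χ z ^ 2 * Lam ^ 2) * (8 * s ^ 4 + 18 * ‖dif h Y z‖ ^ 4) := by gcongr
        _ = _ := by ring
    rw [integral_add (iχ.const_mul _) (iX.const_mul _), integral_const_mul, integral_const_mul] at j2
    have j3 : Lam ^ 2 * (8 * s ^ 4) * ∫ z, χ z ^ 2 ≤ Lam ^ 2 * (8 * s ^ 4) * vol := by gcongr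
    linarith
  have hUint : ∫ z in ball z0 (ρ + δ), ‖(dif h)^[2] V z‖ ^ 2 ≤ C2 * s ^ 4 := by
    refine f2.trans (le_of_eq ?_)
    rw [show s ^ (2:ℝ) = s ^ 2 by norm_cast]; ring
  have hDint : ∫ z in ball z0 (ρ + δ + 2 * s), ‖dif h Y z‖ ^ 2 ≤ C1 * s ^ 2 := by
    refine (setInt_mono_ball (by fun_prop) (fun z => by positivity) z0
      (show ρ + δ + 2 * s ≤ ρ + 2 * δ by linarith)).trans ?_
    rw [show s ^ (2:ℝ) = s ^ 2 by norm_cast] at f1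
    exact f1
  have Xle : X ≤ 82 * ω ^ 2 * Z + E * s ^ 4 := by
    have t1 : 82 * ω ^ 2 * ∫ z, χ z ^ 2 * ‖(dif h)^[2] Y z‖ ^ 2 ≤ 82 * ω ^ 2 * Z := by gcongr
    have t2 : 80 * (M * s) ^ 2 * ω ^ 2 * ∫ z in ball z0 (ρ + δ + 2 * s), ‖dif h Y z‖ ^ 2 ≤
      80 * (M * s) ^ 2 * ω ^ 2 * (C1 * s ^ 2) := by gcongr
    have t3 : 80 * (M * s) ^ 2 * ω ^ 2 * (C1 * s ^ 2) = E * s ^ 4 := by rw [hE]; ring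
    linarith
  have Z0 : 0 ≤ Z := by positivity
  have Zle : Z ≤ D * s ^ 4 := by
    have t1 : Z ≤ Kc * (Lam ^ 2 * (8 * vol * s ^ 4 + 18 * (82 * ω ^ 2 * Z + E * s ^ 4)) + L ^ 2 * (C2 * s ^ 4)) := by
      refine hmain.trans ?_
      refine mul_le_mul_of_nonneg_left ?_ hKc0.le
      have : Lam ^ 2 * (8 * vol * s ^ 4 + 18 * X) ≤
        Lam ^ 2 * (8 * vol * s ^ 4 + 18 * (82 * ω ^ 2 * Z + E * s ^ 4)) := by gcongr
      have : L ^ 2 * ∫ z in ball z0 (ρ + δ), ‖(dif h)^[2] V z‖ ^ 2 ≤ L ^ 2 * (C2 * s ^ 4) := by gcongr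
      linarith
    have t2 : Kc * Lam ^ 2 * 3000 * ω ^ 2 * Z ≤ 1 * Z := mul_le_mul_of_nonneg_right R.sm2 Z0
    have t3 : Kc * (Lam ^ 2 * (8 * vol * s ^ 4 + 18 * (82 * ω ^ 2 * Z + E * s ^ 4)) + L ^ 2 * (C2 * s ^ 4))
      = D / 2 * s ^ 4 + (1476 / 3000) * (Kc * Lam ^ 2 * 3000 * ω ^ 2 * Z) := by rw [hD]; ring
    rw [t3] at t1
    linarith
  have s4 : 0 < s ^ 4 := by positivity
  constructor
  · intro j
    calc _ ≤ ∫ z in ball z0 ρ, χ z ^ 2 * (‖(dif h)^[2] (fun z => fderiv ℝ V z (ee 0)) z‖ ^ 2 +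
            ‖(dif h)^[2] (fun z => fderiv ℝ V z (ee 1)) z‖ ^ 2) := by
          have := cdj j
          apply setIntegral_mono_on (integrableOn_ball_of_cont (by fun_prop) _ _)
            iZ.integrableOn measurableSet_ball
          intro z hz
          rw [hχ1 z hz]
          fin_cases j <;> simp
      _ ≤ Z := setIntegral_le_integral iZ (Eventually.of_forall fun z => by positivity)
      _ ≤ D * s ^ 4 := Zle
      _ ≤ _ := by gcongr; have : 0 ≤ 82 * ω ^ 2 * D + E := by positivity
                  linarith
  · calc _ ≤ ∫ z in ball z0 ρ, χ z ^ 2 * ‖dif h Y z‖ ^ 4 := by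
          apply setIntegral_mono_on (integrableOn_ball_of_cont (by fun_prop) _ _)
            iX.integrableOn measurableSet_ball
          intro z hz
          rw [hχ1 z hz]
          simp
      _ ≤ X := setIntegral_le_integral iX (Eventually.of_forall fun z => by positivity)
      _ ≤ 82 * ω ^ 2 * (D * s ^ 4) + E * s ^ 4 := Xle.trans (by gcongr)
      _ ≤ _ := by
        have : 0 ≤ D * s ^ 4 := by positivity
        linarith

end RegH
end regF10

section regF11
open MeasureTheory
set_option linter.unusedSectionVars false
set_option maxSynthPendingDepth 4
variable {H : Type*} [NormedAddCommGroup H] [InnerProductSpace ℝ H]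

namespace RegH
variable {V : E2 → H} {A : E2 × H → H} {K : Set (E2 × H)} {z0 : E2} {r lam Lam ω : ℝ}

/-- the size function for third differences -/
def m3 (V : E2 → H) (i : Fin 2) (s : ℝ) (z : E2) : ℝ :=
  3 * s + (‖dif (s • ee i) (fun z => fderiv ℝ V z (ee 1)) z‖ +
    ‖dif (s • ee i) (fun z => fderiv ℝ V z (ee 1)) (z + s • ee i)‖ +
    ‖dif (s • ee i) (fun z => fderiv ℝ V z (ee 1)) (z + s • ee i + s • ee i)‖)

/-- the error function for third differences -/
def g3 (V : E2 → H) (Lam : ℝ) (i : Fin 2) (s : ℝ) (z : E2) : ℝ :=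
  Lam * (20 * m3 V i s z * (‖(dif (s • ee i))^[2] (fun z => fderiv ℝ V z (ee 1)) z‖ +
    ‖(dif (s • ee i))^[2] (fun z => fderiv ℝ V z (ee 1)) (z + s • ee i)‖) + 7 * m3 V i s z ^ 3)

lemma prod_norm_le (h : E2) (W : H) : ‖(h, W)‖ ≤ ‖h‖ + ‖W‖ := by
  rw [Prod.norm_def]
  exact max_le (by simp) (by simp)

lemma k3_pt (R : RegH V A K z0 r lam Lam ω) {i : Fin 2} {s : ℝ} (hs : 0 < s)
    {z : E2} (hz : z ∈ ball z0 r) (hz' : z + s • ee i ∈ ball z0 r)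
    (hz'' : z + s • ee i + s • ee i ∈ ball z0 r)
    (hz3 : z + s • ee i + s • ee i + s • ee i ∈ ball z0 r) :
    (lam / 2) * ‖(dif (s • ee i))^[3] (fun z => fderiv ℝ V z (ee 1)) z‖ ^ 2 -
      g3 V Lam i s z * ‖(dif (s • ee i))^[3] (fun z => fderiv ℝ V z (ee 1)) z‖ ≤
      ⟪(dif (s • ee i))^[3] (fun z => A (z, fderiv ℝ V z (ee 1))) z,
        (dif (s • ee i))^[3] (fun z => fderiv ℝ V z (ee 1)) z⟫ ∧
    ‖(dif (s • ee i))^[3] (fun z => A (z, fderiv ℝ V z (ee 1))) z‖ ≤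
      (Lam + lam) * ‖(dif (s • ee i))^[3] (fun z => fderiv ℝ V z (ee 1)) z‖ + g3 V Lam i s z := by
  have m1 := R.mem _ hz
  have m2 := R.mem _ hz'
  have m3 := R.mem _ hz''
  have m4 := R.mem _ hz3
  have hLam := R.hLam
  have e0 : ∀ z, (z + s • ee i, fderiv ℝ V (z + s • ee i) (ee 1)) - (z, fderiv ℝ V z (ee 1)) =
      (s • ee i, dif (s • ee i) (fun z => fderiv ℝ V z (ee 1)) z) := by
    intro z
    ext1 <;> simp [dif]
  have hm : ‖(z + s • ee i, fderiv ℝ V (z + s • ee i) (ee 1)) - (z, fderiv ℝ V z (ee 1))‖ +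
    ‖(z + s • ee i + s • ee i, fderiv ℝ V (z + s • ee i + s • ee i) (ee 1)) -
      (z + s • ee i, fderiv ℝ V (z + s • ee i) (ee 1))‖ +
    ‖(z + s • ee i + s • ee i + s • ee i, fderiv ℝ V (z + s • ee i + s • ee i + s • ee i) (ee 1)) -
      (z + s • ee i + s • ee i, fderiv ℝ V (z + s • ee i + s • ee i) (ee 1))‖ ≤ RegH.m3 V i s z := by
    rw [e0, e0, e0]
    have := prod_norm_le (s • ee i) (dif (s • ee i) (fun z => fderiv ℝ V z (ee 1)) z)
    have := prod_norm_le (s • ee i) (dif (s • ee i) (fun z => fderiv ℝ V z (ee 1)) (z + s • ee i))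
    have := prod_norm_le (s • ee i) (dif (s • ee i) (fun z => fderiv ℝ V z (ee 1)) (z + s • ee i + s • ee i))
    rw [norm_s i hs] at *
    unfold RegH.m3
    linarith
  have t := dif3_taylor R.hA R.hK R.hLam R.b2 R.b3 m1 m2 m3 m4 hm
  have e2 : ∀ a b : H, ((s • ee i, b) : E2 × H) - (s • ee i, a) = (0, b - a) := by intro a b; simp
  have e3 : ∀ a b : H, (((0 : E2), b) : E2 × H) - (0, a) = (0, b - a) := by intro a b; simp
  have e4 : ∀ b : H, ‖(((0 : E2), b) : E2 × H)‖ = ‖b‖ := by intro b; simp [Prod.norm_def]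
  rw [e0, e0, e0, e2, e2, e3, e4, e4] at t
  change ‖(dif (s • ee i))^[3] (fun z => A (z, fderiv ℝ V z (ee 1))) z -
    fderiv ℝ A (z, fderiv ℝ V z (ee 1)) (0, (dif (s • ee i))^[3] (fun z => fderiv ℝ V z (ee 1)) z)‖ ≤
    g3 V Lam i s z at t
  refine B_est (R.ell _ m1 _) (R.T_est m1 _) (t.trans ?_) R.hl.le
  have := R.hl
  have : 0 ≤ lam / 2 * ‖(dif (s • ee i))^[3] (fun z => fderiv ℝ V z (ee 1)) z‖ := by positivity
  linarith

lemma IntE2 [CompleteSpace H] (R : RegH V A K z0 r lam Lam ω) (j : Fin 2) :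
    IntE (fun z => fderiv ℝ V z (ee j)) 2 4 z0 r := by
  intro ρ h0 h1
  obtain ⟨C, s0, hC, hs0, h⟩ := R.k2 h0 h1
  refine ⟨C, s0, hC, hs0, fun i s hs hs' => ?_⟩
  rw [show s ^ (4:ℝ) = s ^ 4 by norm_cast]
  exact (h i s hs hs').1 j

lemma g3_real {Lam m d d' s c a b e : ℝ} (hd : 0 ≤ d) (hd' : 0 ≤ d')
    (hm0 : 0 ≤ m) (hm2 : m ^ 2 ≤ c * s) (hcs : 0 ≤ c * s)
    (hm : m = 3 * s + (a + b + e)) :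
    (Lam * (20 * m * (d + d') + 7 * m ^ 3)) ^ 2 ≤
      Lam ^ 2 * (c * s) * (1600 * (d ^ 2 + d' ^ 2) + 6272 * (81 * s ^ 4 + a ^ 4 + b ^ 4 + e ^ 4)) := by
  have p1 : (20 * m * (d + d') + 7 * m ^ 3) ^ 2 ≤ m ^ 2 * (1600 * (d ^ 2 + d' ^ 2) + 98 * m ^ 4) := by
    have q1 : (20 * (d + d') + 7 * m ^ 2) ^ 2 ≤ 1600 * (d ^ 2 + d' ^ 2) + 98 * m ^ 4 := by
      have := sq_nonneg (20 * (d + d') - 7 * m ^ 2)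
      have := sq_nonneg (d - d')
      linarith
    calc _ = m ^ 2 * (20 * (d + d') + 7 * m ^ 2) ^ 2 := by ring
      _ ≤ _ := by gcongr
  have p2 : m ^ 4 ≤ 64 * (81 * s ^ 4 + a ^ 4 + b ^ 4 + e ^ 4) := by
    have q1 : m ^ 2 ≤ 4 * ((3 * s) ^ 2 + a ^ 2 + b ^ 2 + e ^ 2) := by
      rw [hm]
      nlinarith [sq_nonneg (3 * s - a), sq_nonneg (3 * s - b), sq_nonneg (3 * s - e), sq_nonneg (a - b),
        sq_nonneg (a - e), sq_nonneg (b - e)]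
    have q2 : m ^ 4 ≤ (4 * ((3 * s) ^ 2 + a ^ 2 + b ^ 2 + e ^ 2)) ^ 2 := by
      rw [show m ^ 4 = (m ^ 2) ^ 2 by ring]; gcongr
    have := sq_nonneg ((3 * s) ^ 2 - a ^ 2)
    have := sq_nonneg ((3 * s) ^ 2 - b ^ 2)
    have := sq_nonneg ((3 * s) ^ 2 - e ^ 2)
    have := sq_nonneg (a ^ 2 - b ^ 2)
    have := sq_nonneg (a ^ 2 - e ^ 2)
    have := sq_nonneg (b ^ 2 - e ^ 2)
    linarith
  rw [mul_pow, mul_assoc (Lam ^ 2)]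
  refine mul_le_mul_of_nonneg_left (p1.trans ?_) (sq_nonneg _)
  have : (0:ℝ) ≤ 1600 * (d ^ 2 + d' ^ 2) + 98 * m ^ 4 := by positivity
  calc m ^ 2 * (1600 * (d ^ 2 + d' ^ 2) + 98 * m ^ 4)
      ≤ (c * s) * (1600 * (d ^ 2 + d' ^ 2) + 98 * m ^ 4) := by gcongr
    _ ≤ _ := by
      refine mul_le_mul_of_nonneg_left ?_ hcs
      linarith

lemma k3 [FiniteDimensional ℝ H] (R : RegH V A K z0 r lam Lam ω) (j : Fin 2) :
    IntE (fun z => fderiv ℝ V z (ee j)) 3 5 z0 r := by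
  haveI : CompleteSpace H := FiniteDimensional.complete ℝ H
  intro ρ hρ0 hρ
  have hl := R.hl
  have hLam := R.hLam
  set δ := (r - ρ) / 8 with hδ
  have hδ0 : 0 < δ := by rw [hδ]; linarith
  obtain ⟨K0, hK0, hc⟩ := cacc_ball (H := H) (lam := lam / 2) (Lam := Lam + lam) (by positivity)
    (by positivity) z0 hρ0 (show ρ < ρ + δ by linarith)
  obtain ⟨C1, hC1, e1⟩ := loc_holder R.contY (R.k1 1) (R.IntE2 1) (show 0 < ρ + 4 * δ by linarith)
    (by linarith)
  obtain ⟨C2, s2, hC2, hs2, e2⟩ := R.k2 (show 0 < ρ + 4 * δ by linarith) (by linarith)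
  obtain ⟨C3, s3, hC3, hs3, e3⟩ := difV_le (k := 2) R.hV R.IntE2 (show 0 < ρ + δ by linarith) (by linarith)
  set vol := ∫ z in ball z0 (ρ + δ), (1:ℝ) with hvol
  have vol0 : 0 ≤ vol := by positivity
  set c := (3 + 3 * C1) ^ 2 with hcdef
  refine ⟨K0 * (Lam ^ 2 * c * (1600 * (2 * C2) + 6272 * (81 * vol + 3 * C2)) + C3),
    min (min s2 s3) (min δ 1), by positivity, by positivity, fun i s hs hs' => ?_⟩
  simp only [lt_min_iff] at hs'
  have hns := norm_s i hs
  set h := s • ee i with hh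
  set Y := fun z => fderiv ℝ V z (ee 1) with hY
  have cY : Continuous Y := R.contY
  have cD : Continuous (dif h Y) := dif_continuous cY h
  have cDD : Continuous ((dif h)^[2] Y) := difk_continuous cY h 2
  have hdV := fun v => fderiv_dif2 R.hV h v 3
  have hU : ContDiff ℝ 1 ((dif h)^[3] V) := (hdV (ee 0) 0).2
  have f2 := e2 i s hs hs'.1.1
  have f3 := e3 i s hs hs'.1.2
  have cm : Continuous (RegH.m3 V i s) := by
    unfold RegH.m3
    change Continuous (fun z => 3 * s + (‖dif h Y z‖ + ‖dif h Y (z + h)‖ + ‖dif h Y (z + h + h)‖))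
    fun_prop
  have cg : Continuous (g3 V Lam i s) := by
    unfold g3
    change Continuous (fun z => Lam * (20 * RegH.m3 V i s z * (‖(dif h)^[2] Y z‖ + ‖(dif h)^[2] Y (z + h)‖)
      + 7 * RegH.m3 V i s z ^ 3))
    fun_prop
  have hm0 : ∀ z, 0 ≤ RegH.m3 V i s z := fun z => by unfold RegH.m3; positivity
  have hg0 : ∀ z, 0 ≤ g3 V Lam i s z := fun z => by
    unfold g3
    have := hm0 z
    positivity
  have hm := hc _ _ (g3 V Lam i s) hU (difk_continuous R.contB h 3) cg hg0
    (weqk R.hV R.contB R.w h 3 (r' := ρ + δ) (by rw [hns]; push_cast; linarith))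
    (fun z hz => by
      rw [(hdV (ee 1) z).1]
      have z1 := add_mem (r := ρ + δ + s) h hz (by linarith)
      have z2 := add_mem (r := ρ + δ + 2 * s) h z1 (by linarith)
      have z3 := add_mem (r := ρ + δ + 3 * s) h z2 (by linarith)
      exact R.k3_pt hs (ball_subset_ball (by linarith) hz) (ball_subset_ball (by linarith) z1)
        (ball_subset_ball (by linarith) z2) (ball_subset_ball (by linarith) z3)) j
  simp only [(hdV _ _).1] at hm
  have I : ∀ {f : E2 → ℝ}, Continuous f → IntegrableOn f (ball z0 (ρ + δ)) :=
    fun hf => integrableOn_ball_of_cont hf _ _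
  have hg2 : ∫ z in ball z0 (ρ + δ), g3 V Lam i s z ^ 2 ≤
      Lam ^ 2 * (c * s) * (1600 * (2 * C2 * s ^ 4) + 6272 * (81 * s ^ 4 * vol + 3 * (C2 * s ^ 4))) := by
    have tr : ∀ (G : E2 → ℝ), Continuous G → (∀ z, 0 ≤ G z) → ∀ t : ℝ, 0 ≤ t → t ≤ 3 → ∀ h', h' = t • h →
        ∫ z in ball z0 (ρ + δ), G (z + h') ≤ ∫ z in ball z0 (ρ + 4 * δ), G z := by
      intro G cG hG t ht0 ht h' eh
      refine setInt_translate_le cG hG z0 ?_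
      rw [eh, norm_smul, hns, Real.norm_of_nonneg ht0]
      nlinarith
    have t0 := tr (fun z => ‖(dif h)^[2] Y z‖ ^ 2) (by fun_prop) (fun z => by positivity) 0 le_rfl (by norm_num) 0 (by simp)
    have t1 := tr (fun z => ‖(dif h)^[2] Y z‖ ^ 2) (by fun_prop) (fun z => by positivity) 1 (by norm_num) (by norm_num) h (by simp)
    have u0 := tr (fun z => ‖dif h Y z‖ ^ 4) (by fun_prop) (fun z => by positivity) 0 le_rfl (by norm_num) 0 (by simp)
    have u1 := tr (fun z => ‖dif h Y z‖ ^ 4) (by fun_prop) (fun z => by positivity) 1 (by norm_num) (by norm_num) h (by simp)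
    have u2 := tr (fun z => ‖dif h Y z‖ ^ 4) (by fun_prop) (fun z => by positivity) 2 (by norm_num) (by norm_num) (h + h) (by module)
    simp only [add_zero, ← add_assoc] at t0 u0 u2
    have f21 := f2.1 1
    have f22 := f2.2
    calc ∫ z in ball z0 (ρ + δ), g3 V Lam i s z ^ 2
        ≤ ∫ z in ball z0 (ρ + δ), Lam ^ 2 * (c * s) * (1600 * (‖(dif h)^[2] Y z‖ ^ 2 +
          ‖(dif h)^[2] Y (z + h)‖ ^ 2) + 6272 * (81 * s ^ 4 * 1 + ‖dif h Y z‖ ^ 4 + ‖dif h Y (z + h)‖ ^ 4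
            + ‖dif h Y (z + h + h)‖ ^ 4)) := by
          apply setIntegral_mono_on (I (by fun_prop)) (I (by fun_prop)) measurableSet_ball
          intro z hz
          have z1 := add_mem (r := ρ + δ + s) h hz (by linarith)
          have z2 := add_mem (r := ρ + δ + 2 * s) h z1 (by linarith)
          have z3 := add_mem (r := ρ + δ + 3 * s) h z2 (by linarith)
          have B0 : z ∈ ball z0 (ρ + 4 * δ) := ball_subset_ball (by linarith) hz
          have B1 : z + h ∈ ball z0 (ρ + 4 * δ) := ball_subset_ball (by linarith) z1
          have B2 : z + h + h ∈ ball z0 (ρ + 4 * δ) := ball_subset_ball (by linarith) z2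
          have B3 : z + h + h + h ∈ ball z0 (ρ + 4 * δ) := ball_subset_ball (by linarith) z3
          have y1 := e1 _ B0 h B1
          have y2 := e1 _ B1 h B2
          have y3 := e1 _ B2 h B3
          rw [hns] at y1 y2 y3
          rw [mul_one]
          refine g3_real (norm_nonneg _) (norm_nonneg _) (hm0 z) ?_ (by positivity) rfl
          have hsq : s ≤ s ^ (1/2:ℝ) := by
            have := Real.rpow_le_rpow_of_exponent_ge hs hs'.2.2.le (show (1/2:ℝ) ≤ 1 by norm_num)
            simpa using this
          have hss : s ^ (1/2:ℝ) * s ^ (1/2:ℝ) = s := by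
            rw [← Real.rpow_add hs]; norm_num
          have : RegH.m3 V i s z ≤ (3 + 3 * C1) * s ^ (1/2:ℝ) := by
            change 3 * s + (‖Y (z + h) - Y z‖ + ‖Y (z + h + h) - Y (z + h)‖ +
              ‖Y (z + h + h + h) - Y (z + h + h)‖) ≤ _
            change ‖Y (z + h) - Y z‖ ≤ _ at y1
            change ‖Y (z + h + h) - Y (z + h)‖ ≤ _ at y2
            change ‖Y (z + h + h + h) - Y (z + h + h)‖ ≤ _ at y3
            linarith
          calc RegH.m3 V i s z ^ 2 ≤ ((3 + 3 * C1) * s ^ (1/2:ℝ)) ^ 2 := by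
                have := hm0 z
                gcongr
            _ = c * (s ^ (1/2:ℝ) * s ^ (1/2:ℝ)) := by rw [hcdef]; ring
            _ = c * s := by rw [hss]
      _ = Lam ^ 2 * (c * s) * (1600 * ((∫ z in ball z0 (ρ + δ), ‖(dif h)^[2] Y z‖ ^ 2) +
          ∫ z in ball z0 (ρ + δ), ‖(dif h)^[2] Y (z + h)‖ ^ 2) + 6272 * (81 * s ^ 4 * vol +
          (∫ z in ball z0 (ρ + δ), ‖dif h Y z‖ ^ 4) + (∫ z in ball z0 (ρ + δ), ‖dif h Y (z + h)‖ ^ 4)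
            + ∫ z in ball z0 (ρ + δ), ‖dif h Y (z + h + h)‖ ^ 4)) := by
          rw [integral_const_mul, integral_add (I (by fun_prop)) (I (by fun_prop)), integral_const_mul,
            integral_const_mul, integral_add (I (by fun_prop)) (I (by fun_prop)),
            integral_add (I (by fun_prop)) (I (by fun_prop)), integral_add (I (by fun_prop)) (I (by fun_prop)),
            integral_add (I (by fun_prop)) (I (by fun_prop)), integral_const_mul]
      _ ≤ _ := by
          refine mul_le_mul_of_nonneg_left ?_ (by positivity)
          linarith
  refine hm.trans ?_
  rw [show s ^ (5:ℝ) = s ^ 5 by norm_cast, mul_assoc K0]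
  refine mul_le_mul_of_nonneg_left ?_ hK0
  have f4 : C3 * (s ^ 2 * s ^ (4:ℝ)) ≤ C3 * s ^ 5 := by
    rw [show s ^ (4:ℝ) = s ^ 4 by norm_cast]
    refine mul_le_mul_of_nonneg_left ?_ hC3
    have : s ^ 5 * s ≤ s ^ 5 * 1 := by gcongr; linarith
    linarith
  have e5 : Lam ^ 2 * (c * s) * (1600 * (2 * C2 * s ^ 4) + 6272 * (81 * s ^ 4 * vol + 3 * (C2 * s ^ 4)))
    = Lam ^ 2 * c * (1600 * (2 * C2) + 6272 * (81 * vol + 3 * C2)) * s ^ 5 := by ring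
  linarith

theorem grad_C1 [FiniteDimensional ℝ H] (R : RegH V A K z0 r lam Lam ω) (j : Fin 2) :
    ContDiffAt ℝ 1 (fun z => fderiv ℝ V z (ee j)) z0 := by
  haveI : CompleteSpace H := FiniteDimensional.complete ℝ H
  exact loc_C1 (cont_fderiv_apply R.hV _) (R.k1 j) (R.IntE2 j) (R.k3 j) R.hr

end RegH
end regF11

section regF12
open MeasureTheory
set_option linter.unusedSectionVars false
set_option maxSynthPendingDepth 4
variable {H : Type*} [NormedAddCommGroup H] [InnerProductSpace ℝ H]

lemma fderiv_eq_sum_ee {V : E2 → H} (z : E2) :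
    fderiv ℝ V z = ∑ j : Fin 2, (EuclideanSpace.proj j : E2 →L[ℝ] ℝ).smulRight (fderiv ℝ V z (ee j)) := by
  ext v
  have : v = ∑ j : Fin 2, v j • ee j := by
    ext i
    fin_cases i <;> simp [ee]
  conv_lhs => rw [this]
  simp

lemma contDiffAt_of_partials {n : ℕ} {V : E2 → H} {z0 : E2}
    (hd : ∀ᶠ z in 𝓝 z0, DifferentiableAt ℝ V z)
    (h : ∀ j, ContDiffAt ℝ n (fun z => fderiv ℝ V z (ee j)) z0) : ContDiffAt ℝ (n + 1) V z0 := by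
  rw [contDiffAt_succ_iff_hasFDerivAt (n := n)]
  refine ⟨fderiv ℝ V, ⟨_, hd, fun x hx => hx.hasFDerivAt⟩, ?_⟩
  have e : fderiv ℝ V = fun z => ∑ j : Fin 2,
      (EuclideanSpace.proj j : E2 →L[ℝ] ℝ).smulRight (fderiv ℝ V z (ee j)) :=
    funext fun z => fderiv_eq_sum_ee z
  rw [e]
  apply ContDiffAt.sum
  intro j _
  exact ((ContinuousLinearMap.smulRightL ℝ E2 H (EuclideanSpace.proj j : E2 →L[ℝ] ℝ)).contDiff.contDiffAt).comp z0 (h j)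

lemma bdd_on_ball {F G : Type*} [NormedAddCommGroup F] [NormedAddCommGroup G] [ProperSpace F] {f : F → G}
    (hf : Continuous f) (x0 : F) : ∃ C, 0 ≤ C ∧ ∀ x ∈ closedBall x0 1, ‖f x‖ ≤ C := by
  obtain ⟨C, hC⟩ := (isCompact_closedBall x0 1).exists_bound_of_continuousOn hf.continuousOn
  exact ⟨max C 0, le_max_right _ _, fun x hx => (hC x hx).trans (le_max_left _ _)⟩

theorem reg_base [FiniteDimensional ℝ H] {V : E2 → H} {A : E2 × H → H} {z0 : E2} {r lam : ℝ}
    (hV : ContDiff ℝ 1 V) (hA : ContDiff ℝ (⊤ : ℕ∞) A) (hr : 0 < r) (hl : 0 < lam)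
    (hw : WEq V (fun z => A (z, fderiv ℝ V z (ee 1))) z0 r)
    (hell : ∀ W, lam * ‖W‖ ^ 2 ≤ ⟪fderiv ℝ A (z0, fderiv ℝ V z0 (ee 1)) (0, W), W⟫) :
    ContDiffAt ℝ 2 V z0 := by
  have : ProperSpace H := FiniteDimensional.proper ℝ H
  have : ProperSpace (E2 × H) := inferInstance
  set Y := fun z => fderiv ℝ V z (ee 1) with hY
  set x0 : E2 × H := (z0, Y z0) with hx0
  have hA3 : ContDiff ℝ 3 A := by exact_mod_cast (contDiff_infty.1 hA 3)
  have hA1 : ContDiff ℝ 2 (fderiv ℝ A) := hA3.fderiv_right (by norm_num)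
  have hA2 : ContDiff ℝ 1 (fderiv ℝ (fderiv ℝ A)) := hA1.fderiv_right (by norm_num)
  have hA0 : Continuous (fderiv ℝ (fderiv ℝ (fderiv ℝ A))) := hA2.continuous_fderiv (by norm_num)
  obtain ⟨C1, c1, d1⟩ := bdd_on_ball hA1.continuous x0
  obtain ⟨C2, c2, d2⟩ := bdd_on_ball hA2.continuous x0
  obtain ⟨C3, c3, d3⟩ := bdd_on_ball hA0 x0
  set Lam := C1 + C2 + C3 with hLam
  have hL0 : 0 ≤ Lam := by positivity
  obtain ⟨R, hR0, hR⟩ := Metric.continuous_iff.1 hA1.continuous x0 (lam / 2) (by positivity)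
  set R' := min (R / 2) 1 with hR'
  have hR'0 : 0 < R' := by positivity
  have hR'1 : R' < R := (min_le_left _ _).trans_lt (by linarith)
  -- choose ω
  obtain ⟨ω, hω0, hωR, s1, s2⟩ : ∃ ω : ℝ, 0 < ω ∧ ω ≤ R' ∧ 16 * Lam * ω ≤ lam / 2 ∧
      caccK (lam / 2 / 2) (Lam + lam / 2) * Lam ^ 2 * 3000 * ω ^ 2 ≤ 1 := by
    have t1 : Tendsto (fun ω : ℝ => 16 * Lam * ω) (𝓝[>] 0) (𝓝 0) :=
      ((by fun_prop : Continuous (fun ω : ℝ => 16 * Lam * ω)).tendsto' 0 0 (by simp)).mono_left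
        nhdsWithin_le_nhds
    have t2 : Tendsto (fun ω : ℝ => caccK (lam / 2 / 2) (Lam + lam / 2) * Lam ^ 2 * 3000 * ω ^ 2)
        (𝓝[>] 0) (𝓝 0) :=
      ((by fun_prop : Continuous (fun ω : ℝ => caccK (lam / 2 / 2) (Lam + lam / 2) * Lam ^ 2 * 3000 * ω ^ 2)).tendsto'
        0 0 (by simp)).mono_left nhdsWithin_le_nhds
    have e1 := t1.eventually_le_const (show (0:ℝ) < lam / 2 by positivity)
    have e2 := t2.eventually_le_const (show (0:ℝ) < 1 by positivity)
    have e3 : ∀ᶠ ω in 𝓝[>] (0:ℝ), ω ∈ Set.Ioc 0 R' := Ioc_mem_nhdsGT hR'0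
    obtain ⟨ω, h1, h2, h3⟩ := (e1.and (e2.and e3)).exists
    exact ⟨ω, h3.1, h3.2, h1, h2⟩
  have cY : Continuous Y := cont_fderiv_apply hV _
  obtain ⟨r1, hr1, hr1'⟩ := Metric.continuous_iff.1 cY z0 ω hω0
  set r' := min r (min r1 R') with hr'
  have hr'0 : 0 < r' := by positivity
  have b1 : r' ≤ r := min_le_left _ _
  have b2 : r' ≤ r1 := (min_le_right _ _).trans (min_le_left _ _)
  have b3 : r' ≤ R' := (min_le_right _ _).trans (min_le_right _ _)
  have hsub : ∀ x ∈ closedBall x0 R', x ∈ closedBall x0 1 := fun x hx =>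
    closedBall_subset_closedBall (min_le_right _ _) hx
  have hosc : ∀ z ∈ ball z0 r', ‖Y z - Y z0‖ ≤ ω := fun z hz => by
    rw [← dist_eq_norm]
    exact (hr1' z (lt_of_lt_of_le hz b2)).le
  have RR : RegH V A (closedBall x0 R') z0 r' (lam / 2) Lam ω := by
    refine ⟨hV, hA3, convex_closedBall _ _, hr'0, by positivity, hL0, hω0.le, fun z hz => ?_,
      fun x hx W => ?_, fun x hx => (d1 x (hsub x hx)).trans (by rw [hLam]; linarith),
      fun x hx => (d2 x (hsub x hx)).trans (by rw [hLam]; linarith),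
      fun x hx => (d3 x (hsub x hx)).trans (by rw [hLam]; linarith),
      hosc, hw.mono (ball_subset_ball b1), s1, s2⟩
    · rw [mem_closedBall, hx0, Prod.dist_eq]
      refine max_le ((le_of_lt hz).trans b3) ?_
      rw [dist_eq_norm]
      exact (hosc z hz).trans hωR
    · have h1 := hell W
      have h2 := hR x (lt_of_le_of_lt hx hR'1)
      rw [dist_eq_norm] at h2
      have h3 : ⟪(fderiv ℝ A x0 - fderiv ℝ A x) (0, W), W⟫ ≤ lam / 2 * ‖W‖ * ‖W‖ := by
        refine (real_inner_le_norm _ _).trans ?_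
        gcongr
        refine ((fderiv ℝ A x0 - fderiv ℝ A x).le_opNorm _).trans ?_
        rw [norm_sub_rev]
        have : ‖((0:E2), W)‖ = ‖W‖ := by simp [Prod.norm_def]
        rw [this]
        gcongr
      rw [sub_apply, inner_sub_left] at h3
      change lam * ‖W‖ ^ 2 ≤ ⟪fderiv ℝ A x0 (0, W), W⟫ at h1
      nlinarith
  have := contDiffAt_of_partials (n := 1) (Eventually.of_forall (hV.differentiable (by norm_num)))
    (fun j => RR.grad_C1 j)
  simpa [one_add_one_eq_two] using this

end regF12

section regF13
open MeasureTheory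
set_option linter.unusedSectionVars false
set_option maxSynthPendingDepth 4

lemma exists_ext {G : Type*} [NormedAddCommGroup G] [NormedSpace ℝ G] {n : ℕ} {F : E2 → G} {z0 : E2}
    {r r' : ℝ} (h0 : 0 < r') (h : r' < r) (hF : ∀ z ∈ ball z0 r, ContDiffAt ℝ n F z) :
    ∃ F' : E2 → G, ContDiff ℝ n F' ∧ HasCompactSupport F' ∧ ∀ z ∈ ball z0 r', F' z = F z := by
  obtain ⟨χ, c1, -, -, c2, c3, c4, -⟩ := exists_cutoff z0 h0 h
  refine ⟨fun z => χ z • F z, ?_, c3.smul_right, fun z hz => by simp [c2 z hz]⟩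
  rw [contDiff_iff_contDiffAt]
  intro z
  by_cases hz : z ∈ ball z0 r
  · exact ((contDiff_infty.1 c1 n).contDiffAt).smul (hF z hz)
  · have : (fun z => χ z • F z) =ᶠ[𝓝 z] fun _ => 0 := by
      have h1 : z ∉ tsupport χ := fun h => hz (c4 h)
      filter_upwards [notMem_tsupport_iff_eventuallyEq.1 h1] with y hy
      rw [hy]; simp
    exact contDiffAt_const.congr_of_eventuallyEq this

variable {H : Type*} [NormedAddCommGroup H] [InnerProductSpace ℝ H]

lemma fderiv_symm2 {V : E2 → H} {z : E2} (h : ContDiffAt ℝ 2 V z) (v w : E2) :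
    fderiv ℝ (fun y => fderiv ℝ V y v) z w = fderiv ℝ (fun y => fderiv ℝ V y w) z v := by
  have hd : DifferentiableAt ℝ (fderiv ℝ V) z :=
    (h.fderiv_right (m := 1) (by norm_num)).differentiableAt (by norm_num)
  have e : ∀ v w, fderiv ℝ (fun y => fderiv ℝ V y v) z w = fderiv ℝ (fderiv ℝ V) z w v := by
    intro v w
    rw [fderiv_clm_apply hd (by fun_prop)]
    simp
  rw [e, e]
  exact (h.isSymmSndFDerivAt (by simp)) _ _

lemma lim_dq [CompleteSpace H] {F g : E2 → H} (hF : ContDiff ℝ 1 F) (hFc : HasCompactSupport F) (hg : Continuous g)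
    (hgc : HasCompactSupport g) (i : Fin 2) :
    Tendsto (fun s : ℝ => ∫ z, s⁻¹ * ⟪dif (s • ee i) F z, g z⟫) (𝓝[>] 0)
      (𝓝 (∫ z, ⟪fderiv ℝ F z (ee i), g z⟫)) := by
  have hd : Differentiable ℝ F := hF.differentiable (by norm_num)
  obtain ⟨C, hC⟩ := (hF.continuous_fderiv (by norm_num)).bounded_above_of_compact_support
    (hFc.fderiv (𝕜 := ℝ))
  have hC0 : 0 ≤ C := (norm_nonneg _).trans (hC 0)
  apply tendsto_integral_filter_of_dominated_convergence (fun z => C * ‖g z‖)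
  · refine Eventually.of_forall fun s => ?_
    have := dif_continuous hF.continuous (s • ee i)
    exact (by fun_prop : Continuous (fun z => s⁻¹ * ⟪dif (s • ee i) F z, g z⟫)).aestronglyMeasurable
  · filter_upwards [self_mem_nhdsWithin] with s hs
    have hs : 0 < s := hs
    refine Eventually.of_forall fun z => ?_
    have h1 : ‖dif (s • ee i) F z‖ ≤ C * s := by
      have := convex_univ.norm_image_sub_le_of_norm_fderiv_le (𝕜 := ℝ) (fun x _ => hd x) (fun x _ => hC x)
        (Set.mem_univ z) (Set.mem_univ (z + s • ee i))
      rw [add_sub_cancel_left, norm_smul, norm_ee, mul_one, Real.norm_of_nonneg hs.le] at this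
      exact this
    rw [norm_mul, Real.norm_of_nonneg (inv_nonneg.2 hs.le)]
    calc s⁻¹ * ‖⟪dif (s • ee i) F z, g z⟫‖ ≤ s⁻¹ * (C * s * ‖g z‖) := by
          gcongr
          exact (norm_inner_le_norm _ _).trans (by gcongr)
      _ = C * ‖g z‖ := by field_simp
  · have : Continuous (fun z => C * ‖g z‖) := by fun_prop
    exact this.integrable_of_hasCompactSupport (hgc.norm.mul_left)
  · refine Eventually.of_forall fun z => ?_
    have h1 : HasDerivAt (fun s : ℝ => F (z + s • ee i)) (fderiv ℝ F z (ee i)) 0 := by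
      have e : HasDerivAt (fun s : ℝ => z + s • ee i) (ee i) 0 := by
        simpa using ((hasDerivAt_id (0:ℝ)).smul_const (ee i)).const_add z
      have h2 : HasFDerivAt F (fderiv ℝ F z) (z + (0:ℝ) • ee i) := by
        simpa using (hd z).hasFDerivAt
      exact h2.comp_hasDerivAt (0:ℝ) e
    have h2 := h1.tendsto_slope_zero_right
    have h3 := h2.inner (tendsto_const_nhds (x := g z)) (𝕜 := ℝ)
    refine h3.congr fun s => ?_
    simp [dif, inner_smul_left]

lemma weq_deriv [CompleteSpace H] {V B U B' : E2 → H} {z0 : E2} {r r' : ℝ} (hV : ContDiff ℝ 1 V)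
    (hB : Continuous B) (hw : WEq V B z0 r) (hr'0 : 0 < r') (hr' : r' < r)
    (hV2 : ∀ z ∈ ball z0 r, ContDiffAt ℝ 2 V z) (hB1 : ∀ z ∈ ball z0 r, ContDiffAt ℝ 1 B z) (i : Fin 2)
    (hU : ∀ z ∈ ball z0 r', U z = fderiv ℝ V z (ee i))
    (hB' : ∀ z ∈ ball z0 r', B' z = fderiv ℝ B z (ee i)) : WEq U B' z0 r' := by
  intro η h1 h2 h3
  set r'' := (r' + r) / 2 with hr''
  obtain ⟨F1, f1, f1c, f1e⟩ := exists_ext (n := 1) (F := fun z => fderiv ℝ V z (ee 0)) (z0 := z0) (r := r) (r' := r'')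
    (by linarith) (by linarith) (fun z hz => by
      have := (hV2 z hz).fderiv_right (m := 1) (by norm_num)
      exact_mod_cast this.clm_apply contDiffAt_const)
  obtain ⟨F2, f2, f2c, f2e⟩ := exists_ext (n := 1) (F := B) (z0 := z0) (r := r) (r' := r'')
    (by linarith) (by linarith) (fun z hz => by exact_mod_cast hB1 z hz)
  have f1 : ContDiff ℝ 1 F1 := by exact_mod_cast f1
  have f2 : ContDiff ℝ 1 F2 := by exact_mod_cast f2
  have hc : ∀ v, HasCompactSupport (fun z => fderiv ℝ η z v) := fun v =>
    h2.fderiv_apply (𝕜 := ℝ) v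
  have hs0 : ∀ v z, z ∉ ball z0 r' → fderiv ℝ η z v = 0 := fun v z hz => by
    have : z ∉ tsupport (fderiv ℝ η) := fun h => hz (h3 (tsupport_fderiv_subset ℝ h))
    rw [image_eq_zero_of_notMem_tsupport this]; simp
  have c0 := cont_fderiv_apply h1 (ee 0)
  have c1 := cont_fderiv_apply h1 (ee 1)
  have l1 := lim_dq f1 f1c c0 (hc _) i
  have l2 := lim_dq f2 f2c c1 (hc _) i
  have I : ∀ {a b : E2 → H}, Continuous a → Continuous b → HasCompactSupport b →
      Integrable (fun z => ⟪a z, b z⟫) := fun {a b} ha hb hbc => by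
    apply Continuous.integrable_of_hasCompactSupport (by fun_prop)
    exact hbc.mono (fun z hz => by
        simp only [Function.mem_support, ne_eq] at *; intro h; apply hz; rw [h, inner_zero_right])
  have e0 : ∫ z, (⟪fderiv ℝ U z (ee 0), fderiv ℝ η z (ee 0)⟫ + ⟪B' z, fderiv ℝ η z (ee 1)⟫) =
      (∫ z, ⟪fderiv ℝ F1 z (ee i), fderiv ℝ η z (ee 0)⟫) + ∫ z, ⟪fderiv ℝ F2 z (ee i), fderiv ℝ η z (ee 1)⟫ := by
    rw [← integral_add (I (cont_fderiv_apply f1 _) c0 (hc _)) (I (cont_fderiv_apply f2 _) c1 (hc _))]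
    congr 1
    ext z
    by_cases hz : z ∈ ball z0 r'
    · have nh : ball z0 r' ∈ 𝓝 z := isOpen_ball.mem_nhds hz
      have hz2 : z ∈ ball z0 r := ball_subset_ball hr'.le hz
      have g1 : fderiv ℝ U z = fderiv ℝ (fun z => fderiv ℝ V z (ee i)) z :=
        (show U =ᶠ[𝓝 z] _ from eventually_of_mem nh hU).fderiv_eq
      have g2 : fderiv ℝ F1 z = fderiv ℝ (fun z => fderiv ℝ V z (ee 0)) z :=
        (show F1 =ᶠ[𝓝 z] _ from eventually_of_mem nh (fun y hy => f1e y (ball_subset_ball (by linarith) hy))).fderiv_eq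
      have g3 : fderiv ℝ F2 z = fderiv ℝ B z :=
        (show F2 =ᶠ[𝓝 z] _ from eventually_of_mem nh (fun y hy => f2e y (ball_subset_ball (by linarith) hy))).fderiv_eq
      rw [g1, g2, g3, hB' z hz, fderiv_symm2 (hV2 z hz2)]
    · simp [hs0 _ z hz]
  rw [e0]
  refine tendsto_nhds_unique (l1.add l2) ?_
  refine tendsto_const_nhds.congr' ?_
  have ev : ∀ᶠ s in 𝓝[>] (0:ℝ), s ∈ Set.Ioc 0 (r'' - r') := Ioc_mem_nhdsGT (by linarith)
  filter_upwards [ev] with s hs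
  have hns : ‖s • ee i‖ = s := by rw [norm_smul, norm_ee, mul_one, Real.norm_of_nonneg hs.1.le]
  have hwd := WEq.dif hV hB hw (h := s • ee i) (r' := r') (by rw [hns]; linarith [hs.2]) η h1 h2 h3
  rw [integral_const_mul, integral_const_mul, ← mul_add,
    ← integral_add (I (dif_continuous f1.continuous _) c0 (hc _)) (I (dif_continuous f2.continuous _) c1 (hc _))]
  rw [eq_comm, mul_eq_zero]
  right
  rw [← hwd]
  congr 1
  ext z
  by_cases hz : z ∈ ball z0 r'
  · have hz1 : z ∈ ball z0 r'' := ball_subset_ball (by linarith) hz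
    have hz2 : z + s • ee i ∈ ball z0 r'' := RegH.add_mem _ hz (by rw [hns]; linarith [hs.2])
    rw [fderiv_dif hV]
    simp only [dif]
    rw [f1e z hz1, f1e _ hz2, f2e z hz1, f2e _ hz2]
  · simp [hs0 _ z hz]

end regF13

section regF14
open MeasureTheory
set_option linter.unusedSectionVars false
set_option maxSynthPendingDepth 4

variable {H : Type*} [NormedAddCommGroup H] [InnerProductSpace ℝ H]

/-- pairing into the `L²` product -/
def mkP : H × H →L[ℝ] WithLp 2 (H × H) := ((WithLp.prodContinuousLinearEquiv 2 ℝ H H).symm : H × H →L[ℝ] WithLp 2 (H × H))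

/-- the system satisfied by `(V, κ ∂ᵢ V)` -/
def sysA (A : E2 × H → H) (κ : ℝ) (i : Fin 2) : E2 × WithLp 2 (H × H) → WithLp 2 (H × H) := fun x =>
  mkP (A (x.1, WithLp.fstL 2 ℝ H H x.2), fderiv ℝ A (x.1, WithLp.fstL 2 ℝ H H x.2) (κ • ee i, WithLp.sndL 2 ℝ H H x.2))

lemma sysA_contDiff {A : E2 × H → H} (hA : ContDiff ℝ (⊤ : ℕ∞) A) (κ : ℝ) (i : Fin 2) :
    ContDiff ℝ (⊤ : ℕ∞) (sysA A κ i) := by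
  have h1 : ContDiff ℝ (⊤ : ℕ∞) (fderiv ℝ A) := hA.fderiv_right (by simp)
  have p1 : ContDiff ℝ (⊤ : ℕ∞) (fun x : E2 × WithLp 2 (H × H) => (x.1, WithLp.fstL 2 ℝ H H x.2)) := by fun_prop
  have p2 : ContDiff ℝ (⊤ : ℕ∞) (fun x : E2 × WithLp 2 (H × H) => (κ • ee i, WithLp.sndL 2 ℝ H H x.2)) := by fun_prop
  unfold sysA
  exact mkP.contDiff.comp ((hA.comp p1).prodMk ((h1.comp p1).clm_apply p2))

lemma sysA_fderiv {A : E2 × H → H} (hA : ContDiff ℝ (⊤ : ℕ∞) A) (κ : ℝ) (i : Fin 2) (z : E2)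
    (X W : WithLp 2 (H × H)) : fderiv ℝ (sysA A κ i) (z, X) (0, W) =
    mkP (fderiv ℝ A (z, X.fst) (0, W.fst),
      fderiv ℝ (fderiv ℝ A) (z, X.fst) (0, W.fst) (κ • ee i, X.snd) + fderiv ℝ A (z, X.fst) (0, W.snd)) := by
  have h1 : ContDiff ℝ (⊤ : ℕ∞) (fderiv ℝ A) := hA.fderiv_right (by simp)
  have d0 : Differentiable ℝ A := hA.differentiable (by simp)
  have d1 : Differentiable ℝ (fderiv ℝ A) := h1.differentiable (by simp)
  -- restrict to the line
  have hd : DifferentiableAt ℝ (sysA A κ i) (z, X) := (sysA_contDiff hA κ i).differentiable (by simp) _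
  have hl : HasDerivAt (fun t : ℝ => ((z, X + t • W) : E2 × WithLp 2 (H × H))) (0, W) 0 := by
    apply HasDerivAt.prodMk
    · exact hasDerivAt_const _ _
    · simpa using ((hasDerivAt_id (0:ℝ)).smul_const W).const_add X
  have k1 : HasDerivAt (fun t : ℝ => sysA A κ i (z, X + t • W)) (fderiv ℝ (sysA A κ i) (z, X) (0, W)) 0 := by
    have : HasFDerivAt (sysA A κ i) (fderiv ℝ (sysA A κ i) (z, X)) (z, X + (0:ℝ) • W) := by
      simpa using hd.hasFDerivAt
    exact this.comp_hasDerivAt (0:ℝ) hl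
  have hl2 : HasDerivAt (fun t : ℝ => ((z, X.fst + t • W.fst) : E2 × H)) (0, W.fst) 0 := by
    apply HasDerivAt.prodMk
    · exact hasDerivAt_const _ _
    · simpa using ((hasDerivAt_id (0:ℝ)).smul_const W.fst).const_add X.fst
  have hl3 : HasDerivAt (fun t : ℝ => ((κ • ee i, X.snd + t • W.snd) : E2 × H)) (0, W.snd) 0 := by
    apply HasDerivAt.prodMk
    · exact hasDerivAt_const _ _
    · simpa using ((hasDerivAt_id (0:ℝ)).smul_const W.snd).const_add X.snd
  have a1 : HasDerivAt (fun t : ℝ => A (z, X.fst + t • W.fst)) (fderiv ℝ A (z, X.fst) (0, W.fst)) 0 := by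
    have : HasFDerivAt A (fderiv ℝ A (z, X.fst)) (z, X.fst + (0:ℝ) • W.fst) := by
      simpa using (d0 _).hasFDerivAt
    exact this.comp_hasDerivAt (0:ℝ) hl2
  have a2 : HasDerivAt (fun t : ℝ => fderiv ℝ A (z, X.fst + t • W.fst))
      (fderiv ℝ (fderiv ℝ A) (z, X.fst) (0, W.fst)) 0 := by
    have : HasFDerivAt (fderiv ℝ A) (fderiv ℝ (fderiv ℝ A) (z, X.fst)) (z, X.fst + (0:ℝ) • W.fst) := by
      simpa using (d1 _).hasFDerivAt
    exact this.comp_hasDerivAt (0:ℝ) hl2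
  have a3 := a2.clm_apply hl3
  have k2 := (mkP (H := H)).hasFDerivAt.comp_hasDerivAt (0:ℝ) (a1.prodMk a3)
  have := k1.unique k2
  rw [this]
  simp

lemma inner_mkP (a b : H) (y : WithLp 2 (H × H)) : ⟪mkP (a, b), y⟫ = ⟪a, y.fst⟫ + ⟪b, y.snd⟫ := rfl

lemma mkP_fst (a b : H) : (mkP (a, b)).fst = a := rfl
lemma mkP_snd (a b : H) : (mkP (a, b)).snd = b := rfl

universe u
theorem reg_step (n : ℕ)
    (IH : ∀ (H : Type u) [NormedAddCommGroup H] [InnerProductSpace ℝ H] [FiniteDimensional ℝ H]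
      (V : E2 → H) (A : E2 × H → H) (z0 : E2) (r lam : ℝ),
      ContDiff ℝ 1 V → ContDiff ℝ (⊤ : ℕ∞) A → 0 < r → 0 < lam →
      WEq V (fun z => A (z, fderiv ℝ V z (ee 1))) z0 r →
      (∀ W, lam * ‖W‖ ^ 2 ≤ ⟪fderiv ℝ A (z0, fderiv ℝ V z0 (ee 1)) (0, W), W⟫) → ContDiffAt ℝ n V z0)
    (H : Type u) [NormedAddCommGroup H] [InnerProductSpace ℝ H] [FiniteDimensional ℝ H]
      (V : E2 → H) (A : E2 × H → H) (z0 : E2) (r lam : ℝ)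
      (hV : ContDiff ℝ 1 V) (hA : ContDiff ℝ (⊤ : ℕ∞) A) (hr : 0 < r) (hl : 0 < lam)
      (hw : WEq V (fun z => A (z, fderiv ℝ V z (ee 1))) z0 r)
      (hell : ∀ W, lam * ‖W‖ ^ 2 ≤ ⟪fderiv ℝ A (z0, fderiv ℝ V z0 (ee 1)) (0, W), W⟫) :
      ContDiffAt ℝ (n + 1) V z0 := by
  have hcH : CompleteSpace H := FiniteDimensional.complete ℝ H
  have base := reg_base hV hA hr hl hw hell
  have ev : ∀ᶠ z in 𝓝 z0, ContDiffAt ℝ 2 V z := base.eventually (by simp)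
  obtain ⟨r1, hr1, hr1'⟩ := Metric.eventually_nhds_iff_ball.1 ev
  set r2 := min r r1 with hr2
  have r20 : 0 < r2 := by positivity
  have hV2 : ∀ z ∈ ball z0 r2, ContDiffAt ℝ 2 V z := fun z hz => hr1' z (ball_subset_ball (min_le_right _ _) hz)
  have hw2 := hw.mono (ball_subset_ball (show r2 ≤ r from min_le_left _ _))
  set Y := fun z => fderiv ℝ V z (ee 1) with hY
  have cY : Continuous Y := cont_fderiv_apply hV _
  have hA1 : ContDiff ℝ (⊤ : ℕ∞) (fderiv ℝ A) := hA.fderiv_right (by simp)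
  have hpart : ∀ j, ∀ z ∈ ball z0 r2, ContDiffAt ℝ 1 (fun z => fderiv ℝ V z (ee j)) z := fun j z hz =>
    ((hV2 z hz).fderiv_right (m := 1) (by norm_num)).clm_apply contDiffAt_const
  have hgr : ∀ z ∈ ball z0 r2, ContDiffAt ℝ 1 (fun z => (z, Y z)) z := fun z hz =>
    contDiffAt_id.prodMk (hpart 1 z hz)
  have hA1' : ContDiff ℝ 1 A := by exact_mod_cast contDiff_infty.1 hA 1
  have hB1 : ∀ z ∈ ball z0 r2, ContDiffAt ℝ 1 (fun z => A (z, Y z)) z := fun z hz =>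
    (hA1'.contDiffAt).comp z (hgr z hz)
  refine contDiffAt_of_partials (Eventually.of_forall (hV.differentiable (by norm_num))) fun i => ?_
  set r3 := r2 / 2 with hr3
  have r30 : 0 < r3 := by positivity
  obtain ⟨U, u1, u2, u3⟩ := exists_ext (n := 1) (z0 := z0) (r' := r3) (r := r2) r30 (by linarith)
    (fun z hz => by exact_mod_cast hpart i z hz)
  have u1 : ContDiff ℝ 1 U := by exact_mod_cast u1
  have hball : ball z0 r3 ⊆ ball z0 r2 := ball_subset_ball (by linarith)
  have hfB : ∀ z ∈ ball z0 r3, fderiv ℝ A (z, Y z) (ee i, fderiv ℝ U z (ee 1)) =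
      fderiv ℝ (fun z => A (z, Y z)) z (ee i) := by
    intro z hz
    have g1 : fderiv ℝ U z = fderiv ℝ (fun z => fderiv ℝ V z (ee i)) z :=
      (show U =ᶠ[𝓝 z] _ from eventually_of_mem (isOpen_ball.mem_nhds hz) u3).fderiv_eq
    have g2 : HasFDerivAt (fun z => (z, Y z)) ((ContinuousLinearMap.id ℝ E2).prod (fderiv ℝ Y z)) z :=
      (hasFDerivAt_id z).prodMk ((hpart 1 z (hball hz)).differentiableAt (by norm_num)).hasFDerivAt
    have g3 : HasFDerivAt A (fderiv ℝ A (z, Y z)) (z, Y z) := (hA1'.differentiable (by norm_num) _).hasFDerivAt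
    have g4 : HasFDerivAt (fun z => A (z, Y z))
      ((fderiv ℝ A (z, Y z)).comp ((ContinuousLinearMap.id ℝ E2).prod (fderiv ℝ Y z))) z := g3.comp z g2
    rw [g4.fderiv, g1, fderiv_symm2 (hV2 z (hball hz))]
    simp [hY]
  have hwU : WEq U (fun z => fderiv ℝ A (z, Y z) (ee i, fderiv ℝ U z (ee 1))) z0 r3 :=
    weq_deriv hV (hA.continuous.comp (continuous_id.prodMk cY)) hw2 r30 (by linarith) hV2 hB1 i u3 hfB
  -- choice of κ
  set Y1 := fderiv ℝ U z0 (ee 1) with hY1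
  set C := ‖fderiv ℝ (fderiv ℝ A) (z0, Y z0)‖ * ‖(ee i, Y1)‖ with hC
  have hC0 : 0 ≤ C := by positivity
  set κ := lam / (C + 1) with hκ
  have hκ0 : 0 < κ := by positivity
  have hκC : κ * C ≤ lam := by
    rw [hκ, div_mul_eq_mul_div, div_le_iff₀ (by positivity)]
    nlinarith
  set V' : E2 → WithLp 2 (H × H) := fun z => mkP (V z, κ • U z) with hV'
  have cV' : ContDiff ℝ 1 V' := (mkP (H := H)).contDiff.comp (hV.prodMk (u1.const_smul κ))
  have dV' : ∀ z v, fderiv ℝ V' z v = mkP (fderiv ℝ V z v, κ • fderiv ℝ U z v) := by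
    intro z v
    have d1 := (hV.differentiable (by norm_num) z).hasFDerivAt
    have d2 := ((u1.differentiable (by norm_num) z).hasFDerivAt).const_smul κ
    have := (mkP (H := H)).hasFDerivAt.comp z (d1.prodMk d2)
    rw [show V' = mkP ∘ (fun z => (V z, κ • U z)) from rfl]
    erw [this.fderiv]
    simp
  have sysv : ∀ z, sysA A κ i (z, fderiv ℝ V' z (ee 1)) =
      mkP (A (z, Y z), κ • fderiv ℝ A (z, Y z) (ee i, fderiv ℝ U z (ee 1))) := by
    intro z
    rw [dV']
    unfold sysA
    simp only [WithLp.fstL_apply, WithLp.sndL_apply, mkP_fst, mkP_snd]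
    rw [← map_smul (fderiv ℝ A (z, Y z)), Prod.smul_mk]
  have key : ContDiffAt ℝ n V' z0 := by
    refine IH (WithLp 2 (H × H)) V' (sysA A κ i) z0 r3 (lam / 2) cV' (sysA_contDiff hA κ i) r30 (by positivity) ?_ ?_
    · intro η h1 h2 h3
      have L : ∀ (P : WithLp 2 (H × H) →L[ℝ] H), ContDiff ℝ 1 (fun z => P (η z)) ∧
          HasCompactSupport (fun z => P (η z)) ∧ tsupport (fun z => P (η z)) ⊆ ball z0 r3 ∧
          ∀ z v, fderiv ℝ (fun z => P (η z)) z v = P (fderiv ℝ η z v) := by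
        intro P
        refine ⟨P.contDiff.comp h1, h2.comp_left (g := P) (map_zero P), ?_, fun z v => ?_⟩
        · exact (closure_mono (fun z hz => by
            simp only [Function.mem_support, ne_eq] at *; intro h; apply hz; rw [h, map_zero])).trans h3
        · have := P.hasFDerivAt.comp z (h1.differentiable (by norm_num) z).hasFDerivAt
          rw [show (fun z => P (η z)) = P ∘ η from rfl, this.fderiv]
          rfl
      obtain ⟨a1, a2, a3, a4⟩ := L (WithLp.fstL 2 ℝ H H)
      obtain ⟨b1, b2, b3, b4⟩ := L (WithLp.sndL 2 ℝ H H)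
      have w1 := hw2 _ a1 a2 (a3.trans hball)
      have w2 := hwU _ b1 b2 b3
      have i1 := weq_integrable (B := fun z => A (z, Y z)) hV (hA.continuous.comp (continuous_id.prodMk cY)) a1 a2
      have i2 := weq_integrable (B := fun z => fderiv ℝ A (z, Y z) (ee i, fderiv ℝ U z (ee 1))) u1 (by
        have := cont_fderiv_apply u1 (ee 1)
        have := hA1.continuous
        fun_prop) b1 b2
      have e : ∀ z, ⟪fderiv ℝ V' z (ee 0), fderiv ℝ η z (ee 0)⟫ +
          ⟪sysA A κ i (z, fderiv ℝ V' z (ee 1)), fderiv ℝ η z (ee 1)⟫ =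
          (⟪fderiv ℝ V z (ee 0), fderiv ℝ (fun z => WithLp.fstL 2 ℝ H H (η z)) z (ee 0)⟫ +
            ⟪A (z, Y z), fderiv ℝ (fun z => WithLp.fstL 2 ℝ H H (η z)) z (ee 1)⟫) +
          κ * (⟪fderiv ℝ U z (ee 0), fderiv ℝ (fun z => WithLp.sndL 2 ℝ H H (η z)) z (ee 0)⟫ +
            ⟪fderiv ℝ A (z, Y z) (ee i, fderiv ℝ U z (ee 1)), fderiv ℝ (fun z => WithLp.sndL 2 ℝ H H (η z)) z (ee 1)⟫) := by
        intro z
        rw [dV', sysv, inner_mkP, inner_mkP, a4, a4, b4, b4]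
        simp only [real_inner_smul_left, WithLp.fstL_apply, WithLp.sndL_apply]
        ring
      simp_rw [e]
      rw [integral_add i1 (i2.const_mul κ), integral_const_mul, w1, w2]
      simp
    · intro W
      rw [sysA_fderiv hA, inner_mkP, dV', mkP_fst, mkP_snd, inner_add_left]
      have e1 := hell W.fst
      have e2 := hell W.snd
      change lam * ‖W.fst‖ ^ 2 ≤ ⟪fderiv ℝ A (z0, Y z0) (0, W.fst), W.fst⟫ at e1
      change lam * ‖W.snd‖ ^ 2 ≤ ⟪fderiv ℝ A (z0, Y z0) (0, W.snd), W.snd⟫ at e2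
      change _ ≤ ⟪fderiv ℝ A (z0, Y z0) (0, W.fst), W.fst⟫ +
        (⟪fderiv ℝ (fderiv ℝ A) (z0, Y z0) (0, W.fst) (κ • ee i, κ • Y1), W.snd⟫ +
        ⟪fderiv ℝ A (z0, Y z0) (0, W.snd), W.snd⟫)
      have e3 : |⟪fderiv ℝ (fderiv ℝ A) (z0, Y z0) (0, W.fst) (κ • ee i, κ • Y1), W.snd⟫| ≤
          lam * (‖W.fst‖ * ‖W.snd‖) := by
        rw [← Prod.smul_mk, map_smul, real_inner_smul_left, abs_mul, abs_of_pos hκ0]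
        have q1 : |⟪fderiv ℝ (fderiv ℝ A) (z0, Y z0) (0, W.fst) (ee i, Y1), W.snd⟫| ≤
            C * (‖W.fst‖ * ‖W.snd‖) := by
          refine (abs_real_inner_le_norm _ _).trans ?_
          have : ‖((0:E2), W.fst)‖ = ‖W.fst‖ := by simp [Prod.norm_def]
          have q2 := (fderiv ℝ (fderiv ℝ A) (z0, Y z0)).le_opNorm₂ (0, W.fst) (ee i, Y1)
          rw [this] at q2
          calc _ ≤ (‖fderiv ℝ (fderiv ℝ A) (z0, Y z0)‖ * ‖W.fst‖ * ‖(ee i, Y1)‖) * ‖W.snd‖ := by gcongr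
            _ = _ := by rw [hC]; ring
        calc _ ≤ κ * (C * (‖W.fst‖ * ‖W.snd‖)) := by gcongr
          _ = κ * C * (‖W.fst‖ * ‖W.snd‖) := by ring
          _ ≤ _ := by gcongr
      have e4 := (abs_le.1 e3).1
      rw [WithLp.prod_norm_sq_eq_of_L2]
      have := mul_nonneg hl.le (sq_nonneg (‖W.fst‖ - ‖W.snd‖))
      linarith
  have k2 : ContDiffAt ℝ n (fun z => κ⁻¹ • WithLp.sndL 2 ℝ H H (V' z)) z0 :=
    (((WithLp.sndL 2 ℝ H H).contDiff.contDiffAt).comp z0 key).const_smul κ⁻¹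
  refine k2.congr_of_eventuallyEq ?_
  filter_upwards [ball_mem_nhds z0 r30] with z hz
  rw [← u3 z hz]
  simp only [hV', WithLp.sndL_apply, mkP_snd]
  rw [smul_smul, inv_mul_cancel₀ hκ0.ne', one_smul]

theorem reg_smooth (n : ℕ) :
    ∀ (H : Type u) [NormedAddCommGroup H] [InnerProductSpace ℝ H] [FiniteDimensional ℝ H]
      (V : E2 → H) (A : E2 × H → H) (z0 : E2) (r lam : ℝ),
      ContDiff ℝ 1 V → ContDiff ℝ (⊤ : ℕ∞) A → 0 < r → 0 < lam →
      WEq V (fun z => A (z, fderiv ℝ V z (ee 1))) z0 r →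
      (∀ W, lam * ‖W‖ ^ 2 ≤ ⟪fderiv ℝ A (z0, fderiv ℝ V z0 (ee 1)) (0, W), W⟫) → ContDiffAt ℝ n V z0 := by
  induction n with
  | zero =>
    intro H _ _ _ V A z0 r lam h1 h2 h3 h4 h5 h6
    exact h1.contDiffAt.of_le (by simp)
  | succ n ih =>
    intro H _ _ _ V A z0 r lam h1 h2 h3 h4 h5 h6
    exact_mod_cast reg_step n ih H V A z0 r lam h1 h2 h3 h4 h5 h6

end regF14

section partA1
set_option linter.unusedSectionVars false
set_option linter.unusedVariables false
open MeasureTheory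

/-- every point has a subgradient of norm at most one -/
def Sub1 (w : E2 → ℝ) : Prop := ∀ ζ, ∃ z : E2, ‖z‖ ≤ 1 ∧ ∀ ζ', w ζ + ⟪ζ' - ζ, z⟫ ≤ w ζ'

lemma Sub1.lip {w : E2 → ℝ} (h : Sub1 w) : LipschitzWith 1 w := by
  apply LipschitzWith.of_le_add
  intro x y
  obtain ⟨z, hz, h1⟩ := h x
  have h2 := h1 y
  have h3 : -(‖y - x‖ * ‖z‖) ≤ ⟪y - x, z⟫ := (abs_le.1 (abs_real_inner_le_norm _ _)).1
  rw [dist_eq_norm, norm_sub_rev]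
  have : ‖y - x‖ * ‖z‖ ≤ ‖y - x‖ := mul_le_of_le_one_right (norm_nonneg _) hz
  linarith

lemma Sub1.cont {w : E2 → ℝ} (h : Sub1 w) : Continuous w := h.lip.continuous

lemma Sub1.convex {w : E2 → ℝ} (h : Sub1 w) : ConvexOn ℝ Set.univ w := by
  refine ⟨convex_univ, fun x _ y _ a b ha hb hab => ?_⟩
  obtain ⟨z, hz, h1⟩ := h (a • x + b • y)
  have h2 := mul_le_mul_of_nonneg_left (h1 x) ha
  have h3 := mul_le_mul_of_nonneg_left (h1 y) hb
  have e : a * ⟪x - (a • x + b • y), z⟫ + b * ⟪y - (a • x + b • y), z⟫ = 0 := by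
    rw [← real_inner_smul_left, ← real_inner_smul_left, ← inner_add_left]
    have : a • (x - (a • x + b • y)) + b • (y - (a • x + b • y)) = 0 := by
      have : b = 1 - a := by linarith
      subst this
      module
    rw [this, inner_zero_left]
  simp only [smul_eq_mul]
  have : w (a • x + b • y) = a * w (a • x + b • y) + b * w (a • x + b • y) := by rw [← add_mul, hab, one_mul]
  nlinarith

/-- the support-like function of the boundary datum -/
structure SuppH (Φ : E2 → ℝ) (M : ℝ) : Prop where
  sub : ∀ ζ, ∃ w : E2, ‖w‖ = 1 ∧ ∀ ζ', Φ ζ + ⟪ζ' - ζ, w⟫ ≤ Φ ζ'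
  low : ∀ ζ, ‖ζ‖ - M ≤ Φ ζ

lemma SuppH.sub1 {Φ : E2 → ℝ} {M : ℝ} (h : SuppH Φ M) : Sub1 Φ := fun ζ => by
  obtain ⟨w, h1, h2⟩ := h.sub ζ
  exact ⟨w, h1.le, h2⟩

variable {ι : Type*}

/-- the cell of index `i` -/
def cell (Φ : E2 → ℝ) (z : ι → E2) (t : ι → ℝ) (i : ι) : Set E2 :=
  {ζ | Φ ζ ≤ ⟪ζ, z i⟫ - t i ∧ ∀ j, ⟪ζ, z j⟫ - t j ≤ ⟪ζ, z i⟫ - t i}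

/-- the strict cell -/
def scell (Φ : E2 → ℝ) (z : ι → E2) (t : ι → ℝ) (i : ι) : Set E2 :=
  {ζ | Φ ζ < ⟪ζ, z i⟫ - t i ∧ ∀ j, j ≠ i → ⟪ζ, z j⟫ - t j < ⟪ζ, z i⟫ - t i}

lemma scell_subset (Φ : E2 → ℝ) (z : ι → E2) (t : ι → ℝ) (i : ι) : scell Φ z t i ⊆ cell Φ z t i := by
  intro ζ h
  refine ⟨h.1.le, fun j => ?_⟩
  by_cases hj : j = i
  · rw [hj]
  · exact (h.2 j hj).le

variable {Φ : E2 → ℝ} {M : ℝ} {z : ι → E2}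

lemma cell_closed (hΦ : SuppH Φ M) (t : ι → ℝ) (i : ι) : IsClosed (cell Φ z t i) := by
  have := hΦ.sub1.cont
  unfold cell
  rw [Set.ofPred_and, Set.ofPred_forall]
  exact (isClosed_le (by fun_prop) (by fun_prop)).inter
    (isClosed_iInter fun j => isClosed_le (by fun_prop) (by fun_prop))

lemma cell_convex (hΦ : SuppH Φ M) (t : ι → ℝ) (i : ι) : Convex ℝ (cell Φ z t i) := by
  intro x hx y hy a b ha hb hab
  have h := hΦ.sub1.convex.2 (Set.mem_univ x) (Set.mem_univ y) ha hb hab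
  simp only [smul_eq_mul] at h
  have e : ∀ c : ℝ, c = a * c + b * c := fun c => by rw [← add_mul, hab, one_mul]
  refine ⟨?_, fun j => ?_⟩
  · rw [inner_add_left, real_inner_smul_left, real_inner_smul_left, e (t i)]
    have := mul_le_mul_of_nonneg_left hx.1 ha
    have := mul_le_mul_of_nonneg_left hy.1 hb
    linarith
  · rw [inner_add_left, real_inner_smul_left, real_inner_smul_left, inner_add_left,
      real_inner_smul_left, real_inner_smul_left, e (t i), e (t j)]
    have := mul_le_mul_of_nonneg_left (hx.2 j) ha
    have := mul_le_mul_of_nonneg_left (hy.2 j) hb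
    linarith

lemma cell_bound (hΦ : SuppH Φ M) (hz : ∀ i, ‖z i‖ < 1) {t : ι → ℝ} {i : ι} {ζ : E2}
    (h : ζ ∈ cell Φ z t i) : ‖ζ‖ * (1 - ‖z i‖) ≤ M - t i := by
  have h1 := hΦ.low ζ
  have h2 := h.1
  have h3 := real_inner_le_norm ζ (z i)
  linarith

lemma cell_bounded (hΦ : SuppH Φ M) (hz : ∀ i, ‖z i‖ < 1) (t : ι → ℝ) (i : ι) :
    cell Φ z t i ⊆ closedBall 0 ((M - t i) / (1 - ‖z i‖)) := by
  intro ζ h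
  rw [mem_closedBall_zero_iff, le_div_iff₀ (by linarith [hz i])]
  exact cell_bound hΦ hz h

lemma cell_diff_null (hΦ : SuppH Φ M) (hz : ∀ i, ‖z i‖ < 1) (hinj : Function.Injective z) (t : ι → ℝ) (i : ι) :
    volume (cell Φ z t i \ scell Φ z t i) = 0 := by
  refine measure_mono_null ?_ ((cell_convex hΦ t i (z := z)).addHaar_frontier (volume : Measure E2))
  rintro ζ ⟨h1, h2⟩
  refine ⟨subset_closure h1, fun hi => ?_⟩
  rw [mem_interior_iff_mem_nhds] at hi
  -- a direction in which a competitor wins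
  have main : ∀ d : E2, d ≠ 0 → (∀ ε : ℝ, 0 < ε → ζ + ε • d ∈ cell Φ z t i → False) → False := by
    intro d hd hh
    have : Tendsto (fun ε : ℝ => ζ + ε • d) (𝓝[>] 0) (𝓝 ζ) :=
      ((by fun_prop : Continuous (fun ε : ℝ => ζ + ε • d)).tendsto' 0 ζ (by simp)).mono_left nhdsWithin_le_nhds
    obtain ⟨ε, h3, h4⟩ := ((this.eventually hi).and self_mem_nhdsWithin).exists
    exact hh ε h4 h3
  by_cases hs : Φ ζ < ⟪ζ, z i⟫ - t i
  · have : ∃ j, j ≠ i ∧ ⟪ζ, z i⟫ - t i ≤ ⟪ζ, z j⟫ - t j := by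
      by_contra hc
      push Not at hc
      exact h2 ⟨hs, hc⟩
    obtain ⟨j, hj, hj2⟩ := this
    have hne : z j - z i ≠ 0 := sub_ne_zero.2 fun h => hj (hinj h)
    refine main (z j - z i) hne fun ε hε hc => ?_
    have h5 := hc.2 j
    rw [inner_add_left, inner_add_left] at h5
    have h6 : 0 < ⟪ε • (z j - z i), z j - z i⟫ := by
      rw [real_inner_smul_left]
      exact mul_pos hε (real_inner_self_pos.2 hne)
    rw [inner_sub_right] at h6
    linarith
  · obtain ⟨w, hw, hw2⟩ := hΦ.sub ζ
    have hne : w - z i ≠ 0 := sub_ne_zero.2 fun h => by have := hz i; rw [← h, hw] at this; linarith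
    refine main (w - z i) hne fun ε hε hc => ?_
    have h5 := hc.1
    have h7 := hw2 (ζ + ε • (w - z i))
    rw [add_sub_cancel_left] at h7
    rw [inner_add_left] at h5
    have h6 : 0 < ⟪ε • (w - z i), w - z i⟫ := by
      rw [real_inner_smul_left]
      exact mul_pos hε (real_inner_self_pos.2 hne)
    rw [inner_sub_right] at h6
    linarith

variable [Fintype ι] [DecidableEq ι]

lemma cell_max (s t : ι → ℝ) (i : ι) :
    cell Φ z s i ⊆ cell Φ z (s ⊔ t) i ∨ cell Φ z t i ⊆ cell Φ z (s ⊔ t) i := by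
  rcases le_total (s i) (t i) with h | h
  · right
    intro ζ hζ
    have e : (s ⊔ t) i = t i := sup_eq_right.2 h
    refine ⟨by rw [e]; exact hζ.1, fun j => ?_⟩
    rw [e]
    have : t j ≤ (s ⊔ t) j := le_sup_right
    linarith [hζ.2 j]
  · left
    intro ζ hζ
    have e : (s ⊔ t) i = s i := sup_eq_left.2 h
    refine ⟨by rw [e]; exact hζ.1, fun j => ?_⟩
    rw [e]
    have : s j ≤ (s ⊔ t) j := le_sup_left
    linarith [hζ.2 j]

/-- continuity from above along convergent parameters -/
lemma cell_usc (hΦ : SuppH Φ M) (hz : ∀ i, ‖z i‖ < 1) {m : ENNReal} {i : ι} {tn : ℕ → ι → ℝ} {t t0 : ι → ℝ}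
    (ht : Tendsto tn atTop (𝓝 t)) (h0 : ∀ n, t0 ≤ tn n) (hm : ∀ n, m ≤ volume (cell Φ z (tn n) i)) :
    m ≤ volume (cell Φ z t i) := by
  set A : ℕ → Set E2 := fun n => ⋃ k ≥ n, cell Φ z (tn k) i with hA
  have hbd : ∀ n, A n ⊆ closedBall 0 ((M - t0 i) / (1 - ‖z i‖)) := by
    intro n
    refine Set.iUnion₂_subset fun k _ => (cell_bounded hΦ hz (tn k) i).trans (closedBall_subset_closedBall ?_)
    have := h0 k i
    have := hz i
    gcongr
  have hmeas : ∀ n, MeasurableSet (A n) := fun n =>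
    MeasurableSet.iUnion fun k => MeasurableSet.iUnion fun _ => (cell_closed hΦ _ _).measurableSet
  have hanti : Antitone A := by
    intro a b hab
    refine Set.iUnion₂_subset fun k hk => Set.subset_iUnion₂ (s := fun k _ => cell Φ z (tn k) i) k (le_trans hab hk)
  have hlim := tendsto_measure_iInter_atTop (μ := volume) (fun n => (hmeas n).nullMeasurableSet) hanti
    ⟨0, ((measure_mono (hbd 0)).trans_lt measure_closedBall_lt_top).ne⟩
  have h1 : m ≤ volume (⋂ n, A n) := by
    refine ge_of_tendsto' hlim fun n => (hm n).trans (measure_mono ?_)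
    exact Set.subset_iUnion₂ (s := fun k _ => cell Φ z (tn k) i) n le_rfl
  refine h1.trans (measure_mono fun ζ hζ => ?_)
  simp only [Set.mem_iInter, hA, Set.mem_iUnion] at hζ
  have tj : ∀ j, Tendsto (fun n => tn n j) atTop (𝓝 (t j)) := fun j => (tendsto_pi_nhds.1 ht) j
  have fr : ∃ᶠ k in atTop, ζ ∈ cell Φ z (tn k) i := by
    rw [frequently_atTop]
    intro n
    obtain ⟨k, hk, h⟩ := hζ n
    exact ⟨k, hk, h⟩
  refine ⟨?_, fun j => ?_⟩
  · exact ge_of_tendsto_of_frequently ((tj i).const_sub _) (fr.mono fun k h => h.1)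
  · have t1 : Tendsto (fun n => (⟪ζ, z i⟫ - tn n i) - (⟪ζ, z j⟫ - tn n j)) atTop
        (𝓝 ((⟪ζ, z i⟫ - t i) - (⟪ζ, z j⟫ - t j))) := ((tj i).const_sub _).sub ((tj j).const_sub _)
    have := ge_of_tendsto_of_frequently t1 (fr.mono fun k h => sub_nonneg.2 (h.2 j))
    linarith

/-- raising one coordinate slightly -/
lemma cell_raise (hΦ : SuppH Φ M) (hz : ∀ i, ‖z i‖ < 1) (hinj : Function.Injective z) {m : ENNReal} {i : ι}
    {t : ι → ℝ} (hm : m < volume (cell Φ z t i)) :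
    ∃ ε : ℝ, 0 < ε ∧ m ≤ volume (cell Φ z (Function.update t i (t i + ε)) i) := by
  set A : ℕ → Set E2 := fun n => cell Φ z (Function.update t i (t i + 1 / (n + 1))) i with hA
  have hsub : scell Φ z t i ⊆ ⋃ n, A n := by
    intro ζ hζ
    have hlim : Tendsto (fun n : ℕ => (1:ℝ) / (n + 1)) atTop (𝓝 0) := tendsto_one_div_add_atTop_nhds_zero_nat
    have e1 : ∀ᶠ n : ℕ in atTop, (1:ℝ) / (n + 1) < ⟪ζ, z i⟫ - t i - Φ ζ :=
      hlim.eventually_lt_const (by linarith [hζ.1])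
    have e2 : ∀ᶠ n : ℕ in atTop, ∀ j, j ≠ i → (1:ℝ) / (n + 1) < ⟪ζ, z i⟫ - t i - (⟪ζ, z j⟫ - t j) := by
      rw [eventually_all]
      intro j
      by_cases hj : j = i
      · exact Eventually.of_forall fun n h => absurd hj h
      · filter_upwards [hlim.eventually_lt_const (show (0:ℝ) < ⟪ζ, z i⟫ - t i - (⟪ζ, z j⟫ - t j) by
          linarith [hζ.2 j hj])] with n hn _ using hn
    obtain ⟨n, h1, h2⟩ := (e1.and e2).exists
    refine Set.mem_iUnion.2 ⟨n, ?_, fun j => ?_⟩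
    · simp only [Function.update_self]; linarith
    · by_cases hj : j = i
      · rw [hj]
      · simp only [Function.update_self, Function.update_of_ne hj]
        linarith [h2 j hj]
  have hmono : Monotone A := by
    intro a b hab ζ hζ
    have : (1:ℝ) / (b + 1) ≤ 1 / (a + 1) := by gcongr
    refine ⟨?_, fun j => ?_⟩
    · have := hζ.1
      simp only [Function.update_self] at *
      linarith
    · have := hζ.2 j
      by_cases hj : j = i
      · rw [hj]
      · simp only [Function.update_self, Function.update_of_ne hj] at *
        linarith
  have h1 : volume (cell Φ z t i) ≤ volume (⋃ n, A n) := by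
    calc volume (cell Φ z t i) ≤ volume (cell Φ z t i \ scell Φ z t i) + volume (scell Φ z t i) := by
          refine (measure_mono ?_).trans (measure_union_le _ _)
          intro ζ h
          by_cases hs : ζ ∈ scell Φ z t i
          · exact Or.inr hs
          · exact Or.inl ⟨h, hs⟩
      _ = volume (scell Φ z t i) := by rw [cell_diff_null hΦ hz hinj, zero_add]
      _ ≤ _ := measure_mono hsub
  have hlim := tendsto_measure_iUnion_atTop (μ := volume) hmono
  obtain ⟨n, hn⟩ := (hlim.eventually_const_lt (hm.trans_le h1)).exists
  exact ⟨1 / (n + 1), by positivity, hn.le⟩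

theorem perron (hΦ : SuppH Φ M) (hz : ∀ i, ‖z i‖ < 1) (hinj : Function.Injective z) (m : ι → ENNReal)
    (hm0 : ∀ i, 0 < m i) (t0 : ι → ℝ) (ht0 : ∀ i, m i ≤ volume (cell Φ z t0 i)) :
    ∃ t : ι → ℝ, (∀ i, volume (cell Φ z t i) = m i) ∧
      ∀ s : ι → ℝ, (∀ i, m i ≤ volume (cell Φ z s i)) → s ≤ t := by
  set S : Set (ι → ℝ) := {t | t0 ≤ t ∧ ∀ i, m i ≤ volume (cell Φ z t i)} with hS
  have hub : ∀ s : ι → ℝ, (∀ i, m i ≤ volume (cell Φ z s i)) → ∀ i, s i ≤ M := by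
    intro s hs i
    have : (cell Φ z s i).Nonempty := by
      rw [Set.nonempty_iff_ne_empty]
      intro h
      have := (hm0 i).trans_le (hs i)
      rw [h, measure_empty] at this
      exact lt_irrefl _ this
    obtain ⟨ζ, h⟩ := this
    have := cell_bound hΦ hz h
    have h2 : 0 ≤ ‖ζ‖ * (1 - ‖z i‖) := mul_nonneg (norm_nonneg _) (by linarith [hz i])
    linarith
  have hcl : IsClosed S := by
    rw [← isSeqClosed_iff_isClosed]
    intro tn t h1 h2
    refine ⟨ge_of_tendsto' h2 fun n => (h1 n).1, fun i => cell_usc hΦ hz h2 (fun n => (h1 n).1) fun n => (h1 n).2 i⟩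
  have hcomp : IsCompact S := by
    refine (isCompact_univ_pi fun i => isCompact_Icc (a := t0 i) (b := M)).of_isClosed_subset hcl ?_
    intro t ht i _
    exact ⟨ht.1 i, hub t ht.2 i⟩
  obtain ⟨t, htS, hmax⟩ := hcomp.exists_isMaxOn ⟨t0, le_rfl, ht0⟩
    (f := fun t : ι → ℝ => ∑ i, t i) (by fun_prop)
  have hle : ∀ s : ι → ℝ, (∀ i, m i ≤ volume (cell Φ z s i)) → s ≤ t := by
    intro s hs
    have hmem : s ⊔ t ∈ S := by
      refine ⟨htS.1.trans le_sup_right, fun i => ?_⟩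
      rcases cell_max (Φ := Φ) (z := z) s t i with h | h
      · exact (hs i).trans (measure_mono h)
      · exact (htS.2 i).trans (measure_mono h)
    have h1 : ∑ i, (s ⊔ t) i ≤ ∑ i, t i := hmax hmem
    have h2 : ∀ i ∈ Finset.univ, t i ≤ (s ⊔ t) i := fun i _ => le_sup_right
    have h3 : ∑ i, t i = ∑ i, (s ⊔ t) i := le_antisymm (Finset.sum_le_sum h2) h1
    intro i
    have := (Finset.sum_eq_sum_iff_of_le h2).1 h3 i (Finset.mem_univ i)
    rw [this]
    exact le_sup_left
  refine ⟨t, fun i => ?_, hle⟩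
  by_contra hne
  have hlt : m i < volume (cell Φ z t i) := lt_of_le_of_ne (htS.2 i) (Ne.symm hne)
  obtain ⟨ε, hε, h1⟩ := cell_raise hΦ hz hinj hlt
  have := hle (Function.update t i (t i + ε)) (fun j => by
    by_cases hj : j = i
    · rw [hj]; exact h1
    · refine (htS.2 j).trans (measure_mono fun ζ hζ => ⟨?_, fun k => ?_⟩)
      · rw [Function.update_of_ne hj]; exact hζ.1
      · rw [Function.update_of_ne hj]
        have := hζ.2 k
        by_cases hk : k = i
        · rw [hk] at this ⊢
          rw [Function.update_self]
          linarith
        · rw [Function.update_of_ne hk]; exact this) i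
  rw [Function.update_self] at this
  linarith

end partA1

section partA2
set_option linter.unusedSectionVars false
set_option linter.unusedVariables false
open MeasureTheory

/-- `g` is a subgradient of `w` at `ζ` -/
def SubG (w : E2 → ℝ) (ζ g : E2) : Prop := ∀ ζ', w ζ + ⟪ζ' - ζ, g⟫ ≤ w ζ'

lemma SubG.grad {w : E2 → ℝ} {ζ g : E2} (h : SubG w ζ g) (hd : DifferentiableAt ℝ w ζ) : gradient w ζ = g := by
  have h1 : HasFDerivAt (fun ζ' => w ζ' - ⟪ζ' - ζ, g⟫) (fderiv ℝ w ζ - (InnerProductSpace.toDual ℝ E2 g)) ζ := by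
    apply hd.hasFDerivAt.sub
    have h2 : HasFDerivAt (fun ζ' => InnerProductSpace.toDual ℝ E2 g ζ' - InnerProductSpace.toDual ℝ E2 g ζ)
        (InnerProductSpace.toDual ℝ E2 g) ζ := (InnerProductSpace.toDual ℝ E2 g).hasFDerivAt.sub_const _
    have e : (fun ζ' : E2 => ⟪ζ' - ζ, g⟫) = fun ζ' => InnerProductSpace.toDual ℝ E2 g ζ' - InnerProductSpace.toDual ℝ E2 g ζ := by
      funext x
      rw [InnerProductSpace.toDual_apply_apply, InnerProductSpace.toDual_apply_apply, real_inner_comm, inner_sub_right]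
    rw [e]
    exact h2
  have h3 : IsLocalMin (fun ζ' => w ζ' - ⟪ζ' - ζ, g⟫) ζ := by
    refine Eventually.of_forall fun x => ?_
    simp only [sub_self, inner_zero_left, sub_zero]
    linarith [h x]
  have h4 := h3.hasFDerivAt_eq_zero h1
  unfold gradient
  rw [sub_eq_zero.1 h4]
  simp

lemma Sub1.ae_diff {w : E2 → ℝ} (h : Sub1 w) : ∀ᵐ ζ, DifferentiableAt ℝ w ζ := h.lip.ae_differentiableAt

lemma Sub1.subG_grad {w : E2 → ℝ} (h : Sub1 w) {ζ : E2} (hd : DifferentiableAt ℝ w ζ) :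
    SubG w ζ (gradient w ζ) ∧ ‖gradient w ζ‖ ≤ 1 := by
  obtain ⟨g, h1, h2⟩ := h ζ
  have h3 : SubG w ζ g := h2
  rw [h3.grad hd]
  exact ⟨h3, h1⟩

lemma suppH_norm : SuppH (fun ζ => ‖ζ‖) 0 := by
  refine ⟨fun ζ => ?_, fun ζ => by simp⟩
  by_cases hζ : ζ = 0
  · refine ⟨ee 0, norm_ee 0, fun ζ' => ?_⟩
    have := real_inner_le_norm ζ' (ee 0)
    rw [norm_ee, mul_one] at this
    simpa [hζ] using this
  · have hn : 0 < ‖ζ‖ := norm_pos_iff.2 hζ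
    have h1 : ‖‖ζ‖⁻¹ • ζ‖ = 1 := by rw [norm_smul, norm_inv, norm_norm, inv_mul_cancel₀ hn.ne']
    refine ⟨‖ζ‖⁻¹ • ζ, h1, fun ζ' => ?_⟩
    have h2 := real_inner_le_norm ζ' (‖ζ‖⁻¹ • ζ)
    rw [h1, mul_one] at h2
    have h3 : ⟪ζ, ‖ζ‖⁻¹ • ζ⟫ = ‖ζ‖ := by
      rw [real_inner_smul_right, real_inner_self_eq_norm_sq]; field_simp
    rw [inner_sub_left, h3]
    linarith

/-- conjugate of the boundary datum -/
def PhiOf (φ : E2 → ℝ) (ζ : E2) : ℝ := sSup ((fun w => ⟪ζ, w⟫ - φ w) '' sphere (0 : E2) 1)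

variable {φ : E2 → ℝ} {M : ℝ}

lemma phi_bdd (hφb : ∀ z ∈ sphere (0 : E2) 1, |φ z| ≤ M) (ζ : E2) :
    BddAbove ((fun w => ⟪ζ, w⟫ - φ w) '' sphere (0 : E2) 1) := by
  refine ⟨‖ζ‖ + M, ?_⟩
  rintro _ ⟨w, hw, rfl⟩
  have h1 := real_inner_le_norm ζ w
  rw [mem_sphere_zero_iff_norm.1 hw, mul_one] at h1
  have := (abs_le.1 (hφb w hw)).1
  simp only
  linarith

lemma le_phi (hφb : ∀ z ∈ sphere (0 : E2) 1, |φ z| ≤ M) (ζ : E2) {w : E2} (hw : w ∈ sphere (0 : E2) 1) :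
    ⟪ζ, w⟫ - φ w ≤ PhiOf φ ζ := le_csSup (phi_bdd hφb ζ) ⟨w, hw, rfl⟩

lemma ee_mem_sphere (i : Fin 2) : ee i ∈ sphere (0 : E2) 1 := by simp [norm_ee]

lemma phi_attained (hφb : ∀ z ∈ sphere (0 : E2) 1, |φ z| ≤ M)
    (hφl : LowerSemicontinuousOn φ (sphere (0 : E2) 1)) (ζ : E2) :
    ∃ w ∈ sphere (0 : E2) 1, PhiOf φ ζ = ⟪ζ, w⟫ - φ w := by
  have h1 : LowerSemicontinuousOn (fun w => φ w + (-⟪ζ, w⟫)) (sphere (0 : E2) 1) :=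
    hφl.add (Continuous.continuousOn (by fun_prop)).lowerSemicontinuousOn
  obtain ⟨w, hw, hmin⟩ := h1.exists_isMinOn ⟨ee 0, ee_mem_sphere 0⟩ (isCompact_sphere (0:E2) 1)
  refine ⟨w, hw, le_antisymm ?_ (le_phi hφb ζ hw)⟩
  apply csSup_le (Set.Nonempty.image _ ⟨ee 0, ee_mem_sphere 0⟩)
  rintro _ ⟨w', hw', rfl⟩
  have : φ w + -⟪ζ, w⟫ ≤ φ w' + -⟪ζ, w'⟫ := hmin hw'
  simp only
  linarith

lemma suppH_phi (hφb : ∀ z ∈ sphere (0 : E2) 1, |φ z| ≤ M)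
    (hφl : LowerSemicontinuousOn φ (sphere (0 : E2) 1)) : SuppH (PhiOf φ) M := by
  refine ⟨fun ζ => ?_, fun ζ => ?_⟩
  · obtain ⟨w, hw, e⟩ := phi_attained hφb hφl ζ
    refine ⟨w, mem_sphere_zero_iff_norm.1 hw, fun ζ' => ?_⟩
    rw [e, inner_sub_left]
    linarith [le_phi hφb ζ' hw]
  · obtain ⟨w, hw, h2⟩ := suppH_norm.sub ζ
    have h3 := h2 0
    have h4 := h2 (2 • ζ)
    have hw' : w ∈ sphere (0 : E2) 1 := by simpa using hw
    have := le_phi hφb ζ hw'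
    have := (abs_le.1 (hφb w hw')).2
    simp only [zero_sub, inner_neg_left, norm_zero] at h3
    linarith

lemma phi_le (hφb : ∀ z ∈ sphere (0 : E2) 1, |φ z| ≤ M) {a0 : E2} {b0 : ℝ}
    (h : ∀ w ∈ sphere (0 : E2) 1, ⟪a0, w⟫ + b0 ≤ φ w) (ζ : E2) : PhiOf φ ζ ≤ ‖ζ - a0‖ - b0 := by
  apply csSup_le (Set.Nonempty.image _ ⟨ee 0, ee_mem_sphere 0⟩)
  rintro _ ⟨w, hw, rfl⟩
  have h1 := real_inner_le_norm (ζ - a0) w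
  rw [mem_sphere_zero_iff_norm.1 hw, mul_one, inner_sub_left] at h1
  have := h w hw
  simp only
  linarith

variable {ι : Type*} [Fintype ι]

/-- the upper envelope -/
def wt (Φ : E2 → ℝ) (z : ι → E2) (t : ι → ℝ) (ζ : E2) : ℝ :=
  (Finset.univ : Finset (Option ι)).sup' Finset.univ_nonempty (fun o => o.elim (Φ ζ) (fun i => ⟪ζ, z i⟫ - t i))

variable {Φ : E2 → ℝ} {z : ι → E2} {t : ι → ℝ}

lemma phi_le_wt (ζ : E2) : Φ ζ ≤ wt Φ z t ζ :=
  Finset.le_sup' (fun o : Option ι => o.elim (Φ ζ) (fun i => ⟪ζ, z i⟫ - t i)) (Finset.mem_univ none)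

lemma aff_le_wt (ζ : E2) (i : ι) : ⟪ζ, z i⟫ - t i ≤ wt Φ z t ζ :=
  Finset.le_sup' (fun o : Option ι => o.elim (Φ ζ) (fun i => ⟪ζ, z i⟫ - t i)) (Finset.mem_univ (some i))

lemma wt_eq (ζ : E2) : wt Φ z t ζ = Φ ζ ∨ ∃ i, wt Φ z t ζ = ⟪ζ, z i⟫ - t i := by
  obtain ⟨o, -, h⟩ := Finset.exists_mem_eq_sup' (s := (Finset.univ : Finset (Option ι))) Finset.univ_nonempty
    (fun o => o.elim (Φ ζ) (fun i => ⟪ζ, z i⟫ - t i))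
  cases o with
  | none => exact Or.inl h
  | some i => exact Or.inr ⟨i, h⟩

lemma wt_le {ζ : E2} {C : ℝ} (h1 : Φ ζ ≤ C) (h2 : ∀ i, ⟪ζ, z i⟫ - t i ≤ C) : wt Φ z t ζ ≤ C := by
  rcases wt_eq (Φ := Φ) (z := z) (t := t) ζ with h | ⟨i, h⟩
  · rw [h]; exact h1
  · rw [h]; exact h2 i

lemma wt_subG_aff {ζ : E2} {i : ι} (h : wt Φ z t ζ = ⟪ζ, z i⟫ - t i) : SubG (wt Φ z t) ζ (z i) := by
  intro ζ'
  rw [h, inner_sub_left]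
  linarith [aff_le_wt (Φ := Φ) (z := z) (t := t) ζ' i]

lemma wt_subG_phi {ζ g : E2} (h : wt Φ z t ζ = Φ ζ) (hg : SubG Φ ζ g) : SubG (wt Φ z t) ζ g := by
  intro ζ'
  rw [h]
  exact (hg ζ').trans (phi_le_wt ζ')

lemma wt_sub1 (hΦ : SuppH Φ M) (hz : ∀ i, ‖z i‖ < 1) : Sub1 (wt Φ z t) := by
  intro ζ
  rcases wt_eq (Φ := Φ) (z := z) (t := t) ζ with h | ⟨i, h⟩
  · obtain ⟨w, h1, h2⟩ := hΦ.sub ζ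
    exact ⟨w, h1.le, wt_subG_phi h h2⟩
  · exact ⟨z i, (hz i).le, wt_subG_aff h⟩

lemma wt_of_cell {ζ : E2} {i : ι} (h : ζ ∈ cell Φ z t i) : wt Φ z t ζ = ⟪ζ, z i⟫ - t i :=
  le_antisymm (wt_le h.1 h.2) (aff_le_wt ζ i)

lemma scell_open (hΦ : SuppH Φ M) (i : ι) : IsOpen (scell Φ z t i) := by
  have := hΦ.sub1.cont
  unfold scell
  rw [Set.ofPred_and]
  apply (isOpen_lt (by fun_prop) (by fun_prop)).inter
  simp only [Set.ofPred_forall]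
  refine isOpen_iInter_of_finite fun j => isOpen_iInter_of_finite fun _ => isOpen_lt (by fun_prop) (by fun_prop)

lemma volume_scell (hΦ : SuppH Φ M) (hz : ∀ i, ‖z i‖ < 1) (hinj : Function.Injective z) (i : ι) :
    volume (scell Φ z t i) = volume (cell Φ z t i) := by
  refine le_antisymm (measure_mono (scell_subset _ _ _ _)) ?_
  calc volume (cell Φ z t i) ≤ volume (cell Φ z t i \ scell Φ z t i) + volume (scell Φ z t i) := by
        refine (measure_mono ?_).trans (measure_union_le _ _)
        intro ζ h
        by_cases hs : ζ ∈ scell Φ z t i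
        · exact Or.inr hs
        · exact Or.inl ⟨h, hs⟩
    _ = volume (scell Φ z t i) := by rw [cell_diff_null hΦ hz hinj, zero_add]

lemma volume_cell_lt_top (hΦ : SuppH Φ M) (hz : ∀ i, ‖z i‖ < 1) (i : ι) : volume (cell Φ z t i) < ⊤ :=
  (measure_mono (cell_bounded hΦ hz t i)).trans_lt measure_closedBall_lt_top

theorem int_eta (hΦ : SuppH Φ M) (hz : ∀ i, ‖z i‖ < 1) (hinj : Function.Injective z) {η : E2 → ℝ}
    (hη : ∀ x, 1 ≤ ‖x‖ → η x = 0) :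
    ∫ ζ, η (gradient (wt Φ z t) ζ) = ∑ i, (volume (cell Φ z t i)).toReal * η (z i) := by
  have hae : ∀ᵐ ζ, η (gradient (wt Φ z t) ζ) = ∑ i, (scell Φ z t i).indicator (fun _ => η (z i)) ζ := by
    have h1 := (wt_sub1 (t := t) hΦ hz).ae_diff
    have h2 : ∀ i, ∀ᵐ ζ, ζ ∉ cell Φ z t i \ scell Φ z t i := fun i =>
      measure_eq_zero_iff_ae_notMem.1 (cell_diff_null hΦ hz hinj t i)
    filter_upwards [h1, ae_all_iff.2 h2] with ζ hd hn
    by_cases hc : ∃ i, ζ ∈ cell Φ z t i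
    · obtain ⟨i, hi⟩ := hc
      have his : ζ ∈ scell Φ z t i := by
        by_contra h
        exact hn i ⟨hi, h⟩
      rw [(wt_subG_aff (wt_of_cell hi)).grad hd, Finset.sum_eq_single i]
      · rw [Set.indicator_of_mem his]
      · intro j _ hj
        apply Set.indicator_of_notMem
        intro hjs
        have e1 := his.2 j hj
        have e2 := hjs.2 i (Ne.symm hj)
        linarith
      · simp
    · push Not at hc
      rw [Finset.sum_eq_zero (fun i _ => Set.indicator_of_notMem (fun h => hc i (scell_subset _ _ _ _ h)) _)]
      rcases wt_eq (Φ := Φ) (z := z) (t := t) ζ with h | ⟨i, h⟩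
      · obtain ⟨g, g1, g2⟩ := hΦ.sub ζ
        rw [(wt_subG_phi h g2).grad hd]
        exact hη g g1.ge
      · exact absurd ⟨h ▸ phi_le_wt ζ, fun j => h ▸ aff_le_wt ζ j⟩ (hc i)
  rw [integral_congr_ae hae, integral_finsetSum]
  · congr 1
    ext i
    rw [integral_indicator (scell_open hΦ i).measurableSet, setIntegral_const, smul_eq_mul, measureReal_def,
      volume_scell hΦ hz hinj]
  · intro i _
    rw [integrable_indicator_iff (scell_open hΦ i).measurableSet]
    refine integrableOn_const (hs := ?_)
    rw [volume_scell hΦ hz hinj]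
    exact (volume_cell_lt_top hΦ hz i).ne

end partA2

section partB1
set_option linter.unusedSectionVars false
set_option linter.unusedVariables false
open MeasureTheory

/-- the conjugate of the hyperboloid -/
def RR (c : ℝ) (z : E2) : ℝ := -(c * Real.sqrt (1 - ‖z‖ ^ 2))

lemma hyp_le {c : ℝ} (hc : 0 < c) {z : E2} (hz : ‖z‖ ≤ 1) (ζ : E2) :
    ⟪ζ, z⟫ - RR c z ≤ Real.sqrt (c ^ 2 + ‖ζ‖ ^ 2) := by
  have h0 : (0:ℝ) ≤ 1 - ‖z‖ ^ 2 := by nlinarith [norm_nonneg z]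
  have h1 := real_inner_le_norm ζ z
  have h2 := Real.sq_sqrt h0
  have h3 := Real.sqrt_nonneg (1 - ‖z‖ ^ 2)
  unfold RR
  have h4 : ⟪ζ, z⟫ - -(c * Real.sqrt (1 - ‖z‖ ^ 2)) ≤ ‖ζ‖ * ‖z‖ + c * Real.sqrt (1 - ‖z‖ ^ 2) := by linarith
  refine h4.trans (Real.le_sqrt_of_sq_le ?_)
  nlinarith [sq_nonneg (c * ‖z‖ - ‖ζ‖ * Real.sqrt (1 - ‖z‖ ^ 2))]

/-- the gradient map of `RR` -/
def TT (c : ℝ) (z : E2) : E2 := (c / Real.sqrt (1 - ‖z‖ ^ 2)) • z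

lemma TT_inner {c : ℝ} (hc : 0 < c) {z : E2} (hz : ‖z‖ < 1) :
    ⟪TT c z, z⟫ - RR c z = c / Real.sqrt (1 - ‖z‖ ^ 2) := by
  have h0 : (0:ℝ) < 1 - ‖z‖ ^ 2 := by nlinarith [norm_nonneg z]
  have h2 := Real.sq_sqrt h0.le
  have h3 := Real.sqrt_pos.2 h0
  unfold TT RR
  rw [real_inner_smul_left, real_inner_self_eq_norm_sq]
  field_simp
  nlinarith

lemma TT_sqrt {c : ℝ} (hc : 0 < c) {z : E2} (hz : ‖z‖ < 1) :
    Real.sqrt (c ^ 2 + ‖TT c z‖ ^ 2) = c / Real.sqrt (1 - ‖z‖ ^ 2) := by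
  have h0 : (0:ℝ) < 1 - ‖z‖ ^ 2 := by nlinarith [norm_nonneg z]
  have h2 := Real.sq_sqrt h0.le
  have h3 := Real.sqrt_pos.2 h0
  rw [Real.sqrt_eq_iff_mul_self_eq (by positivity) (by positivity)]
  unfold TT
  rw [norm_smul, Real.norm_of_nonneg (by positivity), mul_pow, div_pow, ← pow_two, div_pow, h2]
  field_simp
  ring

lemma TT_strict {c : ℝ} (hc : 0 < c) {z z' : E2} (hz : ‖z‖ < 1) (hz' : ‖z'‖ < 1) (hne : z' ≠ z) :
    ⟪TT c z, z'⟫ - RR c z' < ⟪TT c z, z⟫ - RR c z := by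
  rw [TT_inner hc hz]
  have h0 : (0:ℝ) < 1 - ‖z‖ ^ 2 := by nlinarith [norm_nonneg z]
  have h2 := Real.sq_sqrt h0.le
  have h3 := Real.sqrt_pos.2 h0
  have h0' : (0:ℝ) < 1 - ‖z'‖ ^ 2 := by nlinarith [norm_nonneg z']
  have h2' := Real.sq_sqrt h0'.le
  have h4 : 0 < ‖z - z'‖ ^ 2 := by
    have : 0 < ‖z - z'‖ := norm_pos_iff.2 (sub_ne_zero.2 hne.symm)
    positivity
  rw [norm_sub_sq_real] at h4
  unfold TT RR
  rw [real_inner_smul_left]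
  have h5 : ⟪z, z'⟫ + Real.sqrt (1 - ‖z‖ ^ 2) * Real.sqrt (1 - ‖z'‖ ^ 2) < 1 := by
    nlinarith [sq_nonneg (Real.sqrt (1 - ‖z‖ ^ 2) - Real.sqrt (1 - ‖z'‖ ^ 2))]
  have h6 : c / Real.sqrt (1 - ‖z‖ ^ 2) * ⟪z, z'⟫ - -(c * Real.sqrt (1 - ‖z'‖ ^ 2))
      = c / Real.sqrt (1 - ‖z‖ ^ 2) * (⟪z, z'⟫ + Real.sqrt (1 - ‖z‖ ^ 2) * Real.sqrt (1 - ‖z'‖ ^ 2)) := by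
    field_simp
    ring
  rw [h6]
  calc _ < c / Real.sqrt (1 - ‖z‖ ^ 2) * 1 := mul_lt_mul_of_pos_left h5 (by positivity)
    _ = _ := mul_one _

variable {ι : Type*} [Fintype ι]

lemma TT_scell {c : ℝ} (hc : 0 < c) {z : ι → E2} (hz : ∀ i, ‖z i‖ < 1) (hinj : Function.Injective z) (i : ι) :
    TT c (z i) ∈ scell (fun ζ => ‖ζ‖) z (fun i => RR c (z i)) i := by
  refine ⟨?_, fun j hj => TT_strict hc (hz i) (hz j) (fun h => hj (hinj h))⟩
  rw [TT_inner hc (hz i)]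
  have h0 : (0:ℝ) < 1 - ‖z i‖ ^ 2 := by nlinarith [norm_nonneg (z i), hz i]
  have h3 := Real.sqrt_pos.2 h0
  unfold TT
  simp only
  rw [norm_smul, Real.norm_of_nonneg (by positivity)]
  calc _ < c / Real.sqrt (1 - ‖z i‖ ^ 2) * 1 := mul_lt_mul_of_pos_left (hz i) (by positivity)
    _ = _ := mul_one _

lemma cell_pos {c : ℝ} (hc : 0 < c) {z : ι → E2} (hz : ∀ i, ‖z i‖ < 1) (hinj : Function.Injective z) (i : ι) :
    0 < volume (cell (fun ζ => ‖ζ‖) z (fun i => RR c (z i)) i) := by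
  rw [← volume_scell suppH_norm hz hinj]
  exact (scell_open suppH_norm i).measure_pos _ ⟨_, TT_scell hc hz hinj i⟩

lemma cell_translate {φ : E2 → ℝ} {M c : ℝ} (hφb : ∀ z ∈ sphere (0 : E2) 1, |φ z| ≤ M) {a0 : E2} {b0 : ℝ}
    (h : ∀ w ∈ sphere (0 : E2) 1, ⟪a0, w⟫ + b0 ≤ φ w) (z : ι → E2) (i : ι) :
    volume (cell (fun ζ => ‖ζ‖) z (fun i => RR c (z i)) i) ≤
      volume (cell (PhiOf φ) z (fun i => (⟪a0, z i⟫ + b0) + RR c (z i)) i) := by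
  rw [← measure_preimage_add_right volume a0 (cell (PhiOf φ) z _ i)]
  apply measure_mono
  intro ζ hζ
  obtain ⟨h1, h2⟩ := hζ
  refine ⟨?_, fun j => ?_⟩
  · have := phi_le hφb h (ζ + a0)
    rw [add_sub_cancel_right] at this
    rw [inner_add_left]
    simp only at h1
    linarith
  · have := h2 j
    rw [inner_add_left, inner_add_left]
    linarith

/-- the discrete problem -/
theorem discrete {φ : E2 → ℝ} {M c a : ℝ} (hc : 0 < c) (ha : 0 < a)
    (hφb : ∀ z ∈ sphere (0 : E2) 1, |φ z| ≤ M)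
    (hφl : LowerSemicontinuousOn φ (sphere (0 : E2) 1)) {ψ : E2 → ℝ}
    (hψ : ∀ z ∈ ball (0 : E2) 1, a ≤ ψ z) {z : ι → E2} (hz : ∀ i, ‖z i‖ < 1)
    (hinj : Function.Injective z) :
    ∃ t : ι → ℝ, (∀ i, volume (cell (PhiOf φ) z t i) =
        ENNReal.ofReal (a / ψ (z i)) * volume (cell (fun ζ => ‖ζ‖) z (fun i => RR c (z i)) i)) ∧
      ∀ (a0 : E2) (b0 : ℝ), (∀ w ∈ sphere (0 : E2) 1, ⟪a0, w⟫ + b0 ≤ φ w) →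
        ∀ i, (⟪a0, z i⟫ + b0) + RR c (z i) ≤ t i := by
  classical
  have hψ' : ∀ i, a ≤ ψ (z i) := fun i => hψ _ (by simpa using hz i)
  have key : ∀ (a0 : E2) (b0 : ℝ), (∀ w ∈ sphere (0 : E2) 1, ⟪a0, w⟫ + b0 ≤ φ w) → ∀ i,
      ENNReal.ofReal (a / ψ (z i)) * volume (cell (fun ζ => ‖ζ‖) z (fun i => RR c (z i)) i) ≤
      volume (cell (PhiOf φ) z (fun i => (⟪a0, z i⟫ + b0) + RR c (z i)) i) := by
    intro a0 b0 h i
    refine le_trans ?_ (cell_translate hφb h z i)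
    have : ENNReal.ofReal (a / ψ (z i)) ≤ 1 := by
      rw [ENNReal.ofReal_le_one, div_le_one (ha.trans_le (hψ' i))]
      exact hψ' i
    calc _ ≤ 1 * volume (cell (fun ζ => ‖ζ‖) z (fun i => RR c (z i)) i) := by gcongr
      _ = _ := one_mul _
  obtain ⟨t, h1, h2⟩ := perron (suppH_phi hφb hφl) hz hinj
    (fun i => ENNReal.ofReal (a / ψ (z i)) * volume (cell (fun ζ => ‖ζ‖) z (fun i => RR c (z i)) i))
    (fun i => by
      apply ENNReal.mul_pos
      · rw [Ne, ENNReal.ofReal_eq_zero, not_le]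
        exact div_pos ha (ha.trans_le (hψ' i))
      · exact (cell_pos hc hz hinj i).ne')
    _ (key 0 (-M) (fun w hw => by
      have := (abs_le.1 (hφb w hw)).1
      simpa using this))
  exact ⟨t, h1, fun a0 b0 h => h2 _ (key a0 b0 h)⟩

lemma wt_upper {φ : E2 → ℝ} {M c : ℝ} (hc : 0 < c) (hφb : ∀ z ∈ sphere (0 : E2) 1, |φ z| ≤ M)
    {z : ι → E2} (hz : ∀ i, ‖z i‖ < 1) {t : ι → ℝ} {a0 : E2} {b0 : ℝ}
    (h : ∀ w ∈ sphere (0 : E2) 1, ⟪a0, w⟫ + b0 ≤ φ w)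
    (ht : ∀ i, (⟪a0, z i⟫ + b0) + RR c (z i) ≤ t i) (ζ : E2) :
    wt (PhiOf φ) z t ζ ≤ Real.sqrt (c ^ 2 + ‖ζ - a0‖ ^ 2) - b0 := by
  apply wt_le
  · have h1 := phi_le hφb h ζ
    have : ‖ζ - a0‖ ≤ Real.sqrt (c ^ 2 + ‖ζ - a0‖ ^ 2) := Real.le_sqrt_of_sq_le (by nlinarith)
    linarith
  · intro i
    have h1 := hyp_le hc (hz i).le (ζ - a0)
    rw [inner_sub_left] at h1
    have := ht i
    linarith

lemma wt_norm_le {c : ℝ} (hc : 0 < c) {z : ι → E2} (hz : ∀ i, ‖z i‖ < 1) (ζ : E2) :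
    wt (fun ζ => ‖ζ‖) z (fun i => RR c (z i)) ζ ≤ Real.sqrt (c ^ 2 + ‖ζ‖ ^ 2) := by
  apply wt_le
  · exact Real.le_sqrt_of_sq_le (by nlinarith)
  · exact fun i => hyp_le hc (hz i).le ζ

end partB1

section partC1
set_option linter.unusedSectionVars false
set_option linter.unusedVariables false
open MeasureTheory

lemma Sub1.limit {w : ℕ → E2 → ℝ} {w0 : E2 → ℝ} (h : ∀ n, Sub1 (w n))
    (hl : ∀ ζ, Tendsto (fun n => w n ζ) atTop (𝓝 (w0 ζ))) : Sub1 w0 := by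
  intro ζ
  choose g hg using fun n => h n ζ
  obtain ⟨g0, hg0, k, hk, hlim⟩ := (isCompact_closedBall (0 : E2) 1).tendsto_subseq
    (x := g) (fun n => by simpa using (hg n).1)
  refine ⟨g0, by simpa using hg0, fun ζ' => ?_⟩
  have h1 : Tendsto (fun n => w (k n) ζ + ⟪ζ' - ζ, g (k n)⟫) atTop (𝓝 (w0 ζ + ⟪ζ' - ζ, g0⟫)) :=
    ((hl ζ).comp hk.tendsto_atTop).add (Tendsto.inner tendsto_const_nhds hlim)
  exact le_of_tendsto_of_tendsto' h1 ((hl ζ').comp hk.tendsto_atTop) (fun n => (hg (k n)).2 ζ')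

lemma grad_conv {w : ℕ → E2 → ℝ} {w0 : E2 → ℝ} (h : ∀ n, Sub1 (w n))
    (hl : ∀ ζ, Tendsto (fun n => w n ζ) atTop (𝓝 (w0 ζ))) :
    ∀ᵐ ζ, Tendsto (fun n => gradient (w n) ζ) atTop (𝓝 (gradient w0 ζ)) := by
  filter_upwards [ae_all_iff.2 (fun n => (h n).ae_diff), (Sub1.limit h hl).ae_diff] with ζ h1 h2
  apply tendsto_of_subseq_tendsto
  intro ns hns
  obtain ⟨g0, hg0, k, hk, hlim⟩ := (isCompact_closedBall (0 : E2) 1).tendsto_subseq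
    (x := fun n => gradient (w (ns n)) ζ) (fun n => by simpa using ((h (ns n)).subG_grad (h1 _)).2)
  refine ⟨k, ?_⟩
  have hsub : SubG w0 ζ g0 := by
    intro ζ'
    have h3 : Tendsto (fun n => w (ns (k n)) ζ + ⟪ζ' - ζ, gradient (w (ns (k n))) ζ⟫) atTop
        (𝓝 (w0 ζ + ⟪ζ' - ζ, g0⟫)) :=
      ((hl ζ).comp (hns.comp hk.tendsto_atTop)).add (Tendsto.inner tendsto_const_nhds hlim)
    exact le_of_tendsto_of_tendsto' h3 ((hl ζ').comp (hns.comp hk.tendsto_atTop))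
      (fun n => ((h (ns (k n))).subG_grad (h1 _)).1 ζ')
  rw [hsub.grad h2]
  exact hlim

lemma grad_meas (w : E2 → ℝ) : Measurable (gradient w) :=
  (InnerProductSpace.toDual ℝ E2).symm.continuous.measurable.comp (measurable_fderiv ℝ w)

lemma grad_small {w : E2 → ℝ} (h : Sub1 w) {M C ρ : ℝ} (hM : ∀ ζ, ‖ζ‖ - M ≤ w ζ) (hC : w 0 ≤ C) (hρ : ρ < 1)
    {ζ g : E2} (hg : SubG w ζ g) (hgρ : ‖g‖ ≤ ρ) : ‖ζ‖ ≤ (C + M) / (1 - ρ) := by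
  rw [le_div_iff₀ (by linarith)]
  have h1 := hg 0
  have h2 := hM ζ
  have h3 := real_inner_le_norm ζ g
  rw [zero_sub, inner_neg_left] at h1
  have h4 : ‖ζ‖ * ‖g‖ ≤ ‖ζ‖ * ρ := by gcongr
  linarith

lemma eta_facts {η : E2 → ℝ} (hη : Continuous η) (hs : HasCompactSupport η) (hb : tsupport η ⊆ ball 0 1) :
    ∃ ρ < 1, ∃ K, 0 ≤ K ∧ (∀ x, ρ < ‖x‖ → η x = 0) ∧ ∀ x, |η x| ≤ K := by
  obtain ⟨K, hK⟩ := hη.bounded_above_of_compact_support hs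
  have h1 : ∃ ρ < (1:ℝ), ∀ x ∈ tsupport η, ‖x‖ ≤ ρ := by
    by_cases hne : (tsupport η).Nonempty
    · obtain ⟨x, hx, hm⟩ := IsCompact.exists_isMaxOn hs hne continuous_norm.continuousOn
      exact ⟨‖x‖, by simpa using hb hx, fun y hy => hm hy⟩
    · exact ⟨0, one_pos, fun x hx => absurd ⟨x, hx⟩ hne⟩
  obtain ⟨ρ, hρ, h2⟩ := h1
  refine ⟨ρ, hρ, K, (norm_nonneg _).trans (hK 0), fun x hx => ?_, hK⟩
  by_contra h
  exact absurd (h2 x (subset_tsupport _ h)) (not_le.2 hx)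

lemma int_conv {w : ℕ → E2 → ℝ} {w0 : E2 → ℝ} (h : ∀ n, Sub1 (w n))
    (hl : ∀ ζ, Tendsto (fun n => w n ζ) atTop (𝓝 (w0 ζ))) {M C : ℝ} (hM : ∀ n ζ, ‖ζ‖ - M ≤ w n ζ)
    (hC : ∀ n, w n 0 ≤ C) {η : E2 → ℝ} (hη : Continuous η) (hs : HasCompactSupport η)
    (hb : tsupport η ⊆ ball 0 1) :
    Tendsto (fun n => ∫ ζ, η (gradient (w n) ζ)) atTop (𝓝 (∫ ζ, η (gradient w0 ζ))) := by
  obtain ⟨ρ, hρ, K, hK0, h0, hK⟩ := eta_facts hη hs hb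
  apply tendsto_integral_of_dominated_convergence
    ((closedBall (0:E2) ((C + M) / (1 - ρ))).indicator (fun _ => K))
  · exact fun n => (hη.measurable.comp (grad_meas _)).aestronglyMeasurable
  · rw [integrable_indicator_iff measurableSet_closedBall]
    exact integrableOn_const (hs := measure_closedBall_lt_top.ne)
  · intro n
    filter_upwards [(h n).ae_diff] with ζ hd
    by_cases hρ' : ρ < ‖gradient (w n) ζ‖
    · rw [h0 _ hρ', norm_zero]
      exact Set.indicator_nonneg (fun _ _ => hK0) _
    · have := grad_small (h n) (hM n) (hC n) hρ ((h n).subG_grad hd).1 (not_lt.1 hρ')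
      rw [Set.indicator_of_mem (by simpa using this)]
      exact hK _
  · filter_upwards [grad_conv h hl] with ζ hζ
    exact (hη.tendsto _).comp hζ

lemma exists_subseq {w : ℕ → E2 → ℝ} (h : ∀ n, Sub1 (w n)) {B : E2 → ℝ} (hB : ∀ n ζ, |w n ζ| ≤ B ζ) :
    ∃ (k : ℕ → ℕ) (w0 : E2 → ℝ), StrictMono k ∧ ∀ ζ, Tendsto (fun n => w (k n) ζ) atTop (𝓝 (w0 ζ)) := by
  set d := TopologicalSpace.denseSeq E2 with hd
  have hK : IsCompact (Set.pi Set.univ (fun j : ℕ => Set.Icc (-B (d j)) (B (d j)))) :=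
    isCompact_univ_pi (fun j => isCompact_Icc)
  obtain ⟨v, hv, k, hk, hlim⟩ := hK.tendsto_subseq (x := fun n j => w n (d j))
    (fun n j _ => abs_le.1 (hB n (d j)))
  have hlim' := tendsto_pi_nhds.1 hlim
  have hc : ∀ ζ, ∃ l, Tendsto (fun n => w (k n) ζ) atTop (𝓝 l) := by
    intro ζ
    apply cauchySeq_tendsto_of_complete
    rw [Metric.cauchySeq_iff]
    intro ε hε
    obtain ⟨j, hj⟩ := (TopologicalSpace.denseRange_denseSeq E2).exists_dist_lt ζ (show 0 < ε / 4 by linarith)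
    have h1 : CauchySeq (fun n => w (k n) (d j)) := (hlim' j).cauchySeq
    rw [Metric.cauchySeq_iff] at h1
    obtain ⟨N, hN⟩ := h1 (ε / 4) (by linarith)
    refine ⟨N, fun m hm n hn => ?_⟩
    have e1 := hN m hm n hn
    have e2 := (h (k m)).lip.dist_le_mul ζ (d j)
    have e3 := (h (k n)).lip.dist_le_mul ζ (d j)
    simp only [NNReal.coe_one, one_mul] at e2 e3
    have e4 := dist_triangle4 (w (k m) ζ) (w (k m) (d j)) (w (k n) (d j)) (w (k n) ζ)
    rw [dist_comm (w (k n) (d j)) (w (k n) ζ)] at e4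
    rw [← hd] at hj
    linarith
  choose w0 hw0 using hc
  exact ⟨k, w0, hk, hw0⟩

end partC1

section partC2
set_option linter.unusedSectionVars false
set_option linter.unusedVariables false
open MeasureTheory

/-- hyperboloid -/
def HS (c : ℝ) (ζ : E2) : ℝ := Real.sqrt (c ^ 2 + ‖ζ‖ ^ 2)

/-- inverse of `TT` -/
def TI (c : ℝ) (ζ : E2) : E2 := (HS c ζ)⁻¹ • ζ

variable {c : ℝ}

lemma HS_pos (hc : 0 < c) (ζ : E2) : 0 < HS c ζ := Real.sqrt_pos.2 (by positivity)

lemma HS_sq (hc : 0 < c) (ζ : E2) : HS c ζ ^ 2 = c ^ 2 + ‖ζ‖ ^ 2 := Real.sq_sqrt (by positivity)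

lemma one_sub_TI (hc : 0 < c) (ζ : E2) : 1 - ‖TI c ζ‖ ^ 2 = (c / HS c ζ) ^ 2 := by
  have h := HS_pos hc ζ
  have h2 := HS_sq hc ζ
  unfold TI
  rw [norm_smul, norm_inv, Real.norm_of_nonneg h.le]
  field_simp
  linarith

lemma TI_lt (hc : 0 < c) (ζ : E2) : ‖TI c ζ‖ < 1 := by
  have h := HS_pos hc ζ
  have h1 := one_sub_TI hc ζ
  have h3 : 0 < (c / HS c ζ) ^ 2 := by positivity
  nlinarith [norm_nonneg (TI c ζ)]

lemma TT_TI (hc : 0 < c) (ζ : E2) : TT c (TI c ζ) = ζ := by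
  have h := HS_pos hc ζ
  unfold TT
  rw [one_sub_TI hc, Real.sqrt_sq (by positivity)]
  unfold TI
  rw [smul_smul]
  have : c / (c / HS c ζ) * (HS c ζ)⁻¹ = 1 := by field_simp
  rw [this, one_smul]

lemma HS_subG (hc : 0 < c) {z : E2} (hz : ‖z‖ < 1) : SubG (HS c) (TT c z) z := by
  intro ζ'
  have h1 : HS c (TT c z) = c / Real.sqrt (1 - ‖z‖ ^ 2) := TT_sqrt hc hz
  have h2 : ⟪ζ', z⟫ - RR c z ≤ HS c ζ' := hyp_le hc hz.le ζ'
  have h3 := TT_inner hc hz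
  rw [inner_sub_left]
  linarith

lemma HS_sub1 (hc : 0 < c) : Sub1 (HS c) := by
  intro ζ
  refine ⟨TI c ζ, (TI_lt hc ζ).le, ?_⟩
  have := HS_subG hc (TI_lt hc ζ)
  rwa [TT_TI hc] at this

lemma HS_diff (hc : 0 < c) (ζ : E2) : DifferentiableAt ℝ (HS c) ζ := by
  unfold HS
  apply DifferentiableAt.sqrt
  · exact (differentiableAt_const _).add (differentiableAt_id.norm_sq ℝ)
  · positivity

lemma HS_grad (hc : 0 < c) {z : E2} (hz : ‖z‖ < 1) : gradient (HS c) (TT c z) = z :=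
  (HS_subG hc hz).grad (HS_diff hc _)

/-- derivative of `TT` -/
def TTd (c : ℝ) (z : E2) : E2 →L[ℝ] E2 :=
  (c / Real.sqrt (1 - ‖z‖ ^ 2)) • ContinuousLinearMap.id ℝ E2 +
    ((c / Real.sqrt (1 - ‖z‖ ^ 2) ^ 3) • innerSL ℝ z).smulRight z

lemma TT_hasFDeriv (c : ℝ) {z : E2} (hz : ‖z‖ < 1) : HasFDerivAt (TT c) (TTd c z) z := by
  have h0 : (0:ℝ) < 1 - ‖z‖ ^ 2 := by nlinarith [norm_nonneg z]
  have h3 := Real.sqrt_pos.2 h0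
  have h1 : HasFDerivAt (fun z : E2 => 1 - ‖z‖ ^ 2) (-(2 • innerSL ℝ z)) z :=
    (hasStrictFDerivAt_norm_sq z).hasFDerivAt.const_sub 1
  have h2 : HasDerivAt (fun t : ℝ => c / Real.sqrt t) (-(c / (2 * Real.sqrt (1 - ‖z‖ ^ 2) ^ 3))) (1 - ‖z‖ ^ 2) := by
    have := (Real.hasDerivAt_sqrt h0.ne').fun_inv h3.ne' |>.const_mul c
    have e1 : (fun t : ℝ => c / Real.sqrt t) = fun t => c * (Real.sqrt t)⁻¹ := by
      funext t; rw [div_eq_mul_inv]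
    rw [e1]
    refine this.congr_deriv ?_
    field_simp
  have h4 := (h2.comp_hasFDerivAt z h1).smul (hasFDerivAt_id z)
  refine HasFDerivAt.congr_fderiv h4 ?_
  unfold TTd
  ext v
  simp
  left
  field_simp

lemma TTd_det (hc : 0 < c) {z : E2} (hz : ‖z‖ < 1) : (TTd c z).det = c ^ 2 * ((1 - ‖z‖ ^ 2) ^ 2)⁻¹ := by
  have h0 : (0:ℝ) < 1 - ‖z‖ ^ 2 := by nlinarith [norm_nonneg z]
  have h2 := Real.sq_sqrt h0.le
  have h3 := Real.sqrt_pos.2 h0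
  have h5 : ‖z‖ ^ 2 = z 0 ^ 2 + z 1 ^ 2 := by
    rw [EuclideanSpace.norm_sq_eq, Fin.sum_univ_two]; simp
  rw [ContinuousLinearMap.det, ← LinearMap.det_toMatrix (EuclideanSpace.basisFun (Fin 2) ℝ).toBasis, Matrix.det_fin_two]
  simp only [LinearMap.toMatrix_apply]
  simp [TTd, EuclideanSpace.inner_single_right]
  set s := Real.sqrt (1 - ‖z‖ ^ 2) with hs
  rw [← h2]
  field_simp
  nlinarith

lemma change_var (hc : 0 < c) (g : E2 → ℝ) :
    ∫ ζ, g (gradient (HS c) ζ) = ∫ z in ball (0:E2) 1, c ^ 2 * ((1 - ‖z‖ ^ 2) ^ 2)⁻¹ * g z := by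
  have h1 : TT c '' ball (0:E2) 1 = Set.univ := by
    ext ζ
    simp only [Set.mem_univ, iff_true]
    exact ⟨TI c ζ, by simpa using TI_lt hc ζ, TT_TI hc ζ⟩
  have hinj : Set.InjOn (TT c) (ball (0:E2) 1) := by
    intro z hz z' hz' h
    rw [← HS_grad hc (z := z) (by simpa using hz), ← HS_grad hc (z := z') (by simpa using hz'), h]
  rw [← setIntegral_univ, ← h1, integral_image_eq_integral_abs_det_fderiv_smul volume measurableSet_ball
    (fun z hz => (TT_hasFDeriv c (by simpa using hz)).hasFDerivWithinAt) hinj]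
  apply setIntegral_congr_fun measurableSet_ball
  intro z hz
  have hz' : ‖z‖ < 1 := by simpa using hz
  have h0 : (0:ℝ) < 1 - ‖z‖ ^ 2 := by nlinarith [norm_nonneg z]
  simp only
  rw [TTd_det hc hz', HS_grad hc hz', abs_of_nonneg (by positivity), smul_eq_mul]

/-- dense injective sequence in the disc -/
lemma exists_seq : ∃ z : ℕ → E2, Function.Injective z ∧ (∀ i, ‖z i‖ < 1) ∧
    ∀ x : E2, ‖x‖ < 1 → ∀ ε > 0, ∃ i, ‖z i - x‖ < ε := by
  obtain ⟨s, hsub, hcount, hdense⟩ := TopologicalSpace.IsSeparable.exists_countable_dense_subset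
    (TopologicalSpace.IsSeparable.of_separableSpace (ball (0:E2) 1))
  have hinf : s.Infinite := by
    intro hfin
    have h1 : ball (0:E2) 1 ⊆ s := by
      rw [hfin.isClosed.closure_eq] at hdense
      exact hdense
    have h2 : volume (ball (0:E2) 1) = 0 := measure_mono_null h1 (hfin.measure_zero _)
    exact (measure_ball_pos volume (0:E2) one_pos).ne' h2
  have := hcount.to_subtype
  have := hinf.to_subtype
  obtain ⟨e⟩ := nonempty_equiv_of_countable (α := ℕ) (β := s)
  refine ⟨fun n => (e n : E2), Subtype.val_injective.comp e.injective, fun i => by simpa using hsub (e i).2, ?_⟩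
  intro x hx ε hε
  obtain ⟨y, hy, hd⟩ := Metric.mem_closure_iff.1 (hdense (by simpa using hx : x ∈ ball (0:E2) 1)) ε hε
  refine ⟨e.symm ⟨y, hy⟩, ?_⟩
  simpa [dist_eq_norm, norm_sub_rev] using hd

lemma hyp_conv (hc : 0 < c) {z : ℕ → E2} (hz : ∀ i, ‖z i‖ < 1)
    (hd : ∀ x : E2, ‖x‖ < 1 → ∀ ε > 0, ∃ i, ‖z i - x‖ < ε) (ζ : E2) :
    Tendsto (fun N : ℕ => wt (fun ζ => ‖ζ‖) (fun i : Fin N => z i) (fun i => RR c (z i)) ζ) atTop (𝓝 (HS c ζ)) := by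
  rw [Metric.tendsto_atTop]
  intro ε hε
  have hcont : Continuous (fun x : E2 => ⟪ζ, x⟫ - RR c x) := by unfold RR; fun_prop
  obtain ⟨δ, hδ, h1⟩ := Metric.continuous_iff.1 hcont (TI c ζ) ε hε
  obtain ⟨i, hi⟩ := hd (TI c ζ) (TI_lt hc ζ) δ hδ
  have h2 := h1 (z i) (by rwa [dist_eq_norm])
  have h3 : ⟪ζ, TI c ζ⟫ - RR c (TI c ζ) = HS c ζ := by
    have e1 := TT_inner hc (TI_lt hc ζ)
    have e2 : HS c (TT c (TI c ζ)) = _ := TT_sqrt hc (TI_lt hc ζ)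
    rw [TT_TI hc] at e1 e2
    rw [e1, e2]
  rw [h3, Real.dist_eq] at h2
  refine ⟨i + 1, fun N hN => ?_⟩
  have h4 : ⟪ζ, z i⟫ - RR c (z i) ≤ wt (fun ζ => ‖ζ‖) (fun i : Fin N => z i) (fun i => RR c (z i)) ζ :=
    aff_le_wt (ι := Fin N) (Φ := fun ζ => ‖ζ‖) (z := fun i : Fin N => z i) (t := fun i : Fin N => RR c (z i)) ζ ⟨i, hN⟩
  have h5 : wt (fun ζ => ‖ζ‖) (fun i : Fin N => z i) (fun i => RR c (z i)) ζ ≤ HS c ζ :=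
    wt_norm_le (ι := Fin N) (z := fun i : Fin N => z i) hc (fun i => hz i) ζ
  have h6 := (abs_lt.1 h2).1
  rw [Real.dist_eq, abs_lt]
  constructor <;> linarith

end partC2

section partC3
set_option linter.unusedSectionVars false
set_option linter.unusedVariables false
open MeasureTheory

lemma cont_mul_of_tsupport {η g : E2 → ℝ} (hη : Continuous η) (hb : tsupport η ⊆ ball 0 1)
    (hg : ContinuousOn g (ball 0 1)) : Continuous (fun x => g x * η x) := by
  rw [continuous_iff_continuousAt]
  intro x
  by_cases hx : x ∈ tsupport η
  · exact (hg.continuousAt (isOpen_ball.mem_nhds (hb hx))).mul hη.continuousAt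
  · have h1 : (fun x => g x * η x) =ᶠ[𝓝 x] fun _ => 0 := by
      filter_upwards [(isClosed_tsupport η).isOpen_compl.mem_nhds hx] with y hy
      rw [image_eq_zero_of_notMem_tsupport hy, mul_zero]
    exact (continuousAt_const).congr h1.symm

theorem exists_w {φ : E2 → ℝ} {M a : ℝ} (ha : 0 < a)
    (hφb : ∀ z ∈ sphere (0 : E2) 1, |φ z| ≤ M)
    (hφl : LowerSemicontinuousOn φ (sphere (0 : E2) 1)) {ψ : E2 → ℝ}
    (hψc : ContinuousOn ψ (ball (0:E2) 1)) (hψ : ∀ z ∈ ball (0 : E2) 1, a ≤ ψ z) :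
    ∃ w : E2 → ℝ, Sub1 w ∧ (∀ ζ, PhiOf φ ζ ≤ w ζ) ∧
      (∀ (a0 : E2) (b0 : ℝ), (∀ x ∈ sphere (0 : E2) 1, ⟪a0, x⟫ + b0 ≤ φ x) →
        ∀ ζ, w ζ ≤ HS (1 / Real.sqrt a) (ζ - a0) - b0) ∧
      ∀ η : E2 → ℝ, Continuous η → HasCompactSupport η → tsupport η ⊆ ball 0 1 →
        ∫ ζ, η (gradient w ζ) = ∫ z in ball (0:E2) 1, η z * ((1 / ψ z) * ((1 - ‖z‖ ^ 2) ^ 2)⁻¹) := by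
  set c := 1 / Real.sqrt a with hcdef
  have hc : 0 < c := by positivity
  have hc2 : c ^ 2 * a = 1 := by
    rw [hcdef, div_pow, Real.sq_sqrt ha.le]; field_simp
  have hM : 0 ≤ M := (abs_nonneg _).trans (hφb _ (ee_mem_sphere 0))
  obtain ⟨z, hinj, hz, hdense⟩ := exists_seq
  have hinjN : ∀ N : ℕ, Function.Injective (fun i : Fin N => z i) := fun N =>
    hinj.comp Fin.val_injective
  choose t ht1 ht2 using fun N : ℕ => discrete (ι := Fin N) (z := fun i : Fin N => z i) hc ha hφb hφl hψ
    (fun i => hz i) (hinjN N)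
  have hS := suppH_phi hφb hφl
  set W : ℕ → E2 → ℝ := fun N => wt (PhiOf φ) (fun i : Fin N => z i) (t N) with hW
  have hsub : ∀ N, Sub1 (W N) := fun N => wt_sub1 hS (fun i => hz i)
  have hlow : ∀ N ζ, PhiOf φ ζ ≤ W N ζ := fun N ζ => phi_le_wt ζ
  have hlow' : ∀ N ζ, ‖ζ‖ - M ≤ W N ζ := fun N ζ => (hS.low ζ).trans (hlow N ζ)
  have hup : ∀ N (a0 : E2) (b0 : ℝ), (∀ x ∈ sphere (0 : E2) 1, ⟪a0, x⟫ + b0 ≤ φ x) →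
        ∀ ζ, W N ζ ≤ HS c (ζ - a0) - b0 := fun N a0 b0 h ζ =>
    wt_upper (ι := Fin N) hc hφb (fun i => hz i) h (ht2 N a0 b0 h) ζ
  have hup0 : ∀ N ζ, W N ζ ≤ HS c ζ + M := by
    intro N ζ
    have := hup N 0 (-M) (fun x hx => by
      have := (abs_le.1 (hφb x hx)).1
      simpa using this) ζ
    simpa using this
  obtain ⟨k, w, hk, hlim⟩ := exists_subseq hsub (B := fun ζ => HS c ζ + M) (by
    intro n ζ
    rw [abs_le]
    refine ⟨?_, hup0 n ζ⟩
    have := hlow' n ζ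
    have := norm_nonneg ζ
    have := HS_pos hc ζ
    linarith)
  refine ⟨w, Sub1.limit (fun n => hsub (k n)) hlim, fun ζ => ge_of_tendsto' (hlim ζ) (fun n => hlow _ ζ),
    fun a0 b0 h ζ => le_of_tendsto' (hlim ζ) (fun n => hup _ a0 b0 h ζ), ?_⟩
  intro η hη hs hb
  have hψ0 : ∀ x ∈ ball (0:E2) 1, ψ x ≠ 0 := fun x hx => (ha.trans_le (hψ x hx)).ne'
  set θ : E2 → ℝ := fun x => a / ψ x * η x with hθ
  have hθc : Continuous θ := cont_mul_of_tsupport hη hb (continuousOn_const.div hψc hψ0)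
  have hθs : HasCompactSupport θ := hs.mul_left
  have hθb : tsupport θ ⊆ ball 0 1 := (tsupport_mul_subset_right).trans hb
  have hzero : ∀ {g : E2 → ℝ}, tsupport g ⊆ ball 0 1 → ∀ x, 1 ≤ ‖x‖ → g x = 0 := by
    intro g hg x hx
    by_contra h
    have := hg (subset_tsupport _ h)
    rw [mem_ball_zero_iff] at this
    linarith
  set V : ℕ → E2 → ℝ := fun N => wt (fun ζ => ‖ζ‖) (fun i : Fin N => z i) (fun i => RR c (z i)) with hV
  have heq : ∀ N, ∫ ζ, η (gradient (W N) ζ) = ∫ ζ, θ (gradient (V N) ζ) := by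
    intro N
    rw [int_eta (ι := Fin N) hS (fun i => hz i) (hinjN N) (hzero hb), int_eta (ι := Fin N) suppH_norm (fun i => hz i) (hinjN N) (hzero hθb)]
    apply Finset.sum_congr rfl
    intro i _
    have hpos : 0 < ψ (z i) := ha.trans_le (hψ _ (by simpa using hz i))
    rw [ht1 N i, ENNReal.toReal_mul, ENNReal.toReal_ofReal (by positivity), hθ]
    ring
  have l1 := int_conv (fun n => hsub (k n)) hlim (fun n => hlow' (k n)) (fun n => hup0 (k n) 0) hη hs hb
  have l2 := int_conv (w := V) (w0 := HS c) (fun n => wt_sub1 suppH_norm (fun i => hz i))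
    (fun ζ => hyp_conv hc hz hdense ζ) (M := 0) (C := HS c 0) (fun n ζ => by
      simpa using phi_le_wt (Φ := fun ζ => ‖ζ‖) (z := fun i : Fin n => z i) (t := fun i : Fin n => RR c (z i)) ζ)
    (fun n => wt_norm_le (ι := Fin n) (z := fun i : Fin n => z i) hc (fun i => hz i) 0) hθc hθs hθb
  have l3 := l2.comp hk.tendsto_atTop
  have l4 : (fun n => ∫ ζ, η (gradient (W (k n)) ζ)) = (fun N => ∫ ζ, θ (gradient (V N) ζ)) ∘ k := by
    funext n
    exact heq (k n)
  rw [l4] at l1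
  rw [tendsto_nhds_unique l1 l3, change_var hc]
  apply setIntegral_congr_fun measurableSet_ball
  intro x hx
  have hp := hψ0 x hx
  simp only [hθ]
  have : c ^ 2 * ((1 - ‖x‖ ^ 2) ^ 2)⁻¹ * (a / ψ x * η x) = (c ^ 2 * a) * (η x * ((1 / ψ x) * ((1 - ‖x‖ ^ 2) ^ 2)⁻¹)) := by
    field_simp
  rw [this, hc2, one_mul]

end partC3

section partD0
set_option linter.unusedSectionVars false
set_option linter.unusedVariables false
open MeasureTheory

/-- dual Alexandrov solution -/
structure MA (w f : E2 → ℝ) (lam M : ℝ) : Prop where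
  sub1 : Sub1 w
  low : ∀ ζ, ‖ζ‖ - M ≤ w ζ
  lam_pos : 0 < lam
  f_low : ∀ z ∈ ball (0:E2) 1, lam ≤ f z
  f_cont : ContinuousOn f (ball (0:E2) 1)
  star : ∀ η : E2 → ℝ, Continuous η → HasCompactSupport η → tsupport η ⊆ ball 0 1 →
        ∫ ζ, η (gradient w ζ) = ∫ z in ball (0:E2) 1, η z * f z

/-- Legendre transform -/
def leg (w : E2 → ℝ) (z : E2) : ℝ := sSup (Set.range fun ζ => ⟪ζ, z⟫ - w ζ)

variable {w f : E2 → ℝ} {lam M : ℝ}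

lemma leg_eq {ζ z : E2} (h : SubG w ζ z) : leg w z = ⟪ζ, z⟫ - w ζ := by
  apply le_antisymm
  · apply csSup_le (Set.range_nonempty _)
    rintro _ ⟨ζ', rfl⟩
    have := h ζ'
    rw [inner_sub_left] at this
    simp only
    linarith
  · refine le_csSup ?_ (Set.mem_range_self ζ)
    refine ⟨⟪ζ, z⟫ - w ζ, ?_⟩
    rintro _ ⟨ζ', rfl⟩
    have := h ζ'
    rw [inner_sub_left] at this
    simp only
    linarith

lemma le_leg (h : ∀ ζ, ‖ζ‖ - M ≤ w ζ) {z : E2} (hz : ‖z‖ ≤ 1) (ζ : E2) : ⟪ζ, z⟫ - w ζ ≤ leg w z := by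
  refine le_csSup ?_ (Set.mem_range_self ζ)
  refine ⟨M, ?_⟩
  rintro _ ⟨ζ', rfl⟩
  have h1 := h ζ'
  have h2 := real_inner_le_norm ζ' z
  have h3 : ‖ζ'‖ * ‖z‖ ≤ ‖ζ'‖ * 1 := by gcongr
  simp only
  linarith

lemma exists_rel (hs : Sub1 w) (h : ∀ ζ, ‖ζ‖ - M ≤ w ζ) {z : E2} (hz : ‖z‖ < 1) : ∃ ζ, SubG w ζ z := by
  have hc : Continuous (fun ζ => w ζ - ⟪ζ, z⟫) := hs.cont.sub (by fun_prop)
  have hK := isCompact_closedBall (0:E2) ((w 0 + M) / (1 - ‖z‖))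
  have h0 : ((w 0 + M) / (1 - ‖z‖)) ≥ 0 := by
    apply div_nonneg _ (by linarith)
    have := h 0
    simp at this
    linarith
  obtain ⟨ζ, hζ, hm⟩ := hK.exists_isMinOn ⟨0, by simpa using h0⟩ hc.continuousOn
  refine ⟨ζ, fun ζ' => ?_⟩
  rw [inner_sub_left]
  by_cases h1 : ζ' ∈ closedBall (0:E2) ((w 0 + M) / (1 - ‖z‖))
  · have : w ζ - ⟪ζ, z⟫ ≤ w ζ' - ⟪ζ', z⟫ := hm h1
    linarith
  · rw [mem_closedBall_zero_iff, not_le, div_lt_iff₀ (by linarith)] at h1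
    have h2 : w ζ - ⟪ζ, z⟫ ≤ w 0 - ⟪(0:E2), z⟫ := hm (by simpa using h0)
    rw [inner_zero_left] at h2
    have h3 := h ζ'
    have h4 := real_inner_le_norm ζ' z
    linarith

lemma leg_sub {ζ z : E2} (h : ∀ ζ, ‖ζ‖ - M ≤ w ζ) (hr : SubG w ζ z) {z' : E2} (hz' : ‖z'‖ ≤ 1) :
    leg w z + ⟪ζ, z' - z⟫ ≤ leg w z' := by
  rw [leg_eq hr, inner_sub_right]
  linarith [le_leg h hz' ζ]

lemma rel_of_leg {ζ z : E2} (h : ∀ ζ, ‖ζ‖ - M ≤ w ζ) (hz : ‖z‖ ≤ 1) (e : leg w z = ⟪ζ, z⟫ - w ζ) : SubG w ζ z := by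
  intro ζ'
  rw [inner_sub_left]
  linarith [le_leg h hz ζ']

lemma MA.int_int (h : MA w f lam M) {η : E2 → ℝ} (hη : Continuous η) (hs : HasCompactSupport η)
    (hb : tsupport η ⊆ ball 0 1) : Integrable (fun ζ => η (gradient w ζ)) := by
  obtain ⟨ρ, hρ, K, hK0, h0, hK⟩ := eta_facts hη hs hb
  have hi : Integrable ((closedBall (0:E2) ((w 0 + M) / (1 - ρ))).indicator (fun _ => K)) := by
    rw [integrable_indicator_iff measurableSet_closedBall]
    exact integrableOn_const (hs := measure_closedBall_lt_top.ne)
  refine hi.mono' (hη.measurable.comp (grad_meas _)).aestronglyMeasurable ?_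
  filter_upwards [h.sub1.ae_diff] with ζ hd
  by_cases hρ' : ρ < ‖gradient w ζ‖
  · rw [h0 _ hρ', norm_zero]
    exact Set.indicator_nonneg (fun _ _ => hK0) _
  · have := grad_small h.sub1 h.low le_rfl hρ (h.sub1.subG_grad hd).1 (not_lt.1 hρ')
    rw [Set.indicator_of_mem (by simpa using this)]
    exact hK _

lemma exists_eta {K O : Set E2} (hK : IsCompact K) (hO : IsOpen O) (hKO : K ⊆ O) :
    ∃ η : E2 → ℝ, Continuous η ∧ HasCompactSupport η ∧ tsupport η ⊆ O ∧ (∀ x ∈ K, η x = 1) ∧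
      ∀ x, 0 ≤ η x ∧ η x ≤ 1 := by
  obtain ⟨K', hK', hKK', hK'O⟩ := exists_compact_between hK hO hKO
  obtain ⟨η, h1, h2, h3, h4⟩ := exists_continuous_one_zero_of_isCompact hK
    (isOpen_interior (s := K')).isClosed_compl (by
      rw [Set.disjoint_compl_right_iff_subset]; exact hKK')
  have hsup : Function.support η ⊆ K' := by
    intro x hx
    by_contra hn
    exact hx (h2 (fun h => hn (interior_subset h)))
  have hts : tsupport η ⊆ K' := closure_minimal hsup hK'.isClosed
  exact ⟨η, η.continuous, h3, hts.trans hK'O, fun x hx => h1 hx, h4⟩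

lemma MA.meas_upper (h : MA w f lam M) {K O : Set E2} (hK : IsCompact K) (hO : IsOpen O) (hKO : K ⊆ O)
    (hOD : O ⊆ ball 0 1) {C : ℝ} (hC : ∀ z ∈ O, f z ≤ C) :
    volume {ζ | gradient w ζ ∈ K} ≤ ENNReal.ofReal (C * (volume O).toReal) := by
  obtain ⟨η, h1, h2, h3, h4, h5⟩ := exists_eta hK hO hKO
  have hfin : volume O ≠ ⊤ := ((measure_mono hOD).trans_lt measure_ball_lt_top).ne
  have hi := h.int_int h1 h2 (h3.trans hOD)
  have e1 : volume {ζ | gradient w ζ ∈ K} ≤ ∫⁻ ζ, ENNReal.ofReal (η (gradient w ζ)) := by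
    rw [show {ζ | gradient w ζ ∈ K} = gradient w ⁻¹' K from rfl, ← lintegral_indicator_one ((grad_meas w) hK.measurableSet)]
    apply lintegral_mono
    intro ζ
    by_cases hζ : gradient w ζ ∈ K
    · simp only
      rw [h4 _ hζ, Set.indicator_of_mem (show ζ ∈ gradient w ⁻¹' K from hζ)]
      simp
    · simp only
      rw [Set.indicator_of_notMem (show ζ ∉ gradient w ⁻¹' K from hζ)]
      simp
  refine e1.trans ?_
  rw [← ofReal_integral_eq_lintegral_ofReal hi (Eventually.of_forall fun x => (h5 _).1), h.star η h1 h2 (h3.trans hOD)]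
  apply ENNReal.ofReal_le_ofReal
  have e2 : ∫ z in ball (0:E2) 1, η z * f z ≤ ∫ z in ball (0:E2) 1, O.indicator (fun _ => C) z := by
    apply integral_mono
    · apply IntegrableOn.integrable
      apply Integrable.integrableOn
      have : Continuous (fun z => f z * η z) := cont_mul_of_tsupport h1 (h3.trans hOD) h.f_cont
      have h7 := this.integrable_of_hasCompactSupport (μ := volume) h2.mul_left
      simpa [mul_comm] using h7
    · apply Integrable.integrableOn
      rw [integrable_indicator_iff hO.measurableSet]
      exact integrableOn_const (hs := hfin)
    · intro z
      by_cases hz : z ∈ O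
      · simp only
        rw [Set.indicator_of_mem hz]
        have hf0 := h.f_low z (hOD hz)
        have := hC z hz
        nlinarith [h5 z, h.lam_pos]
      · simp only
        rw [Set.indicator_of_notMem hz, image_eq_zero_of_notMem_tsupport (fun h => hz (h3 h)), zero_mul]
  refine e2.trans (le_of_eq ?_)
  rw [setIntegral_indicator hO.measurableSet, Set.inter_eq_right.2 hOD, setIntegral_const, smul_eq_mul,
    measureReal_def, mul_comm]

lemma MA.meas_lower (h : MA w f lam M) {K O : Set E2} (hK : IsCompact K) (hO : IsOpen O) (hKO : K ⊆ O)
    (hOD : O ⊆ ball 0 1) :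
    ENNReal.ofReal (lam * (volume K).toReal) ≤ volume {ζ | gradient w ζ ∈ O} := by
  obtain ⟨η, h1, h2, h3, h4, h5⟩ := exists_eta hK hO hKO
  have hi := h.int_int h1 h2 (h3.trans hOD)
  have e1 : ∫⁻ ζ, ENNReal.ofReal (η (gradient w ζ)) ≤ volume {ζ | gradient w ζ ∈ O} := by
    rw [show {ζ | gradient w ζ ∈ O} = gradient w ⁻¹' O from rfl, ← lintegral_indicator_one ((grad_meas w) hO.measurableSet)]
    apply lintegral_mono
    intro ζ
    by_cases hζ : gradient w ζ ∈ O
    · simp only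
      rw [Set.indicator_of_mem (show ζ ∈ gradient w ⁻¹' O from hζ)]
      simpa using (h5 _).2
    · simp only
      rw [image_eq_zero_of_notMem_tsupport (fun h => hζ (h3 h))]
      simp
  refine le_trans ?_ e1
  rw [← ofReal_integral_eq_lintegral_ofReal hi (Eventually.of_forall fun x => (h5 _).1), h.star η h1 h2 (h3.trans hOD)]
  apply ENNReal.ofReal_le_ofReal
  have e2 : ∫ z in ball (0:E2) 1, K.indicator (fun _ => lam) z ≤ ∫ z in ball (0:E2) 1, η z * f z := by
    apply setIntegral_mono_on
    · apply Integrable.integrableOn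
      rw [integrable_indicator_iff hK.measurableSet]
      exact integrableOn_const (hs := hK.measure_lt_top.ne)
    · apply Integrable.integrableOn
      have : Continuous (fun z => f z * η z) := cont_mul_of_tsupport h1 (h3.trans hOD) h.f_cont
      have h7 := this.integrable_of_hasCompactSupport (μ := volume) h2.mul_left
      simpa [mul_comm] using h7
    · exact measurableSet_ball
    · intro z hzb
      have hf0 := h.f_low z hzb
      by_cases hz : z ∈ K
      · rw [Set.indicator_of_mem hz, h4 z hz]
        linarith
      · rw [Set.indicator_of_notMem hz]
        exact mul_nonneg (h5 z).1 (h.lam_pos.le.trans hf0)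
  refine le_trans (le_of_eq ?_) e2
  rw [setIntegral_indicator hK.measurableSet, Set.inter_eq_right.2 (hKO.trans hOD), setIntegral_const, smul_eq_mul,
    measureReal_def, mul_comm]

/-- closed box in an orthonormal frame -/
def cbox (b : OrthonormalBasis (Fin 2) ℝ E2) (m : E2) (l0 h0 l1 h1 : ℝ) : Set E2 :=
  {x | ⟪b 0, x - m⟫ ∈ Set.Icc l0 h0 ∧ ⟪b 1, x - m⟫ ∈ Set.Icc l1 h1}

/-- open box -/
def obox (b : OrthonormalBasis (Fin 2) ℝ E2) (m : E2) (l0 h0 l1 h1 : ℝ) : Set E2 :=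
  {x | ⟪b 0, x - m⟫ ∈ Set.Ioo l0 h0 ∧ ⟪b 1, x - m⟫ ∈ Set.Ioo l1 h1}

lemma frame_mp (b : OrthonormalBasis (Fin 2) ℝ E2) (m : E2) :
    MeasurePreserving (fun x : E2 => (fun i => ⟪b i, x - m⟫ : Fin 2 → ℝ)) volume volume := by
  have h2 := b.measurePreserving_repr
  have h3 : MeasurePreserving (fun x : E2 => x - m) volume volume := measurePreserving_sub_right volume m
  have h4 := (EuclideanSpace.volume_preserving_symm_measurableEquiv_toLp (Fin 2)).comp (h2.comp h3)
  have e : (fun x : E2 => (fun i => ⟪b i, x - m⟫ : Fin 2 → ℝ)) =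
      (MeasurableEquiv.toLp 2 (Fin 2 → ℝ)).symm ∘ b.repr ∘ fun x => x - m := by
    funext x i
    simp [OrthonormalBasis.repr_apply_apply, inner_sub_right]
  rw [e]
  exact h4

lemma volume_cbox (b : OrthonormalBasis (Fin 2) ℝ E2) (m : E2) (l0 h0 l1 h1 : ℝ) :
    volume (cbox b m l0 h0 l1 h1) = ENNReal.ofReal (h0 - l0) * ENNReal.ofReal (h1 - l1) := by
  have h := (frame_mp b m).measure_preimage (s := Set.Icc ![l0, l1] ![h0, h1]) measurableSet_Icc.nullMeasurableSet
  rw [Real.volume_Icc_pi, Fin.prod_univ_two] at h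
  simp only [Matrix.cons_val_zero, Matrix.cons_val_one] at h
  rw [← h]
  congr 1
  ext x
  simp only [cbox, Set.mem_ofPred_eq, Set.mem_preimage, Set.mem_Icc, Pi.le_def, Fin.forall_fin_two, Matrix.cons_val_zero,
    Matrix.cons_val_one]
  tauto

lemma volume_obox (b : OrthonormalBasis (Fin 2) ℝ E2) (m : E2) (l0 h0 l1 h1 : ℝ) :
    volume (obox b m l0 h0 l1 h1) = ENNReal.ofReal (h0 - l0) * ENNReal.ofReal (h1 - l1) := by
  have h := (frame_mp b m).measure_preimage (s := Set.pi Set.univ fun i => Set.Ioo (![l0, l1] i) (![h0, h1] i))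
    (MeasurableSet.univ_pi fun i => measurableSet_Ioo).nullMeasurableSet
  rw [Real.volume_pi_Ioo, Fin.prod_univ_two] at h
  simp only [Matrix.cons_val_zero, Matrix.cons_val_one] at h
  rw [← h]
  congr 1
  ext x
  simp [obox, Set.mem_pi, Fin.forall_fin_two]

lemma cbox_compact (b : OrthonormalBasis (Fin 2) ℝ E2) (m : E2) (l0 h0 l1 h1 : ℝ) : IsCompact (cbox b m l0 h0 l1 h1) := by
  apply Metric.isCompact_of_isClosed_isBounded
  · exact (isClosed_Icc.preimage (by fun_prop)).inter (isClosed_Icc.preimage (by fun_prop))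
  · refine (isBounded_iff_subset_closedBall m).2 ⟨(|l0| + |h0|) + (|l1| + |h1|), ?_⟩
    intro x hx
    rw [mem_closedBall, dist_eq_norm]
    obtain ⟨⟨a1, a2⟩, a3, a4⟩ := hx
    have h2 := b.sum_repr' (x - m)
    rw [Fin.sum_univ_two] at h2
    rw [← h2]
    refine (norm_add_le _ _).trans ?_
    rw [norm_smul, norm_smul, b.norm_eq_one, b.norm_eq_one, mul_one, mul_one, Real.norm_eq_abs, Real.norm_eq_abs]
    apply add_le_add
    · rw [abs_le]
      constructor <;> linarith [le_abs_self h0, neg_abs_le l0, abs_nonneg h0, abs_nonneg l0]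
    · rw [abs_le]
      constructor <;> linarith [le_abs_self h1, neg_abs_le l1, abs_nonneg h1, abs_nonneg l1]

lemma obox_open (b : OrthonormalBasis (Fin 2) ℝ E2) (m : E2) (l0 h0 l1 h1 : ℝ) : IsOpen (obox b m l0 h0 l1 h1) :=
  (isOpen_Ioo.preimage (by fun_prop)).inter (isOpen_Ioo.preimage (by fun_prop))

end partD0

section partD1
set_option linter.unusedSectionVars false
set_option linter.unusedVariables false
open MeasureTheory

/-- frame point -/
def PP (b : OrthonormalBasis (Fin 2) ℝ E2) (m : E2) (s y : ℝ) : E2 := m + s • b 0 + y • b 1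

lemma PP_mem (b : OrthonormalBasis (Fin 2) ℝ E2) (m : E2) {s y ρ : ℝ} (h : |s| + |y| < ρ) : PP b m s y ∈ ball m ρ := by
  rw [mem_ball, dist_eq_norm, PP, add_assoc, add_sub_cancel_left]
  refine (norm_add_le _ _).trans_lt ?_
  rw [norm_smul, norm_smul, b.norm_eq_one, b.norm_eq_one, mul_one, mul_one]
  exact h

lemma b_inner (b : OrthonormalBasis (Fin 2) ℝ E2) : ⟪b 0, b 0⟫ = 1 ∧ ⟪b 1, b 1⟫ = 1 ∧ ⟪b 0, b 1⟫ = 0 ∧ ⟪b 1, b 0⟫ = 0 := by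
  refine ⟨?_, ?_, ?_, ?_⟩ <;> simp [b.inner_eq_ite]

lemma PP_coord (b : OrthonormalBasis (Fin 2) ℝ E2) (m x : E2) : PP b m ⟪b 0, x - m⟫ ⟪b 1, x - m⟫ = x := by
  have h2 := b.sum_repr' (x - m)
  rw [Fin.sum_univ_two] at h2
  rw [PP, add_assoc, h2]
  abel

theorem lemmaD (b : OrthonormalBasis (Fin 2) ℝ E2) {F : E2 → ℝ} {m : E2} {ρ L r : ℝ} (hL : 0 < L) (hr : 0 < r)
    (hρ : L + r < ρ) (hF : ConvexOn ℝ (ball m ρ) F) (h0 : ∀ x ∈ ball m ρ, 0 ≤ F x)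
    (hseg : ∀ s, |s| ≤ L → F (PP b m s 0) = 0) :
    ∃ κ, 0 ≤ κ ∧ (∀ s y, |s| ≤ L → 0 ≤ y → y ≤ r → κ * y ≤ F (PP b m s y)) ∧
      ∀ τ > 0, ∃ δ0 > 0, δ0 ≤ r ∧ ∀ δ, δ ≤ δ0 → ∀ s y, |s| ≤ L / 2 → 0 < y → y ≤ δ →
        ∀ g, (∀ q ∈ ball m ρ, F (PP b m s y) + ⟪g, q - PP b m s y⟫ ≤ F q) →
          κ ≤ ⟪b 1, g⟫ ∧ ⟪b 1, g⟫ ≤ κ + τ ∧ |⟪b 0, g⟫| ≤ τ * δ := by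
  have hmem : ∀ s y, |s| ≤ L → 0 ≤ y → y ≤ r → PP b m s y ∈ ball m ρ := by
    intro s y h1 h2 h3
    apply PP_mem
    rw [abs_of_nonneg h2]
    linarith
  set Q : Set ℝ := {q | ∃ s y, |s| ≤ L ∧ 0 < y ∧ y ≤ r ∧ q = F (PP b m s y) / y} with hQ
  have hbdd : BddBelow Q := by
    refine ⟨0, ?_⟩
    rintro q ⟨s, y, h1, h2, h3, rfl⟩
    exact div_nonneg (h0 _ (hmem s y h1 h2.le h3)) h2.le
  have hne : Q.Nonempty := ⟨_, 0, r, by simpa using hL.le, hr, le_rfl, rfl⟩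
  have hκ0 : 0 ≤ sInf Q := by
    apply le_csInf hne
    rintro q ⟨s, y, h1, h2, h3, rfl⟩
    exact div_nonneg (h0 _ (hmem s y h1 h2.le h3)) h2.le
  have hκl : ∀ s y, |s| ≤ L → 0 ≤ y → y ≤ r → sInf Q * y ≤ F (PP b m s y) := by
    intro s y h1 h2 h3
    rcases h2.eq_or_lt with h | h
    · rw [← h, mul_zero]
      exact h0 _ (hmem s 0 h1 le_rfl hr.le)
    · rw [← le_div_iff₀ h]
      exact csInf_le hbdd ⟨s, y, h1, h, h3, rfl⟩
  refine ⟨sInf Q, hκ0, hκl, ?_⟩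
  intro τ hτ
  set κ := sInf Q with hκ
  set τ' := min (τ / 2) (L * τ / 4) with hτ'
  have hτ'0 : 0 < τ' := lt_min (by positivity) (by positivity)
  have hτ'1 : τ' ≤ τ / 2 := min_le_left _ _
  have hτ'2 : τ' ≤ L * τ / 4 := min_le_right _ _
  obtain ⟨q, ⟨s0, y0, hs0, hy0, hy0r, rfl⟩, hq⟩ := exists_lt_of_csInf_lt hne (show sInf Q < κ + τ' by linarith)
  rw [div_lt_iff₀ hy0] at hq
  have hup : ∀ s y, |s| ≤ 3 * L / 4 → 0 ≤ y → y ≤ y0 / 8 → F (PP b m s y) ≤ (κ + τ') * y := by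
    intro s y h1 h2 h3
    set θ := y / y0 with hθ
    have hθ0 : 0 ≤ θ := by positivity
    have hθ1 : θ ≤ 1 / 8 := by rw [hθ, div_le_iff₀ hy0]; linarith
    have hθy : θ * y0 = y := by rw [hθ]; field_simp
    have h1θ : 0 < 1 - θ := by linarith
    set s' := (s - θ * s0) / (1 - θ) with hs'
    have hs'e : (1 - θ) * s' = s - θ * s0 := by rw [hs']; field_simp
    have hs'L : |s'| ≤ L := by
      rw [hs', abs_div, abs_of_pos h1θ, div_le_iff₀ h1θ]
      have e1 := abs_sub s (θ * s0)
      have e2 : |θ * s0| ≤ 1 / 8 * L := by rw [abs_mul, abs_of_nonneg hθ0]; gcongr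
      nlinarith [abs_nonneg s]
    have hc := hF.2 (hmem s0 y0 hs0 hy0.le hy0r) (hmem s' 0 hs'L le_rfl hr.le) hθ0 h1θ.le (by ring)
    rw [hseg s' hs'L] at hc
    have e : θ • PP b m s0 y0 + (1 - θ) • PP b m s' 0 = PP b m s y := by
      have : PP b m s y = PP b m (θ * s0 + (1 - θ) * s') (θ * y0) := by
        rw [hs'e, hθy]; congr 1; ring
      rw [this]
      unfold PP
      module
    rw [e, smul_eq_mul, smul_eq_mul, mul_zero, add_zero] at hc
    calc _ ≤ θ * F (PP b m s0 y0) := hc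
      _ ≤ θ * ((κ + τ') * y0) := by gcongr
      _ = (κ + τ') * y := by rw [← hθy]; ring
  refine ⟨y0 / 16, by positivity, by linarith, ?_⟩
  intro δ hδ s y hs hy hyδ g hg
  have hsL : |s| ≤ L := by linarith
  obtain ⟨b00, b11, b01, b10⟩ := b_inner b
  have hl := hκl s y hsL hy.le (by linarith)
  have hu := hup s y (by linarith) hy.le (by linarith)
  have k1 := hg _ (hmem s 0 hsL le_rfl hr.le)
  have k2 := hg _ (hmem s (2 * y) hsL (by linarith) (by linarith))
  have hsp : |s + L / 4| ≤ 3 * L / 4 := by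
    refine (abs_add_le _ _).trans ?_
    rw [abs_of_pos (by linarith : 0 < L / 4)]; linarith
  have hsm : |s - L / 4| ≤ 3 * L / 4 := by
    refine (abs_sub _ _).trans ?_
    rw [abs_of_pos (by linarith : 0 < L / 4)]; linarith
  have k3 := hg _ (hmem (s + L / 4) y (by linarith) hy.le (by linarith))
  have k4 := hg _ (hmem (s - L / 4) y (by linarith) hy.le (by linarith))
  have d : ∀ s' y', ⟪g, PP b m s' y' - PP b m s y⟫ = (s' - s) * ⟪b 0, g⟫ + (y' - y) * ⟪b 1, g⟫ := by
    intro s' y'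
    have : PP b m s' y' - PP b m s y = (s' - s) • b 0 + (y' - y) • b 1 := by unfold PP; module
    rw [this, inner_add_right, real_inner_smul_right, real_inner_smul_right, real_inner_comm, real_inner_comm (b 1)]
  rw [d] at k1 k2 k3 k4
  rw [hseg s hsL] at k1
  have u2 := hup s (2 * y) (by linarith) (by linarith) (by linarith)
  have u3 := hup (s + L / 4) y hsp hy.le (by linarith)
  have u4 := hup (s - L / 4) y hsm hy.le (by linarith)
  have hyδ' : τ' * y ≤ L * τ / 4 * δ := by
    calc τ' * y ≤ τ' * δ := by gcongr
      _ ≤ L * τ / 4 * δ := by gcongr; linarith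
  refine ⟨?_, ?_, ?_⟩
  · have : κ * y ≤ ⟪b 1, g⟫ * y := by linarith
    exact le_of_mul_le_mul_right this hy
  · have : ⟪b 1, g⟫ * y ≤ (κ + 2 * τ') * y := by linarith
    have := le_of_mul_le_mul_right this hy
    linarith
  · rw [abs_le]
    constructor
    · have : L / 4 * (-⟪b 0, g⟫) ≤ L / 4 * (τ * δ) := by linarith
      have := le_of_mul_le_mul_left this (by linarith)
      linarith
    · have : L / 4 * (⟪b 0, g⟫) ≤ L / 4 * (τ * δ) := by linarith
      exact le_of_mul_le_mul_left this (by linarith)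

lemma exists_frame {x y : E2} (h : x ≠ y) : ∃ b : OrthonormalBasis (Fin 2) ℝ E2, y - x = ‖y - x‖ • b 0 := by
  have hn : 0 < ‖y - x‖ := norm_pos_iff.2 (sub_ne_zero.2 h.symm)
  have ho : Orthonormal ℝ (({0} : Set (Fin 2)).domRestrict fun _ => ‖y - x‖⁻¹ • (y - x)) := by
    constructor
    · intro i
      change ‖‖y - x‖⁻¹ • (y - x)‖ = 1
      rw [norm_smul, norm_inv, norm_norm, inv_mul_cancel₀ hn.ne']
    · intro i j hij
      exact absurd (Subtype.ext ((i.2 : i.1 = 0).trans (j.2 : j.1 = 0).symm)) hij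
  obtain ⟨b, hb⟩ := ho.exists_orthonormalBasis_extension_of_card_eq (by simp)
  refine ⟨b, ?_⟩
  rw [hb 0 rfl, smul_smul, mul_inv_cancel₀ hn.ne', one_smul]

end partD1

section partD2
set_option linter.unusedSectionVars false
set_option linter.unusedVariables false
open MeasureTheory

variable {w f : E2 → ℝ} {lam M : ℝ}

lemma SubG.conv {ζ z1 z2 : E2} (h1 : SubG w ζ z1) (h2 : SubG w ζ z2) {θ : ℝ} (h0 : 0 ≤ θ) (h3 : θ ≤ 1) :
    SubG w ζ (z1 + θ • (z2 - z1)) := by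
  intro ζ'
  have e1 := h1 ζ'
  have e2 := h2 ζ'
  rw [inner_add_right, real_inner_smul_right, inner_sub_right]
  nlinarith

lemma leg_convex (hs : Sub1 w) (h : ∀ ζ, ‖ζ‖ - M ≤ w ζ) : ConvexOn ℝ (ball (0:E2) 1) (leg w) := by
  refine ⟨convex_ball _ _, ?_⟩
  intro x hx y hy a b ha hb hab
  have hz := (convex_ball (0:E2) 1) hx hy ha hb hab
  rw [mem_ball_zero_iff] at hx hy hz
  obtain ⟨ζ, hζ⟩ := exists_rel hs h hz
  rw [leg_eq hζ, inner_add_right, real_inner_smul_right, real_inner_smul_right, smul_eq_mul, smul_eq_mul]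
  have e1 := le_leg h hx.le ζ
  have e2 := le_leg h hy.le ζ
  have : w ζ = a * w ζ + b * w ζ := by rw [← add_mul, hab, one_mul]
  nlinarith

/-- strict convexity of the dual side -/
theorem MA.d1 (h : MA w f lam M) {ζ z1 z2 : E2} (hz1 : ‖z1‖ < 1) (hz2 : ‖z2‖ < 1) (h1 : SubG w ζ z1)
    (h2 : SubG w ζ z2) : z1 = z2 := by
  by_contra hne
  obtain ⟨b, hb⟩ := exists_frame hne
  have hn : 0 < ‖z2 - z1‖ := norm_pos_iff.2 (sub_ne_zero.2 (Ne.symm hne))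
  set d := ‖z2 - z1‖ with hd
  set m : E2 := z1 + (1 / 2 : ℝ) • (z2 - z1) with hm
  have hmD : ‖m‖ < 1 := by
    have := (convex_ball (0:E2) 1).add_smul_sub_mem (x := z1) (y := z2) (by simpa using hz1) (by simpa using hz2)
      (t := 1 / 2) ⟨by norm_num, by norm_num⟩
    rwa [mem_ball_zero_iff] at this
  set ρ := 1 - ‖m‖ with hρ
  have hρ0 : 0 < ρ := by linarith
  have hball : ball m ρ ⊆ ball (0:E2) 1 := by
    apply ball_subset_ball'
    rw [dist_zero_right]; linarith
  set L := min (d / 2) (ρ / 4) with hL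
  have hL0 : 0 < L := lt_min (by positivity) (by positivity)
  have hL1 : L ≤ d / 2 := min_le_left _ _
  have hL2 : L ≤ ρ / 4 := min_le_right _ _
  set F : E2 → ℝ := fun z => leg w z - leg w m - ⟪ζ, z - m⟫ with hF
  have hsub : ∀ s, |s| ≤ L → SubG w ζ (PP b m s 0) := by
    intro s hs
    have e : PP b m s 0 = z1 + (1 / 2 + s / d) • (z2 - z1) := by
      have : s • b 0 = (s / d) • (z2 - z1) := by rw [hb, smul_smul, div_mul_cancel₀ _ hn.ne']
      rw [PP, hm, this, zero_smul, add_zero]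
      module
    rw [e]
    have h3 := abs_le.1 hs
    apply h1.conv h2
    · have : -(1 / 2) ≤ s / d := by rw [le_div_iff₀ hn]; linarith
      linarith
    · have : s / d ≤ 1 / 2 := by rw [div_le_iff₀ hn]; linarith
      linarith
  have hm0 : SubG w ζ m := by
    have := hsub 0 (by simpa using hL0.le)
    simpa [PP] using this
  have hFc : ConvexOn ℝ (ball m ρ) F := by
    have e1 := (leg_convex h.sub1 h.low).subset hball (convex_ball _ _)
    refine ⟨convex_ball _ _, ?_⟩
    intro x hx y hy α β hα hβ hαβ
    have e2 := e1.2 hx hy hα hβ hαβ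
    simp only [hF, smul_eq_mul] at e2 ⊢
    have e3 : ⟪ζ, α • x + β • y - m⟫ = α * ⟪ζ, x - m⟫ + β * ⟪ζ, y - m⟫ := by
      rw [inner_sub_right, inner_add_right, real_inner_smul_right, real_inner_smul_right, inner_sub_right, inner_sub_right]
      have : ⟪ζ, m⟫ = α * ⟪ζ, m⟫ + β * ⟪ζ, m⟫ := by rw [← add_mul, hαβ, one_mul]
      linarith
    have e4 : leg w m = α * leg w m + β * leg w m := by rw [← add_mul, hαβ, one_mul]
    rw [e3]
    linarith
  have hF0 : ∀ x ∈ ball m ρ, 0 ≤ F x := by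
    intro x hx
    have := leg_sub h.low hm0 (z' := x) (by have := hball hx; rw [mem_ball_zero_iff] at this; exact this.le)
    simp only [hF]
    linarith
  have hseg : ∀ s, |s| ≤ L → F (PP b m s 0) = 0 := by
    intro s hs
    simp only [hF]
    rw [leg_eq (hsub s hs), leg_eq hm0, inner_sub_right]
    ring
  obtain ⟨κ, hκ, -, hD⟩ := lemmaD b hL0 (show 0 < ρ / 4 by linarith) (show L + ρ / 4 < ρ by linarith) hFc hF0 hseg
  have hlam := h.lam_pos
  set τ := Real.sqrt (lam * L / 16) with hτ
  have hτ0 : 0 < τ := Real.sqrt_pos.2 (by positivity)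
  have hτ2 : τ ^ 2 = lam * L / 16 := Real.sq_sqrt (by positivity)
  obtain ⟨δ, hδ0, hδr, hδ⟩ := hD τ hτ0
  have hOD : obox b m (-(L / 2)) (L / 2) 0 δ ⊆ ball m ρ := by
    intro x hx
    rw [← PP_coord b m x]
    apply PP_mem
    have e1 : |⟪b 0, x - m⟫| < L / 2 := abs_lt.2 hx.1
    have e2 := hx.2
    rw [abs_of_pos e2.1]
    linarith [e2.2]
  have hK := cbox_compact b m (-(L / 4)) (L / 4) (δ / 4) (3 * δ / 4)
  have hKO : cbox b m (-(L / 4)) (L / 4) (δ / 4) (3 * δ / 4) ⊆ obox b m (-(L / 2)) (L / 2) 0 δ := by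
    rintro x ⟨⟨e1, e2⟩, e3, e4⟩
    exact ⟨⟨by linarith, by linarith⟩, by linarith, by linarith⟩
  have hlow := h.meas_lower hK (obox_open b m _ _ _ _) hKO (hOD.trans hball)
  have hup : volume {ζ' | gradient w ζ' ∈ obox b m (-(L / 2)) (L / 2) 0 δ} ≤ volume (cbox b ζ (-(τ * δ)) (τ * δ) κ (κ + τ)) := by
    apply measure_mono_ae
    filter_upwards [h.sub1.ae_diff] with ζ' hd' hmem
    have hx : gradient w ζ' ∈ obox b m (-(L / 2)) (L / 2) 0 δ := hmem
    have hsub' := (h.sub1.subG_grad hd').1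
    have e1 : |⟪b 0, gradient w ζ' - m⟫| < L / 2 := abs_lt.2 hx.1
    have := hδ δ le_rfl ⟪b 0, gradient w ζ' - m⟫ ⟪b 1, gradient w ζ' - m⟫ e1.le hx.2.1 hx.2.2.le (ζ' - ζ) (by
      rw [PP_coord]
      intro q hq
      have e2 := leg_sub h.low hsub' (z' := q) (by have := hball hq; rw [mem_ball_zero_iff] at this; exact this.le)
      simp only [hF]
      have e3 : ⟪ζ, q - m⟫ = ⟪ζ, q - gradient w ζ'⟫ + ⟪ζ, gradient w ζ' - m⟫ := by
        rw [← inner_add_right]; congr 1; abel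
      rw [inner_sub_left, e3]
      linarith)
    exact ⟨abs_le.1 this.2.2, this.1, this.2.1⟩
  have hfin := hlow.trans hup
  rw [volume_cbox, volume_cbox, ENNReal.toReal_mul, ENNReal.toReal_ofReal (by linarith), ENNReal.toReal_ofReal (by linarith),
    ← ENNReal.ofReal_mul (by nlinarith), ENNReal.ofReal_le_ofReal_iff (by
      have : 0 < τ * δ := by positivity
      nlinarith)] at hfin
  have e5 : lam * ((L / 4 - -(L / 4)) * (3 * δ / 4 - δ / 4)) = lam * L / 4 * δ := by ring
  have e6 : (τ * δ - -(τ * δ)) * (κ + τ - κ) = 2 * τ ^ 2 * δ := by ring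
  rw [e5, e6, hτ2] at hfin
  have : 0 < lam * L * δ := by positivity
  linarith

/-- differentiability of the Legendre transform -/
theorem MA.d2 (h : MA w f lam M) {z ζ1 ζ2 : E2} (hz : ‖z‖ < 1) (h1 : SubG w ζ1 z)
    (h2 : SubG w ζ2 z) : ζ1 = ζ2 := by
  by_contra hne
  obtain ⟨b, hb⟩ := exists_frame hne
  have hn : 0 < ‖ζ2 - ζ1‖ := norm_pos_iff.2 (sub_ne_zero.2 (Ne.symm hne))
  set d := ‖ζ2 - ζ1‖ with hd
  set m : E2 := ζ1 + (1 / 2 : ℝ) • (ζ2 - ζ1) with hm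
  have hleg := leg_eq h1
  have hleg2 := leg_eq h2
  set F : E2 → ℝ := fun ζ => w ζ - (⟪ζ, z⟫ - leg w z) with hF
  have hF0' : ∀ x, 0 ≤ F x := fun x => by
    have := le_leg h.low hz.le x
    simp only [hF]; linarith
  have hFc' : ConvexOn ℝ Set.univ F := by
    have e1 := h.sub1.convex
    refine ⟨convex_univ, ?_⟩
    intro x hx y hy α β hα hβ hαβ
    have e2 := e1.2 hx hy hα hβ hαβ
    simp only [hF, smul_eq_mul] at e2 ⊢
    rw [inner_add_left, real_inner_smul_left, real_inner_smul_left]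
    have e4 : leg w z = α * leg w z + β * leg w z := by rw [← add_mul, hαβ, one_mul]
    linarith
  set L := d / 2 with hL
  have hL0 : 0 < L := by positivity
  have hseg : ∀ s, |s| ≤ L → F (PP b m s 0) = 0 := by
    intro s hs
    have e : PP b m s 0 = (1 / 2 - s / d) • ζ1 + (1 / 2 + s / d) • ζ2 := by
      have : s • b 0 = (s / d) • (ζ2 - ζ1) := by rw [hb, smul_smul, div_mul_cancel₀ _ hn.ne']
      rw [PP, hm, this, zero_smul, add_zero]
      module
    have h3 := abs_le.1 hs
    have q1 : -(1 / 2) ≤ s / d := by rw [le_div_iff₀ hn]; linarith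
    have q2 : s / d ≤ 1 / 2 := by rw [div_le_iff₀ hn]; linarith
    apply le_antisymm _ (hF0' _)
    rw [e]
    refine (hFc'.2 (Set.mem_univ ζ1) (Set.mem_univ ζ2) (by linarith) (by linarith) (by ring)).trans ?_
    have f1 : F ζ1 = 0 := by simp only [hF]; linarith
    have f2 : F ζ2 = 0 := by simp only [hF]; linarith
    rw [f1, f2]
    simp
  obtain ⟨κ, hκ, hκl, hD⟩ := lemmaD b hL0 (show (0:ℝ) < 1 by norm_num) (show L + 1 < L + 2 by linarith)
    (hFc'.subset (Set.subset_univ _) (convex_ball m (L + 2))) (fun x _ => hF0' x) hseg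
  have hm0 : F m = 0 := by
    have := hseg 0 (by simpa using hL0.le)
    simpa [PP] using this
  -- κ n is a subgradient at m
  have hsg : ∀ q, κ * ⟪b 1, q - m⟫ ≤ F q := by
    intro q
    obtain ⟨t, ht0, ht1, hs, hy⟩ : ∃ t : ℝ, 0 < t ∧ t ≤ 1 ∧ |t * ⟪b 0, q - m⟫| ≤ L ∧ |t * ⟪b 1, q - m⟫| ≤ 1 := by
      have l1 : Tendsto (fun t : ℝ => |t * ⟪b 0, q - m⟫|) (𝓝[>] 0) (𝓝 |0 * ⟪b 0, q - m⟫|) :=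
        ((by fun_prop : Continuous fun t : ℝ => |t * ⟪b 0, q - m⟫|).tendsto 0).mono_left nhdsWithin_le_nhds
      have l2 : Tendsto (fun t : ℝ => |t * ⟪b 1, q - m⟫|) (𝓝[>] 0) (𝓝 |0 * ⟪b 1, q - m⟫|) :=
        ((by fun_prop : Continuous fun t : ℝ => |t * ⟪b 1, q - m⟫|).tendsto 0).mono_left nhdsWithin_le_nhds
      rw [zero_mul, abs_zero] at l1 l2
      have l3 : ∀ᶠ t : ℝ in 𝓝[>] 0, t ∈ Set.Ioc (0:ℝ) 1 := Ioc_mem_nhdsGT one_pos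
      obtain ⟨t, a1, a2, a3⟩ := ((l1.eventually (ge_mem_nhds hL0)).and ((l2.eventually (ge_mem_nhds one_pos)).and l3)).exists
      exact ⟨t, a3.1, a3.2, a1, a2⟩
    have hqt : PP b m (t * ⟪b 0, q - m⟫) (t * ⟪b 1, q - m⟫) = (1 - t) • m + t • q := by
      have := PP_coord b m q
      conv_rhs => rw [← this]
      unfold PP
      module
    have hc := hFc'.2 (Set.mem_univ m) (Set.mem_univ q) (by linarith : 0 ≤ 1 - t) ht0.le (by ring)
    rw [hm0, ← hqt, smul_eq_mul, smul_eq_mul, mul_zero, zero_add] at hc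
    have : t * (κ * ⟪b 1, q - m⟫) ≤ t * F q := by
      rcases le_total 0 ⟪b 1, q - m⟫ with hp | hp
      · have := hκl _ _ hs (by positivity) ((abs_le.1 hy).2)
        linarith
      · have := mul_nonneg ht0.le (hF0' q)
        have : κ * ⟪b 1, q - m⟫ ≤ 0 := mul_nonpos_of_nonneg_of_nonpos hκ hp
        nlinarith
    exact le_of_mul_le_mul_left this ht0
  have hmz : SubG w m z := by
    intro ζ'
    have e1 := hF0' ζ'
    simp only [hF] at e1 hm0
    rw [inner_sub_left]
    linarith
  have hmκ : SubG w m (z + κ • b 1) := by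
    intro ζ'
    have e1 := hsg ζ'
    simp only [hF] at e1 hm0
    rw [inner_add_right, real_inner_smul_right, real_inner_comm (b 1), inner_sub_left ζ' m z]
    linarith
  have hκ0 : κ = 0 := by
    by_contra hκne
    have hκp : 0 < κ := lt_of_le_of_ne hκ (Ne.symm hκne)
    set σ := min 1 ((1 - ‖z‖) / (2 * κ)) with hσ
    have hσ0 : 0 < σ := lt_min one_pos (div_pos (by linarith) (by positivity))
    have hσ1 : σ ≤ 1 := min_le_left _ _
    have hσ2 : σ * κ ≤ (1 - ‖z‖) / 2 := by
      calc σ * κ ≤ (1 - ‖z‖) / (2 * κ) * κ := by gcongr; exact min_le_right _ _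
        _ = _ := by field_simp
    have e1 := hmz.conv hmκ hσ0.le hσ1
    rw [add_sub_cancel_left, smul_smul] at e1
    have e2 : ‖z + (σ * κ) • b 1‖ < 1 := by
      refine (norm_add_le _ _).trans_lt ?_
      rw [norm_smul, b.norm_eq_one, mul_one, Real.norm_of_nonneg (by positivity)]
      linarith
    have e3 := h.d1 hz e2 hmz e1
    have e4 : (σ * κ) • b 1 = 0 := by
      have := e3.symm
      rwa [add_eq_left] at this
    have e5 := congrArg norm e4
    rw [norm_smul, b.norm_eq_one, mul_one, norm_zero, norm_eq_zero] at e5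
    exact (mul_pos hσ0 hκp).ne' e5
  -- bound of f near z
  obtain ⟨C, ρ, hρ0, hC0, hC⟩ : ∃ C ρ : ℝ, 0 < ρ ∧ 0 < C ∧ ∀ x ∈ ball z ρ, x ∈ ball (0:E2) 1 ∧ f x ≤ C := by
    have hzm : z ∈ ball (0:E2) 1 := by simpa using hz
    have e1 : ∀ᶠ x in 𝓝 z, f x < f z + 1 :=
      (h.f_cont.continuousAt (isOpen_ball.mem_nhds hzm)).eventually (gt_mem_nhds (by linarith))
    obtain ⟨ρ, hρ, hb'⟩ := Metric.eventually_nhds_iff_ball.1 (e1.and (isOpen_ball.mem_nhds hzm))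
    exact ⟨f z + 1, ρ, hρ, by linarith [h.f_low z hzm, h.lam_pos], fun x hx => ⟨(hb' x hx).2, (hb' x hx).1.le⟩⟩
  set τ := min (ρ / 8) (Real.sqrt (L / (32 * C))) with hτ
  have hτ0 : 0 < τ := lt_min (by positivity) (Real.sqrt_pos.2 (by positivity))
  have hτρ : τ ≤ ρ / 8 := min_le_left _ _
  have hτ2 : τ ^ 2 ≤ L / (32 * C) := by
    calc τ ^ 2 ≤ (Real.sqrt (L / (32 * C))) ^ 2 := by gcongr; exact min_le_right _ _
      _ = _ := Real.sq_sqrt (by positivity)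
  obtain ⟨δ, hδ0, hδr, hδ⟩ := hD τ hτ0
  have hKO : cbox b z (-(τ * δ)) (τ * δ) 0 τ ⊆ obox b z (-(2 * τ * δ)) (2 * τ * δ) (-(2 * τ)) (2 * τ) := by
    have : 0 < τ * δ := by positivity
    rintro x ⟨⟨e1, e2⟩, e3, e4⟩
    exact ⟨⟨by linarith, by linarith⟩, by linarith, by linarith⟩
  have hOρ : obox b z (-(2 * τ * δ)) (2 * τ * δ) (-(2 * τ)) (2 * τ) ⊆ ball z ρ := by
    intro x hx
    rw [← PP_coord b z x]
    apply PP_mem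
    have e1 : |⟪b 0, x - z⟫| < 2 * τ * δ := abs_lt.2 hx.1
    have e2 : |⟪b 1, x - z⟫| < 2 * τ := abs_lt.2 hx.2
    have e3 : 2 * τ * δ ≤ 2 * τ * 1 := by gcongr
    linarith
  have hup := h.meas_upper (cbox_compact b z _ _ _ _) (obox_open b z _ _ _ _) hKO
    (fun x hx => (hC x (hOρ hx)).1) (fun x hx => (hC x (hOρ hx)).2)
  have hlow : volume (obox b m (-(L / 2)) (L / 2) 0 δ) ≤ volume {ζ' | gradient w ζ' ∈ cbox b z (-(τ * δ)) (τ * δ) 0 τ} := by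
    apply measure_mono_ae
    filter_upwards [h.sub1.ae_diff] with ζ' hd' hmem
    have hx : ζ' ∈ obox b m (-(L / 2)) (L / 2) 0 δ := hmem
    have hsub' := (h.sub1.subG_grad hd').1
    have e1 : |⟪b 0, ζ' - m⟫| < L / 2 := abs_lt.2 hx.1
    have := hδ δ le_rfl ⟪b 0, ζ' - m⟫ ⟪b 1, ζ' - m⟫ e1.le hx.2.1 hx.2.2.le (gradient w ζ' - z) (by
      rw [PP_coord]
      intro q hq
      have e2 := hsub' q
      simp only [hF]
      have e3 : ⟪z, q - ζ'⟫ = ⟪q, z⟫ - ⟪ζ', z⟫ := by rw [real_inner_comm, inner_sub_left]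
      have e4 := real_inner_comm (gradient w ζ') (q - ζ')
      rw [inner_sub_left, e3]
      linarith)
    rw [hκ0, zero_add] at this
    exact ⟨abs_le.1 this.2.2, this.1, this.2.1⟩
  have hfin := hlow.trans hup
  have hτδ : 0 < τ * δ := by positivity
  rw [volume_obox, volume_obox, ENNReal.toReal_mul, ENNReal.toReal_ofReal (by linarith), ENNReal.toReal_ofReal (by linarith),
    ← ENNReal.ofReal_mul (by linarith), ENNReal.ofReal_le_ofReal_iff (by
      apply mul_nonneg hC0.le
      apply mul_nonneg <;> linarith)] at hfin
  have e5 : (L / 2 - -(L / 2)) * (δ - 0) = L * δ := by ring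
  have e6 : C * ((2 * τ * δ - -(2 * τ * δ)) * (2 * τ - -(2 * τ))) = 16 * C * τ ^ 2 * δ := by ring
  rw [e5, e6] at hfin
  have e7 : 16 * C * τ ^ 2 * δ ≤ 16 * C * (L / (32 * C)) * δ := by gcongr
  have e8 : 16 * C * (L / (32 * C)) * δ = L * δ / 2 := by field_simp; ring
  have : 0 < L * δ := by positivity
  linarith

end partD2

section partD3
set_option linter.unusedSectionVars false
set_option linter.unusedVariables false
open MeasureTheory

variable {w f : E2 → ℝ} {lam M : ℝ}

open Classical in
/-- the gradient of the Legendre transform -/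
def ZZ (w : E2 → ℝ) (z : E2) : E2 := if h : ∃ ζ, SubG w ζ z then h.choose else 0

lemma MA.zz (h : MA w f lam M) {z : E2} (hz : ‖z‖ < 1) : SubG w (ZZ w z) z := by
  have he := exists_rel h.sub1 h.low hz
  rw [ZZ, dif_pos he]
  exact he.choose_spec

lemma MA.zz_unique (h : MA w f lam M) {z ζ : E2} (hz : ‖z‖ < 1) (hr : SubG w ζ z) : ζ = ZZ w z :=
  h.d2 hz hr (h.zz hz)

lemma MA.zz_cont (h : MA w f lam M) {z : E2} (hz : ‖z‖ < 1) : ContinuousAt (ZZ w) z := by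
  obtain ⟨ρ, h1, h2⟩ := exists_between hz
  refine (isCompact_closedBall (0:E2) ((w 0 + M) / (1 - ρ))).tendsto_nhds_of_unique_mapClusterPt ?_ ?_
  · have : ∀ᶠ z' : E2 in 𝓝 z, ‖z'‖ < ρ := continuous_norm.continuousAt.eventually_lt continuousAt_const h1
    filter_upwards [this] with z' hz'
    rw [mem_closedBall_zero_iff]
    exact grad_small h.sub1 h.low le_rfl h2 (h.zz (hz'.trans h2)) hz'.le
  · intro y hy hc
    rw [mapClusterPt_iff_ultrafilter] at hc
    obtain ⟨U, hU, hy⟩ := hc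
    refine h.zz_unique hz ?_
    intro ζ'
    have hid : Tendsto (fun z' : E2 => z') U (𝓝 z) := hU
    refine le_of_tendsto ?_ (f := fun z' => w (ZZ w z') + ⟪ζ' - ZZ w z', z'⟫) (x := (U : Filter E2)) ?_
    · exact ((h.sub1.cont.tendsto y).comp hy).add ((tendsto_const_nhds.sub hy).inner hid)
    · have : ∀ᶠ z' : E2 in 𝓝 z, ‖z'‖ < 1 := continuous_norm.continuousAt.eventually_lt continuousAt_const hz
      filter_upwards [hU this] with z' hz'
      exact h.zz hz' ζ'

lemma MA.leg_ge (h : MA w f lam M) {z z' : E2} (hz : ‖z‖ < 1) (hz' : ‖z'‖ < 1) :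
    leg w z + ⟪ZZ w z, z' - z⟫ ≤ leg w z' := leg_sub h.low (h.zz hz) hz'.le

lemma MA.zz_mono (h : MA w f lam M) {z z' : E2} (hz : ‖z‖ < 1) (hz' : ‖z'‖ < 1) (hne : z ≠ z') :
    0 < ⟪ZZ w z' - ZZ w z, z' - z⟫ := by
  have h1 := h.leg_ge hz hz'
  have h2 := h.leg_ge hz' hz
  have e : ⟪ZZ w z', z - z'⟫ = - ⟪ZZ w z', z' - z⟫ := by rw [← inner_neg_right, neg_sub]
  rw [inner_sub_left]
  rcases (by linarith : ⟪ZZ w z, z' - z⟫ ≤ ⟪ZZ w z', z' - z⟫).lt_or_eq with h3 | h3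
  · linarith
  · exfalso
    apply hne
    have h4 : leg w z' = leg w z + ⟪ZZ w z, z' - z⟫ := by linarith
    rw [leg_eq (h.zz hz), inner_sub_right] at h4
    have h5 : SubG w (ZZ w z) z' := rel_of_leg h.low hz'.le (by linarith)
    exact h.d1 hz hz' (h.zz hz) h5

lemma MA.leg_hasFDeriv (h : MA w f lam M) {z : E2} (hz : ‖z‖ < 1) :
    HasFDerivAt (leg w) (innerSL ℝ (ZZ w z)) z := by
  rw [hasFDerivAt_iff_isLittleO, Asymptotics.isLittleO_iff]
  intro c hc
  have h1 : ∀ᶠ z' : E2 in 𝓝 z, ‖z'‖ < 1 := continuous_norm.continuousAt.eventually_lt continuousAt_const hz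
  have h2 : ∀ᶠ z' : E2 in 𝓝 z, ‖ZZ w z' - ZZ w z‖ < c :=
    ((h.zz_cont hz).sub continuousAt_const).norm.eventually_lt continuousAt_const (by simpa using hc)
  filter_upwards [h1, h2] with z' h3 h4
  have e1 := h.leg_ge hz h3
  have e2 := h.leg_ge h3 hz
  have e : ⟪ZZ w z', z - z'⟫ = - ⟪ZZ w z', z' - z⟫ := by rw [← inner_neg_right, neg_sub]
  have e3 := real_inner_le_norm (ZZ w z' - ZZ w z) (z' - z)
  have e4 : ‖ZZ w z' - ZZ w z‖ * ‖z' - z‖ ≤ c * ‖z' - z‖ := by gcongr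
  rw [inner_sub_left] at e3
  simp only [innerSL_apply_apply, Real.norm_eq_abs]
  rw [abs_le]
  constructor <;> nlinarith [norm_nonneg (z' - z)]

/-- if the gradient of `w` at a differentiability point lies in the disc, then it inverts `ZZ` -/
lemma MA.zz_grad (h : MA w f lam M) {ζ : E2} (hd : DifferentiableAt ℝ w ζ) (hz : ‖gradient w ζ‖ < 1) :
    ZZ w (gradient w ζ) = ζ := (h.zz_unique hz (h.sub1.subG_grad hd).1).symm

lemma MA.grad_zz (h : MA w f lam M) {z : E2} (hz : ‖z‖ < 1) (hd : DifferentiableAt ℝ w (ZZ w z)) :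
    gradient w (ZZ w z) = z := (h.zz hz).grad hd

/-- point with coordinates -/
def mk2 (x y : ℝ) : E2 := !₂[x, y]

@[simp] lemma mk2_0 (x y : ℝ) : (mk2 x y) 0 = x := rfl
@[simp] lemma mk2_1 (x y : ℝ) : (mk2 x y) 1 = y := rfl
lemma mk2_eta (z : E2) : mk2 (z 0) (z 1) = z := by
  ext i
  fin_cases i <;> simp [mk2]

lemma mk2_eq (x y : ℝ) : mk2 x y = x • ee 0 + y • ee 1 := by
  ext i
  fin_cases i <;> simp [mk2, ee]

lemma mk2_contDiff {n : WithTop ℕ∞} : ContDiff ℝ n (fun p : ℝ × ℝ => mk2 p.1 p.2) := by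
  simp only [mk2_eq]
  fun_prop

lemma mk2_cont : Continuous (fun p : ℝ × ℝ => mk2 p.1 p.2) := (mk2_contDiff (n := 0)).continuous

@[fun_prop] lemma mk2_cont' {X : Type*} [TopologicalSpace X] {a b : X → ℝ} (ha : Continuous a) (hb : Continuous b) :
    Continuous (fun x => mk2 (a x) (b x)) := mk2_cont.comp (ha.prodMk hb)

lemma inner_E2 (a b : E2) : ⟪a, b⟫ = a 0 * b 0 + a 1 * b 1 := by
  simp [PiLp.inner_apply, Fin.sum_univ_two, mul_comm]

lemma norm_sq_E2 (a : E2) : ‖a‖ ^ 2 = a 0 ^ 2 + a 1 ^ 2 := by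
  rw [EuclideanSpace.norm_sq_eq]; simp [Fin.sum_univ_two]

lemma mk2_mp : MeasurePreserving (fun p : ℝ × ℝ => mk2 p.1 p.2) volume volume := by
  have h1 := (volume_preserving_finTwoArrow ℝ).symm
  have h2 := (EuclideanSpace.volume_preserving_symm_measurableEquiv_toLp (Fin 2)).symm
  have h3 := h2.comp h1
  have e : (fun p : ℝ × ℝ => mk2 p.1 p.2) = (MeasurableEquiv.toLp 2 (Fin 2 → ℝ)).symm.symm ∘ (MeasurableEquiv.finTwoArrow).symm := by
    funext p
    rfl
  rw [e]
  exact h3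

lemma mk2_emb : MeasurableEmbedding (fun p : ℝ × ℝ => mk2 p.1 p.2) := by
  have e : (fun p : ℝ × ℝ => mk2 p.1 p.2) = (MeasurableEquiv.toLp 2 (Fin 2 → ℝ)).symm.symm ∘ (MeasurableEquiv.finTwoArrow).symm := by
    funext p
    rfl
  rw [e]
  exact (MeasurableEquiv.measurableEmbedding _).comp (MeasurableEquiv.measurableEmbedding _)

lemma integrable_mk2 {F : E2 → ℝ} (hF : Integrable F) : Integrable (fun p : ℝ × ℝ => F (mk2 p.1 p.2)) :=
  mk2_mp.integrable_comp_of_integrable hF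

lemma int_E2 {F : E2 → ℝ} (hF : Integrable F) : ∫ z, F z = ∫ x, ∫ y, F (mk2 x y) := by
  rw [← mk2_mp.integral_comp mk2_emb, Measure.volume_eq_prod, integral_prod]
  have := integrable_mk2 hF
  rwa [Measure.volume_eq_prod] at this

lemma int_E2_swap {F : E2 → ℝ} (hF : Integrable F) : ∫ z, F z = ∫ y, ∫ x, F (mk2 x y) := by
  rw [int_E2 hF]
  have := integrable_mk2 hF
  rw [Measure.volume_eq_prod] at this
  exact integral_integral_swap this

end partD3

section partE1
set_option linter.unusedSectionVars false
set_option linter.unusedVariables false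
open MeasureTheory

/-- the layer function -/
def layer (θ m : ℝ → ℝ) (t : ℝ) : ℝ := - ∫ s in {s | t < m s}, deriv θ s

lemma layer_congr {θ m : ℝ → ℝ} {t : ℝ} {S : Set ℝ} (hS : MeasurableSet S) (hm : Continuous m)
    (h : ∀ s, deriv θ s ≠ 0 → (t < m s ↔ s ∈ S)) : layer θ m t = - ∫ s in S, deriv θ s := by
  rw [layer]
  have h1 : MeasurableSet {s | t < m s} := (isOpen_lt continuous_const hm).measurableSet
  rw [← integral_indicator h1, ← integral_indicator hS]
  congr 2
  funext s
  by_cases h2 : deriv θ s = 0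
  · simp [Set.indicator, h2]
  · have := h s h2
    by_cases h3 : s ∈ S
    · rw [Set.indicator_of_mem h3, Set.indicator_of_mem (show s ∈ {s | t < m s} from this.2 h3)]
    · rw [Set.indicator_of_notMem h3, Set.indicator_of_notMem (show s ∉ {s | t < m s} from fun h => h3 (this.1 h))]

lemma layer_step {θ m : ℝ → ℝ} (hθ : ContDiff ℝ 1 θ) (hs : HasCompactSupport θ) (hm : Continuous m) {t P : ℝ}
    (h : ∀ s, deriv θ s ≠ 0 → (t < m s ↔ P < s)) : layer θ m t = θ P := by
  rw [layer_congr (measurableSet_Ioi (a := P)) hm h, hs.integral_Ioi_deriv_eq hθ, neg_neg]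

lemma layer_lt {θ m : ℝ → ℝ} (hθ : ContDiff ℝ 1 θ) (hs : HasCompactSupport θ) (hm : Continuous m) {t : ℝ}
    (h : ∀ s, deriv θ s ≠ 0 → t < m s) : layer θ m t = 0 := by
  rw [layer_congr MeasurableSet.univ hm (S := Set.univ) (by simpa using h), Measure.restrict_univ,
    integral_eq_zero_of_hasDerivAt_of_integrable (f := θ)
    (fun x => (hθ.differentiable (by norm_num) x).hasDerivAt)
    ((hθ.continuous_deriv le_rfl).integrable_of_hasCompactSupport hs.deriv)
    (hθ.continuous.integrable_of_hasCompactSupport hs), neg_zero]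

lemma layer_ge {θ m : ℝ → ℝ} (hθ : ContDiff ℝ 1 θ) (hs : HasCompactSupport θ) (hm : Continuous m) {t : ℝ}
    (h : ∀ s, deriv θ s ≠ 0 → m s ≤ t) : layer θ m t = 0 := by
  rw [layer_congr MeasurableSet.empty hm (S := ∅) (by simpa using h)]
  simp

lemma layer_fubini {θ m h : ℝ → ℝ} (hθ : ContDiff ℝ 1 θ) (hs : HasCompactSupport θ) (hm : Continuous m)
    (hh : Integrable h) :
    ∫ t, h t * layer θ m t = - ∫ s, deriv θ s * ∫ t in Set.Iio (m s), h t := by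
  have hk := (hθ.continuous_deriv le_rfl).integrable_of_hasCompactSupport (μ := volume) hs.deriv
  have hS : MeasurableSet {q : ℝ × ℝ | q.1 < m q.2} :=
    (isOpen_lt continuous_fst (hm.comp continuous_snd)).measurableSet
  have hi := (hh.mul_prod hk).indicator hS
  have e1 : ∀ t, h t * layer θ m t = - ∫ s, {q : ℝ × ℝ | q.1 < m q.2}.indicator (fun q => h q.1 * deriv θ q.2) (t, s) := by
    intro t
    rw [layer, mul_neg, ← integral_indicator (isOpen_lt continuous_const hm).measurableSet, ← integral_const_mul]
    congr 2
    funext s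
    by_cases h3 : t < m s
    · rw [Set.indicator_of_mem (by exact h3), Set.indicator_of_mem (by exact h3)]
    · rw [Set.indicator_of_notMem (by exact h3), Set.indicator_of_notMem (by exact h3), mul_zero]
  simp only [e1]
  rw [integral_neg, integral_integral_swap (f := fun t s => {q : ℝ × ℝ | q.1 < m q.2}.indicator (fun q => h q.1 * deriv θ q.2) (t, s)) hi]
  congr 2
  funext s
  rw [← integral_indicator measurableSet_Iio, ← integral_const_mul]
  congr 1
  funext t
  by_cases h3 : t < m s
  · rw [Set.indicator_of_mem (by exact h3), Set.indicator_of_mem (by exact h3), mul_comm]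
  · rw [Set.indicator_of_notMem (by exact h3), Set.indicator_of_notMem (by exact h3), mul_zero]

/-- primitive in the second variable -/
def GG (g : E2 → ℝ) (x Y : ℝ) : ℝ := ∫ t in Set.Iio Y, g (mk2 x t)

variable {g : E2 → ℝ}

lemma g_slice_supp (hs : HasCompactSupport g) : ∃ R, ∀ x t, t ∉ Set.Icc (-R) R → g (mk2 x t) = 0 := by
  obtain ⟨R, hR⟩ := hs.isCompact.isBounded.subset_closedBall (0:E2)
  refine ⟨R, fun x t ht => ?_⟩
  by_contra hne
  apply ht
  have h1 := hR (subset_tsupport _ (Function.mem_support.2 hne))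
  rw [mem_closedBall_zero_iff] at h1
  have h2 := EuclideanSpace.norm_eq (mk2 x t)
  have h3 : |t| ≤ ‖mk2 x t‖ := by
    have := PiLp.norm_apply_le (mk2 x t) 1
    simpa using this
  exact abs_le.1 (h3.trans h1)

lemma g_slice_int (hg : Continuous g) (hs : HasCompactSupport g) (x : ℝ) : Integrable (fun t => g (mk2 x t)) := by
  obtain ⟨R, hR⟩ := g_slice_supp hs
  have hc : HasCompactSupport (fun t => g (mk2 x t)) :=
    HasCompactSupport.intro (isCompact_Icc (a := -R) (b := R)) (fun t ht => hR x t ht)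
  exact (hg.comp (by fun_prop)).integrable_of_hasCompactSupport hc

lemma GG_deriv (hg : Continuous g) (hs : HasCompactSupport g) (x Y : ℝ) :
    HasDerivAt (GG g x) (g (mk2 x Y)) Y := by
  have hi := g_slice_int hg hs x
  have hc : Continuous (fun t => g (mk2 x t)) := hg.comp (by fun_prop)
  have e : GG g x = fun Y => (∫ t in Set.Iic 0, g (mk2 x t)) + ∫ t in (0:ℝ)..Y, g (mk2 x t) := by
    funext Y
    rw [GG, ← integral_Iic_eq_integral_Iio, ← intervalIntegral.integral_Iic_sub_Iic hi.integrableOn hi.integrableOn]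
    ring
  rw [e]
  exact (intervalIntegral.integral_hasDerivAt_right (hc.intervalIntegrable _ _)
    (hc.stronglyMeasurableAtFilter _ _) hc.continuousAt).const_add _

lemma GG_smooth (hg : ContDiff ℝ (⊤ : ℕ∞) g) (hs : HasCompactSupport g) :
    ContDiff ℝ (⊤ : ℕ∞) (fun q : ℝ × ℝ => GG g q.1 q.2) := by
  obtain ⟨R, hR⟩ := g_slice_supp hs
  have h1 := contDiffOn_convolution_right_with_param (𝕜 := ℝ) (G := ℝ) (P := ℝ) (E := ℝ) (E' := ℝ) (F := ℝ)
    (f := (Set.Ioi (0:ℝ)).indicator (fun _ => (1:ℝ))) (n := ⊤) (μ := volume)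
    (ContinuousLinearMap.lsmul ℝ ℝ) (g := fun x t => g (mk2 x t)) (s := Set.univ) isOpen_univ
    (isCompact_Icc (a := -R) (b := R)) (fun p x _ hx => hR p x hx)
    ((locallyIntegrable_const (1:ℝ)).indicator measurableSet_Ioi)
    (by
      have : ContDiff ℝ (⊤ : ℕ∞) (fun q : ℝ × ℝ => g (mk2 q.1 q.2)) := hg.comp mk2_contDiff
      exact this.contDiffOn)
  rw [Set.univ_prod_univ, contDiffOn_univ] at h1
  have e : (fun q : ℝ × ℝ => GG g q.1 q.2) = fun q : ℝ × ℝ =>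
      (MeasureTheory.convolution ((Set.Ioi (0:ℝ)).indicator (fun _ => (1:ℝ))) (fun t => g (mk2 q.1 t))
        (ContinuousLinearMap.lsmul ℝ ℝ) volume) q.2 := by
    funext q
    rw [convolution_eq_swap, GG, ← integral_indicator measurableSet_Iio]
    congr 1
    funext t
    by_cases h : t < q.2
    · rw [Set.indicator_of_mem (by exact h), Set.indicator_of_mem (by simpa using h)]
      simp
    · rw [Set.indicator_of_notMem (by exact h), Set.indicator_of_notMem (by simpa using h)]
      simp
  rw [e]
  exact h1

/-- the nonlinearity -/
def AA (g : E2 → ℝ) (q : E2 × ℝ) : ℝ := GG g (q.1 0) q.2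

lemma AA_smooth (hg : ContDiff ℝ (⊤ : ℕ∞) g) (hs : HasCompactSupport g) : ContDiff ℝ (⊤ : ℕ∞) (AA g) := by
  have h0 : ContDiff ℝ (⊤ : ℕ∞) (fun q : E2 × ℝ => ((q.1 0 : ℝ), q.2)) := by
    have : ContDiff ℝ (⊤ : ℕ∞) (fun q : E2 × ℝ => (EuclideanSpace.proj 0 : E2 →L[ℝ] ℝ) q.1) :=
      (ContinuousLinearMap.contDiff _).comp contDiff_fst
    exact this.prodMk contDiff_snd
  exact (GG_smooth hg hs).comp h0

lemma AA_fderiv (hg : ContDiff ℝ (⊤ : ℕ∞) g) (hs : HasCompactSupport g) (z : E2) (Y W : ℝ) :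
    fderiv ℝ (AA g) (z, Y) (0, W) = g (mk2 (z 0) Y) * W := by
  have hd : DifferentiableAt ℝ (AA g) (z, Y) := (AA_smooth hg hs).differentiable (by norm_num) _
  have h1 : HasDerivAt (fun t : ℝ => (z, t)) ((0:E2), (1:ℝ)) Y := (hasDerivAt_const Y z).prodMk (hasDerivAt_id Y)
  have h2 := hd.hasFDerivAt.comp_hasDerivAt Y h1
  have h3 : HasDerivAt (AA g ∘ fun t : ℝ => (z, t)) (g (mk2 (z 0) Y)) Y := GG_deriv hg.continuous hs (z 0) Y
  have h4 := h2.unique h3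
  have h5 : ((0:E2), W) = W • ((0:E2), (1:ℝ)) := by simp
  rw [h5, map_smul, h4, smul_eq_mul, mul_comm]

end partE1

section partE2
set_option linter.unusedSectionVars false
set_option linter.unusedVariables false
open MeasureTheory

variable {w f : E2 → ℝ} {lam M : ℝ}

lemma coord_le (z : E2) (i : Fin 2) : |z i| ≤ ‖z‖ := by
  have := PiLp.norm_apply_le z i
  simpa using this

lemma norm_le_coord (z : E2) : ‖z‖ ≤ |z 0| + |z 1| := by
  have h := norm_sq_E2 z
  apply le_of_sq_le_sq _ (by positivity) |> fun h => h
  rw [h]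
  nlinarith [abs_nonneg (z 0), abs_nonneg (z 1), sq_abs (z 0), sq_abs (z 1), mul_nonneg (abs_nonneg (z 0)) (abs_nonneg (z 1))]

/-- the partial gradient map -/
def TM (w : E2 → ℝ) (z : E2) : E2 := mk2 (z 0) ((ZZ w z) 1)

lemma coord_cont (i : Fin 2) : Continuous (fun z : E2 => z i) := (EuclideanSpace.proj i : E2 →L[ℝ] ℝ).continuous

lemma MA.tm_cont (h : MA w f lam M) {z : E2} (hz : ‖z‖ < 1) : ContinuousAt (TM w) z := by
  have h1 : ContinuousAt (fun z => ((z 0 : ℝ), (ZZ w z) 1)) z :=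
    (coord_cont 0).continuousAt.prodMk ((coord_cont 1).continuousAt.comp (h.zz_cont hz))
  exact mk2_cont.continuousAt.comp h1

lemma MA.p_mono (h : MA w f lam M) {z z' : E2} (hz : ‖z‖ < 1) (hz' : ‖z'‖ < 1) (hx : z 0 = z' 0) :
    (ZZ w z) 1 < (ZZ w z') 1 ↔ z 1 < z' 1 := by
  rcases lt_trichotomy (z 1) (z' 1) with h1 | h1 | h1
  · have hne : z ≠ z' := fun e => by rw [e] at h1; exact lt_irrefl _ h1
    have := h.zz_mono hz hz' hne
    rw [inner_E2] at this
    simp only [PiLp.sub_apply, hx, sub_self, mul_zero, zero_add] at this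
    have := pos_of_mul_pos_left this (by linarith)
    constructor
    · intro _; exact h1
    · intro _; linarith
  · have : z = z' := by rw [← mk2_eta z, ← mk2_eta z', hx, h1]
    rw [this]
    simp
  · have hne : z ≠ z' := fun e => by rw [e] at h1; exact lt_irrefl _ h1
    have := h.zz_mono hz' hz hne.symm
    rw [inner_E2] at this
    simp only [PiLp.sub_apply, hx, sub_self, mul_zero, zero_add] at this
    have := pos_of_mul_pos_left this (by linarith)
    constructor
    · intro _; linarith
    · intro _; linarith

lemma MA.q_mono (h : MA w f lam M) {z z' : E2} (hz : ‖z‖ < 1) (hz' : ‖z'‖ < 1) (hp : (ZZ w z) 1 = (ZZ w z') 1) :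
    (ZZ w z) 0 < (ZZ w z') 0 ↔ z 0 < z' 0 := by
  by_cases hne : z = z'
  · rw [hne]; simp
  have := h.zz_mono hz hz' hne
  rw [inner_E2] at this
  simp only [PiLp.sub_apply, hp, sub_self, zero_mul, add_zero] at this
  rcases mul_pos_iff.1 this with h1 | h1
  · constructor <;> intro _ <;> linarith
  · constructor <;> intro _ <;> linarith

lemma MA.tm_inj (h : MA w f lam M) {z z' : E2} (hz : ‖z‖ < 1) (hz' : ‖z'‖ < 1) (e : TM w z = TM w z') : z = z' := by
  have h0 : z 0 = z' 0 := by simpa [TM] using congrArg (fun q : E2 => q 0) e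
  have h1 : (ZZ w z) 1 = (ZZ w z') 1 := by simpa [TM] using congrArg (fun q : E2 => q 1) e
  rcases lt_trichotomy (z 1) (z' 1) with h2 | h2 | h2
  · have := (h.p_mono hz hz' h0).2 h2
    linarith
  · rw [← mk2_eta z, ← mk2_eta z', h0, h2]
  · have := (h.p_mono hz' hz h0.symm).2 h2
    linarith

lemma MA.tm_local (h : MA w f lam M) {z0 : E2} (hz0 : ‖z0‖ < 1) {ρ : ℝ} (hρ : 0 < ρ) :
    ∃ δ > 0, ∃ S : E2 → E2, ∀ q ∈ ball (TM w z0) δ, ‖S q‖ < 1 ∧ S q ∈ ball z0 ρ ∧ TM w (S q) = q ∧ ContinuousAt S q := by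
  -- radius
  obtain ⟨r, hr0, hr1, hr2⟩ : ∃ r > 0, 4 * r < ρ ∧ 4 * r < 1 - ‖z0‖ := by
    refine ⟨min ρ (1 - ‖z0‖) / 5, by have : 0 < min ρ (1 - ‖z0‖) := lt_min hρ (by linarith)
                                     positivity, ?_, ?_⟩
    · have := min_le_left ρ (1 - ‖z0‖); linarith
    · have := min_le_right ρ (1 - ‖z0‖); linarith
  have hsmall : ∀ x y : ℝ, |x - z0 0| ≤ r → |y - z0 1| ≤ r → ‖mk2 x y - z0‖ ≤ 2 * r := by
    intro x y hx hy
    have := norm_le_coord (mk2 x y - z0)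
    simp only [PiLp.sub_apply, mk2_0, mk2_1] at this
    linarith
  have hD : ∀ z : E2, ‖z - z0‖ ≤ 2 * r → ‖z‖ < 1 := by
    intro z hz
    have : ‖z‖ ≤ ‖z0‖ + ‖z - z0‖ := by
      have := norm_add_le z0 (z - z0)
      simpa using this
    linarith
  have hDxy : ∀ x y : ℝ, |x - z0 0| ≤ r → |y - z0 1| ≤ r → ‖mk2 x y‖ < 1 := fun x y hx hy => hD _ (hsmall x y hx hy)
  have hcont : ∀ y : ℝ, |y - z0 1| ≤ r → ContinuousAt (fun x => (ZZ w (mk2 x y)) 1) (z0 0) := by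
    intro y hy
    have h1 := h.zz_cont (hDxy (z0 0) y (by simp [hr0.le]) hy)
    have h2 : ContinuousAt (fun x : ℝ => mk2 x y) (z0 0) := (by fun_prop : Continuous (fun x : ℝ => mk2 x y)).continuousAt
    exact (coord_cont 1).continuousAt.comp (ContinuousAt.comp (f := fun x : ℝ => mk2 x y) h1 h2)
  have hcy : ∀ x : ℝ, |x - z0 0| ≤ r → ContinuousOn (fun y => (ZZ w (mk2 x y)) 1) (Set.Icc (z0 1 - r) (z0 1 + r)) := by
    intro x hx y hy
    have h1 := h.zz_cont (hDxy x y hx (by rw [abs_le]; constructor <;> linarith [hy.1, hy.2]))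
    have h2 : ContinuousAt (fun y : ℝ => mk2 x y) y := (by fun_prop : Continuous (fun y : ℝ => mk2 x y)).continuousAt
    exact ((coord_cont 1).continuousAt.comp (ContinuousAt.comp (f := fun y : ℝ => mk2 x y) h1 h2)).continuousWithinAt
  have hlo : (ZZ w (mk2 (z0 0) (z0 1 - r))) 1 < (ZZ w z0) 1 :=
    (h.p_mono (hDxy _ _ (by simp [hr0.le]) (by simp [abs_of_pos hr0])) hz0 (by simp)).2 (by simp [hr0])
  have hhi : (ZZ w z0) 1 < (ZZ w (mk2 (z0 0) (z0 1 + r))) 1 :=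
    (h.p_mono hz0 (hDxy _ _ (by simp [hr0.le]) (by simp [abs_of_pos hr0])) (by simp)).2 (by simp [hr0])
  obtain ⟨c1, hc1, hc1'⟩ := exists_between hlo
  obtain ⟨c2, hc2, hc2'⟩ := exists_between hhi
  have ev1 := (hcont (z0 1 - r) (by simp [abs_of_pos hr0])).eventually_lt continuousAt_const hc1
  have ev2 := ContinuousAt.eventually_lt continuousAt_const (hcont (z0 1 + r) (by simp [abs_of_pos hr0])) hc2'
  obtain ⟨δ', hδ', hev⟩ := Metric.eventually_nhds_iff.1 (ev1.and ev2)
  obtain ⟨δ, hδ0, hδ1, hδ2, hδ3, hδ4⟩ : ∃ δ > 0, δ ≤ δ' ∧ δ ≤ r ∧ δ ≤ (ZZ w z0) 1 - c1 ∧ δ ≤ c2 - (ZZ w z0) 1 := by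
    refine ⟨min (min δ' r) (min ((ZZ w z0) 1 - c1) (c2 - (ZZ w z0) 1)), ?_, ?_, ?_, ?_, ?_⟩
    · exact lt_min (lt_min hδ' hr0) (lt_min (by linarith) (by linarith))
    · exact (min_le_left _ _).trans (min_le_left _ _)
    · exact (min_le_left _ _).trans (min_le_right _ _)
    · exact (min_le_right _ _).trans (min_le_left _ _)
    · exact (min_le_right _ _).trans (min_le_right _ _)
  have hex : ∀ q ∈ ball (TM w z0) δ, ∃ z : E2, ‖z - z0‖ ≤ 2 * r ∧ TM w z = q := by
    intro q hq
    rw [mem_ball, dist_eq_norm] at hq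
    have a0 := (coord_le (q - TM w z0) 0).trans_lt hq
    have a1 := (coord_le (q - TM w z0) 1).trans_lt hq
    simp only [PiLp.sub_apply, TM, mk2_0, mk2_1] at a0 a1
    have hx : |q 0 - z0 0| ≤ r := by linarith
    obtain ⟨b1, b2⟩ := hev (y := q 0) (by rw [Real.dist_eq]; linarith)
    rw [abs_lt] at a1
    obtain ⟨y, hy, he⟩ := intermediate_value_Icc (by linarith) (hcy (q 0) hx)
      (show q 1 ∈ Set.Icc _ _ from ⟨by linarith, by linarith⟩)
    refine ⟨mk2 (q 0) y, hsmall _ _ hx (by rw [abs_le]; constructor <;> linarith [hy.1, hy.2]), ?_⟩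
    simp only at he
    rw [TM, he, mk2_0, mk2_eta]
  choose! S hS using hex
  refine ⟨δ, hδ0, S, fun q hq => ⟨hD _ (hS q hq).1, ?_, (hS q hq).2, ?_⟩⟩
  · rw [mem_ball, dist_eq_norm]
    linarith [(hS q hq).1]
  · have hn : ∀ᶠ q' in 𝓝 q, q' ∈ ball (TM w z0) δ := isOpen_ball.mem_nhds hq
    refine (isCompact_closedBall z0 (2 * r)).tendsto_nhds_of_unique_mapClusterPt ?_ ?_
    · filter_upwards [hn] with q' hq'
      rw [mem_closedBall, dist_eq_norm]
      exact (hS q' hq').1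
    · intro y hy hc
      rw [mapClusterPt_iff_ultrafilter] at hc
      obtain ⟨U, hU, hyU⟩ := hc
      rw [mem_closedBall, dist_eq_norm] at hy
      have hyD := hD y hy
      apply h.tm_inj hyD (hD _ (hS q hq).1)
      rw [(hS q hq).2]
      have t1 : Tendsto (fun q' => TM w (S q')) U (𝓝 (TM w y)) := (h.tm_cont hyD).tendsto.comp hyU
      have t2 : Tendsto (fun q' => TM w (S q')) U (𝓝 q) := by
        have hid : Tendsto (fun q' : E2 => q') U (𝓝 q) := hU
        refine hid.congr' ?_
        filter_upwards [hU hn] with q' hq'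
        exact (hS q' hq').2.symm
      exact tendsto_nhds_unique t1 t2

/-- the partial Legendre transform -/
theorem MA.partial_leg (h : MA w f lam M) {z0 : E2} (hz0 : ‖z0‖ < 1) {ρ : ℝ} (hρ : 0 < ρ) :
    ∃ δ > 0, ∃ S : E2 → E2, ∃ V : E2 → ℝ, ContDiff ℝ 1 V ∧ ∀ q ∈ ball (TM w z0) δ, ‖S q‖ < 1 ∧ S q ∈ ball z0 ρ ∧
      TM w (S q) = q ∧ ContinuousAt S q ∧ fderiv ℝ V q (ee 0) = - (ZZ w (S q)) 0 ∧ fderiv ℝ V q (ee 1) = (S q) 1 := by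
  obtain ⟨δ, hδ, S, hS⟩ := h.tm_local hz0 hρ
  have hc0 : ∀ q ∈ ball (TM w z0) δ, (S q) 0 = q 0 := fun q hq => by
    simpa [TM] using congrArg (fun q : E2 => q 0) (hS q hq).2.2.1
  have hc1 : ∀ q ∈ ball (TM w z0) δ, (ZZ w (S q)) 1 = q 1 := fun q hq => by
    simpa [TM] using congrArg (fun q : E2 => q 1) (hS q hq).2.2.1
  let v : E2 → ℝ := fun q => q 1 * (S q) 1 - leg w (S q)
  have hZS : ∀ q ∈ ball (TM w z0) δ, ContinuousAt (fun q => ZZ w (S q)) q := fun q hq =>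
    ContinuousAt.comp (f := S) (h.zz_cont (hS q hq).1) (hS q hq).2.2.2
  have hv : ∀ q ∈ ball (TM w z0) δ, HasFDerivAt v (innerSL ℝ (mk2 (-(ZZ w (S q)) 0) ((S q) 1))) q := by
    intro q hq
    rw [hasFDerivAt_iff_isLittleO, Asymptotics.isLittleO_iff]
    intro c hc
    have h1 : ∀ᶠ q' : E2 in 𝓝 q, ‖ZZ w (S q') - ZZ w (S q)‖ < c :=
      ((hZS q hq).sub continuousAt_const).norm.eventually_lt continuousAt_const (by simpa using hc)
    have h2 : ∀ᶠ q' : E2 in 𝓝 q, ‖S q' - S q‖ < c :=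
      ((hS q hq).2.2.2.sub continuousAt_const).norm.eventually_lt continuousAt_const (by simpa using hc)
    filter_upwards [h1, h2, isOpen_ball.mem_nhds hq] with q' g1 g2 hq'
    have e1 := h.leg_ge (hS q hq).1 (hS q' hq').1
    have e2 := h.leg_ge (hS q' hq').1 (hS q hq).1
    rw [inner_E2] at e1 e2
    simp only [PiLp.sub_apply, hc0 q hq, hc0 q' hq', hc1 q hq, hc1 q' hq'] at e1 e2
    have a1 := (coord_le _ 0).trans_lt g1
    have a2 := (coord_le _ 1).trans_lt g2
    have a3 := coord_le (q' - q) 0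
    have a4 := coord_le (q' - q) 1
    simp only [PiLp.sub_apply] at a1 a2 a3 a4
    have b1 : |((ZZ w (S q')) 0 - (ZZ w (S q)) 0) * (q' 0 - q 0)| ≤ c * ‖q' - q‖ := by
      rw [abs_mul]; gcongr
    have b2 : |((S q') 1 - (S q) 1) * (q' 1 - q 1)| ≤ c * ‖q' - q‖ := by
      rw [abs_mul]; gcongr
    rw [abs_le] at b1 b2
    simp only [innerSL_apply_apply, Real.norm_eq_abs, inner_E2, mk2_0, mk2_1, v, PiLp.sub_apply]
    rw [abs_le]
    constructor <;> nlinarith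
  have hv1 : ∀ q ∈ ball (TM w z0) δ, ContDiffAt ℝ (1 : ℕ) v q := by
    intro q hq
    have := (contDiffAt_one_iff (𝕜 := ℝ) (f := v) (x := q)).2 ⟨_, ball (TM w z0) δ, isOpen_ball.mem_nhds hq, ?_, hv⟩
    · exact_mod_cast this
    · intro q1 hq1
      apply ContinuousAt.continuousWithinAt
      have k1 : ContinuousAt (fun q => (-(ZZ w (S q)) 0, (S q) 1)) q1 :=
        ((coord_cont 0).continuousAt.comp (hZS q1 hq1)).neg.prodMk ((coord_cont 1).continuousAt.comp (hS q1 hq1).2.2.2)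
      exact (innerSL ℝ).continuous.continuousAt.comp (mk2_cont.continuousAt.comp k1)
  obtain ⟨V, V1, -, V3⟩ := exists_ext (r' := δ / 2) (by positivity) (by linarith) hv1
  refine ⟨δ / 2, by positivity, S, V, by exact_mod_cast V1, fun q hq => ?_⟩
  have hq' : q ∈ ball (TM w z0) δ := ball_subset_ball (by linarith) hq
  have hf : fderiv ℝ V q = innerSL ℝ (mk2 (-(ZZ w (S q)) 0) ((S q) 1)) := by
    have e : V =ᶠ[𝓝 q] v := by
      filter_upwards [isOpen_ball.mem_nhds hq] with q1 hq1 using V3 q1 hq1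
    rw [e.fderiv_eq]
    exact (hv q hq').fderiv
  refine ⟨(hS q hq').1, (hS q hq').2.1, (hS q hq').2.2.1, (hS q hq').2.2.2, ?_, ?_⟩
  · rw [hf]; simp [inner_E2, ee]
  · rw [hf]; simp [inner_E2, ee]

end partE2

section partE3
set_option linter.unusedSectionVars false
set_option linter.unusedVariables false
open MeasureTheory

variable {w f : E2 → ℝ} {lam M : ℝ}

lemma mk2_hasDeriv1 (x p : ℝ) : HasDerivAt (fun p => mk2 x p) (ee 1) p := by
  simp only [mk2_eq]
  simpa using ((hasDerivAt_id p).smul_const (ee 1)).const_add (x • ee 0)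

lemma mk2_hasDeriv0 (x p : ℝ) : HasDerivAt (fun x => mk2 x p) (ee 0) x := by
  simp only [mk2_eq]
  simpa using ((hasDerivAt_id x).smul_const (ee 0)).add_const (p • ee 1)

lemma deriv_slice1 {η : E2 → ℝ} {x p : ℝ} (h : DifferentiableAt ℝ η (mk2 x p)) :
    deriv (fun p => η (mk2 x p)) p = fderiv ℝ η (mk2 x p) (ee 1) :=
  (h.hasFDerivAt.comp_hasDerivAt p (mk2_hasDeriv1 x p)).deriv

lemma deriv_slice0 {η : E2 → ℝ} {x p : ℝ} (h : DifferentiableAt ℝ η (mk2 x p)) :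
    deriv (fun x => η (mk2 x p)) x = fderiv ℝ η (mk2 x p) (ee 0) :=
  (h.hasFDerivAt.comp_hasDerivAt x (mk2_hasDeriv0 x p)).deriv

lemma slice1_supp {η : E2 → ℝ} (hs : HasCompactSupport η) (x : ℝ) : HasCompactSupport (fun p => η (mk2 x p)) := by
  obtain ⟨R, hR⟩ := g_slice_supp hs
  exact HasCompactSupport.intro (isCompact_Icc (a := -R) (b := R)) (fun t ht => hR x t ht)

lemma slice0_supp {η : E2 → ℝ} (hs : HasCompactSupport η) (p : ℝ) : HasCompactSupport (fun x => η (mk2 x p)) := by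
  obtain ⟨R, hR⟩ := hs.isCompact.isBounded.subset_closedBall (0:E2)
  refine HasCompactSupport.intro (isCompact_Icc (a := -R) (b := R)) (fun t ht => ?_)
  by_contra hne
  apply ht
  have h1 := hR (subset_tsupport _ (Function.mem_support.2 hne))
  rw [mem_closedBall_zero_iff] at h1
  have h3 := coord_le (mk2 t p) 0
  exact abs_le.1 (h3.trans h1)

lemma slice1_contDiff {η : E2 → ℝ} (h : ContDiff ℝ 1 η) (x : ℝ) : ContDiff ℝ 1 (fun p => η (mk2 x p)) :=
  h.comp (mk2_contDiff.comp (contDiff_const.prodMk contDiff_id))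

lemma slice0_contDiff {η : E2 → ℝ} (h : ContDiff ℝ 1 η) (p : ℝ) : ContDiff ℝ 1 (fun x => η (mk2 x p)) :=
  h.comp (mk2_contDiff.comp (contDiff_id.prodMk contDiff_const))

lemma fderiv_ne_tsupport {η : E2 → ℝ} {q v : E2} (h : fderiv ℝ η q v ≠ 0) : q ∈ tsupport η := by
  have : q ∈ Function.support (fderiv ℝ η) := by
    rw [Function.mem_support]
    intro e
    rw [e] at h
    simp at h
  exact support_fderiv_subset ℝ this

/-- data of a partial Legendre transform -/
structure PL (w : E2 → ℝ) (z0 : E2) (ρ δ : ℝ) (S : E2 → E2) (V : E2 → ℝ) : Prop where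
  V1 : ContDiff ℝ 1 V
  prop : ∀ q ∈ ball (TM w z0) δ, ‖S q‖ < 1 ∧ S q ∈ ball z0 ρ ∧
      TM w (S q) = q ∧ ContinuousAt S q ∧ fderiv ℝ V q (ee 0) = - (ZZ w (S q)) 0 ∧ fderiv ℝ V q (ee 1) = (S q) 1

variable {z0 : E2} {ρ δ : ℝ} {S : E2 → E2} {V : E2 → ℝ}

lemma PL.c0 (hP : PL w z0 ρ δ S V) {q : E2} (hq : q ∈ ball (TM w z0) δ) : (S q) 0 = q 0 := by
  simpa [TM] using congrArg (fun q : E2 => q 0) (hP.prop q hq).2.2.1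
lemma PL.c1 (hP : PL w z0 ρ δ S V) {q : E2} (hq : q ∈ ball (TM w z0) δ) : (ZZ w (S q)) 1 = q 1 := by
  simpa [TM] using congrArg (fun q : E2 => q 1) (hP.prop q hq).2.2.1

open Classical in
/-- pulled back test function -/
def etat (w : E2 → ℝ) (η : E2 → ℝ) (z : E2) : ℝ := if ‖z‖ < 1 then η (TM w z) else 0

lemma etat_facts (h : MA w f lam M) (hP : PL w z0 ρ δ S V) {η : E2 → ℝ} (h1 : ContDiff ℝ 1 η) (h2 : HasCompactSupport η)
    (h3 : tsupport η ⊆ ball (TM w z0) δ) :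
    Continuous (etat w η) ∧ HasCompactSupport (etat w η) ∧ tsupport (etat w η) ⊆ ball 0 1 ∧
      (∀ z, etat w η z ≠ 0 → z ∈ ball z0 ρ ∧ ‖z‖ < 1) := by
  have hK : IsCompact (S '' tsupport η) := h2.isCompact.image_of_continuousOn
    fun q hq => (hP.prop q (h3 hq)).2.2.2.1.continuousWithinAt
  have hsub : S '' tsupport η ⊆ ball 0 1 := by
    rintro _ ⟨q, hq, rfl⟩
    rw [mem_ball_zero_iff]
    exact (hP.prop q (h3 hq)).1
  have hne : ∀ z, etat w η z ≠ 0 → z ∈ S '' tsupport η := by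
    intro z hz
    rw [etat] at hz
    split_ifs at hz with hz1
    · have hq := subset_tsupport _ (Function.mem_support.2 hz)
      refine ⟨TM w z, hq, ?_⟩
      exact h.tm_inj (hP.prop _ (h3 hq)).1 hz1 (hP.prop _ (h3 hq)).2.2.1
    · exact absurd rfl hz
  have hts : tsupport (etat w η) ⊆ S '' tsupport η := closure_minimal (fun z hz => hne z hz) hK.isClosed
  refine ⟨?_, hK.of_isClosed_subset (isClosed_tsupport _) hts, hts.trans hsub, ?_⟩
  · rw [continuous_iff_continuousAt]
    intro z
    by_cases hz : ‖z‖ < 1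
    · have e : etat w η =ᶠ[𝓝 z] fun z => η (TM w z) := by
        have : ∀ᶠ z' : E2 in 𝓝 z, ‖z'‖ < 1 := continuous_norm.continuousAt.eventually_lt continuousAt_const hz
        filter_upwards [this] with z' hz'
        simp [etat, hz']
      exact (ContinuousAt.comp (f := TM w) h1.continuous.continuousAt (h.tm_cont hz)).congr e.symm
    · have hz' : z ∉ S '' tsupport η := fun hh => hz (mem_ball_zero_iff.1 (hsub hh))
      have e : etat w η =ᶠ[𝓝 z] fun z => 0 := by
        filter_upwards [hK.isClosed.isOpen_compl.mem_nhds hz'] with y hy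
        by_contra hne'
        exact hy (hne y hne')
      exact continuousAt_const.congr e.symm
  · intro z hz
    obtain ⟨q, hq, rfl⟩ := hne z hz
    exact ⟨(hP.prop q (h3 hq)).2.1, (hP.prop q (h3 hq)).1⟩

lemma side1 (h : MA w f lam M) (hP : PL w z0 ρ δ S V) {η : E2 → ℝ} (h1 : ContDiff ℝ 1 η) (h2 : HasCompactSupport η)
    (h3 : tsupport η ⊆ ball (TM w z0) δ) {g : E2 → ℝ} (hg : ContDiff ℝ (⊤ : ℕ∞) g) (hs : HasCompactSupport g)
    (hgD : ∀ z, g z ≠ 0 → ‖z‖ < 1) :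
    ∫ z, g z * etat w η z = - ∫ q, fderiv ℝ η q (ee 1) * AA g (q, fderiv ℝ V q (ee 1)) := by
  obtain ⟨e1, e2, e3, e4⟩ := etat_facts h hP h1 h2 h3
  have j1 : Integrable (fun z => g z * etat w η z) := (hg.continuous.mul e1).integrable_of_hasCompactSupport e2.mul_left
  rw [int_E2 j1]
  have hVc := cont_fderiv_apply hP.V1 (ee 1)
  have hηc := cont_fderiv_apply h1 (ee 1)
  have hηs : HasCompactSupport (fun q => fderiv ℝ η q (ee 1)) := h2.fderiv_apply (𝕜 := ℝ) _
  have hAc : Continuous (fun q => AA g (q, fderiv ℝ V q (ee 1))) :=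
    (AA_smooth hg hs).continuous.comp (continuous_id.prodMk hVc)
  have j2 : Integrable (fun q => fderiv ℝ η q (ee 1) * AA g (q, fderiv ℝ V q (ee 1))) :=
    (hηc.mul hAc).integrable_of_hasCompactSupport hηs.mul_right
  rw [int_E2 j2, ← integral_neg]
  congr 1
  funext x
  have hm : Continuous (fun p => fderiv ℝ V (mk2 x p) (ee 1)) := hVc.comp (by fun_prop)
  have key : ∀ y, g (mk2 x y) * etat w η (mk2 x y) = g (mk2 x y) *
      layer (fun p => η (mk2 x p)) (fun p => fderiv ℝ V (mk2 x p) (ee 1)) y := by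
    intro y
    by_cases hgz : g (mk2 x y) = 0
    · rw [hgz, zero_mul, zero_mul]
    · congr 1
      have hD := hgD _ hgz
      rw [layer_step (slice1_contDiff h1 x) (slice1_supp h2 x) hm (P := (ZZ w (mk2 x y)) 1)]
      · rw [etat, if_pos hD, TM, mk2_0]
      · intro p hp
        rw [deriv_slice1 (h1.differentiable (by norm_num) _)] at hp
        have hq := h3 (fderiv_ne_tsupport hp)
        obtain ⟨k1, k2, k3, k4, k5, k6⟩ := hP.prop _ hq
        rw [k6]
        have := h.p_mono hD k1 (by rw [hP.c0 hq]; simp)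
        rw [hP.c1 hq] at this
        simpa using this.symm
  simp only [key]
  rw [layer_fubini (slice1_contDiff h1 x) (slice1_supp h2 x) hm (g_slice_int hg.continuous hs x)]
  congr 2
  funext p
  rw [deriv_slice1 (h1.differentiable (by norm_num) _)]
  rfl

lemma side2_ptw (h : MA w f lam M) (hP : PL w z0 ρ δ S V) {η : E2 → ℝ} (h1 : ContDiff ℝ 1 η) (h2 : HasCompactSupport η)
    (h3 : tsupport η ⊆ ball (TM w z0) δ) {ζ : E2} (hd : DifferentiableAt ℝ w ζ) :
    etat w η (gradient w ζ) = layer (fun x => η (mk2 x (ζ 1))) (fun x => - fderiv ℝ V (mk2 x (ζ 1)) (ee 0)) (ζ 0) := by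
  have hVc := cont_fderiv_apply hP.V1 (ee 0)
  have hm : Continuous (fun x => - fderiv ℝ V (mk2 x (ζ 1)) (ee 0)) := (hVc.comp (by fun_prop)).neg
  by_cases hA : ∃ z : E2, ‖z‖ < 1 ∧ ZZ w z = ζ ∧ TM w z ∈ ball (TM w z0) δ
  · obtain ⟨z, hz, rfl, hT⟩ := hA
    rw [h.grad_zz hz hd, etat, if_pos hz,
      layer_step (slice0_contDiff h1 _) (slice0_supp h2 _) hm (P := z 0), TM]
    intro x hx
    rw [deriv_slice0 (h1.differentiable (by norm_num) _)] at hx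
    have hq := h3 (fderiv_ne_tsupport hx)
    obtain ⟨k1, k2, k3, k4, k5, k6⟩ := hP.prop _ hq
    rw [k5, neg_neg]
    have := h.q_mono hz k1 (by rw [hP.c1 hq]; simp)
    rwa [hP.c0 hq, mk2_0] at this
  · have hL : etat w η (gradient w ζ) = 0 := by
      by_contra hne
      apply hA
      rw [etat] at hne
      split_ifs at hne with hz1
      · exact ⟨_, hz1, h.zz_grad hd hz1, h3 (subset_tsupport _ (Function.mem_support.2 hne))⟩
      · exact absurd rfl hne
    rw [hL]
    set J : Set ℝ := {x | mk2 x (ζ 1) ∈ ball (TM w z0) δ} with hJ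
    have hJc : Convex ℝ J := by
      intro x hx y hy a b ha hb hab
      have := (convex_ball (TM w z0) δ) hx hy ha hb hab
      have e : mk2 (a • x + b • y) (ζ 1) = a • mk2 x (ζ 1) + b • mk2 y (ζ 1) := by
        ext i
        fin_cases i
        · simp [mk2]
        · simp [mk2, ← add_mul, hab]
      rw [hJ, Set.mem_ofPred_eq, e]
      exact this
    have hnq : ∀ x ∈ J, - fderiv ℝ V (mk2 x (ζ 1)) (ee 0) ≠ ζ 0 := by
      intro x hx he
      apply hA
      obtain ⟨k1, k2, k3, k4, k5, k6⟩ := hP.prop _ hx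
      refine ⟨S (mk2 x (ζ 1)), k1, ?_, by rw [k3]; exact hx⟩
      rw [← mk2_eta (ZZ w _), hP.c1 hx, mk2_1]
      rw [k5, neg_neg] at he
      rw [he, mk2_eta]
    have hJd : ∀ x, deriv (fun x => η (mk2 x (ζ 1))) x ≠ 0 → x ∈ J := by
      intro x hx
      rw [deriv_slice0 (h1.differentiable (by norm_num) _)] at hx
      exact h3 (fderiv_ne_tsupport hx)
    by_cases hB : ∀ x ∈ J, ζ 0 < - fderiv ℝ V (mk2 x (ζ 1)) (ee 0)
    · rw [layer_lt (slice0_contDiff h1 _) (slice0_supp h2 _) hm (fun x hx => hB x (hJd x hx))]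
    · push Not at hB
      obtain ⟨x1, hx1, hx1'⟩ := hB
      rw [layer_ge (slice0_contDiff h1 _) (slice0_supp h2 _) hm]
      intro x hx
      by_contra hlt
      push Not at hlt
      obtain ⟨y, hy, hy'⟩ := hJc.isPreconnected.intermediate_value hx1 (hJd x hx) hm.continuousOn ⟨hx1', hlt.le⟩
      exact hnq y hy hy'

lemma side2 (h : MA w f lam M) (hP : PL w z0 ρ δ S V) {η : E2 → ℝ} (h1 : ContDiff ℝ 1 η) (h2 : HasCompactSupport η)
    (h3 : tsupport η ⊆ ball (TM w z0) δ) :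
    ∫ ζ, etat w η (gradient w ζ) = ∫ q, fderiv ℝ η q (ee 0) * fderiv ℝ V q (ee 0) := by
  obtain ⟨e1, e2, e3, e4⟩ := etat_facts h hP h1 h2 h3
  have hVc := cont_fderiv_apply hP.V1 (ee 0)
  have hηc := cont_fderiv_apply h1 (ee 0)
  have hηs : HasCompactSupport (fun q => fderiv ℝ η q (ee 0)) := h2.fderiv_apply (𝕜 := ℝ) _
  set H : E2 → ℝ := fun ζ => layer (fun x => η (mk2 x (ζ 1))) (fun x => - fderiv ℝ V (mk2 x (ζ 1)) (ee 0)) (ζ 0) with hH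
  have hae : (fun ζ => etat w η (gradient w ζ)) =ᵐ[volume] H := by
    filter_upwards [h.sub1.ae_diff] with ζ hd
    exact side2_ptw h hP h1 h2 h3 hd
  have hi := (h.int_int e1 e2 e3).congr hae
  have j1 : Integrable (fun q => fderiv ℝ η q (ee 0) * fderiv ℝ V q (ee 0)) :=
    (hηc.mul hVc).integrable_of_hasCompactSupport hηs.mul_right
  rw [integral_congr_ae hae, int_E2_swap hi, int_E2_swap j1]
  obtain ⟨Q, hQ⟩ := h2.isCompact.exists_bound_of_continuousOn hVc.continuousOn
  congr 1
  funext p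
  have hm : Continuous (fun x => - fderiv ℝ V (mk2 x p) (ee 0)) := (hVc.comp (by fun_prop)).neg
  have hdη : ∀ x, deriv (fun x => η (mk2 x p)) x = fderiv ℝ η (mk2 x p) (ee 0) := fun x =>
    deriv_slice0 (h1.differentiable (by norm_num) _)
  have hb : ∀ x, deriv (fun x => η (mk2 x p)) x ≠ 0 → - fderiv ℝ V (mk2 x p) (ee 0) ∈ Set.Icc (-Q) Q := by
    intro x hx
    rw [hdη] at hx
    have := hQ _ (fderiv_ne_tsupport hx)
    rw [Real.norm_eq_abs, abs_le] at this
    constructor <;> linarith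
  have key : ∀ q, H (mk2 q p) = (Set.Icc (-Q) Q).indicator (fun _ => (1:ℝ)) q *
      layer (fun x => η (mk2 x p)) (fun x => - fderiv ℝ V (mk2 x p) (ee 0)) q := by
    intro q
    simp only [hH, mk2_0, mk2_1]
    by_cases hq : q ∈ Set.Icc (-Q) Q
    · rw [Set.indicator_of_mem hq, one_mul]
    · rw [Set.indicator_of_notMem hq, zero_mul]
      rw [Set.mem_Icc, not_and_or, not_le, not_le] at hq
      rcases hq with hq | hq
      · exact layer_lt (slice0_contDiff h1 _) (slice0_supp h2 _) hm fun x hx => hq.trans_le (hb x hx).1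
      · exact layer_ge (slice0_contDiff h1 _) (slice0_supp h2 _) hm fun x hx => (hb x hx).2.trans hq.le
  simp only [key]
  have hintg : Integrable ((Set.Icc (-Q) Q).indicator (fun _ => (1:ℝ))) :=
    (integrable_indicator_iff measurableSet_Icc).2 (integrableOn_const (by simp))
  rw [layer_fubini (slice0_contDiff h1 p) (slice0_supp h2 p) hm hintg]
  have e5 : ∀ x, deriv (fun x => η (mk2 x p)) x * ∫ t in Set.Iio (- fderiv ℝ V (mk2 x p) (ee 0)),
      (Set.Icc (-Q) Q).indicator (fun _ => (1:ℝ)) t = Q * deriv (fun x => η (mk2 x p)) x -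
        fderiv ℝ η (mk2 x p) (ee 0) * fderiv ℝ V (mk2 x p) (ee 0) := by
    intro x
    by_cases hx : deriv (fun x => η (mk2 x p)) x = 0
    · rw [hx, ← hdη, hx]; ring
    · have hbx := hb x hx
      rw [← integral_Iic_eq_integral_Iio, setIntegral_indicator measurableSet_Icc]
      have : Set.Iic (- fderiv ℝ V (mk2 x p) (ee 0)) ∩ Set.Icc (-Q) Q = Set.Icc (-Q) (- fderiv ℝ V (mk2 x p) (ee 0)) := by
        ext t
        simp only [Set.mem_inter_iff, Set.mem_Iic, Set.mem_Icc]
        constructor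
        · rintro ⟨a, b, c⟩; exact ⟨b, a⟩
        · rintro ⟨a, b⟩; exact ⟨b, a, b.trans hbx.2⟩
      rw [this, setIntegral_const, smul_eq_mul, mul_one, Real.volume_real_Icc_of_le hbx.1, ← hdη]
      ring
  simp only [e5]
  have i1 := ((slice0_contDiff h1 p).continuous_deriv le_rfl).integrable_of_hasCompactSupport (μ := volume) (slice0_supp h2 p).deriv
  have i2 : Integrable (fun x => fderiv ℝ η (mk2 x p) (ee 0) * fderiv ℝ V (mk2 x p) (ee 0)) := by
    have hc : HasCompactSupport (fun x => fderiv ℝ η (mk2 x p) (ee 0) * fderiv ℝ V (mk2 x p) (ee 0)) :=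
      (slice0_supp hηs p).mul_right
    exact Continuous.integrable_of_hasCompactSupport (by
      exact (hηc.comp (by fun_prop : Continuous fun x => mk2 x p)).mul (hVc.comp (by fun_prop : Continuous fun x => mk2 x p))) hc
  rw [integral_sub (i1.const_mul Q) i2, integral_const_mul,
    integral_eq_zero_of_hasDerivAt_of_integrable (f := fun x => η (mk2 x p))
    (fun x => ((slice0_contDiff h1 p).differentiable (by norm_num) x).hasDerivAt) i1
    ((slice0_contDiff h1 p).continuous.integrable_of_hasCompactSupport (slice0_supp h2 p))]
  ring

theorem weak_eq (h : MA w f lam M) (hP : PL w z0 ρ δ S V) {g : E2 → ℝ} (hg : ContDiff ℝ (⊤ : ℕ∞) g) (hs : HasCompactSupport g)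
    (hgD : ∀ z, g z ≠ 0 → ‖z‖ < 1) (hgf : ∀ z ∈ ball z0 ρ, g z = f z) :
    WEq V (fun q => AA g (q, fderiv ℝ V q (ee 1))) (TM w z0) δ := by
  intro η h1 h2 h3
  obtain ⟨e1, e2, e3, e4⟩ := etat_facts h hP h1 h2 h3
  have hst := h.star (etat w η) e1 e2 e3
  have hVc := cont_fderiv_apply hP.V1
  have hηc := cont_fderiv_apply h1
  have hηs : ∀ v, HasCompactSupport (fun q => fderiv ℝ η q v) := fun v => h2.fderiv_apply (𝕜 := ℝ) _
  have hAc : Continuous (fun q => AA g (q, fderiv ℝ V q (ee 1))) :=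
    (AA_smooth hg hs).continuous.comp (continuous_id.prodMk (hVc _))
  have hR : ∫ z in ball (0:E2) 1, etat w η z * f z = ∫ z, g z * etat w η z := by
    rw [← integral_indicator measurableSet_ball]
    congr 1
    funext z
    by_cases hz : etat w η z = 0
    · simp [Set.indicator, hz]
    · obtain ⟨a1, a2⟩ := e4 z hz
      rw [Set.indicator_of_mem (by simpa using a2), hgf z a1, mul_comm]
  rw [hR, side1 h hP h1 h2 h3 hg hs hgD, side2 h hP h1 h2 h3] at hst
  have e : ∀ q, ⟪fderiv ℝ V q (ee 0), fderiv ℝ η q (ee 0)⟫ + ⟪AA g (q, fderiv ℝ V q (ee 1)), fderiv ℝ η q (ee 1)⟫ =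
      fderiv ℝ η q (ee 0) * fderiv ℝ V q (ee 0) + fderiv ℝ η q (ee 1) * AA g (q, fderiv ℝ V q (ee 1)) := by
    intro q
    simp [RCLike.inner_apply]
  simp only [e]
  have j1 : Integrable (fun q => fderiv ℝ η q (ee 0) * fderiv ℝ V q (ee 0)) :=
    ((hηc _).mul (hVc _)).integrable_of_hasCompactSupport (hηs _).mul_right
  have j2 : Integrable (fun q => fderiv ℝ η q (ee 1) * AA g (q, fderiv ℝ V q (ee 1))) :=
    ((hηc _).mul hAc).integrable_of_hasCompactSupport (hηs _).mul_right
  rw [integral_add j1 j2, hst]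
  ring

end partE3

section partG1
set_option linter.unusedSectionVars false
set_option linter.unusedVariables false

/-- partial derivative -/
def pd (i : Fin 2) (W : E2 → ℝ) (z : E2) : ℝ := fderiv ℝ W z (ee i)

lemma pd_contDiffAt {n : ℕ} {W : E2 → ℝ} {z : E2} (i : Fin 2) (h : ContDiffAt ℝ (n + 1 : ℕ) W z) :
    ContDiffAt ℝ n (pd i W) z := by
  have h1 : ContDiffAt ℝ n (fderiv ℝ W) z := h.fderiv_right (m := n) (by norm_cast)
  exact h1.clm_apply contDiffAt_const

lemma pd_sub {U W : E2 → ℝ} {z : E2} (i : Fin 2) (c : ℝ) (hU : DifferentiableAt ℝ U z) (hW : DifferentiableAt ℝ W z) :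
    pd i (fun y => U y - c * W y) z = pd i U z - c * pd i W z := by
  unfold pd
  rw [fderiv_fun_sub hU (hW.const_mul c), fderiv_const_mul hW]
  simp

lemma pd_congr {U W : E2 → ℝ} {z : E2} (i : Fin 2) (h : U =ᶠ[𝓝 z] W) : pd i U z = pd i W z := by
  unfold pd; rw [h.fderiv_eq]

lemma pd2_sub {U W : E2 → ℝ} {z : E2} (i : Fin 2) (c : ℝ) (hU : ContDiffAt ℝ 2 U z) (hW : ContDiffAt ℝ 2 W z) :
    pd i (pd i (fun y => U y - c * W y)) z = pd i (pd i U) z - c * pd i (pd i W) z := by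
  have e : pd i (fun y => U y - c * W y) =ᶠ[𝓝 z] fun y => pd i U y - c * pd i W y := by
    filter_upwards [hU.eventually (by simp), hW.eventually (by simp)] with y h1 h2
    exact pd_sub i c (h1.differentiableAt (by norm_num)) (h2.differentiableAt (by norm_num))
  rw [pd_congr i e, pd_sub i c]
  · exact (pd_contDiffAt (n := 1) i hU).differentiableAt (by norm_num)
  · exact (pd_contDiffAt (n := 1) i hW).differentiableAt (by norm_num)

lemma slice_line {W : E2 → ℝ} {z v : E2} {t : ℝ} (h : DifferentiableAt ℝ W (z + t • v)) :
    HasDerivAt (fun s : ℝ => W (z + s • v)) (fderiv ℝ W (z + t • v) v) t := by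
  have e : HasDerivAt (fun s : ℝ => z + s • v) v t := by
    simpa using ((hasDerivAt_id t).smul_const v).const_add z
  exact h.hasFDerivAt.comp_hasDerivAt t e

lemma line_cont (z v : E2) : Continuous (fun s : ℝ => z + s • v) := by fun_prop

/-- second derivative test, necessary part -/
lemma pd2_nonneg {W : E2 → ℝ} {z : E2} (i : Fin 2) (h : ContDiffAt ℝ 2 W z) (hm : IsLocalMin W z) :
    0 ≤ pd i (pd i W) z := by
  by_contra hneg
  push Not at hneg
  have hz : z + (0:ℝ) • ee i = z := by simp
  have ht : Tendsto (fun s : ℝ => z + s • ee i) (𝓝 0) (𝓝 z) := by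
    have := (line_cont z (ee i)).tendsto 0
    rwa [hz] at this
  have d1 : deriv (fun s : ℝ => W (z + s • ee i)) =ᶠ[𝓝 0] fun s => pd i W (z + s • ee i) := by
    filter_upwards [ht.eventually (h.eventually (by simp))] with s hs
    exact (slice_line (hs.differentiableAt (by norm_num))).deriv
  have d2 : deriv (deriv (fun s : ℝ => W (z + s • ee i))) 0 = pd i (pd i W) z := by
    rw [d1.deriv_eq]
    have := slice_line (W := pd i W) (z := z) (v := ee i) (t := 0)
      (by rw [hz]; exact (pd_contDiffAt (n := 1) i h).differentiableAt (by norm_num))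
    rw [this.deriv, hz]; rfl
  have hmin : IsLocalMin (fun s : ℝ => W (z + s • ee i)) 0 := by
    have := ht.eventually hm
    filter_upwards [this] with s hs
    simpa using hs
  have hmax : IsLocalMax (fun s : ℝ => W (z + s • ee i)) 0 := by
    apply isLocalMax_of_deriv_deriv_neg (by rw [d2]; exact hneg) hmin.deriv_eq_zero
    have := slice_line (W := W) (z := z) (v := ee i) (t := 0) (by rw [hz]; exact h.differentiableAt (by norm_num))
    exact this.continuousAt
  have hc : (fun s : ℝ => W (z + s • ee i)) =ᶠ[𝓝 0] fun _ => W z := by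
    filter_upwards [hmin, hmax] with s h1 h2
    apply le_antisymm
    · simpa using h2
    · simpa using h1
  have : deriv (fun s : ℝ => W (z + s • ee i)) =ᶠ[𝓝 0] fun _ => 0 := by
    filter_upwards [hc.eventually_nhds] with s hs
    rw [Filter.EventuallyEq.deriv_eq (f := fun _ => W z) hs]; simp
  rw [this.deriv_eq] at d2
  simp at d2
  linarith

/-- Gaussian barrier -/
def gb (α : ℝ) (z1 z : E2) : ℝ := Real.exp (-α * ‖z - z1‖ ^ 2)

lemma gb_hasFDeriv (α : ℝ) (z1 z : E2) :
    HasFDerivAt (gb α z1) ((-2 * α * gb α z1 z) • innerSL ℝ (z - z1)) z := by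
  have h1 : HasFDerivAt (fun z : E2 => ‖z - z1‖ ^ 2) (2 • innerSL ℝ (z - z1)) z :=
    by simpa using ((hasFDerivAt_id z).sub_const z1).norm_sq
  have h2 := (h1.const_mul (-α)).exp
  refine h2.congr_fderiv ?_
  ext v
  simp [gb]
  ring

lemma gb_contDiff (α : ℝ) (z1 : E2) {n} : ContDiff ℝ n (gb α z1) :=
  Real.contDiff_exp.comp (contDiff_const.mul ((contDiff_id.sub contDiff_const).norm_sq ℝ))

lemma gb_pd (α : ℝ) (z1 : E2) (i : Fin 2) (z : E2) : pd i (gb α z1) z = -2 * α * gb α z1 z * (z - z1) i := by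
  rw [pd, (gb_hasFDeriv α z1 z).fderiv, _root_.smul_apply, innerSL_apply_apply, real_inner_comm, inner_ee,
    smul_eq_mul]

lemma gb_pd2 (α : ℝ) (z1 : E2) (i : Fin 2) (z : E2) :
    pd i (pd i (gb α z1)) z = gb α z1 z * (4 * α ^ 2 * ((z - z1) i) ^ 2 - 2 * α) := by
  have e : pd i (gb α z1) = fun z => -2 * α * gb α z1 z * (z - z1) i := funext (gb_pd α z1 i)
  have hl : HasFDerivAt (fun z : E2 => (z - z1) i) (EuclideanSpace.proj i : E2 →L[ℝ] ℝ) z :=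
    (EuclideanSpace.proj i : E2 →L[ℝ] ℝ).hasFDerivAt.comp z ((hasFDerivAt_id z).sub_const z1)
  have h := ((gb_hasFDeriv α z1 z).const_mul (-2 * α)).mul hl
  rw [e, pd]
  erw [h.fderiv]
  have h1 : (innerSL ℝ (z - z1)) (ee i) = (z - z1) i := by
    rw [innerSL_apply_apply, real_inner_comm, inner_ee]
  have h2 : (EuclideanSpace.proj i : E2 →L[ℝ] ℝ) (ee i) = 1 := by simp [ee]
  simp only [_root_.add_apply, _root_.smul_apply, h1, h2, smul_eq_mul]
  ring

set_option maxHeartbeats 1600000 in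
/-- strong maximum principle (Hopf) -/
theorem hopf_smp {W A b c : E2 → ℝ} {q0 : E2} {r lam K : ℝ} (hlam : 0 < lam) (hK : 0 ≤ K)
    (hW : ∀ z ∈ ball q0 r, ContDiffAt ℝ 2 W z) (h0 : ∀ z ∈ ball q0 r, 0 ≤ W z)
    (hA : ∀ z ∈ ball q0 r, lam ≤ A z ∧ A z ≤ K) (hb : ∀ z ∈ ball q0 r, |b z| ≤ K) (hc : ∀ z ∈ ball q0 r, |c z| ≤ K)
    (heq : ∀ z ∈ ball q0 r, pd 0 (pd 0 W) z + A z * pd 1 (pd 1 W) z + b z * pd 1 W z + c z * W z = 0)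
    (hz : W q0 = 0) : ∀ z ∈ ball q0 (r / 2), W z = 0 := by
  intro z1 hz1
  by_contra hne
  have hd1 : dist z1 q0 < r / 2 := hz1
  have hr : 0 < r := by linarith [dist_nonneg (x := z1) (y := q0)]
  have hsub : ∀ z, dist z z1 ≤ dist z1 q0 → z ∈ ball q0 r := fun z hz => by
    rw [mem_ball]; linarith [dist_triangle z z1 q0]
  have hWc : ∀ z ∈ ball q0 r, ContinuousAt W z := fun z hz => (hW z hz).continuousAt
  -- the nearest zero
  obtain ⟨z2, hz2, hz2m⟩ : ∃ z2, (z2 ∈ closedBall z1 (dist z1 q0) ∧ W z2 = 0) ∧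
      ∀ z, z ∈ closedBall z1 (dist z1 q0) → W z = 0 → dist z2 z1 ≤ dist z z1 := by
    have hcl : IsCompact (closedBall z1 (dist z1 q0) ∩ W ⁻¹' {0}) := by
      apply (isCompact_closedBall z1 (dist z1 q0)).of_isClosed_subset _ Set.inter_subset_left
      exact ContinuousOn.preimage_isClosed_of_isClosed
        (fun z hz => (hWc z (hsub z hz)).continuousWithinAt) isClosed_closedBall isClosed_singleton
    obtain ⟨z2, h2, h2'⟩ := hcl.exists_isMinOn ⟨q0, by simp [dist_comm], by simpa using hz⟩
      (f := fun z => dist z z1) (by fun_prop)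
    exact ⟨z2, ⟨h2.1, h2.2⟩, fun z hz hz' => h2' ⟨hz, hz'⟩⟩
  obtain ⟨hz2b, hz20⟩ := hz2
  set R := dist z2 z1 with hR
  have hR0 : 0 < R := dist_pos.2 fun e => hne (e ▸ hz20)
  have hRle : R ≤ dist z1 q0 := hz2b
  have hpos : ∀ z, dist z z1 < R → 0 < W z := by
    intro z hz
    have hzb := hsub z (hz.le.trans hRle)
    rcases (h0 z hzb).lt_or_eq with h | h
    · exact h
    · exact absurd (hz2m z (hz.le.trans hRle) h.symm) (not_le.2 hz)
  -- parameters
  obtain ⟨m, hm0, hm⟩ : ∃ m > 0, ∀ z, dist z z1 = R / 2 → m ≤ W z := by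
    by_cases hne : (sphere z1 (R / 2)).Nonempty
    · obtain ⟨y, hy, hy'⟩ := (isCompact_sphere z1 (R / 2)).exists_isMinOn hne (f := W)
        (fun z hz => (hWc z (hsub z (by rw [mem_sphere.1 hz]; linarith))).continuousWithinAt)
      exact ⟨W y, hpos y (by rw [mem_sphere.1 hy]; linarith), fun z hz => hy' hz⟩
    · exact ⟨1, one_pos, fun z hz => absurd ⟨z, hz⟩ hne⟩
  set μ := min 1 lam with hμ
  have hμ0 : 0 < μ := lt_min one_pos hlam
  obtain ⟨α, hα1, hα⟩ : ∃ α : ℝ, 1 ≤ α ∧ 2 * (1 + K) + 2 * K * R + K < α * (μ * R ^ 2) := by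
    have hp : 0 < μ * R ^ 2 := by positivity
    obtain ⟨n, hn⟩ := exists_nat_gt ((2 * (1 + K) + 2 * K * R + K) / (μ * R ^ 2))
    refine ⟨max 1 n, le_max_left _ _, ?_⟩
    rw [div_lt_iff₀ hp] at hn
    exact hn.trans_le (mul_le_mul_of_nonneg_right (le_max_right _ _) hp.le)
  have hα0 : 0 < α := by linarith
  set e0 := Real.exp (-α * R ^ 2) with he0
  have he00 : 0 < e0 := Real.exp_pos _
  set v : E2 → ℝ := fun z => W z - m * gb α z1 z with hv
  have hgb : ∀ z, gb α z1 z ≤ 1 := fun z => by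
    rw [gb]; apply Real.exp_le_one_iff.2
    have := mul_nonneg hα0.le (sq_nonneg ‖z - z1‖); linarith
  -- comparison
  have key : ∀ z, R / 2 ≤ dist z z1 → dist z z1 ≤ R → - (m * e0) ≤ v z := by
    have hKc : IsCompact {z : E2 | R / 2 ≤ dist z z1 ∧ dist z z1 ≤ R} := by
      apply (isCompact_closedBall z1 R).of_isClosed_subset _ (fun z hz => hz.2)
      have cd : Continuous (fun z : E2 => dist z z1) := by fun_prop
      exact (isClosed_le continuous_const cd).inter (isClosed_le cd continuous_const)
    obtain ⟨y, ⟨hy1, hy2⟩, hymin⟩ := hKc.exists_isMinOn (f := v) ⟨z2, by linarith, le_rfl⟩ (fun z hz =>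
      ((hWc z (hsub z (hz.2.trans hRle))).sub
        ((gb_contDiff (n := 0) α z1).continuous.continuousAt.const_mul m)).continuousWithinAt)
    intro z hz1 hz2
    refine le_trans ?_ (hymin ⟨hz1, hz2⟩)
    by_contra hlt
    push Not at hlt
    have hyb := hsub y (hy2.trans hRle)
    have hy1' : R / 2 < dist y z1 := by
      rcases hy1.lt_or_eq with h | h
      · exact h
      · exfalso
        have := hm y h.symm
        have h2 := mul_le_mul_of_nonneg_left (hgb y) hm0.le
        have h3 : 0 < m * e0 := by positivity
        simp only [hv] at hlt
        linarith
    have hy2' : dist y z1 < R := by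
      rcases hy2.lt_or_eq with h | h
      · exact h
      · exfalso
        have h2 : gb α z1 y = e0 := by rw [gb, ← dist_eq_norm, h]
        have := h0 y hyb
        simp only [hv, h2] at hlt
        linarith
    have hloc : IsLocalMin v y := by
      have e1 : ∀ᶠ z in 𝓝 y, R / 2 < dist z z1 := continuousAt_const.eventually_lt (by fun_prop) hy1'
      have e2 : ∀ᶠ z in 𝓝 y, dist z z1 < R := ContinuousAt.eventually_lt (by fun_prop) continuousAt_const hy2'
      filter_upwards [e1, e2] with z h1 h2
      exact hymin ⟨h1.le, h2.le⟩
    have hg2 : ContDiffAt ℝ 2 (gb α z1) y := (gb_contDiff α z1).contDiffAt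
    have hv2 : ContDiffAt ℝ 2 v y := (hW y hyb).sub (contDiffAt_const.mul hg2)
    have p0 := pd2_nonneg 0 hv2 hloc
    have p1 := pd2_nonneg 1 hv2 hloc
    have p2 : pd 1 v y = 0 := by rw [pd, hloc.fderiv_eq_zero]; rfl
    rw [pd2_sub 0 m (hW y hyb) hg2, gb_pd2] at p0
    rw [pd2_sub 1 m (hW y hyb) hg2, gb_pd2] at p1
    rw [pd_sub 1 m ((hW y hyb).differentiableAt (by norm_num)) (hg2.differentiableAt (by norm_num)), gb_pd] at p2
    have hE := heq y hyb
    obtain ⟨hA1, hA2⟩ := hA y hyb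
    have hb' := hb y hyb
    have hc' := hc y hyb
    have hWy := h0 y hyb
    set g := gb α z1 y with hg
    have hg0 : 0 < g := Real.exp_pos _
    set d0 := (y - z1) 0 with hd0
    set d1 := (y - z1) 1 with hd1'
    have hn : d0 ^ 2 + d1 ^ 2 = dist y z1 ^ 2 := by
      rw [dist_eq_norm, norm_sq_E2]
    have hlt' : W y < m * g := by
      simp only [hv] at hlt
      have : 0 < m * e0 := by positivity
      linarith
    have hdl : |d1| ≤ R := by
      apply abs_le_of_sq_le_sq _ hR0.le
      have := sq_nonneg d0
      have h3 : dist y z1 ^ 2 ≤ R ^ 2 := by gcongr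
      linarith
    have hmain : 4 * α ^ 2 * (d0 ^ 2 + A y * d1 ^ 2) - 2 * α * (1 + A y) - 2 * α * (b y * d1) - K ≤ 0 := by
      have hcW : - (K * (m * g)) ≤ c y * W y := by
        have h1 := mul_le_mul_of_nonneg_right (abs_le.1 hc').1 hWy
        have h2 := mul_le_mul_of_nonneg_left hlt'.le hK
        linarith
      have hpd1 : pd 1 W y = m * (-2 * α * g * d1) := by linarith
      rw [hpd1] at hE
      have hA0 : 0 < A y := by linarith
      have h5 := mul_nonneg hA0.le p1
      have hfin : m * g * (4 * α ^ 2 * (d0 ^ 2 + A y * d1 ^ 2) - 2 * α * (1 + A y) - 2 * α * (b y * d1) - K) ≤ 0 := by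
        linear_combination p0 + h5 + hcW + hE
      have hmg : 0 < m * g := by positivity
      by_contra hh
      push Not at hh
      exact absurd hfin (not_le.2 (mul_pos hmg hh))
    have hbd : b y * d1 ≤ K * R := by
      calc b y * d1 ≤ |b y * d1| := le_abs_self _
        _ = |b y| * |d1| := abs_mul _ _
        _ ≤ K * R := mul_le_mul hb' hdl (abs_nonneg _) hK
    have hq : μ * R ^ 2 / 4 ≤ d0 ^ 2 + A y * d1 ^ 2 := by
      have h1 : μ * d0 ^ 2 ≤ 1 * d0 ^ 2 := mul_le_mul_of_nonneg_right (min_le_left _ _) (sq_nonneg _)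
      have h2 : μ * d1 ^ 2 ≤ A y * d1 ^ 2 := mul_le_mul_of_nonneg_right ((min_le_right _ _).trans hA1) (sq_nonneg _)
      have h3 : (R / 2) ^ 2 ≤ dist y z1 ^ 2 := by gcongr
      have h4 := mul_le_mul_of_nonneg_left h3 hμ0.le
      rw [← hn] at h4
      linarith
    have h6 : α ^ 2 * (μ * R ^ 2) ≤ 4 * α ^ 2 * (d0 ^ 2 + A y * d1 ^ 2) := by
      have := mul_le_mul_of_nonneg_left hq (by positivity : 0 ≤ 4 * α ^ 2)
      linarith
    have h7 := mul_lt_mul_of_pos_left hα hα0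
    have h8 : 2 * α * (1 + A y) ≤ 2 * α * (1 + K) := by gcongr
    have h9 : 2 * α * (b y * d1) ≤ 2 * α * (K * R) := by gcongr
    have h10 : K ≤ α * K := by nlinarith
    linarith
  -- derivative at z2
  have hz2b' := hsub z2 hz2b
  have hmin2 : IsLocalMin W z2 := by
    filter_upwards [isOpen_ball.mem_nhds hz2b'] with z hz
    rw [hz20]; exact h0 z hz
  have hline : z2 + (0:ℝ) • (z1 - z2) = z2 := by simp
  have D : HasDerivAt (fun s : ℝ => v (z2 + s • (z1 - z2))) (fderiv ℝ v z2 (z1 - z2)) 0 := by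
    have := slice_line (W := v) (z := z2) (v := z1 - z2) (t := 0) (by
      rw [hline]
      exact ((hW z2 hz2b').differentiableAt (by norm_num)).sub
        ((gb_hasFDeriv α z1 z2).differentiableAt.const_mul m))
    rwa [hline] at this
  have hval : fderiv ℝ v z2 (z1 - z2) = - (m * (2 * α * e0 * R ^ 2)) := by
    have : HasFDerivAt v (0 - m • ((-2 * α * gb α z1 z2) • innerSL ℝ (z2 - z1))) z2 := by
      have h1 := ((hW z2 hz2b').differentiableAt (by norm_num)).hasFDerivAt
      rw [hmin2.fderiv_eq_zero] at h1
      exact h1.sub ((gb_hasFDeriv α z1 z2).const_mul m)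
    rw [this.fderiv]
    have e1 : gb α z1 z2 = e0 := by rw [gb, ← dist_eq_norm]
    have e2 : ⟪z2 - z1, z1 - z2⟫ = - R ^ 2 := by
      rw [← neg_sub z2 z1, inner_neg_right, real_inner_self_eq_norm_sq, hR, dist_eq_norm]
    rw [e1, _root_.sub_apply, _root_.smul_apply, _root_.smul_apply,
      innerSL_apply_apply, e2]
    simp only [_root_.zero_apply, smul_eq_mul]
    ring
  have hv2 : v z2 = - (m * e0) := by
    have e1 : gb α z1 z2 = e0 := by rw [gb, ← dist_eq_norm]
    simp only [hv, hz20, e1, zero_sub]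
  have hge : ∀ᶠ s in 𝓝[>] (0:ℝ), 0 ≤ slope (fun s : ℝ => v (z2 + s • (z1 - z2))) 0 s := by
    have ev : ∀ᶠ s in 𝓝[>] (0:ℝ), s ∈ Set.Ioc (0:ℝ) (1 / 2) := Ioc_mem_nhdsGT (by norm_num)
    filter_upwards [ev] with s hs
    have hdist : dist (z2 + s • (z1 - z2)) z1 = (1 - s) * R := by
      rw [hR, dist_eq_norm, dist_eq_norm]
      have : z2 + s • (z1 - z2) - z1 = (1 - s) • (z2 - z1) := by module
      rw [this, norm_smul, Real.norm_of_nonneg (by linarith [hs.2])]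
    have := key (z2 + s • (z1 - z2)) (by rw [hdist]; nlinarith [hs.2]) (by rw [hdist]; nlinarith [hs.1])
    rw [slope_def_field]
    apply div_nonneg _ (by linarith [hs.1])
    simp only [hline, hv2]
    linarith
  have hfl : 𝓝[>] (0:ℝ) ≤ 𝓝[≠] (0:ℝ) := nhdsWithin_mono _ (fun s hs => ne_of_gt hs)
  have hle := ge_of_tendsto ((hasDerivAt_iff_tendsto_slope.1 D).mono_left hfl) hge
  rw [hval] at hle
  have : 0 < m * (2 * α * e0 * R ^ 2) := by positivity
  linarith

end partG1

section partG2
open MeasureTheory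
set_option linter.unusedSectionVars false
set_option linter.unusedVariables false

lemma pd_mul {U W : E2 → ℝ} {z : E2} (i : Fin 2) (hU : DifferentiableAt ℝ U z) (hW : DifferentiableAt ℝ W z) :
    pd i (fun y => U y * W y) z = pd i U z * W z + U z * pd i W z := by
  unfold pd
  rw [fderiv_fun_mul hU hW]
  simp
  ring

lemma pd_add {U W : E2 → ℝ} {z : E2} (i : Fin 2) (hU : DifferentiableAt ℝ U z) (hW : DifferentiableAt ℝ W z) :
    pd i (fun y => U y + W y) z = pd i U z + pd i W z := by
  unfold pd
  rw [fderiv_fun_add hU hW]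
  simp

lemma pd_comm {V : E2 → ℝ} {z : E2} (h : ContDiffAt ℝ 2 V z) (i j : Fin 2) : pd i (pd j V) z = pd j (pd i V) z :=
  fderiv_symm2 h (ee j) (ee i)

theorem strong_eq {V B : E2 → ℝ} {q0 : E2} {r : ℝ} (hV : ∀ z ∈ ball q0 r, ContDiffAt ℝ 3 V z)
    (hB : ∀ z ∈ ball q0 r, ContDiffAt ℝ 2 B z) (hw : WEq V B q0 r) :
    ∀ z ∈ ball q0 r, pd 0 (pd 0 V) z + pd 1 B z = 0 := by
  intro z1 hz1
  obtain ⟨s, hs, hsub⟩ := Metric.isOpen_iff.1 isOpen_ball z1 hz1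
  obtain ⟨F1, f1, f1c, f1e⟩ := exists_ext (n := 1) (F := pd 0 V) (z0 := z1) (r := s) (r' := s / 2)
    (by linarith) (by linarith) (fun z hz => (pd_contDiffAt (n := 2) 0 (hV z (hsub hz))).of_le (by norm_num))
  obtain ⟨F2, f2, f2c, f2e⟩ := exists_ext (n := 1) (F := B) (z0 := z1) (r := s) (r' := s / 2)
    (by linarith) (by linarith) (fun z hz => (hB z (hsub hz)).of_le (by norm_num))
  obtain ⟨F, f, fc, fe⟩ := exists_ext (n := 1) (F := fun z => pd 0 (pd 0 V) z + pd 1 B z) (z0 := z1) (r := s) (r' := s / 2)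
    (by linarith) (by linarith) (fun z hz =>
      (pd_contDiffAt (n := 1) 0 (pd_contDiffAt (n := 2) 0 (hV z (hsub hz)))).add (pd_contDiffAt (n := 1) 1 (hB z (hsub hz))))
  have f1 : ContDiff ℝ 1 F1 := by exact_mod_cast f1
  have f2 : ContDiff ℝ 1 F2 := by exact_mod_cast f2
  have f : ContDiff ℝ 1 F := by exact_mod_cast f
  obtain ⟨χ, c1, cnn, -, c2, c3, c4, -⟩ := exists_cutoff z1 (show 0 < s / 4 by linarith) (show s / 4 < s / 2 by linarith)
  have c1' : ContDiff ℝ 1 χ := c1.of_le (by norm_cast)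
  set η : E2 → ℝ := fun z => χ z * F z with hη
  have h1 : ContDiff ℝ 1 η := c1'.mul f
  have h2 : HasCompactSupport η := c3.mul_right
  have h3 : tsupport η ⊆ ball z1 (s / 2) := (closure_mono (Function.support_mul_subset_left χ F)).trans c4
  have hst := hw.mono (z1 := z1) (r' := s / 2) ((ball_subset_ball (by linarith)).trans hsub) η h1 h2 h3
  have hs0 : ∀ v z, z ∉ ball z1 (s / 2) → fderiv ℝ η z v = 0 := fun v z hz => by
    have : z ∉ tsupport (fderiv ℝ η) := fun h => hz (h3 (tsupport_fderiv_subset ℝ h))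
    rw [image_eq_zero_of_notMem_tsupport this]; simp
  have e0 : ∀ z, ⟪fderiv ℝ V z (ee 0), fderiv ℝ η z (ee 0)⟫ + ⟪B z, fderiv ℝ η z (ee 1)⟫ =
      F1 z * fderiv ℝ η z (ee 0) + F2 z * fderiv ℝ η z (ee 1) := by
    intro z
    by_cases hz : z ∈ ball z1 (s / 2)
    · rw [f1e z hz, f2e z hz]
      simp [RCLike.inner_apply, pd, mul_comm]
    · simp [hs0 _ z hz]
  simp only [e0] at hst
  have hc : ∀ v, HasCompactSupport (fun z => fderiv ℝ η z v) := fun v => h2.fderiv_apply (𝕜 := ℝ) v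
  have ibp : ∀ (P : E2 → ℝ), ContDiff ℝ 1 P → ∀ v, Integrable (fun z => P z * fderiv ℝ η z v) ∧
      Integrable (fun z => fderiv ℝ P z v * η z) ∧
      ∫ z, P z * fderiv ℝ η z v = - ∫ z, fderiv ℝ P z v * η z := by
    intro P hP v
    have i1 : Integrable (fun z => P z * fderiv ℝ η z v) :=
      (hP.continuous.mul (cont_fderiv_apply h1 v)).integrable_of_hasCompactSupport (hc v).mul_left
    have i2 : Integrable (fun z => fderiv ℝ P z v * η z) :=
      ((cont_fderiv_apply hP v).mul h1.continuous).integrable_of_hasCompactSupport h2.mul_left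
    have i3 : Integrable (fun z => P z * η z) :=
      (hP.continuous.mul h1.continuous).integrable_of_hasCompactSupport h2.mul_left
    exact ⟨i1, i2, integral_mul_fderiv_eq_neg_fderiv_mul_of_integrable i2 i1 i3
      (fun z _ => hP.differentiable (by norm_num) z) (fun z _ => h1.differentiable (by norm_num) z)⟩
  obtain ⟨a1, a2, a3⟩ := ibp F1 f1 (ee 0)
  obtain ⟨b1, b2, b3⟩ := ibp F2 f2 (ee 1)
  rw [integral_add a1 b1, a3, b3, ← neg_add, neg_eq_zero, ← integral_add a2 b2] at hst
  have e1 : ∀ z, fderiv ℝ F1 z (ee 0) * η z + fderiv ℝ F2 z (ee 1) * η z = χ z * F z ^ 2 := by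
    intro z
    by_cases hz : z ∈ ball z1 (s / 2)
    · have nh : ball z1 (s / 2) ∈ 𝓝 z := isOpen_ball.mem_nhds hz
      have g1 : fderiv ℝ F1 z (ee 0) = pd 0 (pd 0 V) z :=
        pd_congr 0 (show F1 =ᶠ[𝓝 z] _ from eventually_of_mem nh f1e)
      have g2 : fderiv ℝ F2 z (ee 1) = pd 1 B z :=
        pd_congr 1 (show F2 =ᶠ[𝓝 z] _ from eventually_of_mem nh f2e)
      rw [g1, g2, ← add_mul, ← fe z hz]
      simp only [hη]; ring
    · have : χ z = 0 := image_eq_zero_of_notMem_tsupport fun h => hz (c4 h)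
      simp [hη, this]
  simp only [e1] at hst
  by_contra hne
  have hF : F z1 ≠ 0 := by rw [fe z1 (by simp [hs])]; exact hne
  have hcont : Continuous (fun z => χ z * F z ^ 2) := c1'.continuous.mul (f.continuous.pow 2)
  have := hcont.integral_pos_of_hasCompactSupport_nonneg_nonzero (μ := volume) c3.mul_right
    (fun z => mul_nonneg (cnn z) (sq_nonneg _)) (x := z1)
    (by rw [c2 z1 (by simp [hs]), one_mul]; exact pow_ne_zero 2 hF)
  exact absurd hst this.ne'

theorem vpp_pos {V G : E2 → ℝ} {q0 : E2} {r lam : ℝ} (hr : 0 < r) (hlam : 0 < lam)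
    (hV : ∀ z ∈ ball q0 r, ContDiffAt ℝ 5 V z) (hG : ∀ z ∈ ball q0 r, ContDiffAt ℝ 3 G z)
    (hGl : ∀ z ∈ ball q0 r, lam ≤ G z)
    (heq : ∀ z ∈ ball q0 r, pd 0 (pd 0 V) z + G z * pd 1 (pd 1 V) z = 0)
    (hmono : ∀ q ∈ ball q0 r, ∀ q' ∈ ball q0 r, q 0 = q' 0 → q 1 < q' 1 → pd 1 V q < pd 1 V q') :
    0 < pd 1 (pd 1 V) q0 := by
  set W := pd 1 (pd 1 V) with hW
  have hW3 : ∀ z ∈ ball q0 r, ContDiffAt ℝ 3 W z := fun z hz =>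
    pd_contDiffAt (n := 3) 1 (pd_contDiffAt (n := 4) 1 (hV z hz))
  have hnh : ∀ z ∈ ball q0 r, ball q0 r ∈ 𝓝 z := fun z hz => isOpen_ball.mem_nhds hz
  -- nonnegativity
  have hW0 : ∀ z ∈ ball q0 r, 0 ≤ W z := by
    intro z hz
    have hzl : z + (0:ℝ) • ee 1 = z := by simp
    have hd : DifferentiableAt ℝ (pd 1 V) z := (pd_contDiffAt (n := 4) 1 (hV z hz)).differentiableAt (by norm_num)
    have D := slice_line (W := pd 1 V) (z := z) (v := ee 1) (t := 0) (by rwa [hzl])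
    rw [hzl] at D
    have hfl : 𝓝[>] (0:ℝ) ≤ 𝓝[≠] (0:ℝ) := nhdsWithin_mono _ (fun s hs => ne_of_gt hs)
    refine ge_of_tendsto ((hasDerivAt_iff_tendsto_slope.1 D).mono_left hfl) ?_
    have ht : Tendsto (fun s : ℝ => z + s • ee 1) (𝓝 0) (𝓝 z) := by
      have := (line_cont z (ee 1)).tendsto 0
      rwa [hzl] at this
    filter_upwards [self_mem_nhdsWithin, (ht.eventually (hnh z hz)).filter_mono nhdsWithin_le_nhds] with s hs hsb
    have hs : 0 < s := hs
    rw [slope_def_field]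
    apply div_nonneg _ (by linarith)
    rw [hzl, sub_nonneg]
    exact (hmono z hz _ hsb (by simp [ee]) (by simp [ee, hs])).le
  by_contra hnp
  have hWz : W q0 = 0 := le_antisymm (not_lt.1 hnp) (hW0 q0 (by simp [hr]))
  -- differentiated equation
  have hdeq : ∀ z ∈ ball q0 r, pd 0 (pd 0 W) z + G z * pd 1 (pd 1 W) z + 2 * pd 1 G z * pd 1 W z +
      pd 1 (pd 1 G) z * W z = 0 := by
    have c2 : ∀ {n : ℕ} {U : E2 → ℝ} {z : E2}, ContDiffAt ℝ (n + 1 : ℕ) U z → DifferentiableAt ℝ U z := fun h =>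
      h.differentiableAt (by norm_cast)
    have first : ∀ z ∈ ball q0 r, pd 0 (pd 0 (pd 1 V)) z + (pd 1 G z * W z + G z * pd 1 W z) = 0 := by
      intro z hz
      have e : (fun y => pd 0 (pd 0 V) y + G y * W y) =ᶠ[𝓝 z] fun _ => 0 := eventually_of_mem (hnh z hz) heq
      have h1 := pd_congr 1 e
      rw [pd_add 1 (c2 (n := 2) (pd_contDiffAt (n := 3) 0 (pd_contDiffAt (n := 4) 0 (hV z hz))))
        ((c2 (n := 2) (hG z hz)).fun_mul (c2 (n := 2) (hW3 z hz))), pd_mul 1 (c2 (n := 2) (hG z hz)) (c2 (n := 2) (hW3 z hz)),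
        pd_comm ((pd_contDiffAt (n := 4) 0 (hV z hz)).of_le (by norm_num))] at h1
      have e2 : pd 1 (pd 0 V) =ᶠ[𝓝 z] pd 0 (pd 1 V) := by
        filter_upwards [hnh z hz] with y hy
        exact pd_comm ((hV y hy).of_le (by norm_num)) _ _
      rw [pd_congr 0 e2] at h1
      rw [h1]; simp [pd]
    intro z hz
    have hV1 : ∀ y ∈ ball q0 r, ContDiffAt ℝ 4 (pd 1 V) y := fun y hy => pd_contDiffAt (n := 4) 1 (hV y hy)
    have hG1 := pd_contDiffAt (n := 2) 1 (hG z hz)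
    have hW1 := pd_contDiffAt (n := 2) 1 (hW3 z hz)
    have dG := c2 (n := 2) (hG z hz)
    have dW := c2 (n := 2) (hW3 z hz)
    have dG1 := c2 (n := 1) hG1
    have dW1 := c2 (n := 1) hW1
    have e : (fun y => pd 0 (pd 0 (pd 1 V)) y + (pd 1 G y * W y + G y * pd 1 W y)) =ᶠ[𝓝 z] fun _ => 0 :=
      eventually_of_mem (hnh z hz) first
    have h1 := pd_congr 1 e
    rw [pd_add 1 (c2 (n := 1) (pd_contDiffAt (n := 2) 0 (pd_contDiffAt (n := 3) 0 (hV1 z hz))))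
        ((dG1.fun_mul dW).fun_add (dG.fun_mul dW1)), pd_add 1 (dG1.fun_mul dW) (dG.fun_mul dW1), pd_mul 1 dG1 dW, pd_mul 1 dG dW1,
        pd_comm ((pd_contDiffAt (n := 3) 0 (hV1 z hz)).of_le (by norm_num))] at h1
    have e2 : pd 1 (pd 0 (pd 1 V)) =ᶠ[𝓝 z] pd 0 W := by
      filter_upwards [hnh z hz] with y hy
      exact pd_comm ((hV1 y hy).of_le (by norm_num)) _ _
    rw [pd_congr 0 e2] at h1
    have h2 : pd 1 (fun _ : E2 => (0:ℝ)) z = 0 := by simp [pd]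
    rw [h2] at h1
    linarith
  -- bounds
  have hcb : closedBall q0 (r / 2) ⊆ ball q0 r := closedBall_subset_ball (by linarith)
  have bd : ∀ (U : E2 → ℝ), (∀ z ∈ ball q0 r, ContinuousAt U z) → ∃ K, ∀ z ∈ ball q0 (r / 2), |U z| ≤ K := by
    intro U hU
    obtain ⟨K, hK⟩ := (isCompact_closedBall q0 (r / 2)).exists_bound_of_continuousOn (f := U)
      (fun z hz => (hU z (hcb hz)).continuousWithinAt)
    exact ⟨K, fun z hz => hK z (ball_subset_closedBall hz)⟩
  obtain ⟨K1, hK1⟩ := bd G fun z hz => (hG z hz).continuousAt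
  obtain ⟨K2, hK2⟩ := bd (fun z => 2 * pd 1 G z) fun z hz => ((pd_contDiffAt (n := 2) 1 (hG z hz)).continuousAt).const_mul 2
  obtain ⟨K3, hK3⟩ := bd (pd 1 (pd 1 G)) fun z hz => (pd_contDiffAt (n := 1) 1 (pd_contDiffAt (n := 2) 1 (hG z hz))).continuousAt
  have hs2 : ball q0 (r / 2) ⊆ ball q0 r := ball_subset_ball (by linarith)
  have hK0 : ∀ z ∈ ball q0 (r / 2), |G z| ≤ max K1 (max K2 K3) := fun z hz => (hK1 z hz).trans (le_max_left _ _)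
  have hvan := hopf_smp (W := W) (A := G) (b := fun z => 2 * pd 1 G z) (c := pd 1 (pd 1 G)) (q0 := q0) (r := r / 2)
    (K := max K1 (max K2 K3)) hlam ((abs_nonneg _).trans (hK0 q0 (by simp [hr])))
    (fun z hz => (hW3 z (hs2 hz)).of_le (by norm_num)) (fun z hz => hW0 z (hs2 hz))
    (fun z hz => ⟨hGl z (hs2 hz), (le_abs_self _).trans (hK0 z hz)⟩)
    (fun z hz => (hK2 z hz).trans ((le_max_left _ _).trans (le_max_right _ _)))
    (fun z hz => (hK3 z hz).trans ((le_max_right _ _).trans (le_max_right _ _)))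
    (fun z hz => hdeq z (hs2 hz)) hWz
  -- contradiction
  have hmem : ∀ t ∈ Set.Icc (0:ℝ) (r / 8), q0 + t • ee 1 ∈ ball q0 (r / 2 / 2) := by
    intro t ht
    rw [mem_ball, dist_eq_norm, add_sub_cancel_left, norm_smul, norm_ee, mul_one, Real.norm_of_nonneg ht.1]
    linarith [ht.2]
  have hmem' : ∀ t ∈ Set.Icc (0:ℝ) (r / 8), q0 + t • ee 1 ∈ ball q0 r := fun t ht =>
    ball_subset_ball (by linarith) (hmem t ht)
  have hD : ∀ t ∈ Set.Icc (0:ℝ) (r / 8), HasDerivAt (fun s : ℝ => pd 1 V (q0 + s • ee 1)) 0 t := by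
    intro t ht
    have := slice_line (W := pd 1 V) (z := q0) (v := ee 1) (t := t)
      ((pd_contDiffAt (n := 4) 1 (hV _ (hmem' t ht))).differentiableAt (by norm_num))
    have h2 : fderiv ℝ (pd 1 V) (q0 + t • ee 1) (ee 1) = 0 := hvan _ (hmem t ht)
    rwa [h2] at this
  obtain ⟨t, ht, hts⟩ := exists_hasDerivAt_eq_slope (fun s : ℝ => pd 1 V (q0 + s • ee 1)) (fun _ => 0)
    (show (0:ℝ) < r / 8 by linarith) (fun t ht => (hD t ht).continuousAt.continuousWithinAt)
    (fun t ht => hD t ⟨ht.1.le, ht.2.le⟩)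
  have hlt := hmono (q0 + (0:ℝ) • ee 1) (hmem' 0 ⟨le_rfl, by linarith⟩) (q0 + (r / 8) • ee 1)
    (hmem' (r / 8) ⟨by linarith, le_rfl⟩) (by simp [ee]) (by simp [ee, hr])
  have : 0 < (pd 1 V (q0 + (r / 8) • ee 1) - pd 1 V (q0 + (0:ℝ) • ee 1)) / (r / 8 - 0) :=
    div_pos (by linarith) (by linarith)
  linarith

end partG2

section partG3
open MeasureTheory
set_option linter.unusedSectionVars false
set_option linter.unusedVariables false

variable {w f : E2 → ℝ} {lam M : ℝ} {z0 : E2} {ρ δ : ℝ} {S : E2 → E2} {V g : E2 → ℝ}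

lemma coord_contDiff (i : Fin 2) {n : WithTop ℕ∞} : ContDiff ℝ n (fun z : E2 => z i) :=
  (EuclideanSpace.proj i : E2 →L[ℝ] ℝ).contDiff

lemma mk2_contDiffAt {n : WithTop ℕ∞} {P : E2 → ℝ} {z : E2} (hP : ContDiffAt ℝ n P z) :
    ContDiffAt ℝ n (fun z : E2 => mk2 (z 0) (P z)) z :=
  ContDiffAt.comp (f := fun z : E2 => ((z 0 : ℝ), P z)) z (mk2_contDiff.contDiffAt) ((coord_contDiff 0).contDiffAt.prodMk hP)

lemma mk2_hasFDerivAt {P : E2 → ℝ} {z : E2} (hP : DifferentiableAt ℝ P z) :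
    HasFDerivAt (fun z : E2 => mk2 (z 0) (P z))
      ((EuclideanSpace.proj 0 : E2 →L[ℝ] ℝ).smulRight (ee 0) + (fderiv ℝ P z).smulRight (ee 1)) z := by
  simp only [mk2_eq]
  exact ((EuclideanSpace.proj 0 : E2 →L[ℝ] ℝ).hasFDerivAt.smul_const (ee 0)).add (hP.hasFDerivAt.smul_const (ee 1))

lemma chain_pd {X P : E2 → ℝ} {z : E2} (hP : DifferentiableAt ℝ P z) (hX : DifferentiableAt ℝ X (mk2 (z 0) (P z))) :
    pd 0 (fun z => X (mk2 (z 0) (P z))) z = pd 0 X (mk2 (z 0) (P z)) + pd 0 P z * pd 1 X (mk2 (z 0) (P z)) ∧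
    pd 1 (fun z => X (mk2 (z 0) (P z))) z = pd 1 P z * pd 1 X (mk2 (z 0) (P z)) := by
  have h := HasFDerivAt.comp (f := fun z : E2 => mk2 (z 0) (P z)) z hX.hasFDerivAt (mk2_hasFDerivAt hP)
  have e : fderiv ℝ (fun z => X (mk2 (z 0) (P z))) z = _ := h.fderiv
  unfold pd
  rw [e]
  constructor
  · simp [ee]
  · simp [ee]

lemma PL.S_eq (hP : PL w z0 ρ δ S V) {q : E2} (hq : q ∈ ball (TM w z0) δ) : mk2 (q 0) (pd 1 V q) = S q := by
  have h1 : pd 1 V q = (S q) 1 := (hP.prop q hq).2.2.2.2.2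
  rw [h1, ← hP.c0 hq, mk2_eta]

lemma PL.regular (h : MA w f lam M) (hP : PL w z0 ρ δ S V) (hg : ContDiff ℝ (⊤ : ℕ∞) g) (hs : HasCompactSupport g)
    (hgD : ∀ z, g z ≠ 0 → ‖z‖ < 1) (hgf : ∀ z ∈ ball z0 ρ, g z = f z) (n : ℕ) {q : E2} (hq : q ∈ ball (TM w z0) δ) :
    ContDiffAt ℝ n V q := by
  have hw := weak_eq h hP hg hs hgD hgf
  have hd : 0 < δ - dist q (TM w z0) := by have : dist q (TM w z0) < δ := hq; linarith
  have hsub : ball q (δ - dist q (TM w z0)) ⊆ ball (TM w z0) δ := ball_subset_ball' (by linarith)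
  refine reg_smooth n ℝ V (AA g) q (δ - dist q (TM w z0)) lam hP.V1 (AA_smooth hg hs) hd h.lam_pos (hw.mono hsub) ?_
  intro W
  rw [AA_fderiv hg hs]
  obtain ⟨k1, k2, -⟩ := hP.prop q hq
  have e : mk2 (q 0) (fderiv ℝ V q (ee 1)) = S q := hP.S_eq hq
  rw [e, hgf _ k2]
  have := h.f_low (S q) (by simpa using k1)
  rw [RCLike.inner_apply, Real.norm_eq_abs, sq_abs]
  simp only [conj_trivial]
  nlinarith [mul_le_mul_of_nonneg_right this (sq_nonneg W)]

lemma pd1_AA (hg : ContDiff ℝ (⊤ : ℕ∞) g) (hs : HasCompactSupport g) {q : E2} (hV : ContDiffAt ℝ 2 V q) :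
    pd 1 (fun q => AA g (q, pd 1 V q)) q = g (mk2 (q 0) (pd 1 V q)) * pd 1 (pd 1 V) q := by
  have hl : q + (0:ℝ) • ee 1 = q := by simp
  have hd1 : DifferentiableAt ℝ (pd 1 V) q := (pd_contDiffAt (n := 1) 1 hV).differentiableAt (by norm_num)
  have hd : DifferentiableAt ℝ (fun q => AA g (q, pd 1 V q)) q :=
    ((AA_smooth hg hs).differentiable (by norm_num) _).comp q (differentiableAt_id.prodMk hd1)
  have D1 := slice_line (W := fun q => AA g (q, pd 1 V q)) (z := q) (v := ee 1) (t := 0) (by rwa [hl])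
  have D2 := slice_line (W := pd 1 V) (z := q) (v := ee 1) (t := 0) (by rwa [hl])
  have D3 := (GG_deriv hg.continuous hs (q 0) (pd 1 V (q + (0:ℝ) • ee 1))).comp (0:ℝ) D2
  have e : (fun s : ℝ => AA g (q + s • ee 1, pd 1 V (q + s • ee 1))) = GG g (q 0) ∘ fun s => pd 1 V (q + s • ee 1) := by
    funext s
    simp [AA, ee]
  rw [e] at D1
  have := D1.unique D3
  rwa [hl] at this

lemma PL.strong (h : MA w f lam M) (hP : PL w z0 ρ δ S V) (hg : ContDiff ℝ (⊤ : ℕ∞) g) (hs : HasCompactSupport g)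
    (hgD : ∀ z, g z ≠ 0 → ‖z‖ < 1) (hgf : ∀ z ∈ ball z0 ρ, g z = f z) {q : E2} (hq : q ∈ ball (TM w z0) δ) :
    pd 0 (pd 0 V) q + g (mk2 (q 0) (pd 1 V q)) * pd 1 (pd 1 V) q = 0 := by
  have hr := fun (n : ℕ) (q : E2) (hq : q ∈ ball (TM w z0) δ) => hP.regular h hg hs hgD hgf n hq
  have := strong_eq (V := V) (B := fun q => AA g (q, pd 1 V q)) (hr 3) (fun z hz => by
    have h1 : ContDiffAt ℝ 2 (pd 1 V) z := pd_contDiffAt (n := 2) 1 (hr 3 z hz)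
    exact ContDiffAt.comp (f := fun q : E2 => (q, pd 1 V q)) z
      ((contDiff_infty.1 (AA_smooth hg hs) 2).contDiffAt) (contDiffAt_id.prodMk h1)) (weak_eq h hP hg hs hgD hgf) q hq
  rwa [pd1_AA hg hs (hr 2 q hq)] at this

lemma PL.vpp (h : MA w f lam M) (hδ : 0 < δ) (hP : PL w z0 ρ δ S V) (hg : ContDiff ℝ (⊤ : ℕ∞) g) (hs : HasCompactSupport g)
    (hgD : ∀ z, g z ≠ 0 → ‖z‖ < 1) (hgf : ∀ z ∈ ball z0 ρ, g z = f z) : 0 < pd 1 (pd 1 V) (TM w z0) := by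
  have hr := fun (n : ℕ) (q : E2) (hq : q ∈ ball (TM w z0) δ) => hP.regular h hg hs hgD hgf n hq
  refine vpp_pos (G := fun q => g (mk2 (q 0) (pd 1 V q))) hδ h.lam_pos (hr 5) ?_ ?_
    (fun z hz => hP.strong h hg hs hgD hgf hz) ?_
  · intro z hz
    exact ContDiffAt.comp (f := fun q : E2 => mk2 (q 0) (pd 1 V q)) z ((contDiff_infty.1 hg 3).contDiffAt)
      (mk2_contDiffAt (pd_contDiffAt (n := 3) 1 (hr 4 z hz)))
  · intro z hz
    simp only
    rw [hP.S_eq hz]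
    obtain ⟨k1, k2, -⟩ := hP.prop z hz
    rw [hgf _ k2]
    exact h.f_low _ (by simpa using k1)
  · intro q hq q' hq' e0 e1
    obtain ⟨k1, k2, k3, k4, k5, k6⟩ := hP.prop q hq
    obtain ⟨l1, l2, l3, l4, l5, l6⟩ := hP.prop q' hq'
    have : fderiv ℝ V q (ee 1) < fderiv ℝ V q' (ee 1) := by
      rw [k6, l6]
      refine (h.p_mono k1 l1 ?_).1 ?_
      · rw [hP.c0 hq, hP.c0 hq', e0]
      · rw [hP.c1 hq, hP.c1 hq']; exact e1
    exact this

lemma PL.tm_smooth (h : MA w f lam M) (hz0 : ‖z0‖ < 1) (hδ : 0 < δ) (hP : PL w z0 ρ δ S V)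
    (hV : ∀ n : ℕ, ContDiffAt ℝ n V (TM w z0)) (hpp : 0 < pd 1 (pd 1 V) (TM w z0)) (n : ℕ) :
    ContDiffAt ℝ n (TM w) z0 := by
  set q0 := TM w z0 with hq0
  set T : E2 → E2 := fun q => mk2 (q 0) (pd 1 V q) with hT
  have hST : ∀ z : E2, ‖z‖ < 1 → TM w z ∈ ball q0 δ → T (TM w z) = z := by
    intro z hz hb
    rw [hT]
    simp only
    rw [hP.S_eq hb]
    exact h.tm_inj (hP.prop _ hb).1 hz (hP.prop _ hb).2.2.1
  have hTz : T q0 = z0 := hST z0 hz0 (by simp [hδ, hq0])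
  have hd1 : DifferentiableAt ℝ (pd 1 V) q0 := (pd_contDiffAt (n := 1) 1 (hV 2)).differentiableAt (by norm_num)
  have hTd := mk2_hasFDerivAt hd1
  have hinj : Function.Injective (((EuclideanSpace.proj 0 : E2 →L[ℝ] ℝ).smulRight (ee 0) +
      (fderiv ℝ (pd 1 V) q0).smulRight (ee 1) : E2 →L[ℝ] E2) : E2 →ₗ[ℝ] E2) := by
    rw [← LinearMap.ker_eq_bot, LinearMap.ker_eq_bot']
    intro v hv
    have h0 : v 0 = 0 := by simpa [ee] using congrArg (fun q : E2 => q 0) hv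
    have h1 : fderiv ℝ (pd 1 V) q0 v = 0 := by simpa [ee] using congrArg (fun q : E2 => q 1) hv
    have hv' : v = v 1 • ee 1 := by rw [← mk2_eta v, mk2_eq, h0]; simp [ee]
    rw [hv', map_smul, smul_eq_mul] at h1
    have h2 : v 1 = 0 := by
      rcases mul_eq_zero.1 h1 with h | h
      · exact h
      · exact absurd h hpp.ne'
    rw [hv', h2, zero_smul]
  set e : E2 ≃L[ℝ] E2 := (LinearEquiv.ofInjectiveEndo _ hinj).toContinuousLinearEquiv with he
  have hTd' : HasFDerivAt T (e : E2 →L[ℝ] E2) q0 := by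
    refine hTd.congr_fderiv ?_
    ext v
    rfl
  have hTn : ContDiffAt ℝ (n + 1 : ℕ) T q0 := mk2_contDiffAt (pd_contDiffAt (n := n + 1) 1 (hV (n + 2)))
  have hne : ((n + 1 : ℕ) : WithTop ℕ∞) ≠ 0 := by norm_cast
  have hL := hTn.to_localInverse hTd' hne
  rw [hTz] at hL
  have hle := (hTn.hasStrictFDerivAt' hTd' hne).eventually_left_inverse
  have ev : hTn.localInverse hTd' hne =ᶠ[𝓝 z0] TM w := by
    have c := h.tm_cont hz0
    have e1 : ∀ᶠ z : E2 in 𝓝 z0, ‖z‖ < 1 := continuous_norm.continuousAt.eventually_lt continuousAt_const hz0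
    have e2 : ∀ᶠ z : E2 in 𝓝 z0, TM w z ∈ ball q0 δ := c.eventually (isOpen_ball.mem_nhds (by simp [hδ, hq0]))
    filter_upwards [e1, e2, c.eventually hle] with z h1 h2 h3
    rw [hST z h1 h2] at h3
    exact h3
  exact (hL.congr_of_eventuallyEq ev.symm).of_le (by norm_cast; omega)

lemma MA.pd_leg (h : MA w f lam M) {z : E2} (hz : ‖z‖ < 1) (i : Fin 2) : pd i (leg w) z = (ZZ w z) i := by
  rw [pd, (h.leg_hasFDeriv hz).fderiv, innerSL_apply_apply, real_inner_comm, inner_ee]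

theorem MA.smooth_at (h : MA w f lam M) (hf : ContDiffOn ℝ (⊤ : ℕ∞) f (ball (0:E2) 1)) (hz0 : ‖z0‖ < 1) :
    (∀ n : ℕ, ContDiffAt ℝ n (leg w) z0) ∧ detHess (leg w) z0 = f z0 := by
  obtain ⟨ρ, hρ0, hρ⟩ : ∃ ρ > 0, 2 * ρ = 1 - ‖z0‖ := ⟨(1 - ‖z0‖) / 2, by linarith, by ring⟩
  have hsub : ball z0 (2 * ρ) ⊆ ball 0 1 := ball_subset_ball' (by rw [hρ]; simp)
  obtain ⟨χ, c1, -, -, c2, c3, c4, -⟩ := exists_cutoff z0 hρ0 (show ρ < 2 * ρ by linarith)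
  set g : E2 → ℝ := fun z => χ z * f z with hgdef
  have hg : ContDiff ℝ (⊤ : ℕ∞) g := by
    rw [contDiff_iff_contDiffAt]
    intro z
    by_cases hz : z ∈ ball (0:E2) 1
    · exact c1.contDiffAt.mul (hf.contDiffAt (isOpen_ball.mem_nhds hz))
    · have hz' : z ∉ tsupport χ := fun hh => hz (hsub (c4 hh))
      have ev : g =ᶠ[𝓝 z] fun _ => 0 := by
        filter_upwards [(isClosed_tsupport χ).isOpen_compl.mem_nhds hz'] with y hy
        simp only [hgdef]
        rw [image_eq_zero_of_notMem_tsupport hy, zero_mul]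
      exact contDiffAt_const.congr_of_eventuallyEq ev
  have hs : HasCompactSupport g := c3.mul_right
  have hgD : ∀ z, g z ≠ 0 → ‖z‖ < 1 := by
    intro z hz
    have : z ∈ tsupport χ := subset_tsupport _ (fun h0 => hz (by simp only [hgdef]; rw [h0, zero_mul]))
    simpa using hsub (c4 this)
  have hgf : ∀ z ∈ ball z0 ρ, g z = f z := fun z hz => by simp only [hgdef]; rw [c2 z hz, one_mul]
  obtain ⟨δ, hδ, S, V, hV1, hprop⟩ := h.partial_leg hz0 hρ0
  have hP : PL w z0 ρ δ S V := ⟨hV1, hprop⟩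
  set q0 := TM w z0 with hq0
  have hq0m : q0 ∈ ball q0 δ := by simp [hδ]
  have hVn : ∀ n : ℕ, ContDiffAt ℝ n V q0 := fun n => hP.regular h hg hs hgD hgf n hq0m
  have hpp := hP.vpp h hδ hg hs hgD hgf
  have hstr := hP.strong h hg hs hgD hgf hq0m
  have hTM := hP.tm_smooth h hz0 hδ hVn hpp
  have e1 : ∀ᶠ z : E2 in 𝓝 z0, ‖z‖ < 1 := continuous_norm.continuousAt.eventually_lt continuousAt_const hz0
  have e2 : ∀ᶠ z : E2 in 𝓝 z0, TM w z ∈ ball q0 δ := (h.tm_cont hz0).eventually (isOpen_ball.mem_nhds hq0m)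
  have hS : ∀ z : E2, ‖z‖ < 1 → TM w z ∈ ball q0 δ → S (TM w z) = z := fun z hz hb =>
    h.tm_inj (hP.prop _ hb).1 hz (hP.prop _ hb).2.2.1
  set P : E2 → ℝ := fun z => (ZZ w z) 1 with hPdef
  have hTMP : ∀ z, mk2 (z 0) (P z) = TM w z := fun z => rfl
  have hPn : ∀ n : ℕ, ContDiffAt ℝ n P z0 := fun n =>
    ContDiffAt.comp (f := TM w) z0 ((coord_contDiff 1).contDiffAt) (hTM n)
  have l1 : pd 1 (leg w) =ᶠ[𝓝 z0] P := by
    filter_upwards [e1] with z hz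
    exact h.pd_leg hz 1
  have l0 : pd 0 (leg w) =ᶠ[𝓝 z0] fun z => - pd 0 V (mk2 (z 0) (P z)) := by
    filter_upwards [e1, e2] with z hz hb
    rw [h.pd_leg hz 0, hTMP]
    have := (hP.prop _ hb).2.2.2.2.1
    rw [hS z hz hb] at this
    rw [pd, this, neg_neg]
  have hX : ∀ i (n : ℕ), ContDiffAt ℝ n (pd i V) q0 := fun i n => pd_contDiffAt i (hVn (n + 1))
  have hsm : ∀ n : ℕ, ContDiffAt ℝ n (leg w) z0 := by
    intro n
    have : ContDiffAt ℝ (n + 1) (leg w) z0 := by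
      refine contDiffAt_of_partials (by filter_upwards [e1] with z hz using (h.leg_hasFDeriv hz).differentiableAt) ?_
      intro j
      fin_cases j
      · refine ContDiffAt.congr_of_eventuallyEq ?_ l0
        exact (ContDiffAt.comp (f := TM w) z0 (hX 0 n) (hTM n)).neg
      · exact (hPn n).congr_of_eventuallyEq l1
    exact this.of_le (by norm_cast; omega)
  refine ⟨hsm, ?_⟩
  have dP : DifferentiableAt ℝ P z0 := (hPn 1).differentiableAt (by norm_num)
  have dX : ∀ i, DifferentiableAt ℝ (pd i V) (mk2 (z0 0) (P z0)) := fun i => (hX i 1).differentiableAt (by norm_num)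
  obtain ⟨a0, a1⟩ := chain_pd dP (dX 0)
  obtain ⟨b0, b1⟩ := chain_pd dP (dX 1)
  have hid : (fun z => pd 1 V (mk2 (z 0) (P z))) =ᶠ[𝓝 z0] fun z => z 1 := by
    filter_upwards [e1, e2] with z hz hb
    have := (hP.prop _ hb).2.2.2.2.2
    rw [hS z hz hb] at this
    exact this
  have i1 : pd 1 (fun z : E2 => z 1) z0 = 1 := by
    have : HasFDerivAt (fun z : E2 => z 1) (EuclideanSpace.proj 1 : E2 →L[ℝ] ℝ) z0 :=
      (EuclideanSpace.proj 1 : E2 →L[ℝ] ℝ).hasFDerivAt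
    rw [pd, this.fderiv]
    simp [ee]
  rw [pd_congr 1 hid, i1] at b1
  rw [hTMP] at a0 a1 b0 b1
  have n0 : ∀ i, pd i (pd 0 (leg w)) z0 = - pd i (fun z => pd 0 V (mk2 (z 0) (P z))) z0 := by
    intro i
    rw [pd_congr i l0]
    unfold pd
    rw [fderiv_fun_neg]
    rfl
  have hh : ∀ i j, hess (leg w) z0 (EuclideanSpace.single i 1) (EuclideanSpace.single j 1) = pd i (pd j (leg w)) z0 := by
    intro i j
    have hd : DifferentiableAt ℝ (fderiv ℝ (leg w)) z0 :=
      ((hsm 2).fderiv_right (m := 1) (by norm_num)).differentiableAt (by norm_num)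
    have : pd i (pd j (leg w)) z0 = fderiv ℝ (fun y => fderiv ℝ (leg w) y (ee j)) z0 (ee i) := rfl
    rw [this, fderiv_clm_apply hd (by fun_prop)]
    simp [hess, ee]
  rw [detHess, hh, hh, hh, hh, n0, n0, a0, a1, pd_congr 0 l1, pd_congr 1 l1]
  have hgq : g (mk2 (q0 0) (pd 1 V q0)) = f z0 := by
    rw [hP.S_eq hq0m, hS z0 hz0 hq0m, hgf z0 (by simp [hρ0])]
  rw [hgq] at hstr
  linear_combination (pd 1 P z0) * (-1) * hstr - f z0 * b1

end partG3

section H1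
open MeasureTheory
set_option linter.unusedSectionVars false
set_option linter.unusedVariables false

variable {φ : E2 → ℝ} {M : ℝ}

/-- Affine minorants of `φ` on the circle are at most `M` on the disc; in fact bounded. -/
lemma convEnv_bdd (hφb : ∀ z ∈ sphere (0 : E2) 1, |φ z| ≤ M) {z : E2} (hz : ‖z‖ < 1) :
    BddAbove {y : ℝ | ∃ (a : E2) (b : ℝ),
      (∀ w ∈ sphere (0 : E2) 1, ⟪a, w⟫ + b ≤ φ w) ∧ y = ⟪a, z⟫ + b} := by
  refine ⟨M, ?_⟩
  rintro y ⟨a0, b0, h, rfl⟩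
  by_cases ha : a0 = 0
  · subst ha
    have h1 : (EuclideanSpace.single 0 1 : E2) ∈ sphere (0 : E2) 1 := by simp
    have h2 := h _ h1
    have h3 := abs_le.1 (hφb _ h1)
    simp only [inner_zero_left] at h2 ⊢
    linarith
  · have hn : 0 < ‖a0‖ := norm_pos_iff.2 ha
    have h1 : (‖a0‖⁻¹ • a0) ∈ sphere (0 : E2) 1 := by
      rw [mem_sphere_zero_iff_norm, norm_smul, norm_inv, norm_norm, inv_mul_cancel₀ hn.ne']
    have h2 := h _ h1
    have h3 := abs_le.1 (hφb _ h1)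
    have h4 : ⟪a0, ‖a0‖⁻¹ • a0⟫ = ‖a0‖ := by
      rw [real_inner_smul_right, real_inner_self_eq_norm_sq]; field_simp
    have h5 := real_inner_le_norm a0 z
    have h6 : ‖a0‖ * ‖z‖ ≤ ‖a0‖ := by nlinarith
    linarith

lemma convEnv_ne (hφb : ∀ z ∈ sphere (0 : E2) 1, |φ z| ≤ M) (z : E2) :
    {y : ℝ | ∃ (a : E2) (b : ℝ),
      (∀ w ∈ sphere (0 : E2) 1, ⟪a, w⟫ + b ≤ φ w) ∧ y = ⟪a, z⟫ + b}.Nonempty :=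
  ⟨_, 0, -M, fun w hw => by
    have := abs_le.1 (hφb w hw)
    simp only [inner_zero_left]; linarith, rfl⟩

lemma le_convEnv (hφb : ∀ z ∈ sphere (0 : E2) 1, |φ z| ≤ M) {z : E2} (hz : ‖z‖ < 1)
    {a0 : E2} {b0 : ℝ} (h : ∀ w ∈ sphere (0 : E2) 1, ⟪a0, w⟫ + b0 ≤ φ w) :
    ⟪a0, z⟫ + b0 ≤ convEnv φ z :=
  le_csSup (convEnv_bdd hφb hz) ⟨a0, b0, h, rfl⟩

/-- The convex envelope along a radius. -/
lemma convEnv_ray (hφb : ∀ z ∈ sphere (0 : E2) 1, |φ z| ≤ M) {z : E2} (hz : z ∈ sphere (0 : E2) 1)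
    {r : ℝ} (h0 : 0 ≤ r) (h1 : r < 1) : convEnv φ (r • z) ≤ φ z + 2 * M * (1 - r) := by
  refine csSup_le (convEnv_ne hφb _) ?_
  rintro y ⟨a0, b0, h, rfl⟩
  have hz' : -z ∈ sphere (0 : E2) 1 := by simpa using hz
  have e1 := h z hz
  have e2 := h (-z) hz'
  have e3 := abs_le.1 (hφb z hz)
  have e4 := abs_le.1 (hφb _ hz')
  rw [inner_neg_right] at e2
  rw [real_inner_smul_right]
  nlinarith

lemma sqrt_tendsto {z : E2} (hz : z ∈ sphere (0 : E2) 1) (c : ℝ) :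
    Tendsto (fun x : E2 => c * Real.sqrt (1 - ‖x‖ ^ 2)) (𝓝[ball (0 : E2) 1] z) (𝓝 0) := by
  have h : Continuous (fun x : E2 => c * Real.sqrt (1 - ‖x‖ ^ 2)) := by fun_prop
  have h2 := h.tendsto z
  have h3 : ‖z‖ = 1 := by simpa using hz
  simp only [h3] at h2
  norm_num at h2
  exact h2.mono_left nhdsWithin_le_nhds

/-- Lower semicontinuity gives steep affine minorants. -/
lemma exists_minorant (hφb : ∀ z ∈ sphere (0 : E2) 1, |φ z| ≤ M)
    (hφl : LowerSemicontinuousOn φ (sphere (0 : E2) 1)) {z : E2} (hz : z ∈ sphere (0 : E2) 1)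
    {c : ℝ} (hc : c < φ z) :
    ∃ K : ℝ, ∀ w ∈ sphere (0 : E2) 1, ⟪K • z, w⟫ + (c - K) ≤ φ w := by
  have h1 := hφl z hz c hc
  rw [eventually_nhdsWithin_iff, Metric.eventually_nhds_iff] at h1
  obtain ⟨ε, hε, h1⟩ := h1
  have hzn : ‖z‖ = 1 := by simpa using hz
  have hcM : c ≤ M := by have := abs_le.1 (hφb z hz); linarith
  have hM : 0 ≤ M := (abs_nonneg _).trans (hφb z hz)
  refine ⟨2 * (|c| + M) / ε ^ 2, fun w hw => ?_⟩
  have hwn : ‖w‖ = 1 := by simpa using hw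
  have hd : ‖w - z‖ ^ 2 = 2 - 2 * ⟪z, w⟫ := by
    rw [norm_sub_sq_real, hwn, hzn, real_inner_comm]; ring
  have hK : 0 ≤ 2 * (|c| + M) / ε ^ 2 := by positivity
  rw [real_inner_smul_left]
  by_cases hdw : dist w z < ε
  · have h2 := h1 hdw hw
    have h3 : 0 ≤ ‖w - z‖ ^ 2 := by positivity
    nlinarith
  · have h2 : ε ≤ ‖w - z‖ := by rw [← dist_eq_norm]; exact not_lt.1 hdw
    have h3 : ε ^ 2 ≤ 2 - 2 * ⟪z, w⟫ := by rw [← hd]; gcongr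
    have h4 : 2 * (|c| + M) / ε ^ 2 * ε ^ 2 = 2 * (|c| + M) := by field_simp
    have h5 := mul_le_mul_of_nonneg_left h3 hK
    have h6 := abs_le.1 (hφb w hw)
    have h7 := le_abs_self c
    nlinarith

/-- The boundary value, from the two-sided bound by the convex envelope. -/
lemma liminf_of_bounds (hφb : ∀ z ∈ sphere (0 : E2) 1, |φ z| ≤ M)
    (hφl : LowerSemicontinuousOn φ (sphere (0 : E2) 1)) {u : E2 → ℝ} {c : ℝ}
    (hu : ∀ z ∈ ball (0 : E2) 1, convEnv φ z - c * Real.sqrt (1 - ‖z‖ ^ 2) ≤ u z ∧ u z ≤ convEnv φ z)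
    {z : E2} (hz : z ∈ sphere (0 : E2) 1) :
    Filter.liminf u (𝓝[ball (0 : E2) 1] z) = φ z := by
  have hzn : ‖z‖ = 1 := by simpa using hz
  have hlow : ∀ d < φ z, ∀ᶠ x in 𝓝[ball (0 : E2) 1] z, d ≤ u x := by
    intro d hd
    obtain ⟨d', h1, h2⟩ := exists_between hd
    obtain ⟨K, hK⟩ := exists_minorant hφb hφl hz h2
    have t1 : Tendsto (fun x : E2 => ⟪K • z, x⟫ + (d' - K)) (𝓝[ball (0 : E2) 1] z) (𝓝 d') := by
      have h : Continuous (fun x : E2 => ⟪K • z, x⟫ + (d' - K)) := by fun_prop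
      have h3 := h.tendsto z
      have h4 : ⟪K • z, z⟫ + (d' - K) = d' := by
        rw [real_inner_smul_left, real_inner_self_eq_norm_sq, hzn]; ring
      rw [h4] at h3
      exact h3.mono_left nhdsWithin_le_nhds
    have t2 := t1.sub (sqrt_tendsto hz c)
    rw [sub_zero] at t2
    filter_upwards [t2.eventually (lt_mem_nhds h1), self_mem_nhdsWithin] with x hx hxb
    have e1 := le_convEnv hφb (by simpa using hxb) hK (z := x)
    linarith [(hu x hxb).1]
  have hpath : Tendsto (fun r : ℝ => r • z) (𝓝[<] (1 : ℝ)) (𝓝[ball (0 : E2) 1] z) := by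
    refine tendsto_nhdsWithin_iff.2 ⟨?_, ?_⟩
    · have h : Continuous (fun r : ℝ => r • z) := by fun_prop
      have h3 := h.tendsto 1
      rw [one_smul] at h3
      exact h3.mono_left nhdsWithin_le_nhds
    · have : ∀ᶠ r : ℝ in 𝓝[<] (1 : ℝ), 0 < r := nhdsWithin_le_nhds (lt_mem_nhds one_pos)
      filter_upwards [this, self_mem_nhdsWithin] with r h0 h1
      rw [mem_ball_zero_iff, norm_smul, hzn, mul_one, Real.norm_of_nonneg h0.le]
      exact h1
  have hup : ∀ d, φ z < d → ∃ᶠ x in 𝓝[ball (0 : E2) 1] z, u x ≤ d := by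
    intro d hd
    refine hpath.frequently (Eventually.frequently ?_)
    have t1 : Tendsto (fun r : ℝ => φ z + 2 * M * (1 - r)) (𝓝[<] (1 : ℝ)) (𝓝 (φ z)) := by
      have h : Continuous (fun r : ℝ => φ z + 2 * M * (1 - r)) := by fun_prop
      have h3 := h.tendsto 1
      simp only [sub_self, mul_zero, add_zero] at h3
      exact h3.mono_left nhdsWithin_le_nhds
    have : ∀ᶠ r : ℝ in 𝓝[<] (1 : ℝ), 0 < r := nhdsWithin_le_nhds (lt_mem_nhds one_pos)
    filter_upwards [this, self_mem_nhdsWithin, t1.eventually (gt_mem_nhds hd)] with r h0 h1 h2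
    have hb : r • z ∈ ball (0 : E2) 1 := by
      rw [mem_ball_zero_iff, norm_smul, hzn, mul_one, Real.norm_of_nonneg h0.le]
      exact h1
    exact ((hu _ hb).2.trans (convEnv_ray hφb hz h0.le h1)).trans h2.le
  have hbdd : IsBoundedUnder (· ≥ ·) (𝓝[ball (0 : E2) 1] z) u :=
    ⟨φ z - 1, by simpa [eventually_map] using hlow (φ z - 1) (by linarith)⟩
  have hcob : IsCoboundedUnder (· ≥ ·) (𝓝[ball (0 : E2) 1] z) u :=
    IsCoboundedUnder.of_frequently_le (hup (φ z + 1) (by linarith))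
  refine le_antisymm (le_of_forall_gt_imp_ge_of_dense fun d hd => ?_) (le_of_forall_lt_imp_le_of_dense fun d hd => ?_)
  · exact liminf_le_of_frequently_le (hup d hd) hbdd
  · exact le_liminf_of_le hcob (hlow d hd)

/-- The density is smooth. -/
lemma dens_smooth {ψ : E2 → ℝ} {a : ℝ} (ha : 0 < a)
    (hψs : ContDiffOn ℝ (⊤ : ℕ∞) ψ (ball (0 : E2) 1)) (hψ : ∀ z ∈ ball (0 : E2) 1, a ≤ ψ z) :
    ContDiffOn ℝ (⊤ : ℕ∞) (fun z => (1 / ψ z) * ((1 - ‖z‖ ^ 2) ^ 2)⁻¹) (ball (0 : E2) 1) := by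
  have h1 : ContDiffOn ℝ (⊤ : ℕ∞) (fun z : E2 => (1 - ‖z‖ ^ 2) ^ 2) (ball (0 : E2) 1) :=
    ((contDiff_const.sub (contDiff_norm_sq ℝ)).pow 2).contDiffOn
  refine (contDiffOn_const.div hψs fun z hz => (ha.trans_le (hψ z hz)).ne').mul (h1.inv fun z hz => ?_)
  have : ‖z‖ < 1 := by simpa using hz
  have h2 : 0 < 1 - ‖z‖ ^ 2 := by nlinarith [norm_nonneg z]
  positivity

end H1

/-- **Theorem 3.2 (existence for the Monge–Ampère equation).**
Given `φ : ∂𝔻 → ℝ` bounded lower semicontinuous and `ψ : 𝔻 → ℝ` smooth with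
`0 < a ≤ ψ ≤ b < ∞`, there is a smooth convex solution `u` of
`det D²u(z) = (1/ψ(z))·(1−|z|²)⁻²` on `𝔻` with boundary value `φ` satisfying
`co(φ)(z) − (1/√a)·√(1−|z|²) ≤ u(z) ≤ co(φ)(z)`. -/
theorem existence_monge_ampere_lsc
    (φ : E2 → ℝ)
    (hφb : ∃ M : ℝ, ∀ z ∈ sphere (0 : E2) 1, |φ z| ≤ M)
    (hφl : LowerSemicontinuousOn φ (sphere (0 : E2) 1))
    (ψ : E2 → ℝ) (a b : ℝ) (ha : 0 < a) (hab : a ≤ b)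
    (hψs : ContDiffOn ℝ (⊤ : ℕ∞) ψ (ball (0 : E2) 1))
    (hψ : ∀ z ∈ ball (0 : E2) 1, a ≤ ψ z ∧ ψ z ≤ b) :
    ∃ u : E2 → ℝ,
      ContDiffOn ℝ (⊤ : ℕ∞) u (ball (0 : E2) 1) ∧
      ConvexOn ℝ (ball (0 : E2) 1) u ∧
      (∀ z ∈ ball (0 : E2) 1,
        detHess u z = (1 / ψ z) * ((1 - ‖z‖ ^ 2) ^ 2)⁻¹) ∧
      (∀ z ∈ sphere (0 : E2) 1,
        Filter.liminf u (𝓝[ball (0 : E2) 1] z) = φ z) ∧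
      (∀ z ∈ ball (0 : E2) 1,
        convEnv φ z - (1 / Real.sqrt a) * Real.sqrt (1 - ‖z‖ ^ 2) ≤ u z ∧
        u z ≤ convEnv φ z) := by
  obtain ⟨M, hφb⟩ := hφb
  have hψ1 : ∀ z ∈ ball (0 : E2) 1, a ≤ ψ z := fun z hz => (hψ z hz).1
  obtain ⟨w, hs, hw1, hw2, hstar⟩ := exists_w ha hφb hφl hψs.continuousOn hψ1
  have hlow : ∀ ζ, ‖ζ‖ - M ≤ w ζ := fun ζ => ((suppH_phi hφb hφl).low ζ).trans (hw1 ζ)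
  have hfs := dens_smooth ha hψs hψ1
  have hb : 0 < b := ha.trans_le hab
  have hMA : MA w (fun z => (1 / ψ z) * ((1 - ‖z‖ ^ 2) ^ 2)⁻¹) (1 / b) M := by
    refine ⟨hs, hlow, by positivity, fun z hz => ?_, hfs.continuousOn, hstar⟩
    have hz1 : ‖z‖ < 1 := by simpa using hz
    have h2 : 0 < 1 - ‖z‖ ^ 2 := by nlinarith [norm_nonneg z]
    have h3 : (1 - ‖z‖ ^ 2) ^ 2 ≤ 1 := by nlinarith [sq_nonneg ‖z‖]
    have h4 : 1 ≤ ((1 - ‖z‖ ^ 2) ^ 2)⁻¹ := (one_le_inv₀ (by positivity)).2 h3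
    have h5 : 0 < ψ z := ha.trans_le (hψ1 z hz)
    have h6 : 1 / b ≤ 1 / ψ z := one_div_le_one_div_of_le h5 (hψ z hz).2
    have h7 : 0 < 1 / ψ z := by positivity
    show 1 / b ≤ (1 / ψ z) * ((1 - ‖z‖ ^ 2) ^ 2)⁻¹
    nlinarith
  have hc : 0 < 1 / Real.sqrt a := by positivity
  have hu : ∀ z ∈ ball (0 : E2) 1,
      convEnv φ z - (1 / Real.sqrt a) * Real.sqrt (1 - ‖z‖ ^ 2) ≤ leg w z ∧
        leg w z ≤ convEnv φ z := by
    intro z hz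
    have hz1 : ‖z‖ < 1 := by simpa using hz
    constructor
    · rw [sub_le_iff_le_add]
      refine csSup_le (convEnv_ne hφb _) ?_
      rintro y ⟨a0, b0, h, rfl⟩
      have e1 := hw2 a0 b0 h (a0 + TT (1 / Real.sqrt a) z)
      rw [add_sub_cancel_left] at e1
      have e2 := le_leg hlow hz1.le (a0 + TT (1 / Real.sqrt a) z)
      have e3 : HS (1 / Real.sqrt a) (TT (1 / Real.sqrt a) z) = _ := TT_sqrt hc hz1
      have e4 := TT_inner hc hz1
      rw [inner_add_left] at e2
      unfold RR at e4
      linarith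
    · obtain ⟨ζ, hζ⟩ := exists_rel hs hlow hz1
      rw [leg_eq hζ, sub_eq_add_neg]
      refine le_convEnv hφb hz1 fun x hx => ?_
      linarith [le_phi hφb ζ hx, hw1 ζ]
  refine ⟨leg w, ?_, leg_convex hs hlow, fun z hz => ?_, fun z hz => ?_, hu⟩
  · intro z hz
    have hz1 : ‖z‖ < 1 := by simpa using hz
    exact (contDiffAt_infty.2 (hMA.smooth_at hfs hz1).1).contDiffWithinAt
  · have hz1 : ‖z‖ < 1 := by simpa using hz
    exact (hMA.smooth_at hfs hz1).2
  · exact liminf_of_bounds hφb hφl hu hz
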